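/- Let h = 0 and β ≥ β_c. There exists a g-function P : {−1,+1} × Ω_{<0} → (0,1) such that the Schonmann projection ν_{β,0}^+ is a g-measure consistent with P, ν_{β,0}^+ is the UNIQUE g-measure consistent with P, and P is continuous at ν_{β,0}^+-almost every point of Ω_{<0} (i.e. ν_{β,0}^+ is an almost regular g-measure). -/

import Mathlib

open MeasureTheory Filter Topology ProbabilityTheory

noncomputable section

/-- Spin value of a Boolean spin: `true ↦ +1`, `false ↦ -1`. -/
def sval (b : Bool) : ℝ := if b then 1 else -1

/-- Two-dimensional spin configurations. -/
abbrev Cfg2 := ℤ × ℤ → Bool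

/-- Two-sided sequences over an alphabet `A`. -/
abbrev ZSeq (A : Type*) := ℤ → A

/-- Pasts: index `k` corresponds to the coordinate `-(k+1)`. -/
abbrev Past (A : Type*) := ℕ → A

/-- The four nearest neighbours of a site of `ℤ²`. -/
def nbrs (x : ℤ × ℤ) : Finset (ℤ × ℤ) :=
  {(x.1 + 1, x.2), (x.1 - 1, x.2), (x.1, x.2 + 1), (x.1, x.2 - 1)}

/-- Boltzmann weight
`exp(β[Σ_{{x,y}⊆Λ, x∼y} ω_x ω_y + Σ_{x∈Λ, y∉Λ, x∼y} ω_x σ_y] − h Σ_{x∈Λ} ω_x)`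
(the sum over unordered pairs inside `Λ` is written as half the ordered sum). -/
def isingWeight (β h : ℝ) (Λ : Finset (ℤ × ℤ)) (σ ω : Cfg2) : ℝ :=
  Real.exp (β * ((∑ x ∈ Λ, ∑ y ∈ Λ.filter (fun y => y ∈ nbrs x),
        sval (ω x) * sval (ω y)) / 2
      + ∑ x ∈ Λ, ∑ y ∈ (nbrs x).filter (fun y => y ∉ Λ), sval (ω x) * sval (σ y))
    - h * ∑ x ∈ Λ, sval (ω x))

/-- Fill in the values `τ` inside `Λ` and `σ` outside. -/
def fill (Λ : Finset (ℤ × ℤ)) (σ : Cfg2) (τ : ↥Λ → Bool) : Cfg2 :=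
  fun x => if hx : x ∈ Λ then τ ⟨x, hx⟩ else σ x

/-- The finite-volume Ising measure in `Λ` with boundary condition `σ`, viewed as a measure on
the full configuration space, the spins outside `Λ` being frozen to `σ`. -/
def isingFV (β h : ℝ) (Λ : Finset (ℤ × ℤ)) (σ : Cfg2) : Measure Cfg2 :=
  (∑ τ : ↥Λ → Bool, ENNReal.ofReal (isingWeight β h Λ σ (fill Λ σ τ)))⁻¹ •
    ∑ τ : ↥Λ → Bool,
      ENNReal.ofReal (isingWeight β h Λ σ (fill Λ σ τ)) • Measure.dirac (fill Λ σ τ)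

/-- The box `[-n,n]²`. -/
def box (n : ℕ) : Finset (ℤ × ℤ) :=
  (Finset.Icc (-(n : ℤ)) (n : ℤ)) ×ˢ (Finset.Icc (-(n : ℤ)) (n : ℤ))

/-- Convergence of a sequence of measures on a product space in the sense of convergence of the
measures of all finite-dimensional cylinder events; for probability measures on `{−1,+1}^ι`
this is exactly weak convergence. -/
def CylTendsto {ι A : Type*} [MeasurableSpace A] (μs : ℕ → Measure (ι → A))
    (μ : Measure (ι → A)) : Prop :=
  ∀ (s : Finset ι) (f : ι → A),
    Tendsto (fun n => μs n {η | ∀ i ∈ s, η i = f i}) atTop (𝓝 (μ {η | ∀ i ∈ s, η i = f i}))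

/-- `μ` is the plus phase `μ_{β,h}^+`: the weak limit of the finite-volume Ising measures on
`[-n,n]²` with all-plus boundary conditions. -/
def IsPlusPhase (β h : ℝ) (μ : Measure Cfg2) : Prop :=
  IsProbabilityMeasure μ ∧ CylTendsto (fun n => isingFV β h (box n) (fun _ => true)) μ

/-- `μ` is the minus phase `μ_{β,h}^-`. -/
def IsMinusPhase (β h : ℝ) (μ : Measure Cfg2) : Prop :=
  IsProbabilityMeasure μ ∧ CylTendsto (fun n => isingFV β h (box n) (fun _ => false)) μ

/-- The critical inverse temperature `β_c = ln(1+√2)/2`. -/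
def betaCrit : ℝ := Real.log (1 + Real.sqrt 2) / 2

/-- Projection of a two-dimensional configuration onto the line `ℤ × {0}`. -/
def lineProj (η : Cfg2) : ZSeq Bool := fun i => η (i, 0)

/-- The Schonmann projection of a measure on `{−1,+1}^{ℤ²}`. -/
def schonmann (μ : Measure Cfg2) : Measure (ZSeq Bool) := μ.map lineProj

/-- Restriction of a two-sided sequence to its strict past; index `k` is coordinate `-(k+1)`. -/
def restrictPast {A : Type*} (ω : ZSeq A) : Past A := fun k => ω (-(k + 1 : ℤ))

/-- The shift on two-sided sequences. -/
def shiftSeq {A : Type*} : ZSeq A → ZSeq A := fun ω i => ω (i + 1)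

/-- The σ-algebra `ℱ_{<0}` generated by the coordinates of negative index. -/
def pastSigma (A : Type*) [MeasurableSpace A] : MeasurableSpace (ZSeq A) :=
  MeasurableSpace.comap (fun ω : ZSeq A => restrictPast ω) inferInstance

/-- The σ-algebra generated by the coordinates in `S`. -/
def sigmaOn {ι A : Type*} [MeasurableSpace A] (S : Set ι) : MeasurableSpace (ι → A) :=
  MeasurableSpace.comap (fun ω : ι → A => S.restrict ω) inferInstance

/-- A g-function on the alphabet `A`: measurable, `[0,1]`-valued, normalized. -/
def IsGFunction {A : Type*} [Fintype A] [MeasurableSpace A] (P : A → Past A → ℝ) : Prop :=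
  (∀ a, Measurable (P a)) ∧ ∀ ω, (∑ a : A, P a ω) = 1 ∧ ∀ a, P a ω ∈ Set.Icc (0 : ℝ) 1

/-- `μ` is a translation-invariant g-measure consistent with the g-function `P`: for each `a`,
`ω ↦ P a (restrictPast ω)` is a version of the conditional probability `μ(X₀ = a | ℱ_{<0})`. -/
def IsGMeasure {A : Type*} [MeasurableSpace A] (μ : Measure (ZSeq A))
    (P : A → Past A → ℝ) : Prop :=
  IsProbabilityMeasure μ ∧ μ.map shiftSeq = μ ∧
    ∀ a : A, (fun ω => P a (restrictPast ω))
      =ᵐ[μ] μ[Set.indicator {ω : ZSeq A | ω 0 = a} (fun _ => (1 : ℝ)) | pastSigma A]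

/-- The `k`-th variation of a g-function: the supremum of `|P a ω − P a σ|` over pasts agreeing
on the coordinates `−k,…,−1`. -/
def varG {A : Type*} (P : A → Past A → ℝ) (k : ℕ) : ℝ :=
  sSup {d : ℝ | ∃ (a : A) (ω σ' : Past A), (∀ j < k, ω j = σ' j) ∧ d = |P a ω - P a σ'|}

/-- Elementary conditional probability `μ(B | A)`, as a real number. -/
def condProbR {X : Type*} [MeasurableSpace X] (μ : Measure X) (B A : Set X) : ℝ :=
  ((μ[|A]) B).toReal

/-- The event that `η_i = ω` (suitably reindexed) for `−n ≤ i ≤ −1` and `η_i = b`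
for `−(n+l) ≤ i ≤ −(n+1)`. -/
def pastEvt (n l : ℕ) (b : Bool) (ω : Past Bool) : Set (ZSeq Bool) :=
  {η | (∀ i : ℤ, -(n : ℤ) ≤ i → i ≤ -1 → η i = ω (i.natAbs - 1)) ∧
       (∀ i : ℤ, -((n : ℤ) + l) ≤ i → i ≤ -((n : ℤ) + 1) → η i = b)}

/-- The event that `η_i = b` for `−(n+l) ≤ i ≤ −n`. -/
def blockEvt (n l : ℕ) (b : Bool) : Set (ZSeq Bool) :=
  {η | ∀ i : ℤ, -((n : ℤ) + l) ≤ i → i ≤ -(n : ℤ) → η i = b}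

/-- The event that `η_i = b` for `−n ≤ i ≤ −1`. -/
def allBlock (n : ℕ) (b : Bool) : Set (ZSeq Bool) :=
  {η | ∀ i : ℤ, -(n : ℤ) ≤ i → i ≤ -1 → η i = b}

/-- `P` is the g-function `P^{+,b}` obtained from `ν` by conditioning on the symbol `b`
in the far past: `P(a|ω) = lim_n lim_l ν(η₀ = a | η = b on [−(n+l),−(n+1)], η = ω on [−n,−1])`,
both iterated limits being required to exist. -/
def IsCondG (ν : Measure (ZSeq Bool)) (b : Bool) (P : Bool → Past Bool → ℝ) : Prop :=
  ∀ (a : Bool) (ω : Past Bool), ∃ L : ℕ → ℝ,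
    (∀ n, Tendsto (fun l => condProbR ν {η | η 0 = a} (pastEvt n l b ω)) atTop (𝓝 (L n))) ∧
    Tendsto L atTop (𝓝 (P a ω))

/-- `ν'` is the iterated weak limit `lim_n lim_l ν( · | η = b on [−(n+l),−n])`. -/
def IsCondLimitMeasure (ν : Measure (ZSeq Bool)) (b : Bool) (ν' : Measure (ZSeq Bool)) : Prop :=
  ∃ νseq : ℕ → Measure (ZSeq Bool),
    (∀ n, CylTendsto (fun l => ν[|blockEvt n l b]) (νseq n)) ∧ CylTendsto νseq ν'

/-- Stochastic domination: `ν ≤ μ` iff `ν B ≤ μ B` for every increasing measurable event `B`. -/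
def StochDom {A : Type*} [MeasurableSpace A] [Preorder A]
    (ν μ : Measure (ZSeq A)) : Prop :=
  ∀ B : Set (ZSeq A), MeasurableSet B → (∀ ⦃x y : ZSeq A⦄, x ≤ y → x ∈ B → y ∈ B) → ν B ≤ μ B

/-- `π` is the i.i.d. product measure with `π(η_i = +1) = ρ` for each coordinate. -/
def IsBernoulliProd (ρ : ℝ) (π : Measure (ZSeq Bool)) : Prop :=
  IsProbabilityMeasure π ∧ ∀ (s : Finset ℤ) (f : ℤ → Bool),
    π {η | ∀ i ∈ s, η i = f i} = ∏ i ∈ s, ENNReal.ofReal (if f i then ρ else 1 - ρ)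

/-- Splicing of pasts: coordinates `−k,…,−1` (indices `< k`) from `ω`, the rest from `σ`. -/
def splice {A : Type*} (σ ω : Past A) (k : ℕ) : Past A := fun j => if j < k then ω j else σ j

/-- `ν'` is an extreme point of the convex set of g-measures consistent with `P`. -/
def ExtremeGMeasure (ν' : Measure (ZSeq Bool)) (P : Bool → Past Bool → ℝ) : Prop :=
  IsGMeasure ν' P ∧
  ∀ ν₁ ν₂ : Measure (ZSeq Bool), IsGMeasure ν₁ P → IsGMeasure ν₂ P →
    ∀ t : ℝ, t ∈ Set.Ioo (0 : ℝ) 1 →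
      ν' = ENNReal.ofReal t • ν₁ + ENNReal.ofReal (1 - t) • ν₂ → ν₁ = ν' ∧ ν₂ = ν'

/-- The event that the spins on the line are `−1` on `{−m,…,−n} × {0}`. -/
def lineMinusEvt (n m : ℕ) : Set Cfg2 :=
  {η | ∀ i : ℤ, -(m : ℤ) ≤ i → i ≤ -(n : ℤ) → η (i, 0) = false}

/-- Nearest-neighbour adjacency in `ℤ²` (`‖x−y‖₁ = 1`). -/
def adj2 (x y : ℤ × ℤ) : Prop := (x.1 - y.1).natAbs + (x.2 - y.2).natAbs = 1

/-- The event `A_n`: there is an infinite nearest-neighbour path of `+1` spins starting at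
`(n,0)` entirely contained in the half-plane `{x ≤ n}`. -/
def plusPathEvt (n : ℕ) : Set Cfg2 :=
  {η | ∃ γ : ℕ → ℤ × ℤ, γ 0 = ((n : ℤ), 0) ∧ (∀ j, adj2 (γ j) (γ (j + 1))) ∧
    Function.Injective γ ∧ (∀ j, (γ j).1 ≤ (n : ℤ)) ∧ ∀ j, η (γ j) = true}

/-- The block map for the decimation `ν_{l,k}`: the `j`-th letter consists of the spins on
`[j(k+l), j(k+l)+l−1]`. -/
def blockMap (l k : ℕ) (η : ZSeq Bool) : ZSeq (Fin l → Bool) :=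
  fun j r => η (j * ((k : ℤ) + l) + r)

end

noncomputable section
open scoped Classical FinsetFamily
namespace Schonmann

/-! ### Finite-volume weights -/

/-- Configurations that agree with `σ` off `Λ`. -/
def Cf (Λ : Finset (ℤ × ℤ)) (σ : Cfg2) : Finset Cfg2 := Finset.univ.image (fill Λ σ)

theorem mem_Cf {Λ : Finset (ℤ × ℤ)} {σ ω : Cfg2} : ω ∈ Cf Λ σ ↔ ∀ x ∉ Λ, ω x = σ x := by
  simp only [Cf, Finset.mem_image, Finset.mem_univ, true_and]
  constructor
  · rintro ⟨τ, rfl⟩ x hx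
    simp [fill, hx]
  · intro h
    refine ⟨fun x => ω x, ?_⟩
    ext x
    by_cases hx : x ∈ Λ
    · simp [fill, hx]
    · simp [fill, hx, h x hx]

theorem self_mem_Cf (Λ : Finset (ℤ × ℤ)) (σ : Cfg2) : σ ∈ Cf Λ σ := mem_Cf.2 fun _ _ => rfl

theorem Cf_congr {Λ : Finset (ℤ × ℤ)} {σ σ' : Cfg2} (h : ∀ x ∉ Λ, σ x = σ' x) :
    Cf Λ σ = Cf Λ σ' := by
  ext ω
  simp only [mem_Cf]
  exact forall₂_congr fun x hx => by rw [h x hx]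

theorem Cf_eq_of_mem {Λ : Finset (ℤ × ℤ)} {σ ω : Cfg2} (h : ω ∈ Cf Λ σ) : Cf Λ ω = Cf Λ σ :=
  Cf_congr (mem_Cf.1 h)

theorem Cf_subset {Λ Λ' : Finset (ℤ × ℤ)} (h : Λ' ⊆ Λ) {σ ω : Cfg2} (hω : ω ∈ Cf Λ σ) :
    Cf Λ' ω ⊆ Cf Λ σ := by
  intro η hη
  rw [mem_Cf] at *
  intro x hx
  rw [hη x (fun hx' => hx (h hx')), hω x hx]

theorem mem_nbrs_comm {x y : ℤ × ℤ} : x ∈ nbrs y ↔ y ∈ nbrs x := by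
  obtain ⟨a, b⟩ := x
  obtain ⟨c, d⟩ := y
  simp only [nbrs, Finset.mem_insert, Finset.mem_singleton, Prod.mk.injEq]
  omega

/-- Ordered pairs of adjacent sites with at least one site in `Λ`. -/
def pairs (Λ : Finset (ℤ × ℤ)) : Finset ((ℤ × ℤ) × (ℤ × ℤ)) :=
  (Λ.biUnion fun x => (nbrs x).image fun y => (x, y)) ∪
    (Λ.biUnion fun x => (nbrs x).image fun y => (y, x))

theorem mem_pairs {Λ : Finset (ℤ × ℤ)} {p : (ℤ × ℤ) × (ℤ × ℤ)} :
    p ∈ pairs Λ ↔ p.2 ∈ nbrs p.1 ∧ (p.1 ∈ Λ ∨ p.2 ∈ Λ) := by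
  obtain ⟨x, y⟩ := p
  simp only [pairs, Finset.mem_union, Finset.mem_biUnion, Finset.mem_image, Prod.mk.injEq]
  constructor
  · rintro (⟨a, ha, b, hb, rfl, rfl⟩ | ⟨a, ha, b, hb, rfl, rfl⟩)
    · exact ⟨hb, Or.inl ha⟩
    · exact ⟨mem_nbrs_comm.1 hb, Or.inr ha⟩
  · rintro ⟨h, h1 | h1⟩
    · exact Or.inl ⟨x, h1, y, h, rfl, rfl⟩
    · exact Or.inr ⟨y, h1, x, mem_nbrs_comm.1 h, rfl, rfl⟩

/-- Interaction energy of all the bonds touching `Λ`. -/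
def energy (Λ : Finset (ℤ × ℤ)) (ω : Cfg2) : ℝ :=
  (∑ p ∈ pairs Λ, sval (ω p.1) * sval (ω p.2)) / 2

/-- Boltzmann weight of the bonds touching `Λ`. -/
def wt (β : ℝ) (Λ : Finset (ℤ × ℤ)) (ω : Cfg2) : ℝ := Real.exp (β * energy Λ ω)

theorem wt_pos (β : ℝ) (Λ : Finset (ℤ × ℤ)) (ω : Cfg2) : 0 < wt β Λ ω := Real.exp_pos _

theorem pairs_mono {Λ Λ' : Finset (ℤ × ℤ)} (h : Λ' ⊆ Λ) : pairs Λ' ⊆ pairs Λ := by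
  intro p
  simp only [mem_pairs]
  exact fun ⟨a, b⟩ => ⟨a, b.imp (@h _) (@h _)⟩

theorem energy_sub {Λ Λ' : Finset (ℤ × ℤ)} (h : Λ' ⊆ Λ) {ω ω' : Cfg2}
    (hω : ∀ x ∉ Λ', ω x = ω' x) :
    energy Λ ω + energy Λ' ω' = energy Λ ω' + energy Λ' ω := by
  have key : ∀ ζ : Cfg2, energy Λ ζ = (∑ p ∈ pairs Λ \ pairs Λ', sval (ζ p.1) * sval (ζ p.2)) / 2
      + energy Λ' ζ := by
    intro ζ
    rw [energy, energy, ← add_div, Finset.sum_sdiff (pairs_mono h)]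
  rw [key ω, key ω']
  have : ∑ p ∈ pairs Λ \ pairs Λ', sval (ω p.1) * sval (ω p.2)
      = ∑ p ∈ pairs Λ \ pairs Λ', sval (ω' p.1) * sval (ω' p.2) := by
    refine Finset.sum_congr rfl fun p hp => ?_
    rw [Finset.mem_sdiff, mem_pairs, mem_pairs] at hp
    have h1 : p.1 ∉ Λ' := fun h1 => hp.2 ⟨hp.1.1, Or.inl h1⟩
    have h2 : p.2 ∉ Λ' := fun h1 => hp.2 ⟨hp.1.1, Or.inr h1⟩
    rw [hω _ h1, hω _ h2]
  rw [this]
  ring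

theorem wt_mul_wt (β : ℝ) {Λ Λ' : Finset (ℤ × ℤ)} (h : Λ' ⊆ Λ) {ω ω' : Cfg2}
    (hω : ∀ x ∉ Λ', ω x = ω' x) :
    wt β Λ ω * wt β Λ' ω' = wt β Λ ω' * wt β Λ' ω := by
  rw [wt, wt, wt, wt, ← Real.exp_add, ← Real.exp_add, ← mul_add, ← mul_add, energy_sub h hω]

theorem wt_lattice {β : ℝ} (hβ : 0 ≤ β) (Λ : Finset (ℤ × ℤ)) (a b : Cfg2) :
    wt β Λ a * wt β Λ b ≤ wt β Λ (a ⊓ b) * wt β Λ (a ⊔ b) := by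
  rw [wt, wt, wt, wt, ← Real.exp_add, ← Real.exp_add, ← mul_add, ← mul_add, energy, energy,
    energy, energy, ← add_div, ← add_div, ← Finset.sum_add_distrib, ← Finset.sum_add_distrib]
  refine Real.exp_le_exp.2 (mul_le_mul_of_nonneg_left (div_le_div_of_nonneg_right
    (Finset.sum_le_sum fun p _ => ?_) zero_le_two) hβ)
  change sval (a p.1) * sval (a p.2) + sval (b p.1) * sval (b p.2) ≤
    sval (a p.1 ⊓ b p.1) * sval (a p.2 ⊓ b p.2) + sval (a p.1 ⊔ b p.1) * sval (a p.2 ⊔ b p.2)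
  cases a p.1 <;> cases a p.2 <;> cases b p.1 <;> cases b p.2 <;> norm_num [sval]

theorem sum_pairs_eq (Λ : Finset (ℤ × ℤ)) (f : (ℤ × ℤ) → (ℤ × ℤ) → ℝ) (hf : ∀ x y, f x y = f y x) :
    (∑ p ∈ pairs Λ, f p.1 p.2) / 2 =
      (∑ x ∈ Λ, ∑ y ∈ Λ.filter (fun y => y ∈ nbrs x), f x y) / 2
      + ∑ x ∈ Λ, ∑ y ∈ (nbrs x).filter (fun y => y ∉ Λ), f x y := by
  have h1 : ∑ x ∈ Λ, ∑ y ∈ Λ.filter (fun y => y ∈ nbrs x), f x y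
      = ∑ p ∈ (pairs Λ).filter (fun p => p.1 ∈ Λ ∧ p.2 ∈ Λ), f p.1 p.2 := by
    refine (Finset.sum_finset_product' _ _ _ ?_).symm
    intro p
    simp only [Finset.mem_filter, mem_pairs]
    tauto
  have h2 : ∑ x ∈ Λ, ∑ y ∈ (nbrs x).filter (fun y => y ∉ Λ), f x y
      = ∑ p ∈ (pairs Λ).filter (fun p => p.1 ∈ Λ ∧ p.2 ∉ Λ), f p.1 p.2 := by
    refine (Finset.sum_finset_product' _ _ _ ?_).symm
    intro p
    simp only [Finset.mem_filter, mem_pairs]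
    tauto
  have h3 : ∑ x ∈ Λ, ∑ y ∈ (nbrs x).filter (fun y => y ∉ Λ), f x y
      = ∑ p ∈ (pairs Λ).filter (fun p => p.1 ∉ Λ), f p.1 p.2 := by
    rw [h2]
    refine Finset.sum_nbij' Prod.swap Prod.swap ?_ ?_ ?_ ?_ ?_
    · intro p
      simp only [Finset.mem_filter, mem_pairs, Prod.fst_swap, Prod.snd_swap]
      rintro ⟨⟨a, b⟩, c, d⟩
      exact ⟨⟨mem_nbrs_comm.1 a, Or.inr c⟩, d⟩
    · intro p
      simp only [Finset.mem_filter, mem_pairs, Prod.fst_swap, Prod.snd_swap]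
      rintro ⟨⟨a, b⟩, c⟩
      exact ⟨⟨mem_nbrs_comm.1 a, Or.symm b⟩, by tauto, c⟩
    · simp
    · simp
    · intro p _
      exact hf _ _
  have h4 := Finset.sum_filter_add_sum_filter_not (pairs Λ) (fun p => p.1 ∈ Λ)
    (fun p => f p.1 p.2)
  have h5 := Finset.sum_filter_add_sum_filter_not ((pairs Λ).filter (fun p => p.1 ∈ Λ))
    (fun p => p.2 ∈ Λ) (fun p => f p.1 p.2)
  rw [Finset.filter_filter, Finset.filter_filter] at h5
  rw [h1]
  linarith

theorem isingWeight_eq_wt (β : ℝ) {Λ : Finset (ℤ × ℤ)} {σ ω : Cfg2} (hω : ∀ x ∉ Λ, ω x = σ x) :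
    isingWeight β 0 Λ σ ω = wt β Λ ω := by
  rw [isingWeight, wt, energy, sum_pairs_eq Λ (fun x y => sval (ω x) * sval (ω y))
    (fun x y => mul_comm _ _)]
  simp only [zero_mul, sub_zero]
  congr 3
  refine Finset.sum_congr rfl fun x _ => Finset.sum_congr rfl fun y hy => ?_
  rw [hω y (Finset.mem_filter.1 hy).2]

/-! ### Finite-volume expectations -/

/-- Weighted average of `f` over a finite set of configurations. -/
def exs (β : ℝ) (Λ : Finset (ℤ × ℤ)) (s : Finset Cfg2) (f : Cfg2 → ℝ) : ℝ :=
  (∑ ω ∈ s, wt β Λ ω * f ω) / ∑ ω ∈ s, wt β Λ ω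

/-- Finite-volume expectation. -/
def ex (β : ℝ) (Λ : Finset (ℤ × ℤ)) (σ : Cfg2) (f : Cfg2 → ℝ) : ℝ := exs β Λ (Cf Λ σ) f

/-- Indicator function of an event. -/
def ind (A : Set Cfg2) (ω : Cfg2) : ℝ := if ω ∈ A then 1 else 0

/-- Finite-volume probability. -/
def pr (β : ℝ) (Λ : Finset (ℤ × ℤ)) (σ : Cfg2) (A : Set Cfg2) : ℝ := ex β Λ σ (ind A)

theorem ind_nonneg (A : Set Cfg2) (ω : Cfg2) : 0 ≤ ind A ω := by
  unfold ind; split_ifs <;> norm_num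

theorem ind_le_one (A : Set Cfg2) (ω : Cfg2) : ind A ω ≤ 1 := by
  unfold ind; split_ifs <;> norm_num

theorem ind_mono_of_isUpperSet {A : Set Cfg2} (hA : IsUpperSet A) : Monotone (ind A) := by
  intro a b hab
  unfold ind
  split_ifs with h1 h2
  · exact le_rfl
  · exact absurd (hA hab h1) h2
  · norm_num
  · exact le_rfl

theorem sum_wt_pos (β : ℝ) (Λ : Finset (ℤ × ℤ)) {s : Finset Cfg2} (hs : s.Nonempty) :
    0 < ∑ ω ∈ s, wt β Λ ω := Finset.sum_pos (fun _ _ => wt_pos _ _ _) hs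

theorem Cf_nonempty (Λ : Finset (ℤ × ℤ)) (σ : Cfg2) : (Cf Λ σ).Nonempty := ⟨σ, self_mem_Cf Λ σ⟩

section exs
variable {β : ℝ} {Λ : Finset (ℤ × ℤ)} {s t : Finset Cfg2} {σ : Cfg2} {f g : Cfg2 → ℝ}

theorem exs_congr (h : ∀ ω ∈ s, f ω = g ω) : exs β Λ s f = exs β Λ s g := by
  unfold exs
  rw [Finset.sum_congr rfl fun ω hω => by rw [h ω hω]]

theorem exs_mono (h : ∀ ω ∈ s, f ω ≤ g ω) : exs β Λ s f ≤ exs β Λ s g := by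
  unfold exs
  refine div_le_div_of_nonneg_right ?_ (Finset.sum_nonneg fun _ _ => (wt_pos _ _ _).le)
  exact Finset.sum_le_sum fun ω hω => mul_le_mul_of_nonneg_left (h ω hω) (wt_pos _ _ _).le

theorem exs_const (hs : s.Nonempty) (c : ℝ) : exs β Λ s (fun _ => c) = c := by
  unfold exs
  rw [← Finset.sum_mul, mul_div_assoc, mul_div_cancel₀ _ (sum_wt_pos β Λ hs).ne']

theorem exs_add : exs β Λ s (fun ω => f ω + g ω) = exs β Λ s f + exs β Λ s g := by
  unfold exs
  rw [← add_div, ← Finset.sum_add_distrib]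
  simp only [mul_add]

theorem exs_sub : exs β Λ s (fun ω => f ω - g ω) = exs β Λ s f - exs β Λ s g := by
  unfold exs
  rw [← sub_div, ← Finset.sum_sub_distrib]
  simp only [mul_sub]

theorem exs_const_mul (c : ℝ) : exs β Λ s (fun ω => c * f ω) = c * exs β Λ s f := by
  unfold exs
  rw [mul_div_assoc', Finset.mul_sum]
  congr 1
  exact Finset.sum_congr rfl fun _ _ => by ring

theorem exs_mul_const (c : ℝ) : exs β Λ s (fun ω => f ω * c) = exs β Λ s f * c := by
  simp only [mul_comm _ c, exs_const_mul]

theorem exs_sum {ι : Type*} (S : Finset ι) (F : ι → Cfg2 → ℝ) :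
    exs β Λ s (fun ω => ∑ i ∈ S, F i ω) = ∑ i ∈ S, exs β Λ s (F i) := by
  unfold exs
  rw [← Finset.sum_div, Finset.sum_comm]
  simp only [Finset.mul_sum]

theorem ex_congr (h : ∀ ω ∈ Cf Λ σ, f ω = g ω) : ex β Λ σ f = ex β Λ σ g := exs_congr h
theorem ex_mono (h : ∀ ω ∈ Cf Λ σ, f ω ≤ g ω) : ex β Λ σ f ≤ ex β Λ σ g := exs_mono h
theorem ex_const (c : ℝ) : ex β Λ σ (fun _ => c) = c := exs_const (Cf_nonempty _ _) c
theorem ex_add : ex β Λ σ (fun ω => f ω + g ω) = ex β Λ σ f + ex β Λ σ g := exs_add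
theorem ex_sub : ex β Λ σ (fun ω => f ω - g ω) = ex β Λ σ f - ex β Λ σ g := exs_sub
theorem ex_const_mul (c : ℝ) : ex β Λ σ (fun ω => c * f ω) = c * ex β Λ σ f := exs_const_mul c
theorem ex_mul_const (c : ℝ) : ex β Λ σ (fun ω => f ω * c) = ex β Λ σ f * c := exs_mul_const c

/-- Holley-type comparison of weighted averages. -/
theorem exs_le_exs (hβ : 0 ≤ β) (hs : s.Nonempty) (ht : t.Nonempty)
    (hst : ∀ a ∈ s, ∀ b ∈ t, a ⊓ b ∈ s ∧ a ⊔ b ∈ t) (hf : Monotone f) (hf0 : ∀ ω, 0 ≤ f ω) :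
    exs β Λ s f ≤ exs β Λ t f := by
  unfold exs
  rw [div_le_div_iff₀ (sum_wt_pos β Λ hs) (sum_wt_pos β Λ ht)]
  have h4 := four_functions_theorem (fun ω => wt β Λ ω * f ω) (fun ω => wt β Λ ω)
    (fun ω => wt β Λ ω) (fun ω => wt β Λ ω * f ω)
    (fun ω => mul_nonneg (wt_pos _ _ _).le (hf0 ω)) (fun ω => (wt_pos _ _ _).le)
    (fun ω => (wt_pos _ _ _).le) (fun ω => mul_nonneg (wt_pos _ _ _).le (hf0 ω)) ?_ s t
  · refine h4.trans ?_
    rw [mul_comm]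
    have h5 : s ⊻ t ⊆ t := by
      intro x hx
      obtain ⟨a, ha, b, hb, rfl⟩ := Finset.mem_sups.1 hx
      exact (hst a ha b hb).2
    have h6 : s ⊼ t ⊆ s := by
      intro x hx
      obtain ⟨a, ha, b, hb, rfl⟩ := Finset.mem_infs.1 hx
      exact (hst a ha b hb).1
    exact mul_le_mul
      (Finset.sum_le_sum_of_subset_of_nonneg h5 fun i _ _ => mul_nonneg (wt_pos _ _ _).le (hf0 i))
      (Finset.sum_le_sum_of_subset_of_nonneg h6 fun i _ _ => (wt_pos _ _ _).le)
      (Finset.sum_nonneg fun _ _ => (wt_pos _ _ _).le)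
      (Finset.sum_nonneg fun i _ => mul_nonneg (wt_pos _ _ _).le (hf0 i))
  · intro a b
    have h1 := wt_lattice hβ Λ a b
    have h2 : f a ≤ f (a ⊔ b) := hf le_sup_left
    calc wt β Λ a * f a * wt β Λ b = (wt β Λ a * wt β Λ b) * f a := by ring
      _ ≤ (wt β Λ (a ⊓ b) * wt β Λ (a ⊔ b)) * f (a ⊔ b) := by
          gcongr
          · exact hf0 a
          · exact mul_nonneg (wt_pos _ _ _).le (wt_pos _ _ _).le
      _ = _ := by ring

/-- The average over configurations frozen off `Λ'` may be computed with the weight of `Λ'`. -/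
theorem exs_Cf_eq {Λ' : Finset (ℤ × ℤ)} (h : Λ' ⊆ Λ) : exs β Λ (Cf Λ' σ) f = ex β Λ' σ f := by
  have h1 : ∀ ω ∈ Cf Λ' σ, wt β Λ ω = wt β Λ σ / wt β Λ' σ * wt β Λ' ω := by
    intro ω hω
    have := wt_mul_wt β h (mem_Cf.1 hω)
    field_simp [(wt_pos β Λ' σ).ne']
    linarith
  have hc : 0 < wt β Λ σ / wt β Λ' σ := div_pos (wt_pos _ _ _) (wt_pos _ _ _)
  unfold ex exs
  rw [Finset.sum_congr rfl fun ω hω => by rw [h1 ω hω, mul_assoc], Finset.sum_congr rfl h1,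
    ← Finset.mul_sum, ← Finset.mul_sum, mul_div_mul_left _ _ hc.ne']

end exs

section tower
variable {β : ℝ} {Λ Λ' : Finset (ℤ × ℤ)} {σ : Cfg2}

/-- Consistency (DLR equations) of the finite-volume measures. -/
theorem ex_tower (h : Λ' ⊆ Λ) (f : Cfg2 → ℝ) :
    ex β Λ σ f = ex β Λ σ (fun ω => ex β Λ' ω f) := by
  unfold ex
  conv_lhs => rw [exs]
  conv_rhs => rw [exs]
  congr 1
  have h1 : ∀ ω ∈ Cf Λ σ, wt β Λ ω * exs β Λ' (Cf Λ' ω) f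
      = ∑ η ∈ Cf Λ σ, if η ∈ Cf Λ' ω then
          wt β Λ η * f η * (wt β Λ' ω / ∑ ζ ∈ Cf Λ' ω, wt β Λ' ζ) else 0 := by
    intro ω hω
    rw [← Finset.sum_filter, Finset.filter_mem_eq_inter,
      Finset.inter_eq_right.2 (Cf_subset h hω), exs, mul_div_assoc', Finset.mul_sum,
      Finset.sum_div]
    refine Finset.sum_congr rfl fun η hη => ?_
    have := wt_mul_wt β h (mem_Cf.1 hη)
    rw [mul_div_assoc']
    congr 1
    linear_combination (-f η) * this
  have h2 : ∀ η ∈ Cf Λ σ, wt β Λ η * f η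
      = ∑ ω ∈ Cf Λ σ, if η ∈ Cf Λ' ω then
          wt β Λ η * f η * (wt β Λ' ω / ∑ ζ ∈ Cf Λ' ω, wt β Λ' ζ) else 0 := by
    intro η hη
    have h3 : ∀ ω, η ∈ Cf Λ' ω ↔ ω ∈ Cf Λ' η := by
      intro ω
      simp only [mem_Cf]
      exact forall₂_congr fun _ _ => eq_comm
    simp only [h3]
    rw [← Finset.sum_filter, Finset.filter_mem_eq_inter,
      Finset.inter_eq_right.2 (Cf_subset h hη), ← Finset.mul_sum]
    rw [Finset.sum_congr rfl fun ω hω => by rw [Cf_eq_of_mem hω], ← Finset.sum_div,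
      div_self (sum_wt_pos β Λ' (Cf_nonempty _ _)).ne', mul_one]
  rw [Finset.sum_congr rfl h1, Finset.sum_congr rfl h2, Finset.sum_comm]

/-- Consistency with a factor that does not depend on the inner volume. -/
theorem ex_tower_mul (h : Λ' ⊆ Λ) (f g : Cfg2 → ℝ)
    (hg : ∀ ω ω' : Cfg2, (∀ x ∉ Λ', ω x = ω' x) → g ω = g ω') :
    ex β Λ σ (fun ω => g ω * f ω) = ex β Λ σ (fun ω => g ω * ex β Λ' ω f) := by
  rw [ex_tower h]
  refine ex_congr fun ω _ => ?_
  rw [← ex_const_mul]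
  exact ex_congr fun ω' hω' => by rw [hg _ _ (mem_Cf.1 hω')]

end tower

/-! ### Probabilities of events -/

section pr
variable {β : ℝ} {Λ Λ' : Finset (ℤ × ℤ)} {σ σ' : Cfg2} {A B : Set Cfg2}

theorem pr_congr_bc (h : ∀ x ∉ Λ, σ x = σ' x) : pr β Λ σ A = pr β Λ σ' A := by
  unfold pr ex
  rw [Cf_congr h]

theorem pr_congr (h : ∀ ω ∈ Cf Λ σ, ω ∈ A ↔ ω ∈ B) : pr β Λ σ A = pr β Λ σ B :=
  ex_congr fun ω hω => by simp only [ind, h ω hω]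

theorem pr_mono (h : ∀ ω ∈ Cf Λ σ, ω ∈ A → ω ∈ B) : pr β Λ σ A ≤ pr β Λ σ B :=
  ex_mono fun ω hω => by
    have := h ω hω
    unfold ind
    split_ifs <;> simp_all

theorem pr_nonneg : 0 ≤ pr β Λ σ A := by
  rw [← ex_const (β := β) (Λ := Λ) (σ := σ) 0]
  exact ex_mono fun ω _ => ind_nonneg A ω

theorem pr_le_one : pr β Λ σ A ≤ 1 := by
  rw [← ex_const (β := β) (Λ := Λ) (σ := σ) 1]
  exact ex_mono fun ω _ => ind_le_one A ω

theorem pr_univ : pr β Λ σ Set.univ = 1 := by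
  rw [← ex_const (β := β) (Λ := Λ) (σ := σ) 1]
  exact ex_congr fun ω _ => by simp [ind]

theorem pr_empty : pr β Λ σ ∅ = 0 := by
  rw [← ex_const (β := β) (Λ := Λ) (σ := σ) 0]
  exact ex_congr fun ω _ => by simp [ind]

theorem pr_inter_add_diff (A B : Set Cfg2) : pr β Λ σ (A ∩ B) + pr β Λ σ (A \ B) = pr β Λ σ A := by
  unfold pr
  rw [← ex_add]
  refine ex_congr fun ω _ => ?_
  by_cases h1 : ω ∈ A <;> by_cases h2 : ω ∈ B <;> simp [ind, h1, h2]

theorem pr_compl (A : Set Cfg2) : pr β Λ σ Aᶜ = 1 - pr β Λ σ A := by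
  have := pr_inter_add_diff (β := β) (Λ := Λ) (σ := σ) Set.univ A
  rw [Set.univ_inter, pr_univ, ← Set.compl_eq_univ_sdiff] at this
  linarith

theorem pr_union_le (A B : Set Cfg2) : pr β Λ σ (A ∪ B) ≤ pr β Λ σ A + pr β Λ σ B := by
  unfold pr
  rw [← ex_add]
  refine ex_mono fun ω _ => ?_
  by_cases h1 : ω ∈ A <;> by_cases h2 : ω ∈ B <;> simp [ind, h1, h2]

theorem pr_biUnion_le {ι : Type*} (S : Finset ι) (F : ι → Set Cfg2) :
    pr β Λ σ (⋃ i ∈ S, F i) ≤ ∑ i ∈ S, pr β Λ σ (F i) := by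
  induction S using Finset.induction_on with
  | empty => simp [pr_empty]
  | insert a S ha ih =>
    rw [Finset.set_biUnion_insert, Finset.sum_insert ha]
    exact (pr_union_le _ _).trans (by linarith)

theorem pr_pos (h : ∃ ω ∈ Cf Λ σ, ω ∈ A) : 0 < pr β Λ σ A := by
  obtain ⟨ω, h1, h2⟩ := h
  refine div_pos ?_ (sum_wt_pos β Λ (Cf_nonempty _ _))
  refine Finset.sum_pos' (fun η _ => mul_nonneg (wt_pos _ _ _).le (ind_nonneg _ _)) ⟨ω, h1, ?_⟩
  simpa [ind, h2] using wt_pos β Λ ω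

/-- Average over the configurations in an event. -/
theorem exs_filter (f : Cfg2 → ℝ) (hA : ∃ ω ∈ Cf Λ σ, ω ∈ A) :
    exs β Λ ((Cf Λ σ).filter (· ∈ A)) f * pr β Λ σ A = ex β Λ σ (fun ω => ind A ω * f ω) := by
  have h0 : ((Cf Λ σ).filter (· ∈ A)).Nonempty := by
    obtain ⟨ω, h1, h2⟩ := hA
    exact ⟨ω, Finset.mem_filter.2 ⟨h1, h2⟩⟩
  have h1 : ∀ g : Cfg2 → ℝ, ∑ ω ∈ (Cf Λ σ).filter (· ∈ A), g ω = ∑ ω ∈ Cf Λ σ, g ω * ind A ω := by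
    intro g
    rw [Finset.sum_filter]
    exact Finset.sum_congr rfl fun ω _ => by by_cases h : ω ∈ A <;> simp [ind, h]
  have h2 : exs β Λ ((Cf Λ σ).filter (· ∈ A)) f
      = (∑ ω ∈ Cf Λ σ, wt β Λ ω * (ind A ω * f ω)) / ∑ ω ∈ Cf Λ σ, wt β Λ ω * ind A ω := by
    unfold exs
    rw [h1, h1]
    congr 1
    exact Finset.sum_congr rfl fun _ _ => by ring
  have h3 : 0 < ∑ ω ∈ Cf Λ σ, wt β Λ ω * ind A ω := by
    rw [← h1]
    exact sum_wt_pos _ _ h0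
  rw [h2, pr, ex, exs, ex, exs, div_mul_div_comm, mul_comm, mul_div_mul_left _ _ h3.ne']

theorem exs_filter_pr (A B : Set Cfg2) (hA : ∃ ω ∈ Cf Λ σ, ω ∈ A) :
    exs β Λ ((Cf Λ σ).filter (· ∈ A)) (ind B) * pr β Λ σ A = pr β Λ σ (A ∩ B) := by
  rw [exs_filter _ hA]
  exact ex_congr fun ω _ => by
    by_cases h1 : ω ∈ A <;> by_cases h2 : ω ∈ B <;> simp [ind, h1, h2]

theorem pr_eq_zero_of_forall_notMem (h : ∀ ω ∈ Cf Λ σ, ω ∉ A) : pr β Λ σ A = 0 := by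
  rw [← pr_empty (β := β) (Λ := Λ) (σ := σ)]
  exact pr_congr fun ω hω => by simp [h ω hω]

/-- FKG inequality. -/
theorem fkg (hβ : 0 ≤ β) (hA : IsUpperSet A) (hB : IsUpperSet B) :
    pr β Λ σ A * pr β Λ σ B ≤ pr β Λ σ (A ∩ B) := by
  by_cases h : ∃ ω ∈ Cf Λ σ, ω ∈ A
  · rw [← exs_filter_pr A B h, mul_comm]
    refine mul_le_mul_of_nonneg_right ?_ pr_nonneg
    refine exs_le_exs hβ (Cf_nonempty _ _) ?_ ?_ (ind_mono_of_isUpperSet hB) (ind_nonneg B)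
    · obtain ⟨ω, h1, h2⟩ := h
      exact ⟨ω, Finset.mem_filter.2 ⟨h1, h2⟩⟩
    · intro a ha b hb
      rw [Finset.mem_filter] at *
      simp only [mem_Cf] at *
      refine ⟨fun x hx => ?_, fun x hx => ?_, hA le_sup_right hb.2⟩
      · simp [ha x hx, hb.1 x hx]
      · simp [ha x hx, hb.1 x hx]
  · push Not at h
    rw [pr_eq_zero_of_forall_notMem h, zero_mul]
    exact pr_nonneg

theorem fkg_lower (hβ : 0 ≤ β) (hA : IsLowerSet A) (hB : IsLowerSet B) :
    pr β Λ σ A * pr β Λ σ B ≤ pr β Λ σ (A ∩ B) := by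
  have h1 := fkg (Λ := Λ) (σ := σ) hβ hA.compl hB.compl
  have h2 := pr_inter_add_diff (β := β) (Λ := Λ) (σ := σ) Aᶜ Bᶜ
  have h3 := pr_inter_add_diff (β := β) (Λ := Λ) (σ := σ) B A
  rw [show Aᶜ \ Bᶜ = B \ A by ext; simp; tauto] at h2
  rw [Set.inter_comm B A] at h3
  rw [pr_compl, pr_compl] at h1
  rw [pr_compl] at h2
  nlinarith

/-- Monotonicity in boundary conditions and volume: shrinking the volume by freezing pluses. -/
theorem pr_le_pr_of_plus (hβ : 0 ≤ β) (h : Λ' ⊆ Λ) (hσ : ∀ x ∉ Λ, σ x ≤ σ' x)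
    (hp : ∀ x ∈ Λ, x ∉ Λ' → σ' x = true) (hA : IsUpperSet A) :
    pr β Λ σ A ≤ pr β Λ' σ' A := by
  have h1 : pr β Λ' σ' A = exs β Λ (Cf Λ' σ') (ind A) := (exs_Cf_eq h).symm
  rw [h1]
  refine exs_le_exs hβ (Cf_nonempty _ _) (Cf_nonempty _ _) ?_ (ind_mono_of_isUpperSet hA)
    (ind_nonneg A)
  intro a ha b hb
  simp only [mem_Cf] at *
  refine ⟨fun x hx => ?_, fun x hx => ?_⟩
  · have := hσ x hx
    rw [Pi.inf_apply, ha x hx, hb x (fun h' => hx (h h'))]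
    exact inf_eq_left.2 this
  · rw [Pi.sup_apply, hb x hx]
    by_cases hx' : x ∈ Λ
    · rw [hp x hx' hx]; simp
    · rw [ha x hx']
      exact sup_eq_right.2 (hσ x hx')

/-- Monotonicity in boundary conditions and volume: shrinking the volume by freezing minuses. -/
theorem pr_le_pr_of_minus (hβ : 0 ≤ β) (h : Λ' ⊆ Λ) (hσ : ∀ x ∉ Λ, σ' x ≤ σ x)
    (hp : ∀ x ∈ Λ, x ∉ Λ' → σ' x = false) (hA : IsUpperSet A) :
    pr β Λ' σ' A ≤ pr β Λ σ A := by
  have h1 : pr β Λ' σ' A = exs β Λ (Cf Λ' σ') (ind A) := (exs_Cf_eq h).symm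
  rw [h1]
  refine exs_le_exs hβ (Cf_nonempty _ _) (Cf_nonempty _ _) ?_ (ind_mono_of_isUpperSet hA)
    (ind_nonneg A)
  intro a ha b hb
  simp only [mem_Cf] at *
  refine ⟨fun x hx => ?_, fun x hx => ?_⟩
  · rw [Pi.inf_apply, ha x hx]
    by_cases hx' : x ∈ Λ
    · rw [hp x hx' hx]; simp
    · rw [hb x hx']
      exact inf_eq_left.2 (hσ x hx')
  · have := hσ x hx
    rw [Pi.sup_apply, hb x hx, ha x (fun h' => hx (h h'))]
    exact sup_eq_right.2 this

theorem pr_mono_bc (hβ : 0 ≤ β) (hσ : ∀ x ∉ Λ, σ x ≤ σ' x) (hA : IsUpperSet A) :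
    pr β Λ σ A ≤ pr β Λ σ' A :=
  pr_le_pr_of_plus hβ subset_rfl hσ (fun _ h h' => absurd h h') hA

theorem pr_tower (h : Λ' ⊆ Λ) : pr β Λ σ A = ex β Λ σ (fun ω => pr β Λ' ω A) := ex_tower h _

theorem mem_Cf_sdiff_update {x : ℤ × ℤ} (hx : x ∈ Λ) {a : Bool} {ω : Cfg2} :
    ω ∈ Cf (Λ.erase x) (Function.update σ x a) ↔ ω ∈ Cf Λ σ ∧ ω x = a := by
  simp only [mem_Cf, Finset.mem_erase, not_and]
  constructor
  · intro h
    have h1 : ω x = a := by simpa using h x (fun h => absurd rfl h)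
    refine ⟨fun y hy => ?_, h1⟩
    have hyx : y ≠ x := by rintro rfl; exact hy hx
    simpa [hyx] using h y (fun _ => hy)
  · rintro ⟨h1, h2⟩ y hy
    by_cases hyx : y = x
    · subst hyx; simpa using h2
    · simpa [hyx] using h1 y (hy hyx)

/-- Conditioning on the value of one spin. -/
theorem pr_inter_site {x : ℤ × ℤ} (hx : x ∈ Λ) (a : Bool) (A : Set Cfg2) :
    pr β Λ σ ({ω | ω x = a} ∩ A)
      = pr β Λ σ {ω | ω x = a} * pr β (Λ.erase x) (Function.update σ x a) A := by
  have h0 : ∃ ω ∈ Cf Λ σ, ω ∈ {ω : Cfg2 | ω x = a} := by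
    refine ⟨Function.update σ x a, mem_Cf.2 fun y hy => ?_, by simp⟩
    have hyx : y ≠ x := by rintro rfl; exact hy hx
    simp [hyx]
  rw [← exs_filter_pr _ A h0, mul_comm]
  congr 1
  have h1 : ∀ E : Set Cfg2, E = {ω : Cfg2 | ω x = a} →
      (Cf Λ σ).filter (· ∈ E) = Cf (Λ.erase x) (Function.update σ x a) := by
    intro E hE
    ext ω
    rw [mem_Cf_sdiff_update hx, Finset.mem_filter, hE, Set.mem_ofPred_eq]
  rw [h1 _ rfl]
  exact exs_Cf_eq (Finset.erase_subset _ _)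

theorem pr_split_site {x : ℤ × ℤ} (hx : x ∈ Λ) (A : Set Cfg2) :
    pr β Λ σ A = pr β Λ σ {ω | ω x = true} * pr β (Λ.erase x) (Function.update σ x true) A
      + pr β Λ σ {ω | ω x = false} * pr β (Λ.erase x) (Function.update σ x false) A := by
  rw [← pr_inter_site hx, ← pr_inter_site hx,
    ← pr_inter_add_diff A {ω | ω x = true}, Set.inter_comm]
  congr 2
  ext ω
  simp [and_comm]

theorem pr_site_add {x : ℤ × ℤ} :
    pr β Λ σ {ω | ω x = true} + pr β Λ σ {ω | ω x = false} = 1 := by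
  have := pr_compl (β := β) (Λ := Λ) (σ := σ) {ω | ω x = true}
  rw [show {ω : Cfg2 | ω x = true}ᶜ = {ω | ω x = false} by ext; simp] at this
  linarith

end pr

end Schonmann
end

noncomputable section
open scoped Classical FinsetFamily
namespace Schonmann

/-! ### Symmetries and locality -/

section sym
variable {β : ℝ} {Λ Λ' : Finset (ℤ × ℤ)} {σ σ' : Cfg2} {A B : Set Cfg2}

theorem ex_equiv (T : Cfg2 ≃ Cfg2) {Λ' : Finset (ℤ × ℤ)} (hC : ∀ ω, T ω ∈ Cf Λ' σ' ↔ ω ∈ Cf Λ σ)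
    (hw : ∀ ω, wt β Λ' (T ω) = wt β Λ ω) (f : Cfg2 → ℝ) :
    ex β Λ' σ' f = ex β Λ σ (fun ω => f (T ω)) := by
  have h1 : ∀ g : Cfg2 → ℝ, ∑ ω ∈ Cf Λ' σ', g ω = ∑ ω ∈ Cf Λ σ, g (T ω) := by
    intro g
    refine (Finset.sum_equiv T (fun ω => (hC ω).symm) fun _ _ => rfl).symm
  unfold ex exs
  rw [h1, h1]
  simp only [hw]

theorem pr_equiv (T : Cfg2 ≃ Cfg2) {Λ' : Finset (ℤ × ℤ)} (hC : ∀ ω, T ω ∈ Cf Λ' σ' ↔ ω ∈ Cf Λ σ)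
    (hw : ∀ ω, wt β Λ' (T ω) = wt β Λ ω) (A : Set Cfg2) :
    pr β Λ' σ' A = pr β Λ σ {ω | T ω ∈ A} := ex_equiv T hC hw _

/-- Spin flip of a configuration. -/
def flipCfg (ω : Cfg2) : Cfg2 := fun x => !ω x

theorem flipCfg_flipCfg (ω : Cfg2) : flipCfg (flipCfg ω) = ω := by ext; simp [flipCfg]

theorem sval_not (b : Bool) : sval (!b) = -sval b := by cases b <;> simp [sval]

theorem pr_flip : pr β Λ (flipCfg σ) A = pr β Λ σ {ω | flipCfg ω ∈ A} := by
  refine pr_equiv ⟨flipCfg, flipCfg, flipCfg_flipCfg, flipCfg_flipCfg⟩ (fun ω => ?_) (fun ω => ?_) A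
  · simp [mem_Cf, flipCfg]
  · simp [wt, energy, flipCfg, sval_not]

/-- Lattice symmetries. -/
theorem pr_map (e : (ℤ × ℤ) ≃ (ℤ × ℤ)) (he : ∀ x y, e y ∈ nbrs (e x) ↔ y ∈ nbrs x) :
    pr β (Λ.map e.toEmbedding) σ A = pr β Λ (σ ∘ e) {ω | ω ∘ e.symm ∈ A} := by
  refine pr_equiv (Equiv.arrowCongr e (Equiv.refl _)) (fun ω => ?_) (fun ω => ?_) A
  · simp only [mem_Cf, Finset.mem_map_equiv, Equiv.arrowCongr_apply, Function.comp_apply,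
      Equiv.refl_apply]
    constructor
    · intro h x hx
      simpa using h (e x) (by simpa using hx)
    · intro h x hx
      simpa using h _ hx
  · simp only [wt, energy]
    congr 3
    symm
    refine Finset.sum_equiv (e.prodCongr e) (fun p => ?_) fun p _ => ?_
    · simp [mem_pairs, he]
    · simp

/-- The horizontal translation by `k`. -/
def hshift (k : ℤ) : (ℤ × ℤ) ≃ (ℤ × ℤ) := (Equiv.addRight k).prodCongr (Equiv.refl ℤ)

@[simp] theorem hshift_apply (k : ℤ) (x : ℤ × ℤ) : hshift k x = (x.1 + k, x.2) := rfl

@[simp] theorem hshift_symm_apply (k : ℤ) (x : ℤ × ℤ) : (hshift k).symm x = (x.1 - k, x.2) := by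
  rw [Equiv.symm_apply_eq]
  simp

theorem hshift_nbrs (k : ℤ) (x y : ℤ × ℤ) : hshift k y ∈ nbrs (hshift k x) ↔ y ∈ nbrs x := by
  obtain ⟨a, b⟩ := x
  obtain ⟨c, d⟩ := y
  simp only [nbrs, Finset.mem_insert, Finset.mem_singleton, Prod.mk.injEq, hshift_apply]
  omega

/-- Horizontal translate of a finite volume. -/
def tr (k : ℤ) (Λ : Finset (ℤ × ℤ)) : Finset (ℤ × ℤ) := Λ.map (hshift k).toEmbedding

theorem mem_tr {k : ℤ} {x : ℤ × ℤ} : x ∈ tr k Λ ↔ (x.1 - k, x.2) ∈ Λ := by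
  rw [tr, Finset.mem_map_equiv, hshift_symm_apply]

theorem pr_tr (k : ℤ) :
    pr β (tr k Λ) σ A = pr β Λ (fun x => σ (x.1 + k, x.2)) {ω | (fun x => ω (x.1 - k, x.2)) ∈ A} := by
  rw [tr, pr_map _ (hshift_nbrs k)]
  simp only [Function.comp_def, hshift_apply, hshift_symm_apply]

/-- The reflection in the horizontal axis. -/
def vrefl : (ℤ × ℤ) ≃ (ℤ × ℤ) := (Equiv.refl ℤ).prodCongr (Equiv.neg ℤ)

@[simp] theorem vrefl_apply (x : ℤ × ℤ) : vrefl x = (x.1, -x.2) := rfl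

@[simp] theorem vrefl_symm_apply (x : ℤ × ℤ) : vrefl.symm x = (x.1, -x.2) := by
  rw [Equiv.symm_apply_eq]
  simp

theorem vrefl_nbrs (x y : ℤ × ℤ) : vrefl y ∈ nbrs (vrefl x) ↔ y ∈ nbrs x := by
  obtain ⟨a, b⟩ := x
  obtain ⟨c, d⟩ := y
  simp only [nbrs, Finset.mem_insert, Finset.mem_singleton, Prod.mk.injEq, vrefl_apply]
  omega

theorem pr_vrefl (hΛ : ∀ x : ℤ × ℤ, (x.1, -x.2) ∈ Λ ↔ x ∈ Λ)
    (hσ : ∀ x : ℤ × ℤ, σ (x.1, -x.2) = σ x) :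
    pr β Λ σ A = pr β Λ σ {ω | (fun x => ω (x.1, -x.2)) ∈ A} := by
  have h1 : Λ.map vrefl.toEmbedding = Λ := by
    ext x
    rw [Finset.mem_map_equiv, vrefl_symm_apply, hΛ]
  have h2 : σ ∘ vrefl = σ := by
    ext x
    simp [hσ]
  conv_lhs => rw [← h1]
  rw [pr_map _ vrefl_nbrs, h2]
  simp only [Function.comp_def, vrefl_symm_apply]

/-- Expectations depend on the boundary condition only through the sites adjacent to `Λ`. -/
theorem ex_congr_bdry {f f' : Cfg2 → ℝ}
    (hσ : ∀ x ∈ Λ, ∀ y ∈ nbrs x, y ∉ Λ → σ y = σ' y)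
    (hf : ∀ ω ∈ Cf Λ σ, ∀ ω' ∈ Cf Λ σ', (∀ x ∈ Λ, ω x = ω' x) → f ω = f' ω') :
    ex β Λ σ f = ex β Λ σ' f' := by
  let T : Cfg2 → Cfg2 → Cfg2 := fun τ ω x => if x ∈ Λ then ω x else τ x
  have hT : ∀ τ ω, T τ ω ∈ Cf Λ τ := fun τ ω => mem_Cf.2 fun x hx => by simp [T, hx]
  have hTT : ∀ τ τ' ω, ω ∈ Cf Λ τ → T τ (T τ' ω) = ω := by
    intro τ τ' ω h
    ext x
    by_cases hx : x ∈ Λ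
    · simp [T, hx]
    · simp [T, hx, mem_Cf.1 h x hx]
  have hag : ∀ τ ω, ∀ x ∈ Λ, ω x = T τ ω x := fun τ ω x hx => by simp [T, hx]
  have hw : ∀ ω ∈ Cf Λ σ, wt β Λ ω = wt β Λ (T σ' ω) := by
    intro ω hω
    rw [wt, wt, energy, energy]
    congr 3
    have hs : ∀ x ∈ Λ, ∀ y ∈ nbrs x, ω y = T σ' ω y := by
      intro x hx y hy
      by_cases hy' : y ∈ Λ
      · exact hag _ _ _ hy'
      · rw [mem_Cf.1 hω y hy', mem_Cf.1 (hT σ' ω) y hy', hσ x hx y hy hy']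
    refine Finset.sum_congr rfl fun p hp => ?_
    obtain ⟨h1, h2 | h2⟩ := mem_pairs.1 hp
    · rw [← hs _ h2 _ h1, ← hag σ' ω _ h2]
    · rw [← hs _ h2 _ (mem_nbrs_comm.1 h1), ← hag σ' ω _ h2]
  unfold ex exs
  congr 1
  · refine Finset.sum_nbij' (T σ') (T σ) (fun ω _ => hT _ _) (fun ω _ => hT _ _)
      (fun ω hω => hTT _ _ _ hω) (fun ω hω => hTT _ _ _ hω) fun ω hω => ?_
    rw [hw ω hω, hf ω hω _ (hT _ _) (hag _ _)]
  · exact Finset.sum_nbij' (T σ') (T σ) (fun ω _ => hT _ _) (fun ω _ => hT _ _)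
      (fun ω hω => hTT _ _ _ hω) (fun ω hω => hTT _ _ _ hω) hw

theorem pr_congr_bdry
    (hσ : ∀ x ∈ Λ, ∀ y ∈ nbrs x, y ∉ Λ → σ y = σ' y)
    (hf : ∀ ω ∈ Cf Λ σ, ∀ ω' ∈ Cf Λ σ', (∀ x ∈ Λ, ω x = ω' x) → (ω ∈ A ↔ ω' ∈ B)) :
    pr β Λ σ A = pr β Λ σ' B :=
  ex_congr_bdry hσ fun ω h ω' h' hag => by simp only [ind, hf ω h ω' h' hag]

theorem pr_true_anti (hβ : 0 ≤ β) (h : Λ' ⊆ Λ) (hA : IsUpperSet A) :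
    pr β Λ (fun _ => true) A ≤ pr β Λ' (fun _ => true) A :=
  pr_le_pr_of_plus hβ h (fun _ _ => le_rfl) (fun _ _ _ => rfl) hA

theorem pr_le_true (hβ : 0 ≤ β) (hA : IsUpperSet A) :
    pr β Λ σ A ≤ pr β Λ (fun _ => true) A :=
  pr_mono_bc hβ (fun _ _ => Bool.le_true _) hA

theorem pr_lower_plus (hβ : 0 ≤ β) (h : Λ' ⊆ Λ) (hσ : ∀ x ∉ Λ, σ x ≤ σ' x)
    (hp : ∀ x ∈ Λ, x ∉ Λ' → σ' x = true) (hA : IsLowerSet A) :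
    pr β Λ' σ' A ≤ pr β Λ σ A := by
  have := pr_le_pr_of_plus (β := β) hβ h hσ hp hA.compl
  rw [pr_compl, pr_compl] at this
  linarith

theorem pr_lower_minus (hβ : 0 ≤ β) (h : Λ' ⊆ Λ) (hσ : ∀ x ∉ Λ, σ' x ≤ σ x)
    (hp : ∀ x ∈ Λ, x ∉ Λ' → σ' x = false) (hA : IsLowerSet A) :
    pr β Λ σ A ≤ pr β Λ' σ' A := by
  have := pr_le_pr_of_minus (β := β) hβ h hσ hp hA.compl
  rw [pr_compl, pr_compl] at this
  linarith

end sym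

/-! ### Finite energy -/

theorem isUpperSet_site (x : ℤ × ℤ) : IsUpperSet {ω : Cfg2 | ω x = true} := by
  intro a b hab ha
  have : a x ≤ b x := hab x
  rw [Set.mem_ofPred_eq] at *
  rw [ha] at this
  exact Bool.eq_true_of_true_le this

theorem isLowerSet_site (x : ℤ × ℤ) : IsLowerSet {ω : Cfg2 | ω x = false} := by
  have := (isUpperSet_site x).compl
  convert this using 1
  ext ω
  simp

/-- Lower bound for the conditional probability of either sign at a site. -/
def eps (β : ℝ) : ℝ := pr β {((0 : ℤ), (0 : ℤ))} (fun _ => true) {ω | ω (0, 0) = false}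

theorem eps_pos (β : ℝ) : 0 < eps β := by
  refine pr_pos ⟨Function.update (fun _ => true) (0, 0) false, mem_Cf.2 fun x hx => ?_, by simp⟩
  have : x ≠ (0, 0) := by simpa using hx
  simp [this]

/-- Translations of the lattice. -/
theorem pr_single (β : ℝ) (x : ℤ × ℤ) :
    pr β {x} (fun _ => true) {ω | ω x = false} = eps β := by
  let e : (ℤ × ℤ) ≃ (ℤ × ℤ) := Equiv.addRight x
  have he : ∀ u v, e v ∈ nbrs (e u) ↔ v ∈ nbrs u := by
    rintro ⟨a, b⟩ ⟨c, d⟩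
    simp only [nbrs, Finset.mem_insert, Finset.mem_singleton, e,
      Equiv.coe_addRight, Prod.ext_iff, Prod.fst_add, Prod.snd_add]
    omega
  have := pr_map (β := β) (Λ := {((0 : ℤ), (0 : ℤ))}) (σ := fun _ => true)
    (A := {ω | ω x = false}) e he
  rw [eps, show ({x} : Finset (ℤ × ℤ)) = Finset.map e.toEmbedding {((0 : ℤ), (0 : ℤ))} by
    simp [e], this]
  congr 1
  ext ω
  simp [e, Prod.zero_eq_mk]

theorem eps_le_pr_false {β : ℝ} (hβ : 0 ≤ β) {Λ : Finset (ℤ × ℤ)} {σ : Cfg2} {x : ℤ × ℤ} (hx : x ∈ Λ) :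
    eps β ≤ pr β Λ σ {ω | ω x = false} := by
  rw [← pr_single β x]
  exact pr_lower_plus hβ (by simpa using hx) (fun _ _ => Bool.le_true _) (fun _ _ _ => rfl)
    (isLowerSet_site x)

theorem eps_le_pr_true {β : ℝ} (hβ : 0 ≤ β) {Λ : Finset (ℤ × ℤ)} {σ : Cfg2} {x : ℤ × ℤ} (hx : x ∈ Λ) :
    eps β ≤ pr β Λ σ {ω | ω x = true} := by
  have h := pr_flip (β := β) (Λ := Λ) (σ := flipCfg σ) (A := {ω | ω x = true})
  rw [flipCfg_flipCfg] at h
  rw [h]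
  convert eps_le_pr_false hβ hx (σ := flipCfg σ) using 2
  ext ω
  simp [flipCfg]

theorem pr_true_le {β : ℝ} (hβ : 0 ≤ β) {Λ : Finset (ℤ × ℤ)} {σ : Cfg2} {x : ℤ × ℤ} (hx : x ∈ Λ) :
    pr β Λ σ {ω | ω x = true} ≤ 1 - eps β := by
  have := eps_le_pr_false hβ hx (σ := σ)
  have := pr_site_add (β := β) (Λ := Λ) (σ := σ) (x := x)
  linarith

/-! ### Boxes cut along the axis -/

theorem mem_box {n : ℕ} {x : ℤ × ℤ} :
    x ∈ box n ↔ -(n : ℤ) ≤ x.1 ∧ x.1 ≤ n ∧ -(n : ℤ) ≤ x.2 ∧ x.2 ≤ n := by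
  simp only [box, Finset.mem_product, Finset.mem_Icc]
  tauto

theorem box_mono {n m : ℕ} (h : n ≤ m) : box n ⊆ box m := by
  intro x
  simp only [mem_box]
  omega

/-- Remove from `Λ` the sites of the axis with abscissa at most `i`. -/
def cut (Λ : Finset (ℤ × ℤ)) (i : ℤ) : Finset (ℤ × ℤ) := Λ.filter fun x => ¬(x.2 = 0 ∧ x.1 ≤ i)

theorem mem_cut {Λ : Finset (ℤ × ℤ)} {i : ℤ} {x : ℤ × ℤ} :
    x ∈ cut Λ i ↔ x ∈ Λ ∧ ¬(x.2 = 0 ∧ x.1 ≤ i) := by simp [cut]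

/-- All spins on the axis at the abscissas in `F` are plus. -/
def plusOn (F : Finset ℤ) : Set Cfg2 := {ω | ∀ i ∈ F, ω (i, 0) = true}

theorem isUpperSet_plusOn (F : Finset ℤ) : IsUpperSet (plusOn F) :=
  fun _ _ hab ha i hi => isUpperSet_site (i, 0) hab (ha i hi)

/-- Translate of a finite set of integers. -/
def shiftF (k : ℤ) (F : Finset ℤ) : Finset ℤ := F.map (Equiv.addRight k).toEmbedding

theorem mem_shiftF {k : ℤ} {F : Finset ℤ} {i : ℤ} : i ∈ shiftF k F ↔ i - k ∈ F := by
  rw [shiftF, Finset.mem_map_equiv]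
  simp [sub_eq_add_neg]

theorem shiftF_shiftF (k l : ℤ) (F : Finset ℤ) : shiftF k (shiftF l F) = shiftF (k + l) F := by
  ext i
  simp only [mem_shiftF]
  congr! 1
  ring

theorem shiftF_zero (F : Finset ℤ) : shiftF 0 F = F := by
  ext i
  simp [mem_shiftF]

theorem pr_tr_plusOn {β : ℝ} {Λ : Finset (ℤ × ℤ)} {σ : Cfg2} (k : ℤ) (F : Finset ℤ) :
    pr β (tr k Λ) σ (plusOn (shiftF k F)) = pr β Λ (fun x => σ (x.1 + k, x.2)) (plusOn F) := by
  rw [pr_tr]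
  congr 1
  ext ω
  simp only [plusOn, Set.mem_ofPred_eq, mem_shiftF]
  constructor
  · intro h i hi
    simpa using h (i + k) (by simpa using hi)
  · intro h i hi
    exact h _ hi

end Schonmann
end

noncomputable section
open scoped Classical FinsetFamily
namespace Schonmann

/-! ### Clusters and exploration -/

/-- A step between adjacent sites of `R` of sign `b`. -/
def bstep (b : Bool) (R : Set (ℤ × ℤ)) (ω : Cfg2) (x y : ℤ × ℤ) : Prop :=
  y ∈ nbrs x ∧ x ∈ R ∧ y ∈ R ∧ ω x = b ∧ ω y = b

/-- Connection by a path of sign `b` in `R`. -/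
def conn (b : Bool) (R : Set (ℤ × ℤ)) (ω : Cfg2) : ℤ × ℤ → ℤ × ℤ → Prop :=
  Relation.ReflTransGen (bstep b R ω)

theorem bstep_symm {b : Bool} {R : Set (ℤ × ℤ)} {ω : Cfg2} {x y : ℤ × ℤ} (h : bstep b R ω x y) :
    bstep b R ω y x := ⟨mem_nbrs_comm.1 h.1, h.2.2.1, h.2.1, h.2.2.2.2, h.2.2.2.1⟩

theorem conn_symm {b : Bool} {R : Set (ℤ × ℤ)} {ω : Cfg2} {x y : ℤ × ℤ} (h : conn b R ω x y) :
    conn b R ω y x := by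
  induction h with
  | refl => exact Relation.ReflTransGen.refl
  | tail _ h ih => exact Relation.ReflTransGen.head (bstep_symm h) ih

theorem conn_mono {b : Bool} {R R' : Set (ℤ × ℤ)} (hR : R ⊆ R') {ω ω' : Cfg2}
    (hω : ∀ x ∈ R, ω x = b → ω' x = b) {x y : ℤ × ℤ} (h : conn b R ω x y) : conn b R' ω' x y := by
  refine Relation.ReflTransGen.mono (fun u v huv => ?_) _ _ h
  obtain ⟨h1, h2, h3, h4, h5⟩ := huv
  exact ⟨h1, hR h2, hR h3, hω _ h2 h4, hω _ h3 h5⟩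

/-- The sites of `D` are not connected to sites of sign `b` outside `Λ`. -/
def Sep (b : Bool) (Λ : Finset (ℤ × ℤ)) (D : Set (ℤ × ℤ)) : Set Cfg2 :=
  {ω | ∀ z ∈ D, ∀ y ∉ Λ, ω y = b → ¬conn b Set.univ ω y z}

theorem mem_Sep_erase {Λ : Finset (ℤ × ℤ)} {D : Set (ℤ × ℤ)} {σ : Cfg2} {x w : ℤ × ℤ} (hx : x ∈ Λ)
    (hw : w ∉ Λ) (hxw : w ∈ nbrs x) (hσ : σ w = false) (a : Bool) {ω : Cfg2}
    (hω : ω ∈ Cf (Λ.erase x) (Function.update σ x a)) :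
    ω ∈ Sep false Λ D ↔ ω ∈ Sep false (Λ.erase x) D := by
  rw [mem_Cf_sdiff_update hx] at hω
  obtain ⟨h1, h2⟩ := hω
  constructor
  · intro h z hz y hy hyf hc
    by_cases hyx : y = x
    · subst hyx
      have hwf : ω w = false := by rw [mem_Cf.1 h1 w hw, hσ]
      exact h z hz w hw hwf (Relation.ReflTransGen.head
        ⟨mem_nbrs_comm.1 hxw, trivial, trivial, hwf, hyf⟩ hc)
    · exact h z hz y (fun hyΛ => hy (Finset.mem_erase.2 ⟨hyx, hyΛ⟩)) hyf hc
  · intro h z hz y hy hyf hc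
    exact h z hz y (fun h' => hy (Finset.mem_of_mem_erase h')) hyf hc

/-- Exploring the minus clusters touching the boundary can only help increasing events supported
on the unexplored region. -/
theorem pr_sep_minus {β : ℝ} (hβ : 0 ≤ β) {D : Set (ℤ × ℤ)} {F : Set Cfg2} (hF : IsUpperSet F)
    (hFD : ∀ ω ω' : Cfg2, (∀ z ∈ D, ω z = ω' z) → ω ∈ F → ω' ∈ F)
    (Λ : Finset (ℤ × ℤ)) (σ : Cfg2) :
    pr β Λ σ (Sep false Λ D) * pr β Λ (fun _ => true) F ≤ pr β Λ σ (F ∩ Sep false Λ D) := by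
  induction Λ using Finset.strongInduction generalizing σ with
  | H Λ ih =>
  by_cases hx : ∃ x ∈ Λ, ∃ w ∈ nbrs x, w ∉ Λ ∧ σ w = false
  · obtain ⟨x, hx, w, hxw, hw, hσw⟩ := hx
    rw [pr_split_site hx, pr_split_site hx (A := F ∩ _), add_mul]
    have key : ∀ a : Bool, pr β (Λ.erase x) (Function.update σ x a) (Sep false Λ D)
        * pr β Λ (fun _ => true) F
        ≤ pr β (Λ.erase x) (Function.update σ x a) (F ∩ Sep false Λ D) := by
      intro a
      have h1 := ih (Λ.erase x) (Finset.erase_ssubset hx) (Function.update σ x a)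
      rw [pr_congr fun ω hω => mem_Sep_erase hx hw hxw hσw a hω]
      rw [pr_congr (A := F ∩ Sep false Λ D) (B := F ∩ Sep false (Λ.erase x) D) fun ω hω => by
        rw [Set.mem_inter_iff, Set.mem_inter_iff, mem_Sep_erase hx hw hxw hσw a hω]]
      refine le_trans (mul_le_mul_of_nonneg_left ?_ pr_nonneg) h1
      exact pr_true_anti hβ (Finset.erase_subset _ _) hF
    rw [mul_assoc, mul_assoc]
    exact add_le_add (mul_le_mul_of_nonneg_left (key true) pr_nonneg)
      (mul_le_mul_of_nonneg_left (key false) pr_nonneg)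
  · push Not at hx
    have hstay : ∀ ω ∈ Cf Λ σ, ∀ y z, y ∉ Λ → ω y = false → conn false Set.univ ω y z →
        z ∉ Λ ∧ ω z = false := by
      intro ω hω y z hy hyf hc
      induction hc with
      | refl => exact ⟨hy, hyf⟩
      | tail _ hst ih2 =>
        refine ⟨fun hΛ => ?_, hst.2.2.2.2⟩
        have h1 := hx _ hΛ _ (mem_nbrs_comm.1 hst.1) ih2.1
        rw [← mem_Cf.1 hω _ ih2.1] at h1
        exact h1 ih2.2
    have hdet : ∀ ω ∈ Cf Λ σ, ω ∈ Sep false Λ D ↔ ∀ z ∈ D, z ∉ Λ → σ z = true := by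
      intro ω hω
      constructor
      · intro h z hz hzΛ
        by_contra hz'
        have : ω z = false := by rw [mem_Cf.1 hω z hzΛ]; simpa using hz'
        exact h z hz z hzΛ this Relation.ReflTransGen.refl
      · intro h z hz y hy hyf hc
        obtain ⟨h1, h2⟩ := hstay ω hω y z hy hyf hc
        rw [mem_Cf.1 hω z h1, h z hz h1] at h2
        exact absurd h2 (by simp)
    by_cases hD : ∀ z ∈ D, z ∉ Λ → σ z = true
    · have h1 : pr β Λ σ (F ∩ Sep false Λ D) = pr β Λ σ F :=
        pr_congr fun ω hω => by simp only [Set.mem_inter_iff, hdet ω hω]; tauto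
      have h2 : pr β Λ σ F = pr β Λ (fun _ => true) F := by
        refine pr_congr_bdry (fun x hx' y hy hyΛ => ?_) fun ω hω ω' hω' hag => ?_
        · have := hx x hx' y hy hyΛ
          simpa using this
        · have hall : ∀ z ∈ D, ω z = ω' z := by
            intro z hz
            by_cases hzΛ : z ∈ Λ
            · exact hag z hzΛ
            · rw [mem_Cf.1 hω z hzΛ, mem_Cf.1 hω' z hzΛ, hD z hz hzΛ]
          exact ⟨hFD _ _ hall, hFD _ _ fun z hz => (hall z hz).symm⟩
      rw [h1, h2]
      exact mul_le_of_le_one_left pr_nonneg pr_le_one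
    · have h1 : pr β Λ σ (Sep false Λ D) = 0 :=
        pr_eq_zero_of_forall_notMem fun ω hω => by rw [hdet ω hω]; exact hD
      rw [h1, zero_mul]
      exact pr_nonneg

theorem conn_flip {b : Bool} {R : Set (ℤ × ℤ)} {ω : Cfg2} {x y : ℤ × ℤ} :
    conn b R (flipCfg ω) x y ↔ conn (!b) R ω x y := by
  have : bstep b R (flipCfg ω) = bstep (!b) R ω := by
    ext u v
    simp only [bstep, flipCfg]
    cases b <;> cases ω u <;> cases ω v <;> simp
  rw [conn, this, conn]

theorem flip_mem_Sep {b : Bool} {Λ : Finset (ℤ × ℤ)} {D : Set (ℤ × ℤ)} {ω : Cfg2} :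
    flipCfg ω ∈ Sep b Λ D ↔ ω ∈ Sep (!b) Λ D := by
  simp only [Sep, Set.mem_ofPred_eq, conn_flip]
  refine forall₂_congr fun z _ => forall₂_congr fun y _ => ?_
  simp only [flipCfg]
  cases b <;> cases ω y <;> simp

/-- Exploring the plus clusters touching the boundary can only help decreasing events supported
on the unexplored region. -/
theorem pr_sep_plus {β : ℝ} (hβ : 0 ≤ β) {D : Set (ℤ × ℤ)} {F : Set Cfg2} (hF : IsLowerSet F)
    (hFD : ∀ ω ω' : Cfg2, (∀ z ∈ D, ω z = ω' z) → ω ∈ F → ω' ∈ F)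
    (Λ : Finset (ℤ × ℤ)) (σ : Cfg2) :
    pr β Λ σ (Sep true Λ D) * pr β Λ (fun _ => false) F ≤ pr β Λ σ (F ∩ Sep true Λ D) := by
  have hanti : ∀ a b : Cfg2, a ≤ b → flipCfg b ≤ flipCfg a := by
    intro a b hab x
    have := hab x
    simp only [flipCfg]
    revert this
    cases a x <;> cases b x <;> simp
  have h := pr_sep_minus hβ (F := {ω | flipCfg ω ∈ F}) (D := D)
    (fun a b hab ha => hF (hanti a b hab) ha)
    (fun ω ω' hag hω => hFD _ _ (fun z hz => by simp only [flipCfg, hag z hz]) hω) Λ (flipCfg σ)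
  have e1 : pr β Λ σ (Sep true Λ D) = pr β Λ (flipCfg σ) (Sep false Λ D) := by
    rw [pr_flip]
    simp only [flip_mem_Sep, Bool.not_false]
    rfl
  have e2 : pr β Λ σ (F ∩ Sep true Λ D)
      = pr β Λ (flipCfg σ) ({ω | flipCfg ω ∈ F} ∩ Sep false Λ D) := by
    rw [pr_flip]
    congr 1
    ext ω
    simp [flipCfg_flipCfg, flip_mem_Sep]
  have e3 : pr β Λ (fun _ => false) F = pr β Λ (fun _ => true) {ω | flipCfg ω ∈ F} := by
    rw [← pr_flip]
    rfl
  rw [e1, e2, e3]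
  exact h

/-! ### Planarity -/

/-- Indicator that `u` lies strictly below the right neighbour of `z`. -/
def below (u z : ℤ × ℤ) : ℤ := if u.1 = z.1 + 1 ∧ u.2 < z.2 then 1 else 0

/-- Indicator that `u` does not lie strictly to the right of `z`. -/
def leftOf (u z : ℤ × ℤ) : ℤ := if u.1 ≤ z.1 then 1 else 0

/-- Indicator that the edge from `v` to `w` crosses, below `z`, the line to the right of `z`. -/
def crossing (v w z : ℤ × ℤ) : ℤ :=
  if v.2 = w.2 ∧ v.2 < z.2 ∧ ((v.1 = z.1 ∧ w.1 = z.1 + 1) ∨ (w.1 = z.1 ∧ v.1 = z.1 + 1))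
    then 1 else 0

/-- The parity of the number of crossings of a minus path. -/
theorem exists_parity {R : Set (ℤ × ℤ)} {ω : Cfg2} {u v : ℤ × ℤ} (h : conn false R ω u v) :
    ∃ c : ℤ × ℤ → ℤ,
      (∀ x y : ℤ, ω (x + 1, y) = true →
        (c (x, y) + c (x + 1, y) + below u (x, y) + below v (x, y)) % 2 = 0) ∧
      (∀ x y : ℤ, ω (x, y) = true → (c (x, y) + c (x, y + 1)) % 2 = 0) ∧
      (∀ z, (∀ w ∈ R, z.2 ≤ w.2) → c z % 2 = 0) ∧
      (∀ z, ω z = true → (∀ w ∈ R, w.2 ≤ z.2) → (c z + leftOf u z + leftOf v z) % 2 = 0) ∧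
      (∀ z, (∀ w ∈ R, w.1 ≤ z.1) → c z % 2 = 0) ∧
      (∀ z, (∀ w ∈ R, z.1 < w.1) → c z % 2 = 0) := by
  induction h with
  | refl => exact ⟨fun _ => 0, by intros; beta_reduce; omega, by intros; beta_reduce; omega,
      by intros; beta_reduce; omega, by intros; beta_reduce; omega, by intros; beta_reduce; omega,
      by intros; beta_reduce; omega⟩
  | @tail v w _ hst ih =>
    obtain ⟨c, h1, h2, h3, h4, h5, h6⟩ := ih
    obtain ⟨hvw, hv, hw, hvf, hwf⟩ := hst
    have hadj : (w.1 = v.1 + 1 ∧ w.2 = v.2) ∨ (w.1 = v.1 - 1 ∧ w.2 = v.2) ∨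
        (w.1 = v.1 ∧ w.2 = v.2 + 1) ∨ (w.1 = v.1 ∧ w.2 = v.2 - 1) := by
      simpa [nbrs, Prod.ext_iff] using hvw
    have hne : ∀ z : ℤ × ℤ, ω z = true → ¬(v.1 = z.1 ∧ v.2 = z.2) ∧ ¬(w.1 = z.1 ∧ w.2 = z.2) := by
      intro z hz
      constructor
      · intro ⟨e1, e2⟩
        rw [show v = z from Prod.ext e1 e2, hz] at hvf
        exact absurd hvf (by simp)
      · intro ⟨e1, e2⟩
        rw [show w = z from Prod.ext e1 e2, hz] at hwf
        exact absurd hwf (by simp)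
    refine ⟨fun z => c z + crossing v w z, ?_, ?_, ?_, ?_, ?_, ?_⟩
    · intro x y hxy
      have a1 := h1 x y hxy
      obtain ⟨a2, a3⟩ := hne _ hxy
      have : (crossing v w (x, y) + crossing v w (x + 1, y) + below v (x, y) + below w (x, y)) % 2
          = 0 := by
        simp only at a2 a3
        simp only [crossing, below]
        split_ifs <;> omega
      beta_reduce
      omega
    · intro x y hxy
      have a1 := h2 x y hxy
      obtain ⟨a2, a3⟩ := hne _ hxy
      have : (crossing v w (x, y) + crossing v w (x, y + 1)) % 2 = 0 := by
        simp only at a2 a3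
        simp only [crossing]
        split_ifs <;> omega
      beta_reduce
      omega
    · intro z hz
      have a1 := h3 z hz
      have a2 := hz v hv
      have : crossing v w z = 0 := by
        simp only [crossing]
        split_ifs <;> omega
      beta_reduce
      omega
    · intro z hz hR
      have a1 := h4 z hz hR
      obtain ⟨a2, a3⟩ := hne _ hz
      have a4 := hR v hv
      have a5 := hR w hw
      have : (crossing v w z + leftOf v z + leftOf w z) % 2 = 0 := by
        simp only [crossing, leftOf]
        split_ifs <;> omega
      beta_reduce
      omega
    · intro z hR
      have a1 := h5 z hR
      have a4 := hR v hv
      have a5 := hR w hw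
      have : crossing v w z = 0 := by
        simp only [crossing]
        split_ifs <;> omega
      beta_reduce
      omega
    · intro z hR
      have a1 := h6 z hR
      have a4 := hR v hv
      have a5 := hR w hw
      have : crossing v w z = 0 := by
        simp only [crossing]
        split_ifs <;> omega
      beta_reduce
      omega

/-- The upper half of a box. -/
def upBox (m : ℕ) : Set (ℤ × ℤ) := {x | x ∈ box m ∧ 0 ≤ x.2}

/-- The lower half of a box. -/
def dnBox (m : ℕ) : Set (ℤ × ℤ) := {x | x ∈ box m ∧ x.2 ≤ 0}

theorem conn_mem {b : Bool} {R : Set (ℤ × ℤ)} {ω : Cfg2} {x y : ℤ × ℤ} (h : conn b R ω x y)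
    (hxy : x ≠ y) : (x ∈ R ∧ ω x = b) ∧ (y ∈ R ∧ ω y = b) := by
  refine ⟨?_, ?_⟩
  · rcases Relation.ReflTransGen.cases_head h with h | ⟨c, h, _⟩
    · exact absurd h hxy
    · exact ⟨h.2.1, h.2.2.2.1⟩
  · rcases Relation.ReflTransGen.cases_tail h with h | ⟨c, _, h⟩
    · exact absurd h.symm hxy
    · exact ⟨h.2.2.1, h.2.2.2.2⟩

/-- Minus paths above and below the axis, together with minuses on a half-axis, block plus
paths. -/
theorem planarity {m : ℕ} {ω : Cfg2} {i a a' j t : ℤ} (hi : ∀ x ≤ i, ω (x, 0) = false)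
    (ha : a ≤ i) (ha' : a' ≤ i) (ht : i < t) (htj : t < j)
    (hup : conn false (upBox m) ω (a, 0) (j, 0)) (hdn : conn false (dnBox m) ω (a', 0) (j, 0))
    {z : ℤ × ℤ} (hz : z ∉ box m) : ¬conn true Set.univ ω (t, 0) z := by
  intro hc
  obtain ⟨c, h1, h2, h3, h4, h5, h6⟩ := exists_parity hup
  obtain ⟨d, k1, k2, k3, k4, k5, k6⟩ := exists_parity hdn
  have haR := (conn_mem hup (by simp; omega)).1.1.1
  have haR' := (conn_mem hdn (by simp; omega)).1.1.1
  rw [mem_box] at haR haR'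
  simp only at haR haR'
  have ht0 : (t, (0 : ℤ)) ≠ z := by
    rintro rfl
    have hjR := (conn_mem hup (by simp; omega)).2.1.1
    rw [mem_box] at hjR hz
    simp only at hjR hz
    omega
  obtain ⟨⟨-, htt⟩, -, hzt⟩ := conn_mem hc ht0
  let e : ℤ × ℤ → ℤ := fun z => if 0 < z.2 then leftOf (a, 0) z + leftOf (a', 0) z else 0
  let N : ℤ × ℤ → ℤ := fun z => c z + d z + e z
  have hH : ∀ x y : ℤ, ω (x, y) = true → ω (x + 1, y) = true → N (x, y) % 2 = N (x + 1, y) % 2 := by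
    intro x y _ hxy
    have b1 := h1 x y hxy
    have b2 := k1 x y hxy
    have : (e (x, y) + e (x + 1, y) + below (a, 0) (x, y) + below (a', 0) (x, y)) % 2 = 0 := by
      simp only [e, leftOf, below]
      split_ifs <;> omega
    simp only [N]
    omega
  have hV : ∀ x y : ℤ, ω (x, y) = true → ω (x, y + 1) = true → N (x, y) % 2 = N (x, y + 1) % 2 := by
    intro x y hxy _
    have b1 := h2 x y hxy
    have b2 := k2 x y hxy
    have : (e (x, y) + e (x, y + 1)) % 2 = 0 := by
      by_cases hy : y = 0
      · subst hy
        have : i < x := by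
          by_contra hx
          rw [hi x (by omega)] at hxy
          exact absurd hxy (by simp)
        simp only [e, leftOf]
        split_ifs <;> omega
      · simp only [e, leftOf]
        split_ifs <;> omega
    simp only [N]
    omega
  have hconst : ∀ w, conn true Set.univ ω (t, 0) w → N w % 2 = N (t, 0) % 2 := by
    intro w hw
    induction hw with
    | refl => rfl
    | @tail v w _ hst ih =>
      rw [← ih]
      obtain ⟨hvw, -, -, hvt, hwt⟩ := hst
      obtain ⟨v1, v2⟩ := v
      simp only [nbrs, Finset.mem_insert, Finset.mem_singleton] at hvw
      rcases hvw with rfl | rfl | rfl | rfl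
      · exact (hH v1 v2 hvt hwt).symm
      · have := hH (v1 - 1) v2 hwt (by simpa using hvt)
        simpa using this
      · exact (hV v1 v2 hvt hwt).symm
      · have := hV v1 (v2 - 1) hwt (by simpa using hvt)
        simpa using this
  have hNt : N (t, 0) % 2 = 1 := by
    have b1 := h3 (t, 0) fun w hw => hw.2
    have b2 := k4 (t, 0) htt fun w hw => hw.2
    simp only [leftOf] at b2
    rw [if_pos (by omega), if_neg (by omega)] at b2
    simp only [N, e]
    rw [if_neg (by omega)]
    omega
  have hNz : N z % 2 = 0 := by
    rw [mem_box] at hz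
    have hup' : ∀ w ∈ upBox m, _ := fun w hw => mem_box.1 hw.1
    have hdn' : ∀ w ∈ dnBox m, _ := fun w hw => mem_box.1 hw.1
    simp only [N]
    by_cases c1 : z.1 < -(m : ℤ)
    · have b1 := h6 z fun w hw => by have := hup' w hw; omega
      have b2 := k6 z fun w hw => by have := hdn' w hw; omega
      have : e z = 0 := by
        simp only [e, leftOf]
        split_ifs <;> omega
      omega
    by_cases c2 : (m : ℤ) < z.1
    · have b1 := h5 z fun w hw => by have := hup' w hw; omega
      have b2 := k5 z fun w hw => by have := hdn' w hw; omega
      have : e z % 2 = 0 := by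
        simp only [e, leftOf]
        split_ifs <;> omega
      omega
    by_cases c3 : (m : ℤ) < z.2
    · have b1 := h4 z hzt fun w hw => by have := hup' w hw; omega
      have b2 := k4 z hzt fun w hw => by have := hdn' w hw; omega
      simp only [e, if_pos (show 0 < z.2 by omega)]
      omega
    · have b1 := h3 z fun w hw => by have := hup' w hw; omega
      have b2 := k3 z fun w hw => by have := hdn' w hw; omega
      simp only [e, if_neg (show ¬0 < z.2 by omega)]
      omega
  have := hconst z hc
  omega

end Schonmann
end

noncomputable section
open scoped Classical FinsetFamily
namespace Schonmann

/-! ### The conditional probabilities given the past -/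

/-- Boundary condition given by a past on the negative half-axis and plus elsewhere. -/
def bc (ω : Past Bool) : Cfg2 := fun x => if x.2 = 0 ∧ x.1 < 0 then ω (-x.1 - 1).toNat else true

/-- Probability of pluses on `F` in the box `box n` given the past `ω`. -/
def pin (β : ℝ) (n : ℕ) (F : Finset ℤ) (ω : Past Bool) : ℝ :=
  pr β (cut (box n) (-1)) (bc ω) (plusOn F)

/-- Probability of pluses on `F` given the past `ω`, with plus boundary condition at infinity. -/
def PiF (β : ℝ) (F : Finset ℤ) (ω : Past Bool) : ℝ := ⨅ n, pin β n F ω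

/-- The all-minus past. -/
def allMinus : Past Bool := fun _ => false

/-- The all-plus past. -/
def allPlus : Past Bool := fun _ => true

/-- Minus on the half-axis up to `i`, plus elsewhere. -/
def sl (i : ℤ) : Cfg2 := fun x => if x.2 = 0 ∧ x.1 ≤ i then false else true

theorem bc_allMinus : bc allMinus = sl (-1) := by
  ext x
  simp only [bc, sl, allMinus]
  congr! 2
  omega

theorem bc_allPlus : bc allPlus = fun _ => true := by
  ext x
  simp [bc, allPlus]

theorem exists_subset_box (Λ : Finset (ℤ × ℤ)) : ∃ n, Λ ⊆ box n := by
  refine ⟨Λ.sup fun x => x.1.natAbs + x.2.natAbs, fun x hx => ?_⟩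
  have h : x.1.natAbs + x.2.natAbs ≤ Λ.sup fun x => x.1.natAbs + x.2.natAbs :=
    Finset.le_sup (f := fun x : ℤ × ℤ => x.1.natAbs + x.2.natAbs) hx
  rw [mem_box]
  omega

theorem cut_mono {Λ Λ' : Finset (ℤ × ℤ)} (h : Λ ⊆ Λ') (i : ℤ) : cut Λ i ⊆ cut Λ' i :=
  Finset.filter_subset_filter _ h

theorem pr_cut_anti {β : ℝ} (hβ : 0 ≤ β) {Λ Λ' : Finset (ℤ × ℤ)} (h : Λ ⊆ Λ') {i : ℤ} {σ : Cfg2}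
    (hσ : ∀ x : ℤ × ℤ, ¬(x.2 = 0 ∧ x.1 ≤ i) → σ x = true) {A : Set Cfg2} (hA : IsUpperSet A) :
    pr β (cut Λ' i) σ A ≤ pr β (cut Λ i) σ A := by
  refine pr_le_pr_of_plus hβ (cut_mono h i) (fun _ _ => le_rfl) (fun x hx _ => ?_) hA
  exact hσ x (mem_cut.1 hx).2

theorem bc_of_not {ω : Past Bool} {x : ℤ × ℤ} (h : ¬(x.2 = 0 ∧ x.1 ≤ -1)) : bc ω x = true := by
  rw [bc, if_neg (by omega)]

theorem pin_anti {β : ℝ} (hβ : 0 ≤ β) (F : Finset ℤ) (ω : Past Bool) :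
    Antitone fun n => pin β n F ω := fun _ _ h =>
  pr_cut_anti hβ (box_mono h) (fun _ hx => bc_of_not hx) (isUpperSet_plusOn F)

theorem bddBelow_pin (β : ℝ) (F : Finset ℤ) (ω : Past Bool) :
    BddBelow (Set.range fun n => pin β n F ω) := ⟨0, by rintro _ ⟨n, rfl⟩; exact pr_nonneg⟩

theorem PiF_le_pin (β : ℝ) (F : Finset ℤ) (ω : Past Bool) (n : ℕ) : PiF β F ω ≤ pin β n F ω :=
  ciInf_le (bddBelow_pin β F ω) n

theorem tendsto_pin {β : ℝ} (hβ : 0 ≤ β) (F : Finset ℤ) (ω : Past Bool) :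
    Tendsto (fun n => pin β n F ω) atTop (𝓝 (PiF β F ω)) :=
  tendsto_atTop_ciInf (pin_anti hβ F ω) (bddBelow_pin β F ω)

theorem PiF_nonneg (β : ℝ) (F : Finset ℤ) (ω : Past Bool) : 0 ≤ PiF β F ω :=
  le_ciInf fun _ => pr_nonneg

theorem PiF_le_one (β : ℝ) (F : Finset ℤ) (ω : Past Bool) : PiF β F ω ≤ 1 :=
  (PiF_le_pin β F ω 0).trans pr_le_one

theorem bc_mono {ω ω' : Past Bool} (h : ω ≤ ω') : bc ω ≤ bc ω' := by
  intro x
  simp only [bc]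
  split_ifs
  · exact h _
  · exact le_rfl

theorem pin_mono {β : ℝ} (hβ : 0 ≤ β) (n : ℕ) (F : Finset ℤ) : Monotone (pin β n F) :=
  fun _ _ h => pr_mono_bc hβ (fun x _ => bc_mono h x) (isUpperSet_plusOn F)

theorem PiF_mono {β : ℝ} (hβ : 0 ≤ β) (F : Finset ℤ) : Monotone (PiF β F) :=
  fun _ _ h => ciInf_mono (bddBelow_pin β F _) fun n => pin_mono hβ n F h

/-- In any volume cut along a half-axis, the probability of pluses is at least the limiting
conditional probability. -/
theorem PiF_le_pr {β : ℝ} (hβ : 0 ≤ β) (Λ : Finset (ℤ × ℤ)) (i : ℤ) {σ : Cfg2} {ω : Past Bool}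
    (hσ : ∀ x : ℤ × ℤ, σ (x.1 + (i + 1), x.2) = bc ω x) (F : Finset ℤ) :
    PiF β F ω ≤ pr β (cut Λ i) σ (plusOn (shiftF (i + 1) F)) := by
  have h1 : cut Λ i = tr (i + 1) (cut (tr (-(i + 1)) Λ) (-1)) := by
    ext x
    simp only [mem_cut, mem_tr, sub_neg_eq_add, sub_add_cancel]
    refine and_congr_right fun _ => ?_
    constructor <;> intros <;> omega
  rw [h1, pr_tr_plusOn]
  simp only [hσ]
  obtain ⟨n, hn⟩ := exists_subset_box (tr (-(i + 1)) Λ)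
  exact (PiF_le_pin β F ω n).trans
    (pr_cut_anti hβ hn (fun _ hx => bc_of_not hx) (isUpperSet_plusOn F))

theorem plusOn_singleton (i : ℤ) : plusOn {i} = {ω | ω (i, 0) = true} := by
  ext ω
  simp [plusOn]

theorem PiF_le_pr_site {β : ℝ} (hβ : 0 ≤ β) (Λ : Finset (ℤ × ℤ)) (i : ℤ) {σ : Cfg2} {ω : Past Bool}
    (hσ : ∀ x : ℤ × ℤ, σ (x.1 + (i + 1), x.2) = bc ω x) :
    PiF β {0} ω ≤ pr β (cut Λ i) σ {ω | ω (i + 1, 0) = true} := by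
  rw [← plusOn_singleton]
  convert PiF_le_pr hβ Λ i hσ {0} using 2
  ext j
  simp [shiftF, plusOn]

theorem sl_shift (i : ℤ) (x : ℤ × ℤ) : sl i (x.1 + (i + 1), x.2) = bc allMinus x := by
  rw [bc_allMinus]
  simp only [sl]
  congr! 2
  omega

/-! ### Probabilities of constant segments -/

/-- The event that the spins on the axis at abscissas in `(i, i+k]` have sign `b`. -/
def seg (b : Bool) (i : ℤ) (k : ℕ) : Set Cfg2 := {ω | ∀ t, i < t → t ≤ i + k → ω (t, 0) = b}

theorem seg_succ (b : Bool) (i : ℤ) (k : ℕ) :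
    seg b i (k + 1) = {ω | ω (i + 1, 0) = b} ∩ seg b (i + 1) k := by
  ext ω
  simp only [seg, Set.mem_inter_iff, Set.mem_ofPred_eq]
  push_cast
  constructor
  · intro h
    exact ⟨h _ (by omega) (by omega), fun t h1 h2 => h t (by omega) (by omega)⟩
  · rintro ⟨h1, h2⟩ t h3 h4
    by_cases ht : t = i + 1
    · rw [ht]; exact h1
    · exact h2 t (by omega) (by omega)

theorem seg_zero (b : Bool) (i : ℤ) : seg b i 0 = Set.univ := by
  ext ω
  simp only [seg, Set.mem_ofPred_eq, Set.mem_univ, iff_true]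
  intro t h1 h2
  push_cast at h2
  omega

theorem cut_erase (Λ : Finset (ℤ × ℤ)) (i : ℤ) : (cut Λ i).erase (i + 1, 0) = cut Λ (i + 1) := by
  ext x
  obtain ⟨a, b⟩ := x
  simp only [Finset.mem_erase, mem_cut, ne_eq, Prod.mk.injEq]
  constructor
  · rintro ⟨h1, h2, h3⟩
    refine ⟨h2, fun h => h1 ⟨?_, h.1⟩⟩
    by_contra h4
    exact h3 ⟨h.1, by omega⟩
  · rintro ⟨h1, h2⟩
    exact ⟨fun h => h2 ⟨h.2, h.1.le⟩, h1, fun h => h2 ⟨h.1, by omega⟩⟩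

theorem update_sl (i : ℤ) : Function.update (sl i) (i + 1, 0) false = sl (i + 1) := by
  ext x
  by_cases hx : x = (i + 1, 0)
  · subst hx
    simp [sl]
  · rw [Function.update_of_ne hx]
    obtain ⟨a, b⟩ := x
    simp only [sl]
    simp only [Prod.mk.injEq, not_and] at hx
    have : (b = 0 ∧ a ≤ i) ↔ (b = 0 ∧ a ≤ i + 1) := by
      constructor
      · exact fun h => ⟨h.1, by omega⟩
      · exact fun h => ⟨h.1, by by_contra hc; exact hx (by omega) h.1⟩
    simp only [this]

theorem pr_seg_minus_le {β : ℝ} (hβ : 0 ≤ β) (Λ : Finset (ℤ × ℤ)) (k : ℕ) (i : ℤ)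
    (h : ∀ t, i < t → t ≤ i + k → (t, 0) ∈ Λ) :
    pr β (cut Λ i) (sl i) (seg false i k) ≤ (1 - PiF β {0} allMinus) ^ k := by
  induction k generalizing i with
  | zero => simpa using pr_le_one
  | succ k ih =>
    have hx : (i + 1, (0 : ℤ)) ∈ cut Λ i :=
      mem_cut.2 ⟨h _ (by omega) (by push_cast; omega), by simp⟩
    rw [seg_succ, pr_inter_site hx, cut_erase, update_sl, pow_succ']
    refine mul_le_mul ?_ (ih _ fun t h1 h2 => h t (by omega) (by push_cast; omega)) pr_nonneg
      (by linarith [PiF_le_one β {0} allMinus])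
    have h1 := PiF_le_pr_site hβ Λ i (sl_shift i)
    have h2 := pr_site_add (β := β) (Λ := cut Λ i) (σ := sl i) (x := (i + 1, 0))
    linarith

theorem pr_seg_plus_ge {β : ℝ} (hβ : 0 ≤ β) (Λ : Finset (ℤ × ℤ)) (k : ℕ) (i : ℤ)
    (h : ∀ t, i < t → t ≤ i + k → (t, 0) ∈ Λ) :
    (PiF β {0} allPlus) ^ k ≤ pr β (cut Λ i) (fun _ => true) (seg true i k) := by
  induction k generalizing i with
  | zero => simp [seg_zero, pr_univ]
  | succ k ih =>
    have hx : (i + 1, (0 : ℤ)) ∈ cut Λ i :=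
      mem_cut.2 ⟨h _ (by omega) (by push_cast; omega), by simp⟩
    rw [seg_succ, pr_inter_site hx, cut_erase, pow_succ',
      show Function.update (fun _ => true) (i + 1, (0 : ℤ)) true = fun _ => true by
        ext x; simp [Function.update_apply]]
    refine mul_le_mul ?_ (ih _ fun t h1 h2 => h t (by omega) (by push_cast; omega))
      (pow_nonneg (PiF_nonneg _ _ _) _) pr_nonneg
    exact PiF_le_pr_site hβ Λ i (fun x => by rw [bc_allPlus])

theorem isLowerSet_seg (i : ℤ) (k : ℕ) : IsLowerSet (seg false i k) :=
  fun _ _ hab ha t h1 h2 => isLowerSet_site (t, 0) hab (ha t h1 h2)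

theorem eps_le_PiF {β : ℝ} (hβ : 0 ≤ β) (ω : Past Bool) : eps β ≤ PiF β {0} ω := by
  refine le_ciInf fun n => ?_
  rw [pin, plusOn_singleton]
  exact eps_le_pr_true hβ (mem_cut.2 ⟨mem_box.2 (by simp), by simp⟩)

theorem PiF_le_one_sub_eps {β : ℝ} (hβ : 0 ≤ β) (ω : Past Bool) : PiF β {0} ω ≤ 1 - eps β := by
  refine (PiF_le_pin β _ ω 0).trans ?_
  rw [pin, plusOn_singleton]
  exact pr_true_le hβ (mem_cut.2 ⟨mem_box.2 (by simp), by simp⟩)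

/-- Ratio governing the exponential decay of blocking events. -/
def rho (β : ℝ) : ℝ := (1 - PiF β {0} allMinus) / PiF β {0} allPlus

theorem rho_nonneg (β : ℝ) : 0 ≤ rho β :=
  div_nonneg (by linarith [PiF_le_one β {0} allMinus]) (PiF_nonneg _ _ _)

theorem rho_lt_one {β : ℝ} (hβ : 0 ≤ β)
    (hQ : 1 < PiF β {0} allPlus + PiF β {0} allMinus) : rho β < 1 := by
  rw [rho, div_lt_one (lt_of_lt_of_le (eps_pos β) (eps_le_PiF hβ _))]
  linarith

/-- The axis sites in `(i, i+k]`. -/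
def segSet (i : ℤ) (k : ℕ) : Set (ℤ × ℤ) := {z | z.2 = 0 ∧ i < z.1 ∧ z.1 ≤ i + k}

theorem pr_block_le {β : ℝ} (hβ : 0 ≤ β) (Λ : Finset (ℤ × ℤ)) (k : ℕ) (i : ℤ)
    (h : ∀ t, i < t → t ≤ i + k → (t, 0) ∈ Λ) :
    pr β (cut Λ i) (sl i) (Sep true (cut Λ i) (segSet i k)) ≤ rho β ^ k := by
  have hQ : 0 < PiF β {0} allPlus := lt_of_lt_of_le (eps_pos β) (eps_le_PiF hβ _)
  have h1 := pr_sep_plus hβ (isLowerSet_seg i k) (D := segSet i k)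
    (fun ω ω' hag hω t ht1 ht2 => by
      rw [← hag (t, 0) ⟨rfl, ht1, ht2⟩]; exact hω t ht1 ht2) (cut Λ i) (sl i)
  have h2 : pr β (cut Λ i) (fun _ => false) (seg false i k)
      = pr β (cut Λ i) (fun _ => true) (seg true i k) := by
    have := pr_flip (β := β) (Λ := cut Λ i) (σ := fun _ => true) (A := seg false i k)
    rw [show flipCfg (fun _ => true) = fun _ => false from rfl] at this
    rw [this]
    congr 1
    ext ω
    simp [seg, flipCfg]
  have h3 := pr_seg_plus_ge hβ Λ k i h
  have h4 := pr_seg_minus_le hβ Λ k i h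
  have h5 : pr β (cut Λ i) (sl i) (seg false i k ∩ Sep true (cut Λ i) (segSet i k))
      ≤ pr β (cut Λ i) (sl i) (seg false i k) := pr_mono fun ω _ hω => hω.1
  rw [rho, div_pow, le_div_iff₀ (pow_pos hQ k)]
  calc _ ≤ pr β (cut Λ i) (sl i) (Sep true (cut Λ i) (segSet i k))
        * pr β (cut Λ i) (fun _ => false) (seg false i k) :=
        mul_le_mul_of_nonneg_left (h2 ▸ h3) pr_nonneg
    _ ≤ _ := h1.trans (h5.trans h4)

/-! ### Minus connections along the half-planes -/

/-- There is a minus path in `R` from the axis left of `i` to `(j,0)`. -/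
def Uc (R : Set (ℤ × ℤ)) (i j : ℤ) : Set Cfg2 := {ω | ∃ a ≤ i, conn false R ω (a, 0) (j, 0)}

theorem conn_anti {R : Set (ℤ × ℤ)} {ω ω' : Cfg2} (h : ω' ≤ ω) {x y : ℤ × ℤ}
    (hc : conn false R ω x y) : conn false R ω' x y :=
  conn_mono subset_rfl (fun z _ hz => isLowerSet_site z h hz) hc

theorem isLowerSet_Uc (R : Set (ℤ × ℤ)) (i j : ℤ) : IsLowerSet (Uc R i j) :=
  fun _ _ hab ⟨a, ha, hc⟩ => ⟨a, ha, conn_anti hab hc⟩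

theorem conn_vrefl {R R' : Set (ℤ × ℤ)} {ω : Cfg2} (hR : ∀ x : ℤ × ℤ, x ∈ R → (x.1, -x.2) ∈ R')
    {x y : ℤ × ℤ} (hc : conn false R ω x y) :
    conn false R' (fun z => ω (z.1, -z.2)) (x.1, -x.2) (y.1, -y.2) := by
  induction hc with
  | refl => exact Relation.ReflTransGen.refl
  | tail _ hst ih =>
    refine ih.tail ⟨?_, hR _ hst.2.1, hR _ hst.2.2.1, ?_, ?_⟩
    · exact (vrefl_nbrs _ _).2 hst.1
    · simpa using hst.2.2.2.1
    · simpa using hst.2.2.2.2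

theorem pr_Uc_dn {β : ℝ} (m : ℕ) (i j l : ℤ) :
    pr β (cut (box m) l) (sl l) (Uc (dnBox m) i j) = pr β (cut (box m) l) (sl l) (Uc (upBox m) i j) := by
  rw [pr_vrefl (A := Uc (dnBox m) i j)]
  · congr 1
    ext ω
    have e1 : ∀ x : ℤ × ℤ, x ∈ dnBox m → (x.1, -x.2) ∈ upBox m := by
      intro x
      simp only [dnBox, upBox, Set.mem_ofPred_eq, mem_box]
      omega
    have e2 : ∀ x : ℤ × ℤ, x ∈ upBox m → (x.1, -x.2) ∈ dnBox m := by
      intro x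
      simp only [dnBox, upBox, Set.mem_ofPred_eq, mem_box]
      omega
    constructor
    · rintro ⟨a, ha, hc⟩
      refine ⟨a, ha, ?_⟩
      simpa using conn_vrefl e1 hc
    · rintro ⟨a, ha, hc⟩
      refine ⟨a, ha, ?_⟩
      simpa using conn_vrefl e2 hc
  · intro x
    simp only [mem_cut, mem_box]
    constructor <;> intro h <;> omega
  · intro x
    simp only [sl]
    congr! 2
    omega

theorem pr_Uc_le {β : ℝ} (hβ : 0 ≤ β) (m : ℕ) {i j : ℤ} (hi : -1 ≤ i) (k : ℕ) (hij : i + k + 1 = j) :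
    pr β (cut (box m) (-1)) (sl (-1)) (Uc (upBox m) i j) ≤ Real.sqrt (rho β) ^ k := by
  have h0 : pr β (cut (box m) (-1)) (sl (-1)) (Uc (upBox m) i j)
      ≤ pr β (cut (box m) i) (sl i) (Uc (upBox m) i j) := by
    refine pr_lower_minus hβ (fun x hx => ?_) (fun x _ => ?_) (fun x hx hx' => ?_)
      (isLowerSet_Uc _ _ _)
    · rw [mem_cut] at *
      exact ⟨hx.1, by omega⟩
    · simp only [sl]
      split_ifs <;> first | omega | simp
    · rw [mem_cut] at *
      simp only [sl]
      rw [if_pos (by tauto)]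
  by_cases hjm : j ≤ m
  swap
  · have : pr β (cut (box m) (-1)) (sl (-1)) (Uc (upBox m) i j) = 0 := by
      refine pr_eq_zero_of_forall_notMem fun ω _ hω => ?_
      obtain ⟨a, ha, hc⟩ := hω
      have := mem_box.1 (conn_mem hc (by simp; omega)).2.1.1
      simp only at this
      omega
    rw [this]
    positivity
  have h1 := fkg_lower (β := β) (Λ := cut (box m) i) (σ := sl i) hβ
    (isLowerSet_Uc (upBox m) i j) (isLowerSet_Uc (dnBox m) i j)
  rw [pr_Uc_dn] at h1
  have h2 : pr β (cut (box m) i) (sl i) (Uc (upBox m) i j ∩ Uc (dnBox m) i j)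
      ≤ pr β (cut (box m) i) (sl i) (Sep true (cut (box m) i) (segSet i k)) := by
    refine pr_mono fun ω hω ⟨⟨a, ha, hup⟩, ⟨a', ha', hdn⟩⟩ => ?_
    rintro ⟨t, z2⟩ ⟨hz, hz1, hz2⟩ y hy hyt hc
    simp only at hz hz1 hz2
    subst hz
    have hsl : ∀ x ≤ i, ω (x, 0) = false := by
      intro x hx
      rw [mem_Cf.1 hω _ (fun h => (mem_cut.1 h).2 ⟨rfl, hx⟩), sl, if_pos ⟨rfl, hx⟩]
    have hyb : y ∉ box m := by
      intro hb
      have : y.2 = 0 ∧ y.1 ≤ i := by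
        by_contra hcon
        exact hy (mem_cut.2 ⟨hb, hcon⟩)
      rw [show y = (y.1, 0) from Prod.ext rfl this.1, hsl _ this.2] at hyt
      exact absurd hyt (by simp)
    exact planarity hsl ha ha' hz1 (by omega) hup hdn hyb (conn_symm hc)
  have h3 := pr_block_le hβ (box m) k i fun t h1 h2 => mem_box.2 (by simp; omega)
  refine h0.trans ?_
  have h4 : (Real.sqrt (rho β) ^ k) ^ 2 = rho β ^ k := by
    rw [← pow_mul, mul_comm, pow_mul, Real.sq_sqrt (rho_nonneg β)]
  refine le_of_sq_le_sq ?_ (pow_nonneg (Real.sqrt_nonneg _) k)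
  rw [h4, sq]
  exact h1.trans (h2.trans h3)

end Schonmann
end

noncomputable section
open scoped Classical FinsetFamily
namespace Schonmann

/-! ### Cut points on the half-axis -/

/-- The site `(c,0)` is a plus spin under which no minus path in `R` or `R'` passes. -/
def cutPt (R R' : Set (ℤ × ℤ)) (c : ℤ) : Set Cfg2 :=
  {ω | ω (c, 0) = true ∧ ∀ j, c < j → ω ∉ Uc R (c - 1) j ∧ ω ∉ Uc R' (c - 1) j}

theorem isUpperSet_cutPt (R R' : Set (ℤ × ℤ)) (c : ℤ) : IsUpperSet (cutPt R R' c) :=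
  fun _ _ hab ha => ⟨isUpperSet_site _ hab ha.1, fun j hj =>
    ⟨fun h => (ha.2 j hj).1 (isLowerSet_Uc R _ _ hab h),
      fun h => (ha.2 j hj).2 (isLowerSet_Uc R' _ _ hab h)⟩⟩

theorem Uc_mono {R R' : Set (ℤ × ℤ)} (h : R ⊆ R') (i j : ℤ) : Uc R i j ⊆ Uc R' i j :=
  fun _ ⟨a, ha, hc⟩ => ⟨a, ha, conn_mono h (fun _ _ hz => hz) hc⟩

theorem cutPt_anti {R R' S S' : Set (ℤ × ℤ)} (h : R ⊆ S) (h' : R' ⊆ S') (c : ℤ) :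
    cutPt S S' c ⊆ cutPt R R' c :=
  fun _ hω => ⟨hω.1, fun j hj => ⟨fun hc => (hω.2 j hj).1 (Uc_mono h _ _ hc),
    fun hc => (hω.2 j hj).2 (Uc_mono h' _ _ hc)⟩⟩

theorem upBox_mono {n m : ℕ} (h : n ≤ m) : upBox n ⊆ upBox m :=
  fun _ hx => ⟨box_mono h hx.1, hx.2⟩

theorem dnBox_mono {n m : ℕ} (h : n ≤ m) : dnBox n ⊆ dnBox m :=
  fun _ hx => ⟨box_mono h hx.1, hx.2⟩

theorem upBox_subset (m : ℕ) : upBox m ⊆ {x | x ∈ box m} := fun _ hx => hx.1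

theorem dnBox_subset (m : ℕ) : dnBox m ⊆ {x | x ∈ box m} := fun _ hx => hx.1

theorem Uc_eq_empty {R : Set (ℤ × ℤ)} {m : ℕ} (hR : R ⊆ {x | x ∈ box m}) {i j : ℤ} (hij : i < j)
    (hj : m < j) (ω : Cfg2) : ω ∉ Uc R i j := by
  rintro ⟨a, ha, hc⟩
  have h : (j, (0 : ℤ)) ∈ box m := hR (conn_mem hc (by simp; omega)).2.1
  have := mem_box.1 h
  simp only at this
  omega

/-- Uniform lower bound for the probability of cut points. -/
def cutBd (β : ℝ) : ℝ := eps β * Real.exp (-(2 / (1 - Real.sqrt (rho β)) ^ 2))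

theorem cutBd_pos (β : ℝ) : 0 < cutBd β := mul_pos (eps_pos β) (Real.exp_pos _)

theorem exp_neg_div_le {x s : ℝ} (hxs : x ≤ s) (hs : s < 1) (hx : 0 ≤ x) :
    Real.exp (-(x / (1 - s))) ≤ 1 - x := by
  have h1 : x / (1 - x) ≤ x / (1 - s) := by
    apply div_le_div_of_nonneg_left hx <;> linarith
  have h2 : 1 / (1 - x) ≤ Real.exp (x / (1 - s)) := by
    have h3 : 1 / (1 - x) = x / (1 - x) + 1 := by
      have : 1 - x ≠ 0 := by linarith
      field_simp
      ring
    rw [h3]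
    exact (Real.add_one_le_exp _).trans (Real.exp_le_exp.2 h1)
  rw [Real.exp_neg]
  have h4 : 0 < 1 - x := by linarith
  rw [inv_le_comm₀ (Real.exp_pos _) h4]
  simpa using h2

theorem cutBd_le {β : ℝ} (hβ : 0 ≤ β) (hr : rho β < 1) (m : ℕ) {c : ℤ} (hc : 0 ≤ c) (hcm : c ≤ m) :
    cutBd β ≤ pr β (cut (box m) (-1)) (sl (-1)) (cutPt (upBox m) (dnBox m) c) := by
  set s := Real.sqrt (rho β) with hsdef
  have hs1 : s < 1 := by
    rw [hsdef, Real.sqrt_lt' one_pos]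
    simpa using hr
  have hs0 : 0 ≤ s := Real.sqrt_nonneg _
  have key : ∀ n : ℕ, eps β * Real.exp (-(2 * (∑ k ∈ Finset.range n, s ^ k) / (1 - s)))
      ≤ pr β (cut (box m) (-1)) (sl (-1)) {ω | ω (c, 0) = true ∧ ∀ k < n,
        ω ∉ Uc (upBox m) (c - 1) (c + 1 + (k : ℕ)) ∧ ω ∉ Uc (dnBox m) (c - 1) (c + 1 + (k : ℕ))} := by
    intro n
    induction n with
    | zero =>
      simp only [Finset.range_zero, Finset.sum_empty, mul_zero, zero_div, neg_zero, Real.exp_zero,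
        mul_one, not_lt_zero, IsEmpty.forall_iff, implies_true, and_true]
      exact eps_le_pr_true hβ (mem_cut.2 ⟨mem_box.2 (by simp; omega), by simp; omega⟩)
    | succ n ih =>
      have hlow : IsUpperSet (Uc (upBox m) (c - 1) (c + 1 + n))ᶜ :=
        (isLowerSet_Uc _ _ _).compl
      have hlow' : IsUpperSet (Uc (dnBox m) (c - 1) (c + 1 + n))ᶜ :=
        (isLowerSet_Uc _ _ _).compl
      have hG : IsUpperSet {ω : Cfg2 | ω (c, 0) = true ∧ ∀ k < n,
        ω ∉ Uc (upBox m) (c - 1) (c + 1 + (k : ℕ)) ∧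
          ω ∉ Uc (dnBox m) (c - 1) (c + 1 + (k : ℕ))} := by
        intro a b hab ha
        exact ⟨isUpperSet_site _ hab ha.1, fun k hk =>
          ⟨fun h => (ha.2 k hk).1 (isLowerSet_Uc _ _ _ hab h),
            fun h => (ha.2 k hk).2 (isLowerSet_Uc _ _ _ hab h)⟩⟩
      have h1 := fkg (β := β) (Λ := cut (box m) (-1)) (σ := sl (-1)) hβ hG (hlow.inter hlow')
      have h2 := fkg (β := β) (Λ := cut (box m) (-1)) (σ := sl (-1)) hβ hlow hlow'
      rw [pr_compl, pr_compl, pr_Uc_dn] at h2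
      have h3 := pr_Uc_le hβ m (i := c - 1) (j := c + 1 + n) (by omega) (n + 1) (by push_cast; ring)
      rw [← hsdef] at h3
      have h4 : s ^ (n + 1) ≤ s := by
        simpa using pow_le_pow_of_le_one hs0 hs1.le (Nat.le_add_left 1 n)
      have h5 : Real.exp (-(s ^ n / (1 - s)))
          ≤ 1 - pr β (cut (box m) (-1)) (sl (-1)) (Uc (upBox m) (c - 1) (c + 1 + n)) := by
        have h51 := exp_neg_div_le h4 hs1 (pow_nonneg hs0 (n + 1))
        refine le_trans ?_ (h51.trans (sub_le_sub_left h3 1))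
        apply Real.exp_le_exp.2
        apply neg_le_neg
        apply div_le_div_of_nonneg_right _ (by linarith)
        exact pow_le_pow_of_le_one hs0 hs1.le (Nat.le_succ n)
      have h6 : Real.exp (-(s ^ n / (1 - s))) * Real.exp (-(s ^ n / (1 - s))) ≤
          pr β (cut (box m) (-1)) (sl (-1)) ((Uc (upBox m) (c - 1) (c + 1 + n))ᶜ ∩
            (Uc (dnBox m) (c - 1) (c + 1 + n))ᶜ) :=
        (mul_le_mul h5 h5 (Real.exp_pos _).le ((Real.exp_pos _).le.trans h5)).trans h2
      have h7 : eps β * Real.exp (-(2 * (∑ k ∈ Finset.range (n + 1), s ^ k) / (1 - s)))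
          = eps β * Real.exp (-(2 * (∑ k ∈ Finset.range n, s ^ k) / (1 - s))) *
            (Real.exp (-(s ^ n / (1 - s))) * Real.exp (-(s ^ n / (1 - s)))) := by
        rw [← Real.exp_add, mul_assoc, ← Real.exp_add, Finset.sum_range_succ]
        congr 2
        ring
      rw [h7]
      refine (mul_le_mul ih h6 (by positivity) pr_nonneg).trans (h1.trans (pr_mono ?_))
      rintro ω - ⟨⟨h8, h9⟩, h10, h11⟩
      refine ⟨h8, fun k hk => ?_⟩
      rcases Nat.lt_succ_iff_lt_or_eq.1 hk with h | h
      · exact h9 k h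
      · subst h
        exact ⟨h10, h11⟩
  refine le_trans ?_ ((key m).trans (pr_mono ?_))
  · refine mul_le_mul_of_nonneg_left (Real.exp_le_exp.2 (neg_le_neg ?_)) (eps_pos β).le
    have hg : (∑ k ∈ Finset.range m, s ^ k) ≤ 1 / (1 - s) := by
      rw [geom_sum_eq hs1.ne, ← neg_div_neg_eq, neg_sub, neg_sub]
      apply div_le_div_of_nonneg_right _ (by linarith)
      linarith [pow_nonneg hs0 m]
    rw [show 2 / (1 - s) ^ 2 = 2 * (1 / (1 - s)) / (1 - s) by
      have : 1 - s ≠ 0 := by linarith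
      field_simp]
    apply div_le_div_of_nonneg_right _ (by linarith)
    linarith
  · rintro ω - ⟨h1, h2⟩
    refine ⟨h1, fun j hj => ?_⟩
    by_cases hjm : j ≤ m
    · obtain ⟨k, hk⟩ := Int.eq_ofNat_of_zero_le (show 0 ≤ j - (c + 1) by omega)
      have := h2 k (by omega)
      rwa [show c + 1 + (k : ℤ) = j by omega] at this
    · exact ⟨Uc_eq_empty (upBox_subset m) (by omega) (by omega) ω,
        Uc_eq_empty (dnBox_subset m) (by omega) (by omega) ω⟩

theorem mem_nbrs_iff {x y : ℤ × ℤ} : y ∈ nbrs x ↔ (y.2 = x.2 ∧ (y.1 = x.1 + 1 ∨ y.1 = x.1 - 1)) ∨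
    (y.1 = x.1 ∧ (y.2 = x.2 + 1 ∨ y.2 = x.2 - 1)) := by
  obtain ⟨a, b⟩ := x
  obtain ⟨a', b'⟩ := y
  simp only [nbrs, Finset.mem_insert, Finset.mem_singleton, Prod.mk.injEq]
  omega

/-- A minus path from the left half-axis cannot reach the axis beyond a cut point. -/
theorem cutPt_subset_Sep {m : ℕ} {c : ℤ} (hc : 0 ≤ c) {ω : Cfg2}
    (hω : ω ∈ Cf (cut (box m) (-1)) (sl (-1))) (hE : ω ∈ cutPt (upBox m) (dnBox m) c) :
    ω ∈ Sep false (cut (box m) (-1)) {z | z.2 = 0 ∧ c < z.1} := by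
  have hout : ∀ x, ω x = false → x ∉ cut (box m) (-1) → x.2 = 0 ∧ x.1 ≤ -1 := by
    intro x hx hx'
    rw [mem_Cf.1 hω x hx', sl] at hx
    by_contra h
    rw [if_neg h] at hx
    exact absurd hx (by simp)
  have hbox : ∀ x, ω x = false → x.2 ≠ 0 → x ∈ box m := by
    intro x hx hx'
    by_contra h
    exact hx' (hout x hx fun h' => h (mem_cut.1 h').1).1
  rintro z ⟨hz0, hz1⟩ y hy hyf hyz
  have hy' := hout y hyf hy
  have inv : ∀ w, conn false Set.univ ω y w → (w.2 = 0 ∧ w.1 ≤ c - 1) ∨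
      (0 < w.2 ∧ ∃ a ≤ c - 1, conn false (upBox m) ω (a, 0) w) ∨
      (w.2 < 0 ∧ ∃ a ≤ c - 1, conn false (dnBox m) ω (a, 0) w) := by
    intro w hw
    induction hw with
    | refl => exact Or.inl ⟨hy'.1, by omega⟩
    | @tail w w' _ hst ih =>
      obtain ⟨hn, -, -, hw0, hw0'⟩ := hst
      have hn' := mem_nbrs_iff.1 hn
      rcases ih with ⟨h1, h2⟩ | ⟨h1, a, ha, hconn⟩ | ⟨h1, a, ha, hconn⟩
      · by_cases hw2 : w'.2 = 0
        · left
          refine ⟨hw2, ?_⟩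
          by_contra hcon
          have : w' = (c, 0) := Prod.ext (by simp only; omega) hw2
          rw [this] at hw0'
          rw [hE.1] at hw0'
          exact absurd hw0' (by simp)
        · right
          have hb' := hbox w' hw0' hw2
          have hb : w ∈ box m := by
            rw [mem_box] at *
            omega
          have hww : (w.1, (0 : ℤ)) = w := Prod.ext rfl h1.symm
          rcases lt_or_gt_of_ne hw2 with h | h
          · right
            refine ⟨h, w.1, h2, ?_⟩
            rw [hww]
            exact Relation.ReflTransGen.single ⟨hn, ⟨hb, h1.le⟩, ⟨hb', h.le⟩, hw0, hw0'⟩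
          · left
            refine ⟨h, w.1, h2, ?_⟩
            rw [hww]
            exact Relation.ReflTransGen.single ⟨hn, ⟨hb, h1.ge⟩, ⟨hb', h.le⟩, hw0, hw0'⟩
      · have hb := hbox w hw0 h1.ne'
        have hb' : w' ∈ box m := by
          by_cases hw2 : w'.2 = 0
          · rw [mem_box] at *
            omega
          · exact hbox w' hw0' hw2
        have hconn' := hconn.tail (⟨hn, ⟨hb, h1.le⟩, ⟨hb', by omega⟩, hw0, hw0'⟩ :
          bstep false (upBox m) ω w w')
        by_cases hw2 : w'.2 = 0
        · left
          refine ⟨hw2, ?_⟩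
          by_contra hcon
          by_cases hcw : w'.1 = c
          · rw [show w' = (c, 0) from Prod.ext hcw hw2, hE.1] at hw0'
            exact absurd hw0' (by simp)
          · refine (hE.2 w'.1 (by omega)).1 ⟨a, ha, ?_⟩
            rwa [show (w'.1, (0 : ℤ)) = w' from Prod.ext rfl hw2.symm]
        · right; left
          exact ⟨by omega, a, ha, hconn'⟩
      · have hb := hbox w hw0 h1.ne
        have hb' : w' ∈ box m := by
          by_cases hw2 : w'.2 = 0
          · rw [mem_box] at *
            omega
          · exact hbox w' hw0' hw2
        have hconn' := hconn.tail (⟨hn, ⟨hb, h1.le⟩, ⟨hb', by omega⟩, hw0, hw0'⟩ :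
          bstep false (dnBox m) ω w w')
        by_cases hw2 : w'.2 = 0
        · left
          refine ⟨hw2, ?_⟩
          by_contra hcon
          by_cases hcw : w'.1 = c
          · rw [show w' = (c, 0) from Prod.ext hcw hw2, hE.1] at hw0'
            exact absurd hw0' (by simp)
          · refine (hE.2 w'.1 (by omega)).2 ⟨a, ha, ?_⟩
            rwa [show (w'.1, (0 : ℤ)) = w' from Prod.ext rfl hw2.symm]
        · right; right
          exact ⟨by omega, a, ha, hconn'⟩
  rcases inv z hyz with h | h | h <;> omega

end Schonmann
end

noncomputable section
open scoped Classical FinsetFamily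
namespace Schonmann

/-- Probability in the box cut along the negative half-axis, with minuses on the half-axis. -/
def pm (β : ℝ) (m : ℕ) (A : Set Cfg2) : ℝ := pr β (cut (box m) (-1)) (sl (-1)) A

/-- There is a cut point with abscissa in `[0, r]`. -/
def cutUnion (m r : ℕ) : Set Cfg2 :=
  {ω | ∃ c : ℕ, c ≤ r ∧ ω ∈ cutPt (upBox m) (dnBox m) c}

theorem isUpperSet_cutUnion (m r : ℕ) : IsUpperSet (cutUnion m r) :=
  fun _ _ hab ⟨c, hc, h⟩ => ⟨c, hc, isUpperSet_cutPt _ _ _ hab h⟩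

theorem cutUnion_anti {n m : ℕ} (h : n ≤ m) (r : ℕ) : cutUnion m r ⊆ cutUnion n r :=
  fun _ ⟨c, hc, hω⟩ => ⟨c, hc, cutPt_anti (upBox_mono h) (dnBox_mono h) _ hω⟩

theorem pm_cutUnion_anti {β : ℝ} (hβ : 0 ≤ β) (r : ℕ) : Antitone fun m => pm β m (cutUnion m r) := by
  intro n m h
  refine (pr_mono fun ω _ hω => cutUnion_anti h r hω).trans ?_
  exact pr_cut_anti hβ (box_mono h) (fun x hx => by rw [sl, if_neg hx]) (isUpperSet_cutUnion n r)

/-- Limiting probability of a cut point in `[0, r]`. -/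
def cutLim (β : ℝ) (r : ℕ) : ℝ := ⨅ m, pm β m (cutUnion m r)

theorem bddBelow_cutLim (β : ℝ) (r : ℕ) : BddBelow (Set.range fun m => pm β m (cutUnion m r)) :=
  ⟨0, by rintro _ ⟨m, rfl⟩; exact pr_nonneg⟩

theorem cutLim_le (β : ℝ) (r m : ℕ) : cutLim β r ≤ pm β m (cutUnion m r) :=
  ciInf_le (bddBelow_cutLim β r) m

theorem cutLim_le_one (β : ℝ) (r : ℕ) : cutLim β r ≤ 1 := (cutLim_le β r 0).trans pr_le_one

theorem Uc_congr {R : Set (ℤ × ℤ)} {ω ω' : Cfg2} (h : ∀ x ∈ R, ω x = ω' x) (i j : ℤ) :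
    ω ∈ Uc R i j ↔ ω' ∈ Uc R i j :=
  ⟨fun ⟨a, ha, hc⟩ => ⟨a, ha, conn_mono subset_rfl (fun x hx hx' => (h x hx) ▸ hx') hc⟩,
    fun ⟨a, ha, hc⟩ => ⟨a, ha, conn_mono subset_rfl (fun x hx hx' => (h x hx).symm ▸ hx') hc⟩⟩

theorem cutPt_congr {R R' : Set (ℤ × ℤ)} {ω ω' : Cfg2} (h : ∀ x ∈ R, ω x = ω' x)
    (h' : ∀ x ∈ R', ω x = ω' x) {c : ℤ} (hc : ω (c, 0) = ω' (c, 0)) :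
    ω ∈ cutPt R R' c ↔ ω' ∈ cutPt R R' c := by
  simp only [cutPt, Set.mem_ofPred_eq, hc, Uc_congr h, Uc_congr h']

/-- Conditionally on the configuration away from `box K`, near cut points are dominated by
their probability in `box K`. -/
theorem pm_inter_le {β : ℝ} (hβ : 0 ≤ β) {K m : ℕ} (hK : K ≤ m) (r : ℕ) {c : ℤ} (hc : K < c) :
    pm β m (cutUnion K r ∩ cutPt (upBox m \ {x | x ∈ box K}) (dnBox m \ {x | x ∈ box K}) c)
      ≤ pm β K (cutUnion K r) *
        pm β m (cutPt (upBox m \ {x | x ∈ box K}) (dnBox m \ {x | x ∈ box K}) c) := by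
  set E := cutPt (upBox m \ {x | x ∈ box K}) (dnBox m \ {x | x ∈ box K}) c
  have hsub : cut (box K) (-1) ⊆ cut (box m) (-1) := cut_mono (box_mono hK) _
  have hg : ∀ ω ω' : Cfg2, (∀ x ∉ cut (box K) (-1), ω x = ω' x) → ind E ω = ind E ω' := by
    intro ω ω' h
    have : ω ∈ E ↔ ω' ∈ E := cutPt_congr
      (fun x hx => h x fun hx' => hx.2 (mem_cut.1 hx').1)
      (fun x hx => h x fun hx' => hx.2 (mem_cut.1 hx').1)
      (h _ fun hx' => by
        have := mem_box.1 (mem_cut.1 hx').1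
        simp only at this
        omega)
    simp only [ind, this]
  calc pm β m (cutUnion K r ∩ E)
      = ex β (cut (box m) (-1)) (sl (-1)) (fun ω => ind E ω * ind (cutUnion K r) ω) := by
        refine ex_congr fun ω _ => ?_
        simp only [ind, Set.mem_inter_iff]
        split_ifs <;> simp_all
    _ = ex β (cut (box m) (-1)) (sl (-1))
          (fun ω => ind E ω * ex β (cut (box K) (-1)) ω (ind (cutUnion K r))) :=
        ex_tower_mul hsub _ _ hg
    _ ≤ ex β (cut (box m) (-1)) (sl (-1)) (fun ω => ind E ω * pm β K (cutUnion K r)) := by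
        refine ex_mono fun ω hω => mul_le_mul_of_nonneg_left ?_ (ind_nonneg _ _)
        refine pr_mono_bc hβ (fun x hx => ?_) (isUpperSet_cutUnion K r)
        by_cases hxa : x.2 = 0 ∧ x.1 ≤ -1
        · rw [mem_Cf.1 hω x fun h => (mem_cut.1 h).2 hxa]
        · rw [sl, if_neg hxa]
          exact le_top
    _ = _ := by rw [ex_mul_const, mul_comm]; rfl

/-- There is a minus path in `R` from `box K` to `(j,0)`. -/
def Hit (R : Set (ℤ × ℤ)) (K : ℕ) (j : ℤ) : Set Cfg2 :=
  {ω | ∃ z ∈ box K, z ∈ R ∧ conn false R ω z (j, 0)}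

theorem isLowerSet_Hit (R : Set (ℤ × ℤ)) (K : ℕ) (j : ℤ) : IsLowerSet (Hit R K j) :=
  fun _ _ hab ⟨z, hz, hR, hc⟩ => ⟨z, hz, hR, conn_anti hab hc⟩

/-- All spins of the cut box are minus. -/
def boxMinus (K : ℕ) : Set Cfg2 := {ω | ∀ x ∈ cut (box K) (-1), ω x = false}

theorem isLowerSet_boxMinus (K : ℕ) : IsLowerSet (boxMinus K) :=
  fun _ _ hab ha x hx => isLowerSet_site x hab (ha x hx)

/-- Probability that all spins of the cut box are minus. -/
def kap (β : ℝ) (K : ℕ) : ℝ := pr β (cut (box K) (-1)) (fun _ => true) (boxMinus K)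

theorem kap_pos (β : ℝ) (K : ℕ) : 0 < kap β K := by
  refine pr_pos ⟨fun x => if x ∈ cut (box K) (-1) then false else true, ?_, ?_⟩
  · rw [mem_Cf]
    intro x hx
    simp [hx]
  · intro x hx
    simp [hx]

theorem conn_or_hit {R : Set (ℤ × ℤ)} {K : ℕ} {ω : Cfg2} {a j : ℤ}
    (h : conn false R ω (a, 0) (j, 0)) :
    conn false (R \ {x | x ∈ box K}) ω (a, 0) (j, 0) ∨ ω ∈ Hit R K j := by
  generalize hx : ((a, 0) : ℤ × ℤ) = x at h
  clear hx
  induction h using Relation.ReflTransGen.head_induction_on with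
  | refl => exact Or.inl Relation.ReflTransGen.refl
  | @head y w hst hc ih =>
    rcases ih with h | h
    · by_cases hy : y ∈ box K
      · exact Or.inr ⟨y, hy, hst.2.1, hc.head hst⟩
      by_cases hw : w ∈ box K
      · exact Or.inr ⟨w, hw, hst.2.2.1, hc⟩
      exact Or.inl (h.head ⟨hst.1, ⟨hst.2.1, hy⟩, ⟨hst.2.2.1, hw⟩, hst.2.2.2.1, hst.2.2.2.2⟩)
    · exact Or.inr h

theorem conn_up {K m : ℕ} (hK : K ≤ m) {ω : Cfg2} (hω : ∀ x ∈ box K, ω x = false) (a : ℤ) (n : ℕ)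
    (h : (a, (n : ℤ)) ∈ box K) : conn false (upBox m) ω (a, 0) (a, n) := by
  induction n with
  | zero => exact Relation.ReflTransGen.refl
  | succ n ih =>
    have h' : (a, (n : ℤ)) ∈ box K := by
      rw [mem_box] at *
      push_cast at *
      omega
    refine (ih h').tail ⟨mem_nbrs_iff.2 (by push_cast; omega), ⟨box_mono hK h', by simp⟩,
      ⟨box_mono hK h, by positivity⟩, hω _ h', hω _ h⟩

theorem hit_boxMinus_subset {K m : ℕ} (hK : K ≤ m) {ω : Cfg2}
    (hω : ω ∈ Cf (cut (box m) (-1)) (sl (-1))) {j : ℤ} (h : ω ∈ Hit (upBox m) K j)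
    (h' : ω ∈ boxMinus K) : ω ∈ Uc (upBox m) K j := by
  have hb : ∀ x ∈ box K, ω x = false := by
    intro x hx
    by_cases hxa : x.2 = 0 ∧ x.1 ≤ -1
    · rw [mem_Cf.1 hω x fun h => (mem_cut.1 h).2 hxa, sl, if_pos hxa]
    · exact h' x (mem_cut.2 ⟨hx, hxa⟩)
  obtain ⟨⟨z1, z2⟩, hz, hzR, hc⟩ := h
  obtain ⟨n, rfl⟩ := Int.eq_ofNat_of_zero_le (show 0 ≤ z2 from hzR.2)
  exact ⟨z1, (mem_box.1 hz).2.1, (conn_up hK hb z1 n hz).trans hc⟩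

theorem pm_Hit_up_le {β : ℝ} (hβ : 0 ≤ β) {K m : ℕ} (hK : K ≤ m) (k : ℕ) {j : ℤ}
    (hj : (K : ℤ) + k + 1 = j) :
    pm β m (Hit (upBox m) K j) ≤ Real.sqrt (rho β) ^ k / kap β K := by
  rw [le_div_iff₀ (kap_pos β K)]
  have h1 : kap β K ≤ pm β m (boxMinus K) :=
    pr_lower_plus hβ (cut_mono (box_mono hK) _) (fun _ _ => le_top) (fun _ _ _ => rfl)
      (isLowerSet_boxMinus K)
  calc _ ≤ pm β m (Hit (upBox m) K j) * pm β m (boxMinus K) :=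
        mul_le_mul_of_nonneg_left h1 pr_nonneg
    _ ≤ pm β m (Hit (upBox m) K j ∩ boxMinus K) :=
        fkg_lower hβ (isLowerSet_Hit _ _ _) (isLowerSet_boxMinus K)
    _ ≤ pm β m (Uc (upBox m) K j) := pr_mono fun ω hω h => hit_boxMinus_subset hK hω h.1 h.2
    _ ≤ _ := pr_Uc_le hβ m (by omega) k hj

theorem pm_Hit_dn (β : ℝ) (K m : ℕ) (j : ℤ) :
    pm β m (Hit (dnBox m) K j) = pm β m (Hit (upBox m) K j) := by
  have e1 : ∀ x : ℤ × ℤ, x ∈ dnBox m → (x.1, -x.2) ∈ upBox m := by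
    intro x
    simp only [dnBox, upBox, Set.mem_ofPred_eq, mem_box]
    omega
  have e2 : ∀ x : ℤ × ℤ, x ∈ upBox m → (x.1, -x.2) ∈ dnBox m := by
    intro x
    simp only [dnBox, upBox, Set.mem_ofPred_eq, mem_box]
    omega
  have e3 : ∀ x : ℤ × ℤ, x ∈ box K → (x.1, -x.2) ∈ box K := by
    intro x
    simp only [mem_box]
    omega
  rw [pm, pr_vrefl (A := Hit (dnBox m) K j)]
  · refine pr_congr fun ω _ => ?_
    constructor
    · rintro ⟨z, hz, hR, hc⟩
      exact ⟨_, e3 _ hz, e1 _ hR, by simpa using conn_vrefl e1 hc⟩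
    · rintro ⟨z, hz, hR, hc⟩
      exact ⟨_, e3 _ hz, e2 _ hR, by simpa using conn_vrefl e2 hc⟩
  · intro x
    simp only [mem_cut, mem_box]
    constructor <;> intro h <;> omega
  · intro x
    simp only [sl]
    congr! 2
    omega

/-- Error made when ignoring `box K` in the definition of cut points. -/
theorem pm_cutPt_diff_le {β : ℝ} (hβ : 0 ≤ β) (hr : rho β < 1) {K m c : ℕ} (hK : K ≤ m)
    (hc : K < c) :
    pm β m (cutPt (upBox m \ {x | x ∈ box K}) (dnBox m \ {x | x ∈ box K}) c
        \ cutPt (upBox m) (dnBox m) c)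
      ≤ 2 * (Real.sqrt (rho β) ^ (c - K) / (1 - Real.sqrt (rho β)) / kap β K) := by
  set s := Real.sqrt (rho β) with hsdef
  have hs1 : s < 1 := by
    rw [hsdef, Real.sqrt_lt' one_pos]
    simpa using hr
  have hs0 : 0 ≤ s := Real.sqrt_nonneg _
  have h1 : pm β m (cutPt (upBox m \ {x | x ∈ box K}) (dnBox m \ {x | x ∈ box K}) c
        \ cutPt (upBox m) (dnBox m) c) ≤ pm β m (⋃ i ∈ Finset.range m,
          (Hit (upBox m) K (c + 1 + (i : ℕ)) ∪ Hit (dnBox m) K (c + 1 + (i : ℕ)))) := by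
    refine pr_mono fun ω _ hω => ?_
    obtain ⟨⟨h2, h3⟩, h4⟩ := hω
    have : ∃ j : ℤ, (c : ℤ) < j ∧ (ω ∈ Uc (upBox m) (c - 1) j ∨ ω ∈ Uc (dnBox m) (c - 1) j) := by
      by_contra hcon
      push Not at hcon
      exact h4 ⟨h2, hcon⟩
    obtain ⟨j, hj, h5⟩ := this
    have hjm : j ≤ m := by
      by_contra hcon
      rcases h5 with h | h
      · exact Uc_eq_empty (upBox_subset m) (by omega) (by omega) ω h
      · exact Uc_eq_empty (dnBox_subset m) (by omega) (by omega) ω h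
    obtain ⟨i, hi⟩ := Int.eq_ofNat_of_zero_le (show 0 ≤ j - (c + 1) by omega)
    have hji : (c : ℤ) + 1 + (i : ℕ) = j := by omega
    simp only [Set.mem_iUnion, Finset.mem_range]
    refine ⟨i, by omega, ?_⟩
    rw [hji]
    rcases h5 with ⟨a, ha, h⟩ | ⟨a, ha, h⟩
    · rcases conn_or_hit (K := K) h with h | h
      · exact absurd ⟨a, ha, h⟩ (h3 j hj).1
      · exact Or.inl h
    · rcases conn_or_hit (K := K) h with h | h
      · exact absurd ⟨a, ha, h⟩ (h3 j hj).2
      · exact Or.inr h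
  refine h1.trans ((pr_biUnion_le _ _).trans ?_)
  have h2 : ∀ i ∈ Finset.range m, pr β (cut (box m) (-1)) (sl (-1))
      (Hit (upBox m) K (c + 1 + (i : ℕ)) ∪ Hit (dnBox m) K (c + 1 + (i : ℕ)))
        ≤ 2 * (s ^ (c - K) / kap β K) * s ^ i := by
    intro i _
    refine (pr_union_le _ _).trans ?_
    have h3 := pm_Hit_up_le hβ hK (c - K + i) (j := c + 1 + (i : ℕ)) (by push_cast; omega)
    have h4 := pm_Hit_dn β K m (c + 1 + (i : ℕ))
    rw [pm] at h3 h4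
    rw [h4]
    rw [← hsdef, pow_add] at h3
    refine (add_le_add h3 h3).trans (le_of_eq ?_)
    ring
  refine (Finset.sum_le_sum h2).trans ?_
  rw [← Finset.mul_sum]
  have hg : (∑ k ∈ Finset.range m, s ^ k) ≤ 1 / (1 - s) := by
    rw [geom_sum_eq hs1.ne, ← neg_div_neg_eq, neg_sub, neg_sub]
    apply div_le_div_of_nonneg_right _ (by linarith)
    linarith [pow_nonneg hs0 m]
  have hk := kap_pos β K
  refine (mul_le_mul_of_nonneg_left hg
    (mul_nonneg zero_le_two (div_nonneg (pow_nonneg hs0 _) hk.le))).trans (le_of_eq ?_)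
  ring

theorem cutLim_step {β : ℝ} (hβ : 0 ≤ β) (hr : rho β < 1) {r K c : ℕ} (hrc : r < c) (hc : K < c) :
    cutLim β r + cutBd β * (1 - pm β K (cutUnion K r))
      - 2 * (Real.sqrt (rho β) ^ (c - K) / (1 - Real.sqrt (rho β)) / kap β K) ≤ cutLim β c := by
  have main : ∀ m, c ≤ m → cutLim β r + cutBd β * (1 - pm β K (cutUnion K r))
      - 2 * (Real.sqrt (rho β) ^ (c - K) / (1 - Real.sqrt (rho β)) / kap β K)
      ≤ pm β m (cutUnion m c) := by
    intro m hm
    have hK : K ≤ m := by omega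
    set E := cutPt (upBox m) (dnBox m) c
    set E' := cutPt (upBox m \ {x | x ∈ box K}) (dnBox m \ {x | x ∈ box K}) c
    have hEE : E ⊆ E' := cutPt_anti Set.sdiff_subset Set.sdiff_subset _
    have h1 : pm β m (cutUnion m r) + pm β m (E \ cutUnion m r) ≤ pm β m (cutUnion m c) := by
      have h2 := pr_inter_add_diff (β := β) (Λ := cut (box m) (-1)) (σ := sl (-1))
        (cutUnion m r ∪ E) (cutUnion m r)
      rw [Set.union_inter_cancel_left, Set.union_sdiff_left] at h2
      simp only [pm]
      rw [h2]
      refine pr_mono fun ω _ hω => ?_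
      rcases hω with ⟨c', hc', h⟩ | h
      · exact ⟨c', by omega, h⟩
      · exact ⟨c, le_rfl, h⟩
    have h3 := pr_inter_add_diff (β := β) (Λ := cut (box m) (-1)) (σ := sl (-1)) E (cutUnion m r)
    have h4 : pm β m (E ∩ cutUnion m r) ≤ pm β m (cutUnion K r ∩ E') :=
      pr_mono fun ω _ hω => ⟨cutUnion_anti hK r hω.2, hEE hω.1⟩
    have h5 := pm_inter_le hβ hK r (c := c) (by omega)
    have h6 := pr_inter_add_diff (β := β) (Λ := cut (box m) (-1)) (σ := sl (-1)) E' E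
    rw [Set.inter_eq_self_of_subset_right hEE] at h6
    have h7 := pm_cutPt_diff_le hβ hr hK hc
    have h8 : cutBd β ≤ pm β m E := cutBd_le hβ hr m (by omega) (by omega)
    have h9 := cutLim_le β r m
    have h10 : pm β K (cutUnion K r) ≤ 1 := pr_le_one
    have h11 : 0 ≤ pm β K (cutUnion K r) := pr_nonneg
    have h12 : 0 ≤ pm β m (E' \ E) := pr_nonneg
    change pm β m (E ∩ cutUnion m r) + pm β m (E \ cutUnion m r) = pm β m E at h3
    change pm β m E + pm β m (E' \ E) = pm β m E' at h6
    change pm β m (cutUnion K r ∩ E') ≤ pm β K (cutUnion K r) * pm β m E' at h5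
    change pm β m (E' \ E) ≤ _ at h7
    nlinarith [mul_le_mul_of_nonneg_right h8 (sub_nonneg.2 h10),
      mul_nonneg h12 (sub_nonneg.2 h10)]
  refine le_ciInf fun m => ?_
  rcases le_total c m with h | h
  · exact main m h
  · exact (main c le_rfl).trans (pm_cutUnion_anti hβ c h)

theorem exists_cutLim {β : ℝ} (hβ : 0 ≤ β) (hr : rho β < 1) {ε : ℝ} (hε : 0 < ε) :
    ∃ r, 1 - ε < cutLim β r := by
  by_contra hcon
  push Not at hcon
  set u := ⨆ r, cutLim β r
  have hbdd : BddAbove (Set.range (cutLim β)) := ⟨1, by rintro _ ⟨r, rfl⟩; exact cutLim_le_one β r⟩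
  have hu : u ≤ 1 - ε := ciSup_le hcon
  have hp := cutBd_pos β
  set η := cutBd β * ε / 8 with hη
  have hη0 : 0 < η := by positivity
  have hcb : cutBd β ≤ 1 := (cutBd_le hβ hr 0 (c := 0) le_rfl le_rfl).trans pr_le_one
  obtain ⟨r, hr'⟩ := exists_lt_of_lt_ciSup (show u - η < ⨆ r, cutLim β r from sub_lt_self _ hη0)
  obtain ⟨K, hK⟩ := exists_lt_of_ciInf_lt (show (⨅ m, pm β m (cutUnion m r)) < cutLim β r + η from
    lt_add_of_pos_right _ hη0)
  have hs1 : Real.sqrt (rho β) < 1 := by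
    rw [Real.sqrt_lt' one_pos]
    simpa using hr
  have hlim : Tendsto (fun n : ℕ => 2 * (Real.sqrt (rho β) ^ n / (1 - Real.sqrt (rho β)) / kap β K))
      atTop (𝓝 (2 * (0 / (1 - Real.sqrt (rho β)) / kap β K))) :=
    (((tendsto_pow_atTop_nhds_zero_of_lt_one (Real.sqrt_nonneg _) hs1).div_const _).div_const
      _).const_mul _
  rw [zero_div, zero_div, mul_zero] at hlim
  obtain ⟨n, hn⟩ := ((hlim.eventually (gt_mem_nhds hη0)).and
    (eventually_ge_atTop (r + 1))).exists
  have h1 := cutLim_step hβ hr (r := r) (K := K) (c := K + n) (by omega) (by omega)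
  rw [Nat.add_sub_cancel_left] at h1
  have h2 : cutLim β (K + n) ≤ u := le_ciSup hbdd _
  have h3 : cutLim β r ≤ u := le_ciSup hbdd _
  have h4 : cutBd β * (ε - η) ≤ cutBd β * (1 - pm β K (cutUnion K r)) :=
    mul_le_mul_of_nonneg_left (by linarith) hp.le
  have h5 : cutBd β * η ≤ η := by nlinarith
  have h6 : cutBd β * (ε - η) = 8 * η - cutBd β * η := by rw [hη]; ring
  linarith [hn.1]

/-! ### Forgetting the minus half-axis -/

/-- Probability of pluses on `F` in the plus phase. -/
def EP (β : ℝ) (F : Finset ℤ) : ℝ := ⨅ n, pr β (box n) (fun _ => true) (plusOn F)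

theorem bddBelow_EP (β : ℝ) (F : Finset ℤ) :
    BddBelow (Set.range fun n => pr β (box n) (fun _ => true) (plusOn F)) :=
  ⟨0, by rintro _ ⟨n, rfl⟩; exact pr_nonneg⟩

theorem EP_le (β : ℝ) (F : Finset ℤ) (n : ℕ) : EP β F ≤ pr β (box n) (fun _ => true) (plusOn F) :=
  ciInf_le (bddBelow_EP β F) n

theorem tendsto_EP {β : ℝ} (hβ : 0 ≤ β) (F : Finset ℤ) :
    Tendsto (fun n => pr β (box n) (fun _ => true) (plusOn F)) atTop (𝓝 (EP β F)) :=
  tendsto_atTop_ciInf (fun _ _ h => pr_true_anti hβ (box_mono h) (isUpperSet_plusOn F))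
    (bddBelow_EP β F)

theorem EP_le_pr {β : ℝ} (hβ : 0 ≤ β) (F : Finset ℤ) (Λ : Finset (ℤ × ℤ)) :
    EP β F ≤ pr β Λ (fun _ => true) (plusOn F) := by
  obtain ⟨n, hn⟩ := exists_subset_box Λ
  exact (EP_le β F n).trans (pr_true_anti hβ hn (isUpperSet_plusOn F))

theorem EP_shift_le {β : ℝ} (hβ : 0 ≤ β) (F : Finset ℤ) (k : ℤ) : EP β (shiftF k F) ≤ EP β F :=
  le_ciInf fun n => by
    have := pr_tr_plusOn (β := β) (Λ := box n) (σ := fun _ => true) k F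
    rw [← this]
    exact EP_le_pr hβ _ _

theorem EP_shift {β : ℝ} (hβ : 0 ≤ β) (F : Finset ℤ) (k : ℤ) : EP β (shiftF k F) = EP β F := by
  refine le_antisymm (EP_shift_le hβ F k) ?_
  have := EP_shift_le hβ (shiftF k F) (-k)
  rwa [shiftF_shiftF, neg_add_cancel, shiftF_zero] at this

theorem forget_supercritical {β : ℝ} (hβ : 0 ≤ β)
    (hQ : 1 < PiF β {0} allPlus + PiF β {0} allMinus) (F : Finset ℤ) {ε : ℝ} (hε : 0 < ε) :
    ∃ r0 : ℕ, ∀ r : ℕ, r0 ≤ r → EP β F - ε ≤ PiF β (shiftF r F) allMinus := by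
  obtain ⟨r, hr⟩ := exists_cutLim hβ (rho_lt_one hβ hQ) hε
  refine ⟨r + 1 + F.sup Int.natAbs, fun n hn => le_ciInf fun m => ?_⟩
  have hF : ∀ i ∈ shiftF n F, (r : ℤ) < i := by
    intro i hi
    have h1 : (i - n).natAbs ≤ F.sup Int.natAbs := Finset.le_sup (f := Int.natAbs) (mem_shiftF.1 hi)
    omega
  rw [pin, bc_allMinus]
  have h1 := pr_sep_minus hβ (isUpperSet_plusOn (shiftF n F)) (D := {z | z.2 = 0 ∧ (r : ℤ) < z.1})
    (fun ω ω' h hω i hi => by rw [← h (i, 0) ⟨rfl, hF i hi⟩]; exact hω i hi)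
    (cut (box m) (-1)) (sl (-1))
  have h2 : pm β m (cutUnion m r) ≤ pr β (cut (box m) (-1)) (sl (-1))
      (Sep false (cut (box m) (-1)) {z | z.2 = 0 ∧ (r : ℤ) < z.1}) := by
    refine pr_mono fun ω hω ⟨c, hc, h⟩ => ?_
    have := cutPt_subset_Sep (by omega) hω h
    rintro z ⟨hz, hz'⟩
    exact this z ⟨hz, by omega⟩
  have h3 : pr β (cut (box m) (-1)) (sl (-1)) (plusOn (shiftF n F) ∩
      Sep false (cut (box m) (-1)) {z | z.2 = 0 ∧ (r : ℤ) < z.1})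
      ≤ pr β (cut (box m) (-1)) (sl (-1)) (plusOn (shiftF n F)) := pr_mono fun _ _ h => h.1
  have h4 := EP_le_pr hβ (shiftF n F) (cut (box m) (-1))
  rw [EP_shift hβ] at h4
  have h5 := cutLim_le β r m
  have h6 : EP β F ≤ 1 := (EP_le β F 0).trans pr_le_one
  have h7 : 0 ≤ EP β F := le_ciInf fun _ => pr_nonneg
  have h8 : pm β m (cutUnion m r) ≤ 1 := pr_le_one
  have h9 := (mul_le_mul (h5.trans h2) h4 h7 pr_nonneg).trans (h1.trans h3)
  nlinarith [cutLim_le_one β r]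

end Schonmann
end

noncomputable section
open scoped Classical FinsetFamily
namespace Schonmann

theorem pr_false_site {β : ℝ} {N : ℕ} (i : ℤ) :
    pr β (box N) (fun _ => false) (plusOn {i}) = 1 - pr β (box N) (fun _ => true) (plusOn {i}) := by
  have h := pr_flip (β := β) (Λ := box N) (σ := fun _ => true) (A := plusOn {i})
  rw [show flipCfg (fun _ => true) = fun _ => false from rfl] at h
  rw [h, ← pr_compl]
  refine pr_congr fun ω _ => ?_
  simp [plusOn, flipCfg]

theorem ind_of_mem {A : Set Cfg2} {ω : Cfg2} (h : ω ∈ A) : ind A ω = 1 := if_pos h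

theorem ind_of_notMem {A : Set Cfg2} {ω : Cfg2} (h : ω ∉ A) : ind A ω = 0 := if_neg h

theorem monotone_count (F : Finset ℤ) :
    Monotone fun ω : Cfg2 => ((∑ i ∈ F, ind (plusOn {i}) ω) + 1) - ind (plusOn F) ω := by
  intro a b hab
  have h1 : ∀ ω, ω ∈ plusOn F → (∑ i ∈ F, ind (plusOn {i}) ω) = F.card := by
    intro ω hω
    rw [Finset.sum_congr rfl fun i hi => ind_of_mem (show ω ∈ plusOn {i} by
      simpa [plusOn] using hω i hi)]
    simp
  have h2 : ∀ ω, ω ∉ plusOn F → (∑ i ∈ F, ind (plusOn {i}) ω) + 1 ≤ F.card := by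
    intro ω hω
    have : ∃ i ∈ F, ω ∉ plusOn {i} := by
      by_contra hcon
      push Not at hcon
      exact hω fun i hi => by simpa [plusOn] using hcon i hi
    obtain ⟨i, hi, hωi⟩ := this
    rw [← Finset.add_sum_erase _ _ hi, ind_of_notMem hωi, ← Finset.card_erase_add_one hi]
    push_cast
    have : ∑ x ∈ F.erase i, ind (plusOn {x}) ω ≤ ∑ x ∈ F.erase i, (1 : ℝ) :=
      Finset.sum_le_sum fun _ _ => ind_le_one _ _
    simp only [Finset.sum_const, nsmul_eq_mul, mul_one] at this
    linarith
  have h3 : (∑ i ∈ F, ind (plusOn {i}) a) ≤ ∑ i ∈ F, ind (plusOn {i}) b :=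
    Finset.sum_le_sum fun i _ => ind_mono_of_isUpperSet (isUpperSet_plusOn {i}) hab
  by_cases ha : a ∈ plusOn F
  · have hb := isUpperSet_plusOn F hab ha
    simp only [h1 a ha, h1 b hb, ind_of_mem ha, ind_of_mem hb, le_refl]
  · by_cases hb : b ∈ plusOn F
    · have := h2 a ha
      simp only [h1 b hb, ind_of_notMem ha, ind_of_mem hb]
      linarith
    · simp only [ind_of_notMem ha, ind_of_notMem hb]
      linarith

theorem pr_true_sub_false_le {β : ℝ} (hβ : 0 ≤ β) (N : ℕ) (F : Finset ℤ) :
    pr β (box N) (fun _ => true) (plusOn F) - pr β (box N) (fun _ => false) (plusOn F) ≤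
      ∑ i ∈ F, (2 * pr β (box N) (fun _ => true) (plusOn {i}) - 1) := by
  have h := exs_le_exs (β := β) (Λ := box N) hβ (Cf_nonempty (box N) fun _ => false)
    (Cf_nonempty (box N) fun _ => true) (fun a ha b hb => ?_) (monotone_count F) (fun ω => ?_)
  · change ex β (box N) (fun _ => false) _ ≤ ex β (box N) (fun _ => true) _ at h
    simp only [ex_sub, ex_add, ex_const] at h
    simp only [ex, exs_sum] at h
    change (∑ i ∈ F, pr β (box N) (fun _ => false) (plusOn {i})) + 1
      - pr β (box N) (fun _ => false) (plusOn F) ≤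
      (∑ i ∈ F, pr β (box N) (fun _ => true) (plusOn {i})) + 1
      - pr β (box N) (fun _ => true) (plusOn F) at h
    simp only [pr_false_site, Finset.sum_sub_distrib] at h
    simp only [Finset.sum_sub_distrib, ← Finset.mul_sum]
    linarith
  · refine ⟨mem_Cf.2 fun x hx => ?_, mem_Cf.2 fun x hx => ?_⟩
    · rw [Pi.inf_apply, mem_Cf.1 ha x hx]; simp
    · rw [Pi.sup_apply, mem_Cf.1 hb x hx]; simp
  · have := ind_le_one (plusOn F) ω
    have : 0 ≤ ∑ i ∈ F, ind (plusOn {i}) ω := Finset.sum_nonneg fun _ _ => ind_nonneg _ _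
    linarith

theorem forget_critical {β : ℝ} (hβ : 0 ≤ β) (hp : EP β {0} ≤ 1 / 2) (F : Finset ℤ) {ε : ℝ}
    (hε : 0 < ε) : ∃ r0 : ℕ, ∀ r : ℕ, r0 ≤ r → EP β F - ε ≤ PiF β (shiftF r F) allMinus := by
  have h0 : ∀ i : ℤ, EP β {i} = EP β {0} := by
    intro i
    rw [← EP_shift hβ {0} i]
    congr 1
    ext j
    simp [mem_shiftF, sub_eq_zero]
  have hlim : Tendsto (fun N => ∑ i ∈ F, (2 * pr β (box N) (fun _ => true) (plusOn {i}) - 1))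
      atTop (𝓝 (∑ i ∈ F, (2 * EP β {i} - 1))) :=
    tendsto_finsetSum _ fun i _ => ((tendsto_EP hβ {i}).const_mul 2).sub_const 1
  have hle : (∑ i ∈ F, (2 * EP β {i} - 1)) ≤ 0 :=
    Finset.sum_nonpos fun i _ => by rw [h0]; linarith
  obtain ⟨N, hN⟩ := (hlim.eventually (gt_mem_nhds (lt_of_le_of_lt hle hε))).exists
  have h1 := pr_true_sub_false_le hβ N F
  have h2 := EP_le β F N
  refine ⟨N + 1, fun r hr => le_ciInf fun m => ?_⟩
  refine le_trans ?_ (pin_anti hβ (shiftF r F) allMinus (le_max_left m (N + r)))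
  simp only [pin, bc_allMinus]
  refine le_trans (show _ ≤ pr β (tr r (box N)) (fun _ => false) (plusOn (shiftF r F)) from ?_)
    (pr_le_pr_of_minus hβ (fun x hx => ?_) (fun _ _ => bot_le) (fun _ _ _ => rfl)
      (isUpperSet_plusOn _))
  · rw [pr_tr_plusOn]
    linarith
  · rw [mem_tr, mem_box] at hx
    rw [mem_cut, mem_box]
    have := le_max_right m (N + r)
    simp only at hx
    push_cast
    omega

theorem forget_minus {β : ℝ} (hβ : 0 ≤ β)
    (hQ : 1 < PiF β {0} allPlus + PiF β {0} allMinus ∨ EP β {0} ≤ 1 / 2) (F : Finset ℤ) {ε : ℝ}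
    (hε : 0 < ε) : ∃ r0 : ℕ, ∀ r : ℕ, r0 ≤ r → EP β F - ε ≤ PiF β (shiftF r F) allMinus :=
  hQ.elim (fun h => forget_supercritical hβ h F hε) fun h => forget_critical hβ h F hε

theorem forget_plus {β : ℝ} (hβ : 0 ≤ β) (F : Finset ℤ) {ε : ℝ} (hε : 0 < ε) :
    ∃ r0 : ℕ, ∀ r : ℕ, r0 ≤ r → PiF β (shiftF r F) allPlus ≤ EP β F + ε := by
  obtain ⟨N, hN⟩ := exists_lt_of_ciInf_lt (show (⨅ n, pr β (box n) (fun _ => true) (plusOn F))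
    < EP β F + ε from lt_add_of_pos_right _ hε)
  refine ⟨N + 1, fun r hr => (PiF_le_pin _ _ _ (N + r)).trans (le_trans ?_ hN.le)⟩
  have h1 := pr_tr_plusOn (β := β) (Λ := box N) (σ := fun _ => true) r F
  rw [← h1, pin, bc_allPlus]
  refine pr_true_anti hβ (fun x hx => ?_) (isUpperSet_plusOn _)
  rw [mem_tr, mem_box] at hx
  rw [mem_cut, mem_box]
  simp only at hx
  push_cast
  omega

end Schonmann
end

noncomputable section
open scoped Classical FinsetFamily
namespace Schonmann

/-! ### The one-step identity -/

/-- Append a new most recent symbol to a past. -/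
def snocPast (a : Bool) (ω : Past Bool) : Past Bool := fun k => Nat.casesOn k a ω

theorem update_bc (a : Bool) (ω : Past Bool) (x : ℤ × ℤ) :
    Function.update (bc ω) (0, 0) a (x.1 + 1, x.2) = bc (snocPast a ω) x := by
  obtain ⟨u, v⟩ := x
  by_cases h : u = -1 ∧ v = 0
  · obtain ⟨rfl, rfl⟩ := h
    simp [bc, snocPast]
  · rw [Function.update_of_ne (by simp only [ne_eq, Prod.mk.injEq]; omega)]
    simp only [bc]
    by_cases hv : v = 0 ∧ u < 0
    · rw [if_pos ⟨hv.1, by omega⟩, if_pos hv]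
      obtain ⟨n, hn⟩ := Int.eq_ofNat_of_zero_le (show 0 ≤ -u - 2 by omega)
      rw [show (-(u + 1) - 1).toNat = n by omega, show (-u - 1).toNat = n + 1 by omega]
      rfl
    · rw [if_neg (by omega), if_neg hv]

theorem tendsto_pr_snoc {β : ℝ} (hβ : 0 ≤ β) (F : Finset ℤ) (a : Bool) (ω : Past Bool) :
    Tendsto (fun n => pr β (cut (box n) 0) (Function.update (bc ω) (0, 0) a) (plusOn F)) atTop
      (𝓝 (PiF β (shiftF (-1) F) (snocPast a ω))) := by
  have hσ : ∀ x : ℤ × ℤ, Function.update (bc ω) (0, 0) a (x.1 + (0 + 1), x.2) = bc (snocPast a ω) x :=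
    fun x => by rw [zero_add]; exact update_bc a ω x
  rw [← tendsto_add_atTop_iff_nat 1]
  refine tendsto_of_tendsto_of_tendsto_of_le_of_le tendsto_const_nhds
    (tendsto_pin hβ (shiftF (-1) F) (snocPast a ω)) (fun n => ?_) fun n => ?_
  · have := PiF_le_pr hβ (box (n + 1)) 0 hσ (shiftF (-1) F)
    rwa [shiftF_shiftF, show (0 + 1 + -1 : ℤ) = 0 by norm_num, shiftF_zero] at this
  · have h1 : cut (box (n + 1)) 0 = tr 1 (cut (tr (-1) (box (n + 1))) (-1)) := by
      ext x
      simp only [mem_cut, mem_tr, sub_neg_eq_add, sub_add_cancel]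
      refine and_congr_right fun _ => ?_
      constructor <;> intros <;> omega
    have h2 := pr_tr_plusOn (β := β) (Λ := cut (tr (-1) (box (n + 1))) (-1))
      (σ := Function.update (bc ω) (0, 0) a) 1 (shiftF (-1) F)
    rw [shiftF_shiftF, show (1 + -1 : ℤ) = 0 by norm_num, shiftF_zero] at h2
    rw [h1, h2]
    simp only [update_bc]
    refine pr_cut_anti hβ (fun x hx => ?_) (fun _ hx => bc_of_not hx) (isUpperSet_plusOn _)
    rw [mem_box] at hx
    rw [mem_tr, mem_box]
    push_cast
    omega

theorem PiF_step {β : ℝ} (hβ : 0 ≤ β) (F : Finset ℤ) (ω : Past Bool) :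
    PiF β F ω = PiF β {0} ω * PiF β (shiftF (-1) F) (snocPast true ω)
      + (1 - PiF β {0} ω) * PiF β (shiftF (-1) F) (snocPast false ω) := by
  refine tendsto_nhds_unique (tendsto_pin hβ F ω) ?_
  have h : ∀ n, pin β n F ω
      = pin β n {0} ω * pr β (cut (box n) 0) (Function.update (bc ω) (0, 0) true) (plusOn F)
      + (1 - pin β n {0} ω) *
        pr β (cut (box n) 0) (Function.update (bc ω) (0, 0) false) (plusOn F) := by
    intro n
    have hx : ((0 : ℤ), (0 : ℤ)) ∈ cut (box n) (-1) := mem_cut.2 ⟨mem_box.2 (by simp), by simp⟩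
    have h1 := cut_erase (box n) (-1)
    rw [show (-1 + 1 : ℤ) = 0 by norm_num] at h1
    have h2 := pr_site_add (β := β) (Λ := cut (box n) (-1)) (σ := bc ω) (x := (0, 0))
    rw [pin, pr_split_site hx, h1, pin, plusOn_singleton, ← h2]
    ring
  simp only [h]
  exact ((tendsto_pin hβ {0} ω).mul (tendsto_pr_snoc hβ F true ω)).add
    (((tendsto_pin hβ {0} ω).const_sub 1).mul (tendsto_pr_snoc hβ F false ω))

/-! ### Locality, continuity and measurability -/

theorem pin_congr {β : ℝ} {n M : ℕ} {F : Finset ℤ} (hM : n + 2 ≤ M) (hF : ∀ i ∈ F, -(M : ℤ) ≤ i)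
    {ω ω' : Past Bool} (h : ∀ k < M, ω k = ω' k) : pin β n F ω = pin β n F ω' := by
  have hbc : ∀ x : ℤ × ℤ, -(M : ℤ) ≤ x.1 → bc ω x = bc ω' x := by
    intro x hx
    simp only [bc]
    split_ifs with hx'
    · exact h _ (by omega)
    · rfl
  refine pr_congr_bdry (fun x hx y hy _ => hbc y ?_) fun η hη η' hη' hag => ?_
  · have h1 := mem_box.1 (mem_cut.1 hx).1
    have h2 := mem_nbrs_iff.1 hy
    omega
  · refine forall₂_congr fun i hi => ?_
    by_cases hx : (i, (0 : ℤ)) ∈ cut (box n) (-1)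
    · rw [hag _ hx]
    · rw [mem_Cf.1 hη _ hx, mem_Cf.1 hη' _ hx, hbc _ (hF i hi)]

theorem continuous_of_local {f : Past Bool → ℝ} {M : ℕ}
    (h : ∀ ω ω' : Past Bool, (∀ k < M, ω k = ω' k) → f ω = f ω') : Continuous f := by
  refine continuous_iff_continuousAt.2 fun ω => ?_
  have : f =ᶠ[𝓝 ω] fun _ => f ω := by
    have hU : ∀ᶠ ω' in 𝓝 ω, ∀ k ∈ Finset.range M, ω' k = ω k := by
      rw [Finset.eventually_all]
      intro k _
      have : ContinuousAt (fun ω' : Past Bool => ω' k) ω := (continuous_apply k).continuousAt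
      exact this.eventually (IsOpen.mem_nhds (isOpen_discrete {ω k}) rfl)
    filter_upwards [hU] with ω' h'
    exact h _ _ fun k hk => h' k (Finset.mem_range.2 hk)
  exact continuousAt_const.congr this.symm

theorem exists_bound (n : ℕ) (F : Finset ℤ) : ∃ M : ℕ, n + 2 ≤ M ∧ ∀ i ∈ F, -(M : ℤ) ≤ i := by
  refine ⟨n + 2 + F.sup Int.natAbs, by omega, fun i hi => ?_⟩
  have h1 : i.natAbs ≤ F.sup Int.natAbs := Finset.le_sup (f := Int.natAbs) hi
  omega

theorem continuous_pin (β : ℝ) (n : ℕ) (F : Finset ℤ) : Continuous (pin β n F) := by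
  obtain ⟨M, h1, h2⟩ := exists_bound n F
  exact continuous_of_local fun _ _ h => pin_congr h1 h2 h

theorem measurable_PiF (β : ℝ) (F : Finset ℤ) : Measurable (PiF β F) :=
  Measurable.iInf fun n => (continuous_pin β n F).measurable

/-- The event that a past has pluses on the negative sites `F`. -/
def pastPlus (F : Finset ℤ) : Set (Past Bool) := {ω | ∀ i ∈ F, ω (-i - 1).toNat = true}

theorem pin_of_neg {β : ℝ} {F : Finset ℤ} (hF : ∀ i ∈ F, i < 0) (n : ℕ) (ω : Past Bool) :
    pin β n F ω = (pastPlus F).indicator (fun _ => 1) ω := by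
  have key : ∀ η ∈ Cf (cut (box n) (-1)) (bc ω), η ∈ plusOn F ↔ ω ∈ pastPlus F := by
    intro η hη
    refine forall₂_congr fun i hi => ?_
    have := hF i hi
    rw [mem_Cf.1 hη _ fun h => (mem_cut.1 h).2 ⟨rfl, by simp only; omega⟩, bc, if_pos ⟨rfl, this⟩]
  rw [pin]
  by_cases h : ω ∈ pastPlus F
  · rw [Set.indicator_of_mem h, pr_congr (B := Set.univ) fun η hη => by simp [key η hη, h], pr_univ]
  · rw [Set.indicator_of_notMem h, pr_congr (B := ∅) fun η hη => by simp [key η hη, h], pr_empty]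

theorem PiF_of_neg {β : ℝ} {F : Finset ℤ} (hF : ∀ i ∈ F, i < 0) (ω : Past Bool) :
    PiF β F ω = (pastPlus F).indicator (fun _ => 1) ω := by
  simp only [PiF, pin_of_neg hF, ciInf_const]

theorem measurableSet_pastPlus (F : Finset ℤ) : MeasurableSet (pastPlus F) := by
  have : pastPlus F = ⋂ i ∈ F, (fun ω : Past Bool => ω (-i - 1).toNat) ⁻¹' {true} := by
    ext ω
    simp [pastPlus]
  rw [this]
  exact Finset.measurableSet_biInter _ fun i _ => measurable_pi_apply _ (measurableSet_singleton _)

theorem measurable_restrictPast : Measurable (restrictPast : ZSeq Bool → Past Bool) :=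
  measurable_pi_lambda _ fun _ => measurable_pi_apply _

theorem measurable_shiftSeq : Measurable (shiftSeq : ZSeq Bool → ZSeq Bool) :=
  measurable_pi_lambda _ fun _ => measurable_pi_apply _

theorem measurable_snocPast (a : Bool) : Measurable (snocPast a) := by
  refine measurable_pi_lambda _ fun k => ?_
  cases k with
  | zero => exact measurable_const
  | succ k => exact measurable_pi_apply k

theorem restrictPast_shiftSeq (ω : ZSeq Bool) :
    restrictPast (shiftSeq ω) = snocPast (ω 0) (restrictPast ω) := by
  ext k
  cases k with
  | zero => simp [restrictPast, shiftSeq, snocPast]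
  | succ k =>
    simp only [restrictPast, shiftSeq, snocPast]
    congr 1

/-- The event of pluses on `F`. -/
def zPlus (F : Finset ℤ) : Set (ZSeq Bool) := {ω | ∀ i ∈ F, ω i = true}

theorem measurableSet_zPlus (F : Finset ℤ) : MeasurableSet (zPlus F) := by
  have : zPlus F = ⋂ i ∈ F, (fun ω : ZSeq Bool => ω i) ⁻¹' {true} := by
    ext ω
    simp [zPlus]
  rw [this]
  exact Finset.measurableSet_biInter _ fun i _ => measurable_pi_apply _ (measurableSet_singleton _)

theorem restrictPast_preimage {F : Finset ℤ} (hF : ∀ i ∈ F, i < 0) :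
    restrictPast ⁻¹' pastPlus F = zPlus F := by
  ext ω
  refine forall₂_congr fun i hi => ?_
  have := hF i hi
  simp only [restrictPast]
  rw [show -(((-i - 1).toNat : ℤ) + 1) = i by omega]

theorem isPiSystem_pastPlus : IsPiSystem {s | ∃ F : Finset ℤ, (∀ i ∈ F, i < 0) ∧ pastPlus F = s} := by
  rintro _ ⟨F, hF, rfl⟩ _ ⟨G, hG, rfl⟩ _
  refine ⟨F ∪ G, fun i hi => (Finset.mem_union.1 hi).elim (hF i) (hG i), ?_⟩
  ext ω
  simp only [pastPlus, Finset.mem_union, Set.mem_ofPred_eq, Set.mem_inter_iff]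
  exact ⟨fun h => ⟨fun i hi => h i (Or.inl hi), fun i hi => h i (Or.inr hi)⟩,
    fun h i hi => hi.elim (h.1 i) (h.2 i)⟩

theorem generateFrom_pastPlus : (inferInstance : MeasurableSpace (Past Bool)) =
    MeasurableSpace.generateFrom {s | ∃ F : Finset ℤ, (∀ i ∈ F, i < 0) ∧ pastPlus F = s} := by
  refine le_antisymm (iSup_le fun k => ?_) (MeasurableSpace.generateFrom_le ?_)
  · rintro _ ⟨t, -, rfl⟩
    have hbase : ∀ t : Set Bool, t = {true} → MeasurableSet[MeasurableSpace.generateFrom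
        {s | ∃ F : Finset ℤ, (∀ i ∈ F, i < 0) ∧ pastPlus F = s}] ((fun ω : Past Bool => ω k) ⁻¹' t) := by
      rintro _ rfl
      refine MeasurableSpace.measurableSet_generateFrom ⟨{-(k + 1 : ℤ)}, by simp; omega, ?_⟩
      ext ω
      simp [pastPlus]
    exact measurable_to_bool (f := fun ω : Past Bool => ω k)
      (hbase _ rfl) trivial
  · rintro _ ⟨F, -, rfl⟩
    exact measurableSet_pastPlus F

theorem ext_zPlus {μ ν : Measure (ZSeq Bool)} [IsFiniteMeasure μ]
    (h : ∀ F, μ (zPlus F) = ν (zPlus F)) : μ = ν := by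
  refine ext_of_generate_finite (Set.range zPlus) ?_ ?_ ?_ ?_
  · refine le_antisymm (iSup_le fun k => ?_) (MeasurableSpace.generateFrom_le ?_)
    · rintro _ ⟨t, -, rfl⟩
      have hbase : MeasurableSet[MeasurableSpace.generateFrom (Set.range zPlus)]
          ((fun ω : ZSeq Bool => ω k) ⁻¹' {true}) := by
        refine MeasurableSpace.measurableSet_generateFrom ⟨{k}, ?_⟩
        ext ω
        simp [zPlus]
      exact measurable_to_bool (f := fun ω : ZSeq Bool => ω k) hbase trivial
    · rintro _ ⟨F, rfl⟩
      exact measurableSet_zPlus F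
  · rintro _ ⟨F, rfl⟩ _ ⟨G, rfl⟩ _
    refine ⟨F ∪ G, ?_⟩
    ext ω
    simp only [zPlus, Finset.mem_union, Set.mem_ofPred_eq, Set.mem_inter_iff]
    exact ⟨fun h => ⟨fun i hi => h i (Or.inl hi), fun i hi => h i (Or.inr hi)⟩,
      fun h i hi => hi.elim (h.1 i) (h.2 i)⟩
  · rintro _ ⟨F, rfl⟩
    exact h F
  · simpa [zPlus] using h ∅

end Schonmann
end

noncomputable section
open scoped Classical
namespace Schonmann

/-! ### The g-function and its g-measures -/

/-- The g-function: conditional probability of a symbol at the origin given the past. -/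
def gP (β : ℝ) (a : Bool) (ω : Past Bool) : ℝ := if a then PiF β {0} ω else 1 - PiF β {0} ω

theorem measurable_gP (β : ℝ) (a : Bool) : Measurable (gP β a) := by
  cases a
  · exact (measurable_PiF β {0}).const_sub 1
  · exact measurable_PiF β {0}

theorem gP_mem_Ioo {β : ℝ} (hβ : 0 ≤ β) (a : Bool) (ω : Past Bool) : gP β a ω ∈ Set.Ioo (0 : ℝ) 1 := by
  have h1 := eps_le_PiF hβ ω
  have h2 := PiF_le_one_sub_eps hβ ω
  have h3 := eps_pos β
  cases a <;> simp only [gP, Set.mem_Ioo] <;> constructor <;> simp <;> linarith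

theorem isGFunction_gP {β : ℝ} (hβ : 0 ≤ β) : IsGFunction (gP β) :=
  ⟨measurable_gP β, fun ω => ⟨by simp [gP], fun a => Set.Ioo_subset_Icc_self (gP_mem_Ioo hβ a ω)⟩⟩

theorem pastSigma_le : pastSigma Bool ≤ (inferInstance : MeasurableSpace (ZSeq Bool)) :=
  measurable_restrictPast.comap_le

theorem measurable_restrictPast_pastSigma : Measurable[pastSigma Bool] (restrictPast (A := Bool)) :=
  comap_measurable _

theorem measurableSet_symbol (a : Bool) : MeasurableSet {ω : ZSeq Bool | ω 0 = a} :=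
  measurableSet_eq_fun (measurable_pi_apply 0) measurable_const

theorem integrable_of_bdd {X : Type*} [MeasurableSpace X] {μ : Measure X} [IsFiniteMeasure μ]
    {f : X → ℝ} (hf : Measurable f) {C : ℝ} (hC : ∀ x, |f x| ≤ C) : Integrable f μ :=
  Integrable.of_bound hf.aestronglyMeasurable C (Eventually.of_forall fun x => hC x)

theorem integral_symbol_mul {P : Bool → Past Bool → ℝ} {ν : Measure (ZSeq Bool)}
    (hν : IsGMeasure ν P) (a : Bool) {H : Past Bool → ℝ} (hH : Measurable H) {C : ℝ}
    (hC : ∀ ω, |H ω| ≤ C) :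
    ∫ ω, H (restrictPast ω) * Set.indicator {ω : ZSeq Bool | ω 0 = a} (fun _ => (1 : ℝ)) ω ∂ν
      = ∫ ω, H (restrictPast ω) * P a (restrictPast ω) ∂ν := by
  have := hν.1
  have hf : StronglyMeasurable[pastSigma Bool] fun ω => H (restrictPast ω) :=
    (hH.comp measurable_restrictPast_pastSigma).stronglyMeasurable
  have hg : Integrable (Set.indicator {ω : ZSeq Bool | ω 0 = a} fun _ => (1 : ℝ)) ν :=
    (integrable_const _).indicator (measurableSet_symbol a)
  have hfg : Integrable ((fun ω => H (restrictPast ω)) *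
      Set.indicator {ω : ZSeq Bool | ω 0 = a} fun _ => (1 : ℝ)) ν :=
    hg.bdd_mul (hH.comp measurable_restrictPast).aestronglyMeasurable
      (Eventually.of_forall fun ω => hC (restrictPast ω))
  have h1 := condExp_mul_of_stronglyMeasurable_left hf hfg hg
  rw [← integral_condExp pastSigma_le]
  refine integral_congr_ae (h1.trans ?_)
  filter_upwards [hν.2.2 a] with ω h
  rw [Pi.mul_apply, ← h]

theorem g_step {P : Bool → Past Bool → ℝ} {ν : Measure (ZSeq Bool)} (hν : IsGMeasure ν P)
    {G : Past Bool → ℝ} (hG : Measurable G) {C : ℝ} (hC : ∀ ω, |G ω| ≤ C)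
    (hP : IsGFunction P) :
    ∫ ω, G ω ∂(ν.map restrictPast) = ∫ ω, (P true ω * G (snocPast true ω)
      + P false ω * G (snocPast false ω)) ∂(ν.map restrictPast) := by
  have := hν.1
  have hm : ∀ a, Measurable fun ω => G (snocPast a ω) := fun a => hG.comp (measurable_snocPast a)
  have hmm : Measurable fun ω => P true ω * G (snocPast true ω) + P false ω * G (snocPast false ω) :=
    ((hP.1 true).mul (hm true)).add ((hP.1 false).mul (hm false))
  rw [integral_map measurable_restrictPast.aemeasurable hG.aestronglyMeasurable,
    integral_map measurable_restrictPast.aemeasurable hmm.aestronglyMeasurable]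
  have hmr : Measurable fun ω : ZSeq Bool => G (restrictPast ω) := hG.comp measurable_restrictPast
  conv_lhs => rw [← hν.2.1]
  rw [integral_map measurable_shiftSeq.aemeasurable hmr.aestronglyMeasurable]
  have hi : ∀ a, Integrable (fun ω : ZSeq Bool => G (snocPast a (restrictPast ω))) ν := fun a =>
    integrable_of_bdd ((hm a).comp measurable_restrictPast) fun ω => hC _
  have hi' : ∀ a, Integrable (fun ω : ZSeq Bool => G (snocPast a (restrictPast ω)) *
      Set.indicator {ω : ZSeq Bool | ω 0 = a} (fun _ => (1 : ℝ)) ω) ν := fun a =>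
    (hi a).mul_bdd (c := 1) (measurable_const.indicator (measurableSet_symbol a)).aestronglyMeasurable
      (Eventually.of_forall fun ω => by
        by_cases h : ω 0 = a <;> simp [h])
  have hi'' : ∀ a, Integrable (fun ω : ZSeq Bool => P a (restrictPast ω) *
      G (snocPast a (restrictPast ω))) ν := fun a =>
    (hi a).bdd_mul (c := 1) ((hP.1 a).comp measurable_restrictPast).aestronglyMeasurable
      (Eventually.of_forall fun ω => by
        have := ((hP.2 (restrictPast ω)).2 a)
        rw [Real.norm_eq_abs, abs_of_nonneg this.1]
        exact this.2)
  have h1 : ∀ ω : ZSeq Bool, G (restrictPast (shiftSeq ω))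
      = G (snocPast true (restrictPast ω)) *
        Set.indicator {ω : ZSeq Bool | ω 0 = true} (fun _ => (1 : ℝ)) ω
      + G (snocPast false (restrictPast ω)) *
        Set.indicator {ω : ZSeq Bool | ω 0 = false} (fun _ => (1 : ℝ)) ω := by
    intro ω
    rw [restrictPast_shiftSeq]
    cases h : ω 0 <;> simp [h]
  simp only [h1]
  rw [integral_add (hi' true) (hi' false), integral_add (hi'' true) (hi'' false),
    integral_symbol_mul hν true (hm true) fun ω => hC _,
    integral_symbol_mul hν false (hm false) fun ω => hC _]
  simp only [mul_comm]

theorem abs_PiF_le (β : ℝ) (F : Finset ℤ) (ω : Past Bool) : |PiF β F ω| ≤ 1 := by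
  rw [abs_of_nonneg (PiF_nonneg _ _ _)]
  exact PiF_le_one _ _ _

theorem integral_PiF_shift {β : ℝ} (hβ : 0 ≤ β) {ν : Measure (ZSeq Bool)}
    (hν : IsGMeasure ν (gP β)) (F : Finset ℤ) (k : ℕ) :
    ∫ ω, PiF β (shiftF k F) ω ∂(ν.map restrictPast) = ∫ ω, PiF β F ω ∂(ν.map restrictPast) := by
  induction k with
  | zero => simp [shiftF_zero]
  | succ k ih =>
    rw [← ih, g_step hν (measurable_PiF β (shiftF k F)) (abs_PiF_le β _) (isGFunction_gP hβ)]
    refine integral_congr_ae (Eventually.of_forall fun ω => ?_)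
    have := PiF_step hβ (shiftF (k + 1 : ℕ) F) ω
    rw [shiftF_shiftF, show (-1 + (k + 1 : ℕ) : ℤ) = k by push_cast; ring] at this
    simpa [gP] using this

theorem integral_PiF {β : ℝ} (hβ : 0 ≤ β)
    (hQ : 1 < PiF β {0} allPlus + PiF β {0} allMinus ∨ EP β {0} ≤ 1 / 2) {ν : Measure (ZSeq Bool)}
    (hν : IsGMeasure ν (gP β)) (F : Finset ℤ) :
    ∫ ω, PiF β F ω ∂(ν.map restrictPast) = EP β F := by
  have := hν.1
  have : IsProbabilityMeasure (ν.map restrictPast) :=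
    Measure.isProbabilityMeasure_map measurable_restrictPast.aemeasurable
  have hi : ∀ F, Integrable (PiF β F) (ν.map restrictPast) := fun F =>
    integrable_of_bdd (measurable_PiF β F) (abs_PiF_le β F)
  refine le_antisymm (le_of_forall_pos_le_add fun ε hε => ?_)
    (le_of_forall_sub_le fun ε hε => ?_)
  · obtain ⟨r, hr⟩ := forget_plus hβ F hε
    rw [← integral_PiF_shift hβ hν F r]
    refine le_trans (integral_mono (hi _) (integrable_const _) fun ω =>
      (PiF_mono hβ _ (fun k => Bool.le_true _ : ω ≤ allPlus)).trans (hr r le_rfl)) ?_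
    simp
  · obtain ⟨r, hr⟩ := forget_minus hβ hQ F hε
    rw [← integral_PiF_shift hβ hν F r]
    refine le_trans ?_ (integral_mono (integrable_const _) (hi _) fun ω =>
      (hr r le_rfl).trans (PiF_mono hβ _ (fun k => Bool.false_le _ : allMinus ≤ ω)))
    simp

theorem integral_PiF_of_neg (β : ℝ) {ν : Measure (ZSeq Bool)} {F : Finset ℤ}
    (hF : ∀ i ∈ F, i < 0) : ∫ ω, PiF β F ω ∂(ν.map restrictPast) = ν.real (zPlus F) := by
  simp only [PiF_of_neg hF]
  rw [integral_indicator (measurableSet_pastPlus F), setIntegral_const, smul_eq_mul, mul_one,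
    map_measureReal_apply measurable_restrictPast (measurableSet_pastPlus F),
    restrictPast_preimage hF]

theorem zPlus_shift (F : Finset ℤ) : shiftSeq ⁻¹' zPlus F = zPlus (shiftF 1 F) := by
  ext ω
  simp only [zPlus, shiftSeq, Set.mem_preimage, Set.mem_ofPred_eq, mem_shiftF]
  exact ⟨fun h i hi => by simpa using h _ hi, fun h i hi => h _ (by simpa using hi)⟩

theorem real_zPlus_shift {ν : Measure (ZSeq Bool)} (hν : ν.map shiftSeq = ν) (F : Finset ℤ)
    (k : ℕ) : ν.real (zPlus (shiftF (-k) F)) = ν.real (zPlus F) := by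
  induction k with
  | zero => simp [shiftF_zero]
  | succ k ih =>
    rw [← ih]
    conv_lhs => rw [← hν]
    rw [map_measureReal_apply measurable_shiftSeq (measurableSet_zPlus _), zPlus_shift, shiftF_shiftF]
    congr 4
    push_cast
    ring

theorem exists_shift_neg (F : Finset ℤ) : ∃ k : ℕ, ∀ i ∈ shiftF (-k) F, i < 0 := by
  refine ⟨1 + F.sup Int.natAbs, fun i hi => ?_⟩
  have h1 := Finset.le_sup (f := Int.natAbs) (mem_shiftF.1 hi)
  push_cast at h1
  omega

theorem real_zPlus_eq {β : ℝ} (hβ : 0 ≤ β)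
    (hQ : 1 < PiF β {0} allPlus + PiF β {0} allMinus ∨ EP β {0} ≤ 1 / 2) {ν : Measure (ZSeq Bool)}
    (hν : IsGMeasure ν (gP β)) (F : Finset ℤ) : ν.real (zPlus F) = EP β F := by
  obtain ⟨k, hk⟩ := exists_shift_neg F
  rw [← real_zPlus_shift hν.2.1 F k, ← integral_PiF_of_neg β hk, integral_PiF hβ hQ hν,
    EP_shift hβ]

end Schonmann
end

noncomputable section
open scoped Classical
namespace Schonmann

/-! ### Almost sure continuity -/

theorem snocPast_splice (a : Bool) (ω : Past Bool) (k : ℕ) :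
    snocPast a (splice allMinus ω k) = splice allMinus (snocPast a ω) (k + 1) := by
  ext j
  cases j <;> simp [snocPast, splice, allMinus]

theorem snocPast_mono (ω : Past Bool) : snocPast false ω ≤ snocPast true ω := by
  intro k
  cases k <;> simp [snocPast]

theorem splice_allMinus_le (ω : Past Bool) (k : ℕ) : splice allMinus ω k ≤ ω := by
  intro j
  simp only [splice, allMinus]
  split_ifs <;> simp

theorem splice_mono {ω ω' : Past Bool} (h : ω ≤ ω') (k : ℕ) :
    splice allMinus ω k ≤ splice allMinus ω' k := by
  intro j
  simp only [splice]
  split_ifs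
  exacts [h j, le_rfl]

theorem continuous_PiF_splice (β : ℝ) (F : Finset ℤ) (σ : Past Bool) (k : ℕ) :
    Continuous fun ω => PiF β F (splice σ ω k) := by
  refine continuous_of_local (M := k) fun ω ω' h => ?_
  rw [show splice σ ω k = splice σ ω' k from ?_]
  ext j
  simp only [splice]
  split_ifs with hj
  exacts [h j hj ▸ rfl, rfl]

theorem integral_splice_step {β : ℝ} (hβ : 0 ≤ β) {ν : Measure (ZSeq Bool)}
    (hν : IsGMeasure ν (gP β)) (F : Finset ℤ) (k : ℕ) :
    ∫ ω, PiF β F (splice allMinus ω k) ∂(ν.map restrictPast)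
      ≤ ∫ ω, PiF β (shiftF (-1) F) (splice allMinus ω (k + 1)) ∂(ν.map restrictPast) := by
  have := hν.1
  have : IsProbabilityMeasure (ν.map (restrictPast (A := Bool))) :=
    Measure.isProbabilityMeasure_map measurable_restrictPast.aemeasurable
  have hG : ∀ F k, Measurable fun ω => PiF β F (splice allMinus ω k) := fun F k =>
    (continuous_PiF_splice β F _ k).measurable
  rw [g_step hν (hG (shiftF (-1) F) (k + 1)) (fun ω => abs_PiF_le β _ _) (isGFunction_gP hβ)]
  refine integral_mono (integrable_of_bdd (hG _ _) fun ω => abs_PiF_le β _ _)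
    (integrable_of_bdd (C := 2) (((measurable_gP β true).mul ((hG _ _).comp (measurable_snocPast _))).add
      ((measurable_gP β false).mul ((hG _ _).comp (measurable_snocPast _)))) fun ω => ?_) fun ω => ?_
  · refine (abs_add_le _ _).trans ?_
    rw [abs_mul, abs_mul]
    have h1 := abs_PiF_le β (shiftF (-1) F) (splice allMinus (snocPast true ω) (k + 1))
    have h2 := abs_PiF_le β (shiftF (-1) F) (splice allMinus (snocPast false ω) (k + 1))
    have h3 : ∀ a, |gP β a ω| ≤ 1 := fun a => by
      rw [abs_of_pos (gP_mem_Ioo hβ a ω).1]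
      exact (gP_mem_Ioo hβ a ω).2.le
    have h4 := mul_le_mul (h3 true) h1 (abs_nonneg _) zero_le_one
    have h5 := mul_le_mul (h3 false) h2 (abs_nonneg _) zero_le_one
    linarith
  · beta_reduce
    rw [PiF_step hβ F, snocPast_splice, snocPast_splice]
    have h1 := PiF_mono hβ {0} (splice_allMinus_le ω k)
    have h2 := PiF_mono hβ (shiftF (-1) F) (splice_mono (snocPast_mono ω) (k + 1))
    simp only [gP, if_true, Bool.false_eq_true, if_false]
    nlinarith

theorem le_integral_splice {β : ℝ} (hβ : 0 ≤ β) {ν : Measure (ZSeq Bool)}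
    (hν : IsGMeasure ν (gP β)) (k : ℕ) (F : Finset ℤ) :
    PiF β (shiftF k F) allMinus ≤ ∫ ω, PiF β F (splice allMinus ω k) ∂(ν.map restrictPast) := by
  have := hν.1
  have : IsProbabilityMeasure (ν.map (restrictPast (A := Bool))) :=
    Measure.isProbabilityMeasure_map measurable_restrictPast.aemeasurable
  induction k generalizing F with
  | zero =>
    have h : ∀ ω : Past Bool, splice allMinus ω 0 = allMinus := fun ω => by ext; simp [splice]
    simp [h, shiftF_zero]
  | succ k ih =>
    have h1 := integral_splice_step hβ hν (shiftF 1 F) k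
    rw [shiftF_shiftF, neg_add_cancel, shiftF_zero] at h1
    have h2 := ih (shiftF 1 F)
    rw [shiftF_shiftF] at h2
    exact (by exact_mod_cast h2 : PiF β (shiftF (k + 1 : ℕ) F) allMinus ≤ _).trans h1

theorem continuousAt_PiF {β : ℝ} (hβ : 0 ≤ β) {F : Finset ℤ} {ω : Past Bool}
    (h : (⨆ k, PiF β F (splice allMinus ω k)) = PiF β F ω) : ContinuousAt (PiF β F) ω := by
  refine tendsto_order.2 ⟨fun a ha => ?_, fun a ha => ?_⟩
  · rw [← h] at ha
    obtain ⟨k, hk⟩ := exists_lt_of_lt_ciSup ha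
    filter_upwards [(continuous_PiF_splice β F allMinus k).continuousAt.eventually_const_lt hk]
      with ω' h'
    exact h'.trans_le (PiF_mono hβ F (splice_allMinus_le ω' k))
  · obtain ⟨n, hn⟩ := exists_lt_of_ciInf_lt ha
    filter_upwards [(continuous_pin β n F).continuousAt.eventually_lt_const hn] with ω' h'
    exact (PiF_le_pin β F ω' n).trans_lt h'

theorem ae_continuousAt {β : ℝ} (hβ : 0 ≤ β)
    (hQ : 1 < PiF β {0} allPlus + PiF β {0} allMinus ∨ EP β {0} ≤ 1 / 2) {ν : Measure (ZSeq Bool)}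
    (hν : IsGMeasure ν (gP β)) :
    ∀ᵐ ω ∂(ν.map restrictPast), ∀ a, ContinuousAt (gP β a) ω := by
  have := hν.1
  have : IsProbabilityMeasure (ν.map (restrictPast (A := Bool))) :=
    Measure.isProbabilityMeasure_map measurable_restrictPast.aemeasurable
  set f : Past Bool → ℝ := fun ω => ⨆ k, PiF β {0} (splice allMinus ω k) with hf
  have hle : ∀ ω k, PiF β {0} (splice allMinus ω k) ≤ PiF β {0} ω := fun ω k =>
    PiF_mono hβ _ (splice_allMinus_le ω k)
  have hfle : ∀ ω, f ω ≤ PiF β {0} ω := fun ω => ciSup_le (hle ω)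
  have hbdd : ∀ ω, BddAbove (Set.range fun k => PiF β {0} (splice allMinus ω k)) := fun ω =>
    ⟨_, by rintro _ ⟨k, rfl⟩; exact hle ω k⟩
  have hfm : Measurable f := Measurable.iSup fun k => (continuous_PiF_splice β {0} _ k).measurable
  have hf0 : ∀ ω, 0 ≤ f ω := fun ω => (PiF_nonneg β _ _).trans (le_ciSup (hbdd ω) 0)
  have hfi : Integrable f (ν.map restrictPast) := integrable_of_bdd (C := 1) hfm fun ω => by
    rw [abs_of_nonneg (hf0 ω)]
    exact (hfle ω).trans (PiF_le_one _ _ _)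
  have hQi : Integrable (PiF β {0}) (ν.map restrictPast) :=
    integrable_of_bdd (measurable_PiF β {0}) (abs_PiF_le β {0})
  have h1 : EP β {0} ≤ ∫ ω, f ω ∂(ν.map restrictPast) := by
    refine le_of_forall_sub_le fun ε hε => ?_
    obtain ⟨r, hr⟩ := forget_minus hβ hQ {0} hε
    refine (hr r le_rfl).trans ((le_integral_splice hβ hν r {0}).trans ?_)
    exact integral_mono (integrable_of_bdd (continuous_PiF_splice β {0} _ r).measurable
      fun ω => abs_PiF_le β _ _) hfi fun ω => le_ciSup (hbdd ω) r
  have h2 := integral_PiF hβ hQ hν {0}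
  have h3 : ∫ ω, (PiF β {0} ω - f ω) ∂(ν.map restrictPast) = 0 := by
    refine le_antisymm ?_ (integral_nonneg fun ω => sub_nonneg.2 (hfle ω))
    rw [integral_sub hQi hfi]
    linarith
  rw [integral_eq_zero_iff_of_nonneg (fun ω => sub_nonneg.2 (hfle ω)) (hQi.sub hfi)] at h3
  filter_upwards [h3] with ω hω a
  have hc : ContinuousAt (PiF β {0}) ω := continuousAt_PiF hβ (sub_eq_zero.1 hω).symm
  cases a
  · exact continuousAt_const.sub hc
  · exact hc

end Schonmann
end

noncomputable section
open scoped Classical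
namespace Schonmann

/-! ### The Schonmann projection -/

theorem fill_mem_Cf (Λ : Finset (ℤ × ℤ)) (σ : Cfg2) (τ : ↥Λ → Bool) : fill Λ σ τ ∈ Cf Λ σ :=
  mem_Cf.2 fun x hx => by simp [fill, hx]

theorem fill_injective (Λ : Finset (ℤ × ℤ)) (σ : Cfg2) : Function.Injective (fill Λ σ) := by
  intro τ τ' h
  ext ⟨x, hx⟩
  simpa [fill, hx] using congrFun h x

theorem sum_fill (Λ : Finset (ℤ × ℤ)) (σ : Cfg2) (f : Cfg2 → ℝ) :
    ∑ τ : ↥Λ → Bool, f (fill Λ σ τ) = ∑ ω ∈ Cf Λ σ, f ω := by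
  rw [Cf, Finset.sum_image fun _ _ _ _ h => fill_injective Λ σ h]

theorem isingFV_apply (β : ℝ) (Λ : Finset (ℤ × ℤ)) (σ : Cfg2) {A : Set Cfg2}
    (hA : MeasurableSet A) : isingFV β 0 Λ σ A = ENNReal.ofReal (pr β Λ σ A) := by
  have hw : ∀ τ : ↥Λ → Bool, isingWeight β 0 Λ σ (fill Λ σ τ) = wt β Λ (fill Λ σ τ) := fun τ =>
    isingWeight_eq_wt β (mem_Cf.1 (fill_mem_Cf Λ σ τ))
  have h0 : ∀ ω, 0 ≤ wt β Λ ω := fun ω => (wt_pos β Λ ω).le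
  have h1 : ∑ τ : ↥Λ → Bool, ENNReal.ofReal (wt β Λ (fill Λ σ τ))
      = ENNReal.ofReal (∑ ω ∈ Cf Λ σ, wt β Λ ω) := by
    rw [← ENNReal.ofReal_sum_of_nonneg fun _ _ => h0 _, sum_fill Λ σ fun ω => wt β Λ ω]
  have h2 : ∑ τ : ↥Λ → Bool, ENNReal.ofReal (wt β Λ (fill Λ σ τ)) * A.indicator 1 (fill Λ σ τ)
      = ENNReal.ofReal (∑ ω ∈ Cf Λ σ, wt β Λ ω * ind A ω) := by
    rw [← sum_fill Λ σ fun ω => wt β Λ ω * ind A ω, ENNReal.ofReal_sum_of_nonneg]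
    · refine Finset.sum_congr rfl fun τ _ => ?_
      by_cases h : fill Λ σ τ ∈ A <;> simp [ind, h]
    · intro τ _
      unfold ind
      split_ifs
      · simpa using h0 _
      · simp
  have h3 : 0 < ∑ ω ∈ Cf Λ σ, wt β Λ ω :=
    Finset.sum_pos (fun ω _ => wt_pos β Λ ω) (Cf_nonempty Λ σ)
  simp only [isingFV, hw, Measure.smul_apply, Measure.finsetSum_apply, smul_eq_mul,
    Measure.dirac_apply' _ hA]
  rw [h1, h2, pr, ex, exs, ENNReal.ofReal_div_of_pos h3, ENNReal.div_eq_inv_mul]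

theorem measurable_lineProj : Measurable lineProj :=
  measurable_pi_lambda _ fun _ => measurable_pi_apply _

section
variable {β : ℝ} {μp : Measure Cfg2}

theorem isProbabilityMeasure_schonmann (hμp : IsPlusPhase β 0 μp) :
    IsProbabilityMeasure (schonmann μp) := by
  have := hμp.1
  exact Measure.isProbabilityMeasure_map measurable_lineProj.aemeasurable

/-- The past of the line configuration of a two-dimensional configuration. -/
def linePast (η : Cfg2) : Past Bool := restrictPast (lineProj η)

theorem tendsto_cyl (hμp : IsPlusPhase β 0 μp) (s : Finset (ℤ × ℤ)) (f : ℤ × ℤ → Bool) :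
    Tendsto (fun n => pr β (box n) (fun _ => true) {η | ∀ i ∈ s, η i = f i}) atTop
      (𝓝 (μp.real {η | ∀ i ∈ s, η i = f i})) := by
  have := hμp.1
  have hm : MeasurableSet {η : Cfg2 | ∀ i ∈ s, η i = f i} := by
    have : {η : Cfg2 | ∀ i ∈ s, η i = f i} = ⋂ i ∈ s, {η : Cfg2 | η i = f i} := by ext; simp
    rw [this]
    exact Finset.measurableSet_biInter _ fun i _ =>
      measurableSet_eq_fun (measurable_pi_apply i) measurable_const
  have h := (ENNReal.tendsto_toReal (measure_ne_top μp _)).comp (hμp.2 s f)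
  refine h.congr fun n => ?_
  rw [Function.comp_apply, isingFV_apply β _ _ hm, ENNReal.toReal_ofReal pr_nonneg]

theorem real_zPlus_schonmann (hβ : 0 ≤ β) (hμp : IsPlusPhase β 0 μp) (F : Finset ℤ) :
    (schonmann μp).real (zPlus F) = EP β F := by
  have h := tendsto_cyl hμp (F.image fun i => (i, 0)) fun _ => true
  have hs : {η : Cfg2 | ∀ i ∈ F.image fun i => (i, (0 : ℤ)), η i = true} = plusOn F := by
    ext
    simp [plusOn]
  rw [hs] at h
  rw [schonmann, map_measureReal_apply measurable_lineProj (measurableSet_zPlus F)]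
  exact tendsto_nhds_unique h (tendsto_EP hβ F)

theorem tendsto_local (hμp : IsPlusPhase β 0 μp) {g : Past Bool → ℝ} {M : ℕ}
    (hg : ∀ ω ω' : Past Bool, (∀ k < M, ω k = ω' k) → g ω = g ω') :
    Tendsto (fun n => ex β (box n) (fun _ => true) fun η => g (linePast η)) atTop
      (𝓝 (∫ ω, g ω ∂((schonmann μp).map restrictPast))) := by
  have := hμp.1
  let c : (Fin M → Bool) → Past Bool := fun τ k => if h : k < M then τ ⟨k, h⟩ else true
  let s : Finset (ℤ × ℤ) := (Finset.range M).image fun k : ℕ => (-((k : ℤ) + 1), 0)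
  let A : (Fin M → Bool) → Set Cfg2 := fun τ => {η | ∀ i ∈ s, η i = c τ (-i.1 - 1).toNat}
  have hA : ∀ τ η, η ∈ A τ ↔ ∀ k : Fin M, linePast η k = τ k := by
    intro τ η
    simp only [A, s, Finset.mem_image, Finset.mem_range, Set.mem_ofPred_eq, forall_exists_index,
      and_imp, forall_apply_eq_imp_iff₂, linePast, restrictPast, lineProj, c]
    constructor
    · intro h k
      have := h k k.2
      rw [show (-(-((k : ℕ) + 1 : ℤ)) - 1).toNat = k by omega, dif_pos k.2] at this
      exact this
    · intro h k hk
      rw [show (-(-((k : ℕ) + 1 : ℤ)) - 1).toNat = k by omega, dif_pos hk]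
      exact h ⟨k, hk⟩
  have hdec : ∀ η, g (linePast η) = ∑ τ, g (c τ) * ind (A τ) η := by
    intro η
    rw [Finset.sum_eq_single (fun k : Fin M => linePast η k)]
    · rw [ind, if_pos ((hA _ _).2 fun k => rfl), mul_one]
      refine hg _ _ fun k hk => ?_
      simp [c, hk]
    · intro τ _ hτ
      rw [ind, if_neg fun h => hτ (funext fun k => ((hA _ _).1 h k).symm), mul_zero]
    · simp
  have hmA : ∀ τ, MeasurableSet (A τ) := by
    intro τ
    have : A τ = ⋂ i ∈ s, {η : Cfg2 | η i = c τ (-i.1 - 1).toNat} := by ext; simp [A]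
    rw [this]
    exact Finset.measurableSet_biInter _ fun i _ =>
      measurableSet_eq_fun (measurable_pi_apply i) measurable_const
  have h1 : ∫ ω, g ω ∂((schonmann μp).map restrictPast) = ∑ τ, g (c τ) * μp.real (A τ) := by
    have hm : Measurable g := (continuous_of_local hg).measurable
    have hm' : Measurable fun ω : ZSeq Bool => g (restrictPast ω) := hm.comp measurable_restrictPast
    rw [integral_map measurable_restrictPast.aemeasurable hm.aestronglyMeasurable, schonmann,
      integral_map measurable_lineProj.aemeasurable hm'.aestronglyMeasurable]
    have hind : ∀ τ, (ind (A τ)) = (A τ).indicator fun _ => (1 : ℝ) := fun τ => by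
      ext η
      simp [ind, Set.indicator]
    have : (fun η => g (restrictPast (lineProj η))) = fun η => ∑ τ, g (c τ) * ind (A τ) η :=
      funext hdec
    rw [this, integral_finsetSum]
    · refine Finset.sum_congr rfl fun τ _ => ?_
      rw [integral_const_mul, hind, integral_indicator (hmA τ), setIntegral_const, smul_eq_mul,
        mul_one]
    · intro τ _
      rw [hind]
      exact ((integrable_const _).indicator (hmA τ)).const_mul _
  rw [h1]
  simp only [hdec, ex]
  simp only [exs_sum, exs_const_mul]
  exact tendsto_finsetSum _ fun τ _ => (tendsto_cyl hμp s _).const_mul _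

theorem pr_cut_eq_pin (n N : ℕ) {η : Cfg2} (hη : η ∈ Cf (box n) fun _ => true) (F : Finset ℤ)
    (hN : n = N) : pr β (cut (box N) (-1)) η (plusOn F) = pin β N F (linePast η) := by
  subst hN
  refine pr_congr_bc fun x hx => ?_
  simp only [bc, linePast, restrictPast, lineProj]
  obtain ⟨u, v⟩ := x
  by_cases h : v = 0 ∧ u < 0
  · obtain ⟨rfl, h⟩ := h
    simp only [h, and_self, if_true]
    congr 2
    omega
  · rw [if_neg h]
    refine mem_Cf.1 hη _ fun h' => hx (mem_cut.2 ⟨h', ?_⟩)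
    simp only
    omega

theorem pr_box_eq (n : ℕ) (F : Finset ℤ) : pr β (box n) (fun _ => true) (plusOn F)
    = ex β (box n) (fun _ => true) fun η => pin β n F (linePast η) := by
  rw [pr_tower (Finset.filter_subset _ _ : cut (box n) (-1) ⊆ box n)]
  exact ex_congr fun η hη => pr_cut_eq_pin n n hη F rfl

theorem linePast_mono {η η' : Cfg2} (h : η ≤ η') : linePast η ≤ linePast η' := fun _ => h _

theorem ex_pin_le (hβ : 0 ≤ β) {n N : ℕ} (h : N ≤ n) (F : Finset ℤ) :
    ex β (box n) (fun _ => true) (fun η => pin β N F (linePast η))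
      ≤ pr β (box N) (fun _ => true) (plusOn F) := by
  rw [ex_tower (box_mono h), ← ex_const (β := β) (Λ := box n) (σ := fun _ => true)
    (pr β (box N) (fun _ => true) (plusOn F))]
  refine ex_mono fun ω _ => ?_
  rw [pr_box_eq]
  refine exs_le_exs hβ (Cf_nonempty _ _) (Cf_nonempty _ _) (fun a ha b hb => ⟨?_, ?_⟩)
    (fun η η' h => pin_mono hβ N F (linePast_mono h)) fun η => pr_nonneg
  · refine mem_Cf.2 fun x hx => ?_
    simp [mem_Cf.1 ha x hx, mem_Cf.1 hb x hx]
  · refine mem_Cf.2 fun x hx => ?_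
    simp [mem_Cf.1 ha x hx, mem_Cf.1 hb x hx]

theorem le_ex_pin (hβ : 0 ≤ β) {n N : ℕ} (h : N ≤ n) (F : Finset ℤ) :
    EP β F ≤ ex β (box n) (fun _ => true) (fun η => pin β N F (linePast η)) := by
  refine (EP_le β F n).trans ?_
  rw [pr_box_eq]
  exact ex_mono fun ω _ => pin_anti hβ F _ h

theorem integral_PiF_schonmann (hβ : 0 ≤ β) (hμp : IsPlusPhase β 0 μp) (F : Finset ℤ) :
    ∫ ω, PiF β F ω ∂((schonmann μp).map restrictPast) = EP β F := by
  have := isProbabilityMeasure_schonmann hμp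
  have : IsProbabilityMeasure ((schonmann μp).map (restrictPast (A := Bool))) :=
    Measure.isProbabilityMeasure_map measurable_restrictPast.aemeasurable
  have hlim : ∀ N, Tendsto (fun n => ex β (box n) (fun _ => true) fun η => pin β N F (linePast η))
      atTop (𝓝 (∫ ω, pin β N F ω ∂((schonmann μp).map restrictPast))) := fun N => by
    obtain ⟨M, h1, h2⟩ := exists_bound N F
    exact tendsto_local hμp fun _ _ h => pin_congr h1 h2 h
  have h1 : ∀ N, ∫ ω, pin β N F ω ∂((schonmann μp).map restrictPast)
      ≤ pr β (box N) (fun _ => true) (plusOn F) := fun N =>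
    le_of_tendsto (hlim N) (eventually_atTop.2 ⟨N, fun n hn => ex_pin_le hβ hn F⟩)
  have h2 : ∀ N, EP β F ≤ ∫ ω, pin β N F ω ∂((schonmann μp).map restrictPast) := fun N =>
    ge_of_tendsto (hlim N) (eventually_atTop.2 ⟨N, fun n hn => le_ex_pin hβ hn F⟩)
  have h3 : Tendsto (fun N => ∫ ω, pin β N F ω ∂((schonmann μp).map restrictPast)) atTop
      (𝓝 (∫ ω, PiF β F ω ∂((schonmann μp).map restrictPast))) := by
    refine tendsto_integral_of_dominated_convergence (fun _ => 1)
      (fun N => (continuous_pin β N F).measurable.aestronglyMeasurable) (integrable_const _)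
      (fun N => Eventually.of_forall fun ω => ?_)
      (Eventually.of_forall fun ω => tendsto_pin hβ F ω)
    rw [Real.norm_eq_abs, pin, abs_of_nonneg pr_nonneg]
    exact pr_le_one
  exact tendsto_nhds_unique h3
    (tendsto_of_tendsto_of_tendsto_of_le_of_le tendsto_const_nhds (tendsto_EP hβ F) h2 h1)

theorem PiF_insert_zero (hβ : 0 ≤ β) {F : Finset ℤ} (hF : ∀ i ∈ F, i < 0) (ω : Past Bool) :
    PiF β (insert 0 F) ω = (pastPlus F).indicator (PiF β {0}) ω := by
  have key : ∀ n, pin β n (insert 0 F) ω = (pastPlus F).indicator (fun _ => (1 : ℝ)) ω * pin β n {0} ω := by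
    intro n
    rw [← pin_of_neg (β := β) hF n ω]
    have hin : ∀ η ∈ Cf (cut (box n) (-1)) (bc ω), η ∈ plusOn F ↔ ω ∈ pastPlus F := by
      intro η hη
      refine forall₂_congr fun i hi => ?_
      have := hF i hi
      rw [mem_Cf.1 hη _ fun h => (mem_cut.1 h).2 ⟨rfl, by simp only; omega⟩, bc, if_pos ⟨rfl, this⟩]
    have hu : plusOn (insert 0 F) = plusOn F ∩ plusOn {0} := by
      ext η
      simp [plusOn, and_comm]
    rw [pin_of_neg hF, pin, hu]
    by_cases h : ω ∈ pastPlus F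
    · rw [Set.indicator_of_mem h, one_mul, pin]
      exact pr_congr fun η hη => by simp [hin η hη, h]
    · rw [Set.indicator_of_notMem h, zero_mul, ← pr_empty]
      exact pr_congr fun η hη => by simp [hin η hη, h]
  have h1 := tendsto_pin hβ (insert 0 F) ω
  simp only [key] at h1
  rw [tendsto_nhds_unique h1 ((tendsto_pin hβ {0} ω).const_mul _)]
  by_cases h : ω ∈ pastPlus F <;> simp [h]

theorem map_shiftSeq_schonmann (hβ : 0 ≤ β) (hμp : IsPlusPhase β 0 μp) :
    (schonmann μp).map shiftSeq = schonmann μp := by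
  have := isProbabilityMeasure_schonmann hμp
  have : IsProbabilityMeasure ((schonmann μp).map (shiftSeq (A := Bool))) :=
    Measure.isProbabilityMeasure_map measurable_shiftSeq.aemeasurable
  refine ext_zPlus fun F => ?_
  rw [← measureReal_eq_measureReal_iff,
    map_measureReal_apply measurable_shiftSeq (measurableSet_zPlus F), zPlus_shift,
    real_zPlus_schonmann hβ hμp, real_zPlus_schonmann hβ hμp, EP_shift hβ]

theorem setIntegral_PiF_schonmann (hβ : 0 ≤ β) (hμp : IsPlusPhase β 0 μp) {B : Set (Past Bool)}
    (hB : MeasurableSet B) : ∫ ω in restrictPast ⁻¹' B, PiF β {0} (restrictPast ω) ∂(schonmann μp)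
      = (schonmann μp).real (restrictPast ⁻¹' B ∩ {ω | ω 0 = true}) := by
  have := isProbabilityMeasure_schonmann hμp
  have hQ : Measurable fun ω : ZSeq Bool => PiF β {0} (restrictPast ω) :=
    (measurable_PiF β {0}).comp measurable_restrictPast
  have hQi : Integrable (fun ω : ZSeq Bool => PiF β {0} (restrictPast ω)) (schonmann μp) :=
    integrable_of_bdd hQ fun ω => abs_PiF_le β _ _
  have huniv : pastPlus ∅ = Set.univ := by
    ext
    simp [pastPlus]
  have hbase : ∀ F : Finset ℤ, (∀ i ∈ F, i < 0) →
      ∫ ω in restrictPast ⁻¹' (pastPlus F), PiF β {0} (restrictPast ω) ∂(schonmann μp)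
      = (schonmann μp).real (restrictPast ⁻¹' (pastPlus F) ∩ {ω | ω 0 = true}) := by
    intro F hF
    have h1 := integral_PiF_schonmann hβ hμp (insert 0 F)
    rw [← real_zPlus_schonmann hβ hμp] at h1
    simp only [PiF_insert_zero hβ hF] at h1
    rw [integral_map measurable_restrictPast.aemeasurable
      ((measurable_PiF β {0}).indicator (measurableSet_pastPlus F)).aestronglyMeasurable] at h1
    rw [← integral_indicator (measurable_restrictPast (measurableSet_pastPlus F))]
    rw [show (restrictPast ⁻¹' pastPlus F ∩ {ω | ω 0 = true}) = zPlus (insert 0 F) from ?_]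
    · exact h1
    · rw [restrictPast_preimage hF]
      ext ω
      simp [zPlus, and_comm]
  induction B, hB using MeasurableSpace.induction_on_inter generateFrom_pastPlus
    isPiSystem_pastPlus with
  | empty => simp
  | basic t ht =>
    obtain ⟨F, hF, rfl⟩ := ht
    exact hbase F hF
  | compl t ht ih =>
    have h0 := hbase ∅ (by simp)
    rw [huniv, Set.preimage_univ, setIntegral_univ, Set.univ_inter] at h0
    have h1 := integral_add_compl (measurable_restrictPast ht) hQi
    have h2 := measureReal_inter_add_sdiff (μ := schonmann μp) (s := {ω : ZSeq Bool | ω 0 = true})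
      (measurable_restrictPast ht)
    rw [Set.preimage_compl]
    rw [Set.sdiff_eq, Set.inter_comm, Set.inter_comm {ω : ZSeq Bool | ω 0 = true}] at h2
    linarith
  | iUnion f hd hf ih =>
    rw [Set.preimage_iUnion, Set.iUnion_inter,
      integral_iUnion (fun i => measurable_restrictPast (hf i))
        (fun i j h => (hd h).preimage _) hQi.integrableOn, measureReal_def,
      measure_iUnion (fun i j h => ((hd h).preimage _).mono Set.inter_subset_left
        Set.inter_subset_left) fun i => (measurable_restrictPast (hf i)).inter
          (measurableSet_symbol true), ENNReal.tsum_toReal_eq fun i => measure_ne_top _ _]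
    exact tsum_congr ih

theorem isGMeasure_schonmann (hβ : 0 ≤ β) (hμp : IsPlusPhase β 0 μp) :
    IsGMeasure (schonmann μp) (gP β) := by
  have := isProbabilityMeasure_schonmann hμp
  refine ⟨this, map_shiftSeq_schonmann hβ hμp, fun a => ?_⟩
  have hm : Measurable fun ω : ZSeq Bool => gP β a (restrictPast ω) :=
    (measurable_gP β a).comp measurable_restrictPast
  have hb : ∀ ω : ZSeq Bool, |gP β a (restrictPast ω)| ≤ 1 := fun ω => by
    rw [abs_of_pos (gP_mem_Ioo hβ a _).1]
    exact (gP_mem_Ioo hβ a _).2.le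
  refine ae_eq_condExp_of_forall_setIntegral_eq pastSigma_le
    ((integrable_const _).indicator (measurableSet_symbol a))
    (fun s _ _ => (integrable_of_bdd hm hb).integrableOn) (fun s hs _ => ?_)
    ((measurable_gP β a).comp measurable_restrictPast_pastSigma).aestronglyMeasurable
  obtain ⟨B, hB, rfl⟩ := hs
  have h1 := setIntegral_PiF_schonmann hβ hμp hB
  have h2 : ∀ a : Bool, ∫ ω in restrictPast ⁻¹' B, {ω : ZSeq Bool | ω 0 = a}.indicator
      (fun _ => (1 : ℝ)) ω ∂(schonmann μp)
      = (schonmann μp).real (restrictPast ⁻¹' B ∩ {ω | ω 0 = a}) := fun a => by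
    rw [setIntegral_indicator (measurableSet_symbol a), setIntegral_const, smul_eq_mul, mul_one]
  rw [h2]
  cases a
  · have h3 := measureReal_inter_add_sdiff (μ := schonmann μp) (s := restrictPast ⁻¹' B)
      (measurableSet_symbol true)
    have h4 : (restrictPast ⁻¹' B \ {ω : ZSeq Bool | ω 0 = true})
        = restrictPast ⁻¹' B ∩ {ω | ω 0 = false} := by
      ext ω
      simp
    rw [h4] at h3
    have h5 : ∫ ω in restrictPast ⁻¹' B, (1 - PiF β {0} (restrictPast ω)) ∂(schonmann μp)
        = (schonmann μp).real (restrictPast ⁻¹' B)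
          - ∫ ω in restrictPast ⁻¹' B, PiF β {0} (restrictPast ω) ∂(schonmann μp) := by
      have hmQ : Measurable fun ω : ZSeq Bool => PiF β {0} (restrictPast ω) :=
        (measurable_PiF β {0}).comp measurable_restrictPast
      rw [integral_sub (integrable_const _) (integrable_of_bdd hmQ fun ω => abs_PiF_le β _ _),
        setIntegral_const, smul_eq_mul, mul_one]
    exact h5.trans (by linarith)
  · exact h1

theorem almost_regular (hβ : 0 ≤ β)
    (hQ : 1 < PiF β {0} allPlus + PiF β {0} allMinus ∨ EP β {0} ≤ 1 / 2)
    (hμp : IsPlusPhase β 0 μp) :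
    ∃ P : Bool → Past Bool → ℝ,
      IsGFunction P ∧ (∀ a ω, P a ω ∈ Set.Ioo (0 : ℝ) 1) ∧
      IsGMeasure (schonmann μp) P ∧
      (∀ ν : Measure (ZSeq Bool), IsGMeasure ν P → ν = schonmann μp) ∧
      (∀ᵐ ω ∂((schonmann μp).map restrictPast), ∀ a, ContinuousAt (P a) ω) := by
  have hg := isGMeasure_schonmann hβ hμp
  refine ⟨gP β, isGFunction_gP hβ, gP_mem_Ioo hβ, hg, fun ν hν => ?_, ae_continuousAt hβ hQ hg⟩
  have := hν.1
  have := hg.1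
  refine ext_zPlus fun F => ?_
  rw [← measureReal_eq_measureReal_iff, real_zPlus_eq hβ hQ hν, real_zPlus_eq hβ hQ hg]

end

end Schonmann
end

noncomputable section
open scoped Classical
namespace Schonmann

/-! ### Fermionic operators on column states -/

/-- States of a column with `M` interior sites and two wall sites. -/
abbrev St (M : ℕ) := Fin (M + 2) → Bool

section
variable {M : ℕ}

/-- The spin at height `j` of a column state. -/
def sp (τ : St M) (j : ℕ) : ℝ := if h : j < M + 2 then sval (τ ⟨j, h⟩) else 1

/-- Flip all spins at height at most `k`. -/
def flipTo (k : ℕ) (τ : St M) : St M := fun j => if (j : ℕ) ≤ k then !τ j else τ j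

theorem sval_mul_self (b : Bool) : sval b * sval b = 1 := by cases b <;> simp [sval]

theorem sp_mul_self (τ : St M) (j : ℕ) : sp τ j * sp τ j = 1 := by
  unfold sp
  split_ifs
  exacts [sval_mul_self _, mul_one 1]

theorem sp_eq (τ : St M) (j : ℕ) : sp τ j = 1 ∨ sp τ j = -1 :=
  mul_self_eq_one_iff.1 (sp_mul_self τ j)

theorem flipTo_flipTo (k : ℕ) (τ : St M) : flipTo k (flipTo k τ) = τ := by
  ext j
  simp only [flipTo]
  split_ifs <;> simp

theorem flipTo_comm (k l : ℕ) (τ : St M) : flipTo k (flipTo l τ) = flipTo l (flipTo k τ) := by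
  ext j
  simp only [flipTo]
  split_ifs <;> rfl

/-- Flipping as an involution. -/
def flipEquiv (k : ℕ) : St M ≃ St M := ⟨flipTo k, flipTo k, flipTo_flipTo k, flipTo_flipTo k⟩

theorem sp_flipTo_le {k j : ℕ} (hk : k ≤ M) (h : j ≤ k) (τ : St M) :
    sp (flipTo k τ) j = -sp τ j := by
  have h1 : j < M + 2 := by omega
  simp only [sp, flipTo, h1, h, dif_pos, if_true, sval_not]

theorem sp_flipTo_lt {k j : ℕ} (h : k < j) (τ : St M) : sp (flipTo k τ) j = sp τ j := by
  unfold sp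
  split_ifs with h1
  · simp only [flipTo, if_neg (not_le.2 h)]
  · rfl

/-- Inner product of functions of column states. -/
def ip (φ χ : St M → ℝ) : ℝ := ∑ τ, φ τ * χ τ

/-- The fermionic operator with coefficients `a`, `b`. -/
def psi (a b : ℕ → ℝ) (φ : St M → ℝ) (τ : St M) : ℝ :=
  ∑ k ∈ Finset.range (M + 1), (a k * sp τ (k + 1) - b k * sp τ k) * φ (flipTo k τ)

theorem ip_psi (a b : ℕ → ℝ) (φ χ : St M → ℝ) : ip (psi a b φ) χ = ip φ (psi a (-b) χ) := by
  simp only [ip, psi, Finset.sum_mul, Finset.mul_sum]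
  rw [Finset.sum_comm]
  conv_rhs => rw [Finset.sum_comm]
  refine Finset.sum_congr rfl fun k hk => ?_
  have hk' : k ≤ M := by
    rw [Finset.mem_range] at hk
    omega
  rw [← Equiv.sum_comp (flipEquiv k)]
  refine Finset.sum_congr rfl fun τ _ => ?_
  simp only [flipEquiv, Equiv.coe_fn_mk, flipTo_flipTo, sp_flipTo_le hk' le_rfl,
    sp_flipTo_lt (Nat.lt_succ_self k), Pi.neg_apply]
  ring

theorem psi_anticomm (a b : ℕ → ℝ) (φ : St M → ℝ) (τ : St M) :
    psi a b (psi a (-b) φ) τ + psi a (-b) (psi a b φ) τ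
      = 2 * (∑ k ∈ Finset.range (M + 1), (a k ^ 2 + b k ^ 2)) * φ τ := by
  simp only [psi, Finset.mul_sum]
  conv_lhs =>
    congr
    · skip
    · rw [Finset.sum_comm]
  rw [← Finset.sum_add_distrib, Finset.sum_mul]
  refine Finset.sum_congr rfl fun k hk => ?_
  rw [← Finset.sum_add_distrib, Finset.sum_eq_single_of_mem k hk]
  · have hk' : k ≤ M := by
      rw [Finset.mem_range] at hk
      omega
    rw [flipTo_flipTo, sp_flipTo_le hk' le_rfl, sp_flipTo_lt (Nat.lt_succ_self k), Pi.neg_apply]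
    have h1 := sp_mul_self τ k
    have h2 := sp_mul_self τ (k + 1)
    linear_combination (2 * a k ^ 2 * φ τ) * h2 + (2 * b k ^ 2 * φ τ) * h1
  · intro l hl hlk
    rw [Finset.mem_range] at hk hl
    simp only [Pi.neg_apply]
    rw [flipTo_comm k l]
    rcases lt_or_gt_of_ne hlk with h | h
    · rw [sp_flipTo_le (by omega) (show l + 1 ≤ k from h), sp_flipTo_le (by omega) h.le,
        sp_flipTo_lt (show l < k + 1 by omega), sp_flipTo_lt h]
      ring
    · rw [sp_flipTo_le (by omega) (show k + 1 ≤ l from h), sp_flipTo_le (by omega) h.le,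
        sp_flipTo_lt (show k < l + 1 by omega), sp_flipTo_lt h]
      ring

/-- Squared norm of a coefficient pair. -/
def nf (M : ℕ) (a b : ℕ → ℝ) : ℝ := ∑ k ∈ Finset.range (M + 1), (a k ^ 2 + b k ^ 2)

theorem ip_add_right (φ χ χ' : St M → ℝ) : ip φ (fun τ => χ τ + χ' τ) = ip φ χ + ip φ χ' := by
  simp only [ip, mul_add, Finset.sum_add_distrib]

theorem ip_psi_psi_add (a b : ℕ → ℝ) (φ χ : St M → ℝ) :
    ip (psi a b φ) (psi a b χ) + ip (psi a (-b) φ) (psi a (-b) χ) = 2 * nf M a b * ip φ χ := by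
  rw [ip_psi, ip_psi, neg_neg, ← ip_add_right]
  simp only [add_comm (psi a (-b) (psi a b χ) _), psi_anticomm]
  simp only [ip, nf, Finset.mul_sum]
  refine Finset.sum_congr rfl fun τ _ => ?_
  rw [← Finset.mul_sum]
  ring

theorem ip_self_nonneg (φ : St M → ℝ) : 0 ≤ ip φ φ :=
  Finset.sum_nonneg fun _ _ => mul_self_nonneg _

theorem ip_psi_self_le (a b : ℕ → ℝ) (φ : St M → ℝ) :
    ip (psi a b φ) (psi a b φ) ≤ 2 * nf M a b * ip φ φ := by
  have := ip_self_nonneg (psi a (-b) φ)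
  rw [← ip_psi_psi_add]
  linarith

/-- Vertical interaction in a column. -/
def vert (τ : St M) : ℝ := ∑ k ∈ Finset.range (M + 1), sp τ k * sp τ (k + 1)

theorem vert_flipTo {k : ℕ} (hk : k ≤ M) (τ : St M) :
    vert (flipTo k τ) = vert τ - 2 * (sp τ k * sp τ (k + 1)) := by
  rw [eq_sub_iff_add_eq, vert, vert,
    ← Finset.sum_erase_add _ _ (show k ∈ Finset.range (M + 1) by simp; omega),
    ← Finset.sum_erase_add _ (fun k => sp τ k * sp τ (k + 1))
      (show k ∈ Finset.range (M + 1) by simp; omega),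
    sp_flipTo_le hk le_rfl, sp_flipTo_lt (Nat.lt_succ_self k)]
  rw [Finset.sum_congr rfl (g := fun k => sp τ k * sp τ (k + 1))]
  · ring
  · intro l hl
    rcases lt_or_gt_of_ne (Finset.ne_of_mem_erase hl) with h | h
    · rw [sp_flipTo_le hk h.le, sp_flipTo_le hk h, neg_mul_neg]
    · rw [sp_flipTo_lt h, sp_flipTo_lt (by omega)]

theorem exp_mul_sign (t : ℝ) {s : ℝ} (hs : s = 1 ∨ s = -1) :
    Real.exp (t * s) = Real.cosh t + Real.sinh t * s := by
  rcases hs with rfl | rfl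
  · rw [mul_one, mul_one, Real.cosh_add_sinh]
  · rw [mul_neg_one, mul_neg_one, ← sub_eq_add_neg, Real.cosh_sub_sinh]

theorem sp_mul_eq (τ : St M) (j k : ℕ) : sp τ j * sp τ k = 1 ∨ sp τ j * sp τ k = -1 := by
  rcases sp_eq τ j with h | h <;> rcases sp_eq τ k with h' | h' <;> simp [h, h']

/-- Multiplication by the vertical Boltzmann weight at inverse temperature `t`. -/
def Dop (t : ℝ) (φ : St M → ℝ) (τ : St M) : ℝ := Real.exp (t * vert τ) * φ τ

theorem Dop_psi (t : ℝ) (a b : ℕ → ℝ) (φ : St M → ℝ) :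
    Dop t (psi a b φ) = psi (fun k => Real.cosh (2 * t) * a k - Real.sinh (2 * t) * b k)
      (fun k => Real.cosh (2 * t) * b k - Real.sinh (2 * t) * a k) (Dop t φ) := by
  ext τ
  simp only [Dop, psi, Finset.mul_sum]
  refine Finset.sum_congr rfl fun k hk => ?_
  have hk' : k ≤ M := by
    rw [Finset.mem_range] at hk
    omega
  have h1 : Real.exp (t * vert τ) = Real.exp (t * vert (flipTo k τ)) *
      (Real.cosh (2 * t) + Real.sinh (2 * t) * (sp τ k * sp τ (k + 1))) := by
    rw [← exp_mul_sign _ (sp_mul_eq τ k (k + 1)), ← Real.exp_add, vert_flipTo hk']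
    congr 1
    ring
  rw [h1]
  have h2 := sp_mul_self τ k
  have h3 := sp_mul_self τ (k + 1)
  linear_combination (Real.exp (t * vert (flipTo k τ)) * φ (flipTo k τ) * Real.sinh (2 * t)) *
    (a k * sp τ k * h3 - b k * sp τ (k + 1) * h2)

theorem ip_Dop (t : ℝ) (φ χ : St M → ℝ) : ip (Dop t φ) χ = ip φ (Dop t χ) :=
  Finset.sum_congr rfl fun τ _ => by simp only [Dop]; ring

theorem Dop_Dop (s t : ℝ) (φ : St M → ℝ) : Dop s (Dop t φ) = Dop (s + t) φ := by
  ext τ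
  simp only [Dop]
  rw [← mul_assoc, ← Real.exp_add, add_mul]

/-- Two column states have the same walls. -/
def sameWalls (τ τ' : St M) : Prop := sp τ 0 = sp τ' 0 ∧ sp τ (M + 1) = sp τ' (M + 1)

/-- Horizontal interaction of adjacent columns. -/
def horiz (τ τ' : St M) : ℝ := ∑ j ∈ Finset.range M, sp τ (j + 1) * sp τ' (j + 1)

/-- Horizontal transfer kernel. -/
def Kw (β : ℝ) (τ τ' : St M) : ℝ := if sameWalls τ τ' then Real.exp (β * horiz τ τ') else 0

/-- Horizontal transfer operator. -/
def Kop (β : ℝ) (φ : St M → ℝ) (τ : St M) : ℝ := ∑ τ', Kw β τ τ' * φ τ'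

theorem Kw_comm (β : ℝ) (τ τ' : St M) : Kw β τ τ' = Kw β τ' τ := by
  have h1 : sameWalls τ τ' ↔ sameWalls τ' τ := by
    simp only [sameWalls]
    exact and_congr eq_comm eq_comm
  have h2 : horiz τ τ' = horiz τ' τ := Finset.sum_congr rfl fun _ _ => mul_comm _ _
  simp only [Kw, h1, h2]

theorem ip_Kop (β : ℝ) (φ χ : St M → ℝ) : ip (Kop β φ) χ = ip φ (Kop β χ) := by
  simp only [ip, Kop, Finset.sum_mul, Finset.mul_sum]
  rw [Finset.sum_comm]
  refine Finset.sum_congr rfl fun τ _ => Finset.sum_congr rfl fun τ' _ => ?_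
  rw [Kw_comm]
  ring

theorem Kw_flipTo {k : ℕ} (hk : k ≤ M) (β : ℝ) (τ τ' : St M) :
    Kw β τ (flipTo k τ') = Kw β (flipTo k τ) τ' := by
  have h1 : sameWalls τ (flipTo k τ') ↔ sameWalls (flipTo k τ) τ' := by
    simp only [sameWalls, sp_flipTo_le hk (Nat.zero_le k), sp_flipTo_lt (show k < M + 1 by omega),
      neg_eq_iff_eq_neg]
  have h2 : horiz τ (flipTo k τ') = horiz (flipTo k τ) τ' := by
    refine Finset.sum_congr rfl fun j _ => ?_
    rcases le_or_gt (j + 1) k with h | h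
    · rw [sp_flipTo_le hk h, sp_flipTo_le hk h]
      ring
    · rw [sp_flipTo_lt h, sp_flipTo_lt h]
  simp only [Kw, h1, h2]

theorem Kw_flipTo_succ {k : ℕ} (hk : k < M) (β : ℝ) (τ τ' : St M) :
    Kw β (flipTo k τ) τ' = Kw β (flipTo (k + 1) τ) τ' *
      Real.exp ((2 * β) * (sp τ (k + 1) * sp τ' (k + 1))) := by
  have h1 : sameWalls (flipTo k τ) τ' ↔ sameWalls (flipTo (k + 1) τ) τ' := by
    simp only [sameWalls, sp_flipTo_le hk.le (Nat.zero_le k),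
      sp_flipTo_le (show k + 1 ≤ M from hk) (Nat.zero_le _),
      sp_flipTo_lt (show k < M + 1 by omega), sp_flipTo_lt (show k + 1 < M + 1 by omega)]
  have h2 : horiz (flipTo k τ) τ' = horiz (flipTo (k + 1) τ) τ' +
      2 * (sp τ (k + 1) * sp τ' (k + 1)) := by
    rw [horiz, horiz, ← Finset.sum_erase_add _ _ (Finset.mem_range.2 hk),
      ← Finset.sum_erase_add _ (fun j => sp (flipTo (k + 1) τ) (j + 1) * sp τ' (j + 1))
      (Finset.mem_range.2 hk), sp_flipTo_lt (Nat.lt_succ_self k), sp_flipTo_le hk le_rfl,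
      Finset.sum_congr rfl (g := fun j => sp (flipTo (k + 1) τ) (j + 1) * sp τ' (j + 1))]
    · ring
    · intro j hj
      rcases lt_or_gt_of_ne (Finset.ne_of_mem_erase hj) with h | h
      · rw [sp_flipTo_le hk.le h, sp_flipTo_le (show k + 1 ≤ M from hk) (by omega)]
      · rw [sp_flipTo_lt (by omega), sp_flipTo_lt (by omega)]
  simp only [Kw, h1, h2]
  split_ifs
  · rw [← Real.exp_add]
    congr 1
    ring
  · rw [zero_mul]

/-- Action of the horizontal transfer operator on the `a` coefficients. -/
def tra (M : ℕ) (β : ℝ) (a b : ℕ → ℝ) (k : ℕ) : ℝ :=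
  if k < M then (Real.cosh (2 * β) * a k + b (k + 1)) / Real.sinh (2 * β) else a k

/-- Action of the horizontal transfer operator on the `b` coefficients. -/
def trb (β : ℝ) (a b : ℕ → ℝ) (k : ℕ) : ℝ :=
  if k = 0 then b k else (Real.cosh (2 * β) * b k + a (k - 1)) / Real.sinh (2 * β)

theorem Kop_psi {β : ℝ} (hβ : 0 < β) (a b : ℕ → ℝ) (φ : St M → ℝ) :
    Kop β (psi a b φ) = psi (tra M β a b) (trb β a b) (Kop β φ) := by
  have hs : Real.sinh (2 * β) ≠ 0 := (Real.sinh_pos_iff.2 (by linarith)).ne'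
  ext τ
  have h1 : Kop β (psi a b φ) τ = ∑ τ', ∑ k ∈ Finset.range (M + 1),
      ((a k * sp τ' (k + 1) + b k * sp τ' k) * Kw β (flipTo k τ) τ') * φ τ' := by
    simp only [Kop, psi, Finset.mul_sum]
    rw [Finset.sum_comm]
    conv_rhs => rw [Finset.sum_comm]
    refine Finset.sum_congr rfl fun k hk => ?_
    have hk' : k ≤ M := by
      rw [Finset.mem_range] at hk
      omega
    rw [← Equiv.sum_comp (flipEquiv k)]
    refine Finset.sum_congr rfl fun τ' _ => ?_
    simp only [flipEquiv, Equiv.coe_fn_mk, flipTo_flipTo, sp_flipTo_le hk' le_rfl,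
      sp_flipTo_lt (Nat.lt_succ_self k), Kw_flipTo hk']
    ring
  have h2 : psi (tra M β a b) (trb β a b) (Kop β φ) τ = ∑ τ', ∑ k ∈ Finset.range (M + 1),
      ((tra M β a b k * sp τ (k + 1) - trb β a b k * sp τ k) * Kw β (flipTo k τ) τ') * φ τ' := by
    simp only [Kop, psi, Finset.mul_sum]
    rw [Finset.sum_comm]
    exact Finset.sum_congr rfl fun τ' _ => Finset.sum_congr rfl fun k _ => by ring
  rw [h1, h2]
  refine Finset.sum_congr rfl fun τ' _ => ?_
  rw [← Finset.sum_mul, ← Finset.sum_mul]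
  congr 1
  simp only [add_mul, sub_mul, Finset.sum_add_distrib, Finset.sum_sub_distrib]
  rw [Finset.sum_range_succ, Finset.sum_range_succ' (fun k => b k * _ * _),
    Finset.sum_range_succ (fun k => tra M β a b k * _ * _),
    Finset.sum_range_succ' (fun k => trb β a b k * _ * _)]
  have h3 : ∑ k ∈ Finset.range M, a k * sp τ' (k + 1) * Kw β (flipTo k τ) τ' +
      ∑ k ∈ Finset.range M, b (k + 1) * sp τ' (k + 1) * Kw β (flipTo (k + 1) τ) τ'
      = ∑ k ∈ Finset.range M, tra M β a b k * sp τ (k + 1) * Kw β (flipTo k τ) τ' -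
      ∑ k ∈ Finset.range M, trb β a b (k + 1) * sp τ (k + 1) * Kw β (flipTo (k + 1) τ) τ' := by
    rw [← Finset.sum_add_distrib, ← Finset.sum_sub_distrib]
    refine Finset.sum_congr rfl fun k hk => ?_
    have hk := Finset.mem_range.1 hk
    have hss : sp τ (k + 1) * sp τ' (k + 1) = 1 ∨ sp τ (k + 1) * sp τ' (k + 1) = -1 := by
      rcases sp_eq τ (k + 1) with h | h <;> rcases sp_eq τ' (k + 1) with h' | h' <;> simp [h, h']
    rw [Kw_flipTo_succ hk, exp_mul_sign _ hss, tra, trb, if_pos hk, if_neg (Nat.succ_ne_zero k),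
      Nat.add_sub_cancel]
    have h4 := sp_mul_self τ (k + 1)
    have h5 := sp_mul_self τ' (k + 1)
    have h6 := Real.cosh_sq (2 * β)
    field_simp
    generalize Kw β (flipTo (k + 1) τ) τ' = w at *
    generalize sp τ (k + 1) = s at *
    generalize sp τ' (k + 1) = s' at *
    generalize Real.cosh (2 * β) = ch at *
    generalize Real.sinh (2 * β) = sh at *
    linear_combination (-(s' * w * sh * a k * ch) - s' * w * sh * b (k + 1)) * h4 + (w * sh ^ 2 * a k * s) * h5 - (w * a k * s) * h6
  have h7 : ∀ τ τ' : St M, sp τ 0 = -sp τ' 0 ∨ Kw β (flipTo 0 τ) τ' = 0 := by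
    intro τ τ'
    by_cases h : sameWalls (flipTo 0 τ) τ'
    · left
      rw [← h.1, sp_flipTo_le (Nat.zero_le M) le_rfl, neg_neg]
    · right
      rw [Kw, if_neg h]
  have h8 : sp τ (M + 1) = sp τ' (M + 1) ∨ Kw β (flipTo M τ) τ' = 0 := by
    by_cases h : sameWalls (flipTo M τ) τ'
    · left
      rw [← h.2, sp_flipTo_lt (Nat.lt_succ_self M)]
    · right
      rw [Kw, if_neg h]
  have h9 : a M * sp τ' (M + 1) * Kw β (flipTo M τ) τ'
      = tra M β a b M * sp τ (M + 1) * Kw β (flipTo M τ) τ' := by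
    rw [tra, if_neg (lt_irrefl M)]
    rcases h8 with h | h <;> simp [h]
  have h10 : b 0 * sp τ' 0 * Kw β (flipTo 0 τ) τ' = -(trb β a b 0 * sp τ 0 * Kw β (flipTo 0 τ) τ') := by
    rw [trb, if_pos rfl]
    rcases h7 τ τ' with h | h <;> simp [h]
  linarith

end

end Schonmann
end

noncomputable section
open scoped Classical
namespace Schonmann

/-! ### Transfer operators and rectangles -/

theorem sum_Cf_union {Λ₁ Λ₂ : Finset (ℤ × ℤ)} (h : Disjoint Λ₁ Λ₂) (σ : Cfg2) (F : Cfg2 → ℝ) :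
    ∑ ω ∈ Cf (Λ₁ ∪ Λ₂) σ, F ω = ∑ ω₁ ∈ Cf Λ₂ σ, ∑ ω ∈ Cf Λ₁ ω₁, F ω := by
  rw [Finset.sum_sigma']
  symm
  refine Finset.sum_bij' (fun p _ => p.2)
    (fun ω _ => ⟨fun x => if x ∈ Λ₂ then ω x else σ x, ω⟩) ?_ ?_ ?_ ?_ ?_
  · rintro ⟨ω₁, ω⟩ h1
    simp only [Finset.mem_sigma, mem_Cf] at h1 ⊢
    intro x hx
    rw [Finset.mem_union, not_or] at hx
    rw [h1.2 x hx.1, h1.1 x hx.2]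
  · intro ω hω
    simp only [Finset.mem_sigma, mem_Cf] at hω ⊢
    refine ⟨fun x hx => if_neg hx, fun x hx => ?_⟩
    by_cases hx2 : x ∈ Λ₂
    · rw [if_pos hx2]
    · rw [if_neg hx2]
      exact hω x (by simp [hx, hx2])
  · rintro ⟨ω₁, ω⟩ h1
    simp only [Finset.mem_sigma, mem_Cf] at h1
    simp only [Sigma.mk.injEq, heq_eq_eq, and_true]
    ext x
    by_cases hx2 : x ∈ Λ₂
    · rw [if_pos hx2, h1.2 x (fun hx => Finset.disjoint_left.1 h hx hx2)]
    · rw [if_neg hx2, h1.1 x hx2]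
  · intro ω _
    rfl
  · intro _ _
    rfl

section
variable {M : ℕ}

/-- The rectangle with `n` columns at abscissas `1, …, n` and `M` rows at ordinates
`o + 1, …, o + M`. -/
def rc (o : ℤ) (n M : ℕ) : Finset (ℤ × ℤ) := Finset.Icc (1 : ℤ) n ×ˢ Finset.Icc (o + 1) (o + M)

/-- The column at abscissa `n`. -/
def rcol (o : ℤ) (n M : ℕ) : Finset (ℤ × ℤ) := {(n : ℤ)} ×ˢ Finset.Icc (o + 1) (o + M)

theorem mem_rc {o : ℤ} {n : ℕ} {x : ℤ × ℤ} :
    x ∈ rc o n M ↔ (1 ≤ x.1 ∧ x.1 ≤ n) ∧ o + 1 ≤ x.2 ∧ x.2 ≤ o + M := by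
  simp [rc]

theorem mem_rcol {o : ℤ} {n : ℕ} {x : ℤ × ℤ} :
    x ∈ rcol o n M ↔ x.1 = n ∧ o + 1 ≤ x.2 ∧ x.2 ≤ o + M := by
  rw [rcol, Finset.mem_product, Finset.mem_singleton, Finset.mem_Icc]

theorem rc_succ (o : ℤ) (n : ℕ) : rc o (n + 1) M = rc o n M ∪ rcol o (n + 1) M := by
  ext x
  simp only [mem_rc, mem_rcol, Finset.mem_union]
  push_cast
  omega

theorem disjoint_rc_rcol (o : ℤ) (n : ℕ) : Disjoint (rc o n M) (rcol o (n + 1) M) := by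
  rw [Finset.disjoint_left]
  intro x
  simp only [mem_rc, mem_rcol]
  push_cast
  omega

/-- The state of a column of a configuration. -/
def colSt (M : ℕ) (o : ℤ) (i : ℕ) (ω : Cfg2) : St M := fun j => ω (i, o + (j : ℕ))

theorem sp_colSt {j : ℕ} (hj : j < M + 2) (o : ℤ) (i : ℕ) (ω : Cfg2) :
    sp (colSt M o i ω) j = sval (ω (i, o + j)) := by
  rw [sp, dif_pos hj, colSt]

theorem horiz_congr {τ₁ τ₂ τ₁' τ₂' : St M} (h₁ : ∀ j < M, sp τ₁ (j + 1) = sp τ₁' (j + 1))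
    (h₂ : ∀ j < M, sp τ₂ (j + 1) = sp τ₂' (j + 1)) : horiz τ₁ τ₂ = horiz τ₁' τ₂' :=
  Finset.sum_congr rfl fun j hj => by rw [h₁ j (Finset.mem_range.1 hj), h₂ j (Finset.mem_range.1 hj)]

theorem sval_injective : Function.Injective sval := by
  intro a b
  cases a <;> cases b <;> simp [sval] <;> norm_num

theorem st_ext {τ τ' : St M} (h : ∀ j < M + 2, sp τ j = sp τ' j) : τ = τ' := by
  ext1 j
  have := h j j.2
  simp only [sp, j.2, dif_pos] at this
  exact sval_injective this

theorem st_ext_walls {τ τ' : St M} (hw : sameWalls τ τ')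
    (h : ∀ j < M, sp τ (j + 1) = sp τ' (j + 1)) : τ = τ' := by
  refine st_ext fun j hj => ?_
  rcases Nat.eq_zero_or_pos j with rfl | hj0
  · exact hw.1
  · rcases Nat.lt_or_ge j (M + 1) with h1 | h1
    · have := h (j - 1) (by omega)
      rwa [Nat.sub_add_cancel hj0] at this
    · rw [show j = M + 1 by omega]
      exact hw.2

theorem sameWalls_symm {τ τ' : St M} (h : sameWalls τ τ') : sameWalls τ' τ := ⟨h.1.symm, h.2.symm⟩

theorem sameWalls_trans {τ τ' τ'' : St M} (h : sameWalls τ τ') (h' : sameWalls τ' τ'') :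
    sameWalls τ τ'' := ⟨h.1.trans h'.1, h.2.trans h'.2⟩

theorem sum_Cf_rcol (o : ℤ) (n : ℕ) (σ : Cfg2) (F : St M → ℝ) :
    ∑ ω ∈ Cf (rcol o n M) σ, F (colSt M o n ω)
      = ∑ τ, if sameWalls τ (colSt M o n σ) then F τ else 0 := by
  rw [← Finset.sum_filter]
  refine Finset.sum_bij' (fun ω _ => colSt M o n ω)
    (fun τ _ x => if hx : x ∈ rcol o n M then τ ⟨(x.2 - o).toNat, by rw [mem_rcol] at hx; omega⟩
      else σ x) ?_ ?_ ?_ ?_ ?_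
  · intro ω hω
    rw [mem_Cf] at hω
    refine Finset.mem_filter.2 ⟨Finset.mem_univ _, ?_⟩
    unfold sameWalls
    rw [sp_colSt (by omega), sp_colSt (by omega), sp_colSt (by omega), sp_colSt (by omega),
      hω _ (by simp [mem_rcol]), hω _ (by rw [mem_rcol]; push_cast; omega)]
    exact ⟨rfl, rfl⟩
  · intro τ _
    exact mem_Cf.2 fun x hx => by rw [dif_neg hx]
  · intro ω hω
    rw [mem_Cf] at hω
    ext x
    by_cases hx : x ∈ rcol o n M
    · rw [dif_pos hx, colSt]
      rw [mem_rcol] at hx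
      have h1 : ((n : ℤ), o + (((x.2 - o).toNat : ℕ) : ℤ)) = x := by
        ext
        · exact hx.1.symm
        · simp only
          omega
      simp only [h1]
    · rw [dif_neg hx, hω x hx]
  · intro τ hτ
    simp only [Finset.mem_filter, Finset.mem_univ, true_and] at hτ
    refine st_ext_walls (τ' := τ) ?_ ?_
    · refine sameWalls_trans ?_ (sameWalls_symm hτ)
      unfold sameWalls
      rw [sp_colSt (by omega), sp_colSt (by omega), sp_colSt (by omega), sp_colSt (by omega),
        dif_neg (by simp [mem_rcol]), dif_neg (by rw [mem_rcol]; push_cast; omega)]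
      exact ⟨rfl, rfl⟩
    · intro j hj
      rw [sp_colSt (by omega), dif_pos (by rw [mem_rcol]; push_cast; omega), sp, dif_pos (by omega)]
      congr 2
      ext
      simp
  · intro _ _
    rfl

/-- Product of interactions and column factors along a sequence of columns. -/
def pathW (β : ℝ) (M : ℕ) (o : ℤ) (f : ℕ → St M → ℝ) (n : ℕ) (ω : Cfg2) : ℝ :=
  Real.exp (β * horiz (colSt M o 0 ω) (colSt M o 1 ω)) * ∏ i ∈ Finset.range n,
    (f i (colSt M o (i + 1) ω) *
      Real.exp (β * horiz (colSt M o (i + 1) ω) (colSt M o (i + 2) ω)))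

/-- Iterated transfer operators with column factors. -/
def Gf (β : ℝ) (f : ℕ → St M → ℝ) (c : St M) : ℕ → St M → ℝ
  | 0 => fun τ => Kw β τ c
  | n + 1 => Kop β fun τ => f n τ * Gf β f c n τ

theorem sum_pathW (β : ℝ) (o : ℤ) (f : ℕ → St M → ℝ) (n : ℕ) (c τ : St M) (σ : Cfg2)
    (hτc : sameWalls τ c) (hc : ∀ j < M, sp c (j + 1) = sp (colSt M o 0 σ) (j + 1))
    (hτ : ∀ j < M, sp τ (j + 1) = sp (colSt M o (n + 1) σ) (j + 1))
    (hw : ∀ i, 1 ≤ i → i ≤ n → sameWalls (colSt M o i σ) c) :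
    ∑ ω ∈ Cf (rc o n M) σ, pathW β M o f n ω = Gf β f c n τ := by
  induction n generalizing τ σ with
  | zero =>
    have h0 : rc o 0 M = ∅ := by
      ext x
      simp only [mem_rc, Finset.notMem_empty, iff_false]
      push_cast
      omega
    have h1 : Cf (∅ : Finset (ℤ × ℤ)) σ = {σ} := by
      ext ω
      simp [mem_Cf, funext_iff]
    rw [h0, h1, Finset.sum_singleton, pathW, Finset.range_zero, Finset.prod_empty, mul_one]
    simp only [Gf, Kw, if_pos hτc]
    rw [horiz_congr (fun j hj => (hc j hj).symm) (fun j hj => (hτ j hj).symm)]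
    congr 2
    exact Finset.sum_congr rfl fun _ _ => mul_comm _ _
  | succ n ih =>
    rw [rc_succ, sum_Cf_union (disjoint_rc_rcol o n)]
    have h1 : ∀ ω₁ ∈ Cf (rcol o (n + 1) M) σ,
        ∑ ω ∈ Cf (rc o n M) ω₁, pathW β M o f (n + 1) ω
          = Real.exp (β * horiz τ (colSt M o (n + 1) ω₁)) *
            (f n (colSt M o (n + 1) ω₁) * Gf β f c n (colSt M o (n + 1) ω₁)) := by
      intro ω₁ hω₁
      rw [mem_Cf] at hω₁
      have hw' : ∀ i, 1 ≤ i → i ≤ n + 1 → sameWalls (colSt M o i ω₁) c := by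
        intro i hi hi'
        refine sameWalls_trans ?_ (hw i hi hi')
        unfold sameWalls
        rw [sp_colSt (by omega), sp_colSt (by omega), sp_colSt (by omega), sp_colSt (by omega),
          hω₁ _ (by simp [mem_rcol]), hω₁ _ (by rw [mem_rcol]; push_cast; omega)]
        exact ⟨rfl, rfl⟩
      rw [← ih (colSt M o (n + 1) ω₁) ω₁ (hw' _ (by omega) le_rfl) ?_ (fun _ _ => rfl)
        (fun i hi hi' => hw' i hi (by omega)), Finset.mul_sum, Finset.mul_sum]
      · refine Finset.sum_congr rfl fun ω hω => ?_
        rw [mem_Cf] at hω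
        have h2 : colSt M o (n + 1) ω = colSt M o (n + 1) ω₁ := by
          ext j
          exact hω _ (by rw [mem_rc]; push_cast; omega)
        have h3 : horiz (colSt M o (n + 1) ω) (colSt M o (n + 2) ω)
            = horiz τ (colSt M o (n + 1) ω₁) := by
          rw [h2]
          refine (Finset.sum_congr rfl fun j hj => ?_).trans
            (Finset.sum_congr rfl fun j _ => mul_comm _ _)
          have hj := Finset.mem_range.1 hj
          rw [hτ j hj, sp_colSt (j := j + 1) (i := n + 2) (by omega),
            sp_colSt (j := j + 1) (i := n + 1 + 1) (by omega),
            hω _ (by rw [mem_rc]; push_cast; omega), hω₁ _ (by rw [mem_rcol]; push_cast; omega)]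
        rw [pathW, pathW, Finset.prod_range_succ, h3, h2]
        ring
      · intro j hj
        rw [hc j hj, sp_colSt (by omega), sp_colSt (by omega), hω₁ _ (by rw [mem_rcol]; push_cast; omega)]
    rw [Finset.sum_congr rfl h1, sum_Cf_rcol o (n + 1) σ
      (fun τ' => Real.exp (β * horiz τ τ') * (f n τ' * Gf β f c n τ')), Gf, Kop]
    refine Finset.sum_congr rfl fun τ' _ => ?_
    have h2 : sameWalls τ' (colSt M o (n + 1) σ) ↔ sameWalls τ τ' := by
      have h3 := hw (n + 1) (by omega) le_rfl
      exact ⟨fun h => sameWalls_trans hτc (sameWalls_symm (sameWalls_trans h h3)),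
        fun h => sameWalls_trans (sameWalls_trans (sameWalls_symm h) hτc) (sameWalls_symm h3)⟩
    rw [Kw]
    simp only [h2]
    split_ifs
    · rfl
    · rw [zero_mul]

theorem energy_rc (hM : 1 ≤ M) (o : ℤ) {n : ℕ} (hn : 1 ≤ n) (ω : Cfg2) :
    energy (rc o n M) ω = ∑ i ∈ Finset.range (n + 1), horiz (colSt M o i ω) (colSt M o (i + 1) ω)
      + ∑ i ∈ Finset.range n, vert (colSt M o (i + 1) ω) := by
  have hp : pairs (rc o n M) =
      ((Finset.range (n + 1) ×ˢ Finset.range M).image fun p =>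
        (((p.1 : ℤ), o + 1 + (p.2 : ℤ)), ((p.1 : ℤ) + 1, o + 1 + (p.2 : ℤ)))) ∪
      ((Finset.range (n + 1) ×ˢ Finset.range M).image fun p =>
        (((p.1 : ℤ) + 1, o + 1 + (p.2 : ℤ)), ((p.1 : ℤ), o + 1 + (p.2 : ℤ)))) ∪
      ((Finset.range n ×ˢ Finset.range (M + 1)).image fun p =>
        (((p.1 : ℤ) + 1, o + (p.2 : ℤ)), ((p.1 : ℤ) + 1, o + (p.2 : ℤ) + 1))) ∪
      ((Finset.range n ×ˢ Finset.range (M + 1)).image fun p =>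
        (((p.1 : ℤ) + 1, o + (p.2 : ℤ) + 1), ((p.1 : ℤ) + 1, o + (p.2 : ℤ)))) := by
    ext ⟨⟨a, b⟩, c, d⟩
    simp only [mem_pairs, nbrs, mem_rc, Finset.mem_union, Finset.mem_image, Finset.mem_product,
      Finset.mem_range, Prod.exists, Prod.mk.injEq, Finset.mem_insert, Finset.mem_singleton]
    constructor
    · rintro ⟨(h | h | h | h), h'⟩
      · refine Or.inl (Or.inl (Or.inl ⟨a.toNat, (b - o - 1).toNat, ?_⟩))
        omega
      · refine Or.inl (Or.inl (Or.inr ⟨c.toNat, (b - o - 1).toNat, ?_⟩))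
        omega
      · refine Or.inl (Or.inr ⟨(a - 1).toNat, (b - o).toNat, ?_⟩)
        omega
      · refine Or.inr ⟨(a - 1).toNat, (d - o).toNat, ?_⟩
        omega
    · rintro (((⟨i, j, h⟩ | ⟨i, j, h⟩) | ⟨i, j, h⟩) | ⟨i, j, h⟩) <;> omega
  rw [energy, hp, Finset.sum_union, Finset.sum_union, Finset.sum_union, Finset.sum_image,
    Finset.sum_image, Finset.sum_image, Finset.sum_image, Finset.sum_product, Finset.sum_product,
    Finset.sum_product, Finset.sum_product]
  · have h1 : ∀ i ∈ Finset.range (n + 1), horiz (colSt M o i ω) (colSt M o (i + 1) ω) =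
        ∑ j ∈ Finset.range M, sval (ω ((i : ℤ), o + 1 + (j : ℤ))) *
          sval (ω ((i : ℤ) + 1, o + 1 + (j : ℤ))) := by
      intro i _
      refine Finset.sum_congr rfl fun j hj => ?_
      have hj := Finset.mem_range.1 hj
      rw [sp_colSt (by omega), sp_colSt (by omega)]
      push_cast
      rw [show o + ((j : ℤ) + 1) = o + 1 + j by ring]
    have h2 : ∀ i ∈ Finset.range n, vert (colSt M o (i + 1) ω) =
        ∑ j ∈ Finset.range (M + 1), sval (ω ((i : ℤ) + 1, o + (j : ℤ))) *
          sval (ω ((i : ℤ) + 1, o + (j : ℤ) + 1)) := by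
      intro i _
      refine Finset.sum_congr rfl fun j hj => ?_
      have hj := Finset.mem_range.1 hj
      rw [sp_colSt (by omega), sp_colSt (by omega)]
      push_cast
      rw [show o + ((j : ℤ) + 1) = o + j + 1 by ring]
    rw [Finset.sum_congr rfl h1, Finset.sum_congr rfl h2]
    simp only [mul_comm (sval (ω ((_ : ℤ) + 1, o + 1 + (_ : ℤ)))),
      mul_comm (sval (ω ((_ : ℤ) + 1, o + (_ : ℤ) + 1)))]
    ring
  all_goals first
    | (rintro ⟨i, j⟩ _ ⟨i', j'⟩ _ h
       simp only [Prod.mk.injEq] at h ⊢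
       omega)
    | (simp only [Finset.disjoint_union_left]
       refine ⟨⟨?_, ?_⟩, ?_⟩ <;>
       (rw [Finset.disjoint_left]
        rintro ⟨⟨a, b⟩, c, d⟩
        simp only [Finset.mem_image, Finset.mem_product, Finset.mem_range, Prod.exists,
          Prod.mk.injEq]
        rintro ⟨i', j', h⟩ ⟨i, j, h'⟩
        omega))
    | (simp only [Finset.disjoint_union_left]
       refine ⟨?_, ?_⟩ <;>
       (rw [Finset.disjoint_left]
        rintro ⟨⟨a, b⟩, c, d⟩
        simp only [Finset.mem_image, Finset.mem_product, Finset.mem_range, Prod.exists,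
          Prod.mk.injEq]
        rintro ⟨i', j', h⟩ ⟨i, j, h'⟩
        omega))
    | (rw [Finset.disjoint_left]
       rintro ⟨⟨a, b⟩, c, d⟩
       simp only [Finset.mem_image, Finset.mem_product, Finset.mem_range, Prod.exists,
         Prod.mk.injEq]
       rintro ⟨i', j', h⟩ ⟨i, j, h'⟩
       omega)

theorem wt_rc (hM : 1 ≤ M) (β : ℝ) (o : ℤ) {n : ℕ} (hn : 1 ≤ n) (ω : Cfg2) :
    wt β (rc o n M) ω = pathW β M o (fun _ τ => Real.exp (β * vert τ)) n ω := by
  rw [wt, energy_rc hM o hn, pathW, Finset.prod_mul_distrib, ← Real.exp_sum, ← Real.exp_sum,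
    ← Real.exp_add, ← Real.exp_add, Finset.sum_range_succ']
  congr 1
  rw [← Finset.mul_sum, ← Finset.mul_sum]
  ring

end

end Schonmann
end

noncomputable section
open scoped Classical
namespace Schonmann

/-! ### Perron–Frobenius eigenvectors -/

/-- The Perron–Frobenius theorem for positive matrices. -/
theorem exists_pos_eigenvector {ι : Type*} [Fintype ι] [Nonempty ι] (A : ι → ι → ℝ)
    (hA : ∀ i j, 0 < A i j) :
    ∃ (r : ℝ) (x : ι → ℝ), 0 < r ∧ (∀ i, 0 < x i) ∧ ∀ i, ∑ j, A i j * x j = r * x i := by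
  set C : ℝ := ∑ i, ∑ j, A i j with hC
  have hC0 : 0 ≤ C := Finset.sum_nonneg fun i _ => Finset.sum_nonneg fun j _ => (hA i j).le
  have hbound : ∀ (x : ι → ℝ) (t : ℝ), x ∈ stdSimplex ℝ ι → (∀ i, t * x i ≤ ∑ j, A i j * x j) →
      t ≤ C := by
    intro x t hx ht
    have h1 : ∑ i, t * x i ≤ ∑ i, ∑ j, A i j * x j := Finset.sum_le_sum fun i _ => ht i
    rw [← Finset.mul_sum, hx.2, mul_one] at h1
    refine h1.trans (Finset.sum_le_sum fun i _ => Finset.sum_le_sum fun j _ => ?_)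
    have h2 : x j ≤ 1 := by
      rw [← hx.2]
      exact Finset.single_le_sum (fun k _ => hx.1 k) (Finset.mem_univ j)
    exact mul_le_of_le_one_right (hA i j).le h2
  set S : Set ((ι → ℝ) × ℝ) := (stdSimplex ℝ ι ×ˢ Set.Icc 0 C) ∩
    {p | ∀ i, p.2 * p.1 i ≤ ∑ j, A i j * p.1 j} with hS
  have hcl : IsClosed {p : (ι → ℝ) × ℝ | ∀ i, p.2 * p.1 i ≤ ∑ j, A i j * p.1 j} := by
    have : {p : (ι → ℝ) × ℝ | ∀ i, p.2 * p.1 i ≤ ∑ j, A i j * p.1 j}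
        = ⋂ i, {p | p.2 * p.1 i ≤ ∑ j, A i j * p.1 j} := by
      ext
      simp
    rw [this]
    exact isClosed_iInter fun i => isClosed_le (by fun_prop) (by fun_prop)
  have hSc : IsCompact S := ((isCompact_stdSimplex (𝕜 := ℝ) (ι := ι)).prod isCompact_Icc).inter_right hcl
  obtain ⟨i₀⟩ := ‹Nonempty ι›
  have hSn : S.Nonempty := by
    refine ⟨(Pi.single i₀ 1, 0), ⟨⟨single_mem_stdSimplex ℝ i₀, le_rfl, hC0⟩, fun i => ?_⟩⟩
    simp only [zero_mul]
    refine Finset.sum_nonneg fun j _ => mul_nonneg (hA i j).le ?_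
    exact (single_mem_stdSimplex ℝ i₀).1 j
  obtain ⟨⟨x, r⟩, ⟨⟨hx, hr⟩, hxr⟩, hmax⟩ := hSc.exists_isMaxOn hSn continuous_snd.continuousOn
  simp only at hx hr hxr
  replace hxr : ∀ i, r * x i ≤ ∑ j, A i j * x j := hxr
  set y : ι → ℝ := fun i => ∑ j, A i j * x j with hy
  obtain ⟨k, hk⟩ : ∃ k, 0 < x k := by
    by_contra h
    push Not at h
    have : ∑ i, x i ≤ 0 := Finset.sum_nonpos fun i _ => h i
    rw [hx.2] at this
    linarith
  have hypos : ∀ i, 0 < y i := fun i =>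
    Finset.sum_pos' (fun j _ => mul_nonneg (hA i j).le (hx.1 j)) ⟨k, Finset.mem_univ k, mul_pos (hA i k) hk⟩
  have heq : ∀ i, y i = r * x i := by
    by_contra h
    push Not at h
    obtain ⟨l, hl⟩ := h
    have hl' : r * x l < y l := lt_of_le_of_ne (hxr l) (Ne.symm hl)
    have h1 : ∀ i, r * y i < ∑ j, A i j * y j := by
      intro i
      change r * ∑ j, A i j * x j < _
      rw [Finset.mul_sum]
      refine Finset.sum_lt_sum (fun j _ => ?_) ⟨l, Finset.mem_univ l, ?_⟩
      · have := mul_le_mul_of_nonneg_left (hxr j) (hA i j).le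
        simp only [hy] at this ⊢
        linarith
      · have := mul_lt_mul_of_pos_left hl' (hA i l)
        simp only [hy] at this ⊢
        linarith
    obtain ⟨m, -, hm⟩ := Finset.exists_min_image Finset.univ (fun i => (∑ j, A i j * y j) / y i)
      ⟨i₀, Finset.mem_univ i₀⟩
    set r' := (∑ j, A m j * y j) / y m with hr'
    have hrr' : r < r' := (lt_div_iff₀ (hypos m)).2 (h1 m)
    set s : ℝ := ∑ i, y i with hs
    have hspos : 0 < s := Finset.sum_pos (fun i _ => hypos i) ⟨i₀, Finset.mem_univ i₀⟩
    have hz : (fun i => y i / s) ∈ stdSimplex ℝ ι := by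
      refine ⟨fun i => (div_pos (hypos i) hspos).le, ?_⟩
      rw [← Finset.sum_div, div_self hspos.ne']
    have hzr : ∀ i, r' * (y i / s) ≤ ∑ j, A i j * (y j / s) := by
      intro i
      have h2 := (le_div_iff₀ (hypos i)).1 (hm i (Finset.mem_univ i))
      simp only [← mul_div_assoc]
      rw [← Finset.sum_div]
      exact div_le_div_of_nonneg_right h2 hspos.le
    have h3 : ((fun i => y i / s), r') ∈ S :=
      ⟨⟨hz, (hr.1.trans hrr'.le), hbound _ _ hz hzr⟩, hzr⟩
    exact absurd (hmax h3) (not_le.2 hrr')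
  have hrpos : 0 < r := by
    refine lt_of_le_of_ne hr.1 fun h => ?_
    have := hypos i₀
    rw [heq, ← h, zero_mul] at this
    exact lt_irrefl _ this
  refine ⟨r, x, hrpos, fun i => ?_, heq⟩
  have := hypos i
  rw [heq] at this
  exact pos_of_mul_pos_right this hrpos.le

section
variable {M : ℕ} {β : ℝ}

/-- The symmetrized transfer operator. -/
def Wop (β : ℝ) (φ : St M → ℝ) : St M → ℝ := Dop (β / 2) (Kop β (Dop (β / 2) φ))

/-- The kernel of the symmetrized transfer operator. -/
def Ww (β : ℝ) (τ τ' : St M) : ℝ :=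
  Real.exp (β / 2 * vert τ) * Kw β τ τ' * Real.exp (β / 2 * vert τ')

theorem Wop_eq (φ : St M → ℝ) (τ : St M) : Wop β φ τ = ∑ τ', Ww β τ τ' * φ τ' := by
  simp only [Wop, Dop, Kop, Finset.mul_sum, Ww]
  exact Finset.sum_congr rfl fun _ _ => by ring

theorem Ww_comm (τ τ' : St M) : Ww β τ τ' = Ww β τ' τ := by
  rw [Ww, Ww, Kw_comm]
  ring

theorem Kw_nonneg (β : ℝ) (τ τ' : St M) : 0 ≤ Kw β τ τ' := by
  unfold Kw
  split_ifs
  exacts [(Real.exp_pos _).le, le_rfl]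

theorem Kw_pos {τ τ' : St M} (h : sameWalls τ τ') : 0 < Kw β τ τ' := by
  rw [Kw, if_pos h]
  exact Real.exp_pos _

theorem Kw_eq_zero {τ τ' : St M} (h : ¬sameWalls τ τ') : Kw β τ τ' = 0 := by
  rw [Kw, if_neg h]

theorem Ww_nonneg (τ τ' : St M) : 0 ≤ Ww β τ τ' :=
  mul_nonneg (mul_nonneg (Real.exp_pos _).le (Kw_nonneg _ _ _)) (Real.exp_pos _).le

theorem sameWalls_refl (τ : St M) : sameWalls τ τ := ⟨rfl, rfl⟩

/-- The functions supported on the states with the same walls as `c`. -/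
def Supp (c : St M) (φ : St M → ℝ) : Prop := ∀ τ, ¬sameWalls τ c → φ τ = 0

/-- `u` is the positive eigenvector of the symmetrized transfer operator in the sector of `c`. -/
def IsPF (β : ℝ) (c : St M) (r : ℝ) (u : St M → ℝ) : Prop :=
  0 < r ∧ (∀ τ, sameWalls τ c → 0 < u τ) ∧ Supp c u ∧ ∀ τ, Wop β u τ = r * u τ

theorem Supp.Kop {c : St M} {φ : St M → ℝ} (h : Supp c φ) : Supp c (Kop β φ) := by
  intro τ hτ
  refine Finset.sum_eq_zero fun τ' _ => ?_
  by_cases h1 : sameWalls τ' c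
  · rw [Kw_eq_zero (fun h2 => hτ (sameWalls_trans h2 h1)), zero_mul]
  · rw [h τ' h1, mul_zero]

theorem Supp.Dop {c : St M} {φ : St M → ℝ} (h : Supp c φ) (t : ℝ) : Supp c (Dop t φ) :=
  fun τ hτ => by rw [Schonmann.Dop, h τ hτ, mul_zero]

theorem Supp.Wop {c : St M} {φ : St M → ℝ} (h : Supp c φ) : Supp c (Wop β φ) :=
  ((h.Dop _).Kop).Dop _

theorem exists_isPF (β : ℝ) (c : St M) : ∃ r u, IsPF β c r u := by
  have : Nonempty {τ : St M // sameWalls τ c} := ⟨⟨c, sameWalls_refl c⟩⟩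
  obtain ⟨r, x, hr, hx, h⟩ := exists_pos_eigenvector
    (fun i j : {τ : St M // sameWalls τ c} => Ww β i.1 j.1) (fun i j => by
      have := Kw_pos (β := β) (sameWalls_trans i.2 (sameWalls_symm j.2))
      unfold Ww
      positivity)
  set u : St M → ℝ := fun τ => if h : sameWalls τ c then x ⟨τ, h⟩ else 0 with hu
  have hsupp : Supp c u := fun τ hτ => dif_neg hτ
  refine ⟨r, u, hr, fun τ hτ => ?_, hsupp, fun τ => ?_⟩
  · rw [hu]
    simp only [dif_pos hτ]
    exact hx _
  · by_cases hτ : sameWalls τ c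
    · rw [Wop_eq]
      have h1 : ∑ τ', Ww β τ τ' * u τ' = ∑ j : {τ : St M // sameWalls τ c}, Ww β τ j.1 * u j.1 := by
        rw [← Finset.sum_subtype (Finset.univ.filter fun τ' => sameWalls τ' c) (by simp)
          (fun τ' => Ww β τ τ' * u τ'), Finset.sum_filter]
        refine Finset.sum_congr rfl fun τ' _ => ?_
        split_ifs with h2
        · rfl
        · rw [hsupp τ' h2, mul_zero]
      rw [h1, show u τ = x ⟨τ, hτ⟩ from dif_pos hτ, ← h]
      refine Finset.sum_congr rfl fun j _ => ?_
      rw [show u j.1 = x j from dif_pos j.2]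
    · rw [hsupp.Wop τ hτ, hsupp τ hτ, mul_zero]

/-- The Schur test in a sector. -/
theorem IsPF.schur {c : St M} {r : ℝ} {u : St M → ℝ} (hu : IsPF β c r u) {φ : St M → ℝ}
    (hφ : Supp c φ) : ip (Wop β φ) (Wop β φ) ≤ r ^ 2 * ip φ φ := by
  have hu0 : ∀ τ, 0 ≤ u τ := fun τ => by
    by_cases h : sameWalls τ c
    · exact (hu.2.1 τ h).le
    · rw [hu.2.2.1 τ h]
  have h1 : ∀ τ, Wop β φ τ * Wop β φ τ ≤ r * u τ * ∑ τ', Ww β τ τ' * (φ τ' ^ 2 / u τ') := by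
    intro τ
    rw [← hu.2.2.2, Wop_eq, Wop_eq, ← sq]
    refine Finset.sum_sq_le_sum_mul_sum_of_sq_le_mul _
      (fun τ' _ => mul_nonneg (Ww_nonneg _ _) (hu0 _))
      (fun τ' _ => mul_nonneg (Ww_nonneg _ _) (div_nonneg (sq_nonneg _) (hu0 _))) (fun τ' _ => le_of_eq ?_)
    by_cases h : sameWalls τ' c
    · have := (hu.2.1 τ' h).ne'
      field_simp
    · rw [hφ τ' h, hu.2.2.1 τ' h]
      simp
  calc ip (Wop β φ) (Wop β φ)
      ≤ ∑ τ, r * u τ * ∑ τ', Ww β τ τ' * (φ τ' ^ 2 / u τ') := Finset.sum_le_sum fun τ _ => h1 τ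
    _ = ∑ τ', r * (φ τ' ^ 2 / u τ') * ∑ τ, Ww β τ' τ * u τ := by
        simp only [Finset.mul_sum]
        rw [Finset.sum_comm]
        exact Finset.sum_congr rfl fun _ _ => Finset.sum_congr rfl fun _ _ => by
          rw [Ww_comm]
          ring
    _ = r ^ 2 * ip φ φ := by
        rw [ip, Finset.mul_sum]
        refine Finset.sum_congr rfl fun τ _ => ?_
        rw [← Wop_eq, hu.2.2.2]
        by_cases h : sameWalls τ c
        · have := (hu.2.1 τ h).ne'
          field_simp
        · rw [hφ τ h]
          simp

/-- The vertical Boltzmann weights of columns. -/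
def vw (β : ℝ) (_ : ℕ) (τ : St M) : ℝ := Real.exp (β * vert τ)

/-- The eigenvector for the non-symmetrized transfer operator. -/
theorem IsPF.Kop_Dop {c : St M} {r : ℝ} {u : St M → ℝ} (hu : IsPF β c r u) (τ : St M) :
    Schonmann.Kop β (Schonmann.Dop β (Schonmann.Dop (-(β / 2)) u)) τ
      = r * Schonmann.Dop (-(β / 2)) u τ := by
  have h1 := hu.2.2.2 τ
  simp only [Schonmann.Wop] at h1
  rw [Dop_Dop, show β + -(β / 2) = β / 2 by ring]
  have h2 : Schonmann.Kop β (Schonmann.Dop (β / 2) u) τ = Schonmann.Dop (-(β / 2))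
      (Schonmann.Dop (β / 2) (Schonmann.Kop β (Schonmann.Dop (β / 2) u))) τ := by
    rw [Dop_Dop]
    simp [Schonmann.Dop]
  rw [h2]
  simp only [Schonmann.Dop] at h1 ⊢
  rw [h1]
  ring

theorem Kop_mono {φ χ : St M → ℝ} (h : ∀ τ, φ τ ≤ χ τ) (τ : St M) : Kop β φ τ ≤ Kop β χ τ :=
  Finset.sum_le_sum fun _ _ => mul_le_mul_of_nonneg_left (h _) (Kw_nonneg _ _ _)

theorem Kop_smul (t : ℝ) (φ : St M → ℝ) (τ : St M) : Kop β (fun τ => t * φ τ) τ = t * Kop β φ τ := by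
  simp only [Kop, Finset.mul_sum]
  exact Finset.sum_congr rfl fun _ _ => by ring

/-- Partition functions grow like powers of the Perron–Frobenius eigenvalue. -/
theorem IsPF.growth {c : St M} {r : ℝ} {u : St M → ℝ} (hu : IsPF β c r u) :
    ∃ A B : ℝ, 0 < A ∧ 0 < B ∧ ∀ n, A * r ^ n ≤ Gf β (vw β) c n c ∧ Gf β (vw β) c n c ≤ B * r ^ n := by
  set x : St M → ℝ := Schonmann.Dop (-(β / 2)) u with hx
  have hxs : Supp c x := hu.2.2.1.Dop _
  have hxpos : ∀ τ, sameWalls τ c → 0 < x τ := fun τ h => mul_pos (Real.exp_pos _) (hu.2.1 τ h)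
  have hgs : Supp c (Gf β (vw β) c 0) := fun τ h => Kw_eq_zero h
  set S : Finset (St M) := Finset.univ.filter fun τ => sameWalls τ c with hS
  have hSn : S.Nonempty := ⟨c, Finset.mem_filter.2 ⟨Finset.mem_univ c, sameWalls_refl c⟩⟩
  obtain ⟨m, hm, hmin⟩ := S.exists_min_image (fun τ => Kw β τ c / x τ) hSn
  obtain ⟨m', hm', hmax⟩ := S.exists_max_image (fun τ => Kw β τ c / x τ) hSn
  have hmS := (Finset.mem_filter.1 hm).2
  have hmS' := (Finset.mem_filter.1 hm').2
  set a := Kw β m c / x m with ha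
  set b := Kw β m' c / x m' with hb
  have ha0 : 0 < a := div_pos (Kw_pos hmS) (hxpos m hmS)
  have hb0 : 0 < b := div_pos (Kw_pos hmS') (hxpos m' hmS')
  have h : ∀ n τ, a * r ^ n * x τ ≤ Gf β (vw β) c n τ ∧ Gf β (vw β) c n τ ≤ b * r ^ n * x τ := by
    intro n
    induction n with
    | zero =>
      intro τ
      rw [pow_zero, mul_one, mul_one]
      by_cases hτ : sameWalls τ c
      · have h1 : τ ∈ S := Finset.mem_filter.2 ⟨Finset.mem_univ _, hτ⟩
        exact ⟨(le_div_iff₀ (hxpos τ hτ)).1 (hmin τ h1), (div_le_iff₀ (hxpos τ hτ)).1 (hmax τ h1)⟩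
      · rw [hgs τ hτ, hxs τ hτ]
        simp
    | succ n ih =>
      intro τ
      have h1 : ∀ t : ℝ, t * r ^ (n + 1) * x τ
          = Schonmann.Kop β (fun τ => vw β n τ * (t * r ^ n * x τ)) τ := by
        intro t
        have h2 := hu.Kop_Dop τ
        rw [← hx] at h2
        rw [show (fun τ => vw β n τ * (t * r ^ n * x τ))
          = fun τ => (t * r ^ n) * Schonmann.Dop β x τ by
            ext
            simp only [vw, Schonmann.Dop]
            ring, Kop_smul, h2]
        ring
      rw [h1, h1]
      exact ⟨Kop_mono (fun τ => mul_le_mul_of_nonneg_left (ih τ).1 (Real.exp_pos _).le) τ,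
        Kop_mono (fun τ => mul_le_mul_of_nonneg_left (ih τ).2 (Real.exp_pos _).le) τ⟩
  refine ⟨a * x c, b * x c, mul_pos ha0 (hxpos c (sameWalls_refl c)),
    mul_pos hb0 (hxpos c (sameWalls_refl c)), fun n => ?_⟩
  have := h n c
  constructor <;> linarith [this.1, this.2]

end

end Schonmann
end

noncomputable section
open scoped Classical
namespace Schonmann

/-! ### Line events and the surface tension -/

theorem sum_wt_map {β : ℝ} {Λ : Finset (ℤ × ℤ)} {σ : Cfg2} (e : (ℤ × ℤ) ≃ (ℤ × ℤ))
    (he : ∀ x y, e y ∈ nbrs (e x) ↔ y ∈ nbrs x) :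
    ∑ ω ∈ Cf (Λ.map e.toEmbedding) σ, wt β (Λ.map e.toEmbedding) ω
      = ∑ ω ∈ Cf Λ (σ ∘ e), wt β Λ ω := by
  symm
  refine Finset.sum_equiv (Equiv.arrowCongr e (Equiv.refl _)) (fun ω => ?_) (fun ω _ => ?_)
  · simp only [mem_Cf, Finset.mem_map_equiv, Equiv.arrowCongr_apply, Function.comp_apply,
      Equiv.refl_apply]
    constructor
    · intro h x hx
      simpa using h _ hx
    · intro h x hx
      simpa using h (e x) (by simpa using hx)
  · simp only [wt, energy]
    congr 3
    refine Finset.sum_equiv (e.prodCongr e) (fun p => ?_) fun p _ => ?_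
    · simp [mem_pairs, he]
    · simp

theorem energy_union {Λ₁ Λ₂ : Finset (ℤ × ℤ)} (h : ∀ x ∈ Λ₁, x ∉ Λ₂ ∧ ∀ y ∈ Λ₂, y ∉ nbrs x) (ω : Cfg2) :
    energy (Λ₁ ∪ Λ₂) ω = energy Λ₁ ω + energy Λ₂ ω := by
  have h1 : pairs (Λ₁ ∪ Λ₂) = pairs Λ₁ ∪ pairs Λ₂ := by
    ext p
    simp only [mem_pairs, Finset.mem_union]
    tauto
  rw [energy, h1, Finset.sum_union, add_div, energy, energy]
  rw [Finset.disjoint_left]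
  rintro ⟨x, y⟩ h2 h3
  rw [mem_pairs] at h2 h3
  rcases h2.2 with h4 | h4 <;> rcases h3.2 with h5 | h5
  · exact (h _ h4).1 h5
  · exact (h _ h4).2 _ h5 h2.1
  · exact (h _ h4).2 _ h5 (mem_nbrs_comm.1 h2.1)
  · exact (h _ h4).1 h5

/-- The configuration with sign `b` on the axis at abscissas `1, …, N` and plus elsewhere. -/
def lin (N : ℕ) (b : Bool) : Cfg2 := fun x => if x.2 = 0 ∧ 1 ≤ x.1 ∧ x.1 ≤ N then b else true

theorem lin_of_ne {N : ℕ} {b : Bool} {x : ℤ × ℤ} (h : x.2 ≠ 0) : lin N b x = true :=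
  if_neg fun h' => h h'.1

theorem wt_congr {β : ℝ} {Λ : Finset (ℤ × ℤ)} {ω ω' : Cfg2}
    (h : ∀ p ∈ pairs Λ, ω p.1 = ω' p.1 ∧ ω p.2 = ω' p.2) : wt β Λ ω = wt β Λ ω' := by
  rw [wt, wt, energy, energy,
    Finset.sum_congr rfl fun p hp => by rw [(h p hp).1, (h p hp).2]]

/-- The rectangle with `N` columns which is symmetric with respect to the axis. -/
def recS (N M : ℕ) : Finset (ℤ × ℤ) := rc (-(M : ℤ) - 1) N (2 * M + 1)

/-- The upper half of `recS`. -/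
def recU (N M : ℕ) : Finset (ℤ × ℤ) := rc 0 N M

/-- The lower half of `recS`. -/
def recL (N M : ℕ) : Finset (ℤ × ℤ) := rc (-(M : ℤ) - 1) N M

/-- The axis sites of `recS`. -/
def recA (N : ℕ) : Finset (ℤ × ℤ) := rc (-1) N 1

theorem mem_recS {N M : ℕ} {x : ℤ × ℤ} :
    x ∈ recS N M ↔ (1 ≤ x.1 ∧ x.1 ≤ N) ∧ -(M : ℤ) ≤ x.2 ∧ x.2 ≤ M := by
  rw [recS, mem_rc]
  push_cast
  constructor <;> intro h <;> omega

theorem mem_recU {N M : ℕ} {x : ℤ × ℤ} :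
    x ∈ recU N M ↔ (1 ≤ x.1 ∧ x.1 ≤ N) ∧ 1 ≤ x.2 ∧ x.2 ≤ M := by
  rw [recU, mem_rc]
  simp

theorem mem_recL {N M : ℕ} {x : ℤ × ℤ} :
    x ∈ recL N M ↔ (1 ≤ x.1 ∧ x.1 ≤ N) ∧ -(M : ℤ) ≤ x.2 ∧ x.2 ≤ -1 := by
  rw [recL, mem_rc]
  constructor <;> intro h <;> omega

theorem mem_recA {N : ℕ} {x : ℤ × ℤ} : x ∈ recA N ↔ (1 ≤ x.1 ∧ x.1 ≤ N) ∧ x.2 = 0 := by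
  rw [recA, mem_rc]
  push_cast
  constructor <;> intro h <;> omega

theorem recS_eq (N M : ℕ) : recS N M = (recU N M ∪ recL N M) ∪ recA N := by
  ext x
  simp only [Finset.mem_union, mem_recS, mem_recU, mem_recL, mem_recA]
  omega

theorem recL_eq_map (N M : ℕ) : recL N M = (recU N M).map vrefl.toEmbedding := by
  ext x
  rw [Finset.mem_map_equiv, mem_recL, mem_recU]
  have : vrefl.symm x = (x.1, -x.2) := rfl
  rw [this]
  simp only
  omega

theorem energy_recU_recL (N M : ℕ) (ω : Cfg2) :
    energy (recU N M ∪ recL N M) ω = energy (recU N M) ω + energy (recL N M) ω := by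
  refine energy_union (fun x hx => ⟨fun h => ?_, fun y hy h => ?_⟩) ω
  · rw [mem_recU] at hx
    rw [mem_recL] at h
    omega
  · rw [mem_recU] at hx
    rw [mem_recL] at hy
    simp only [nbrs, Finset.mem_insert, Finset.mem_singleton, Prod.ext_iff] at h
    omega

/-- Energy of the bonds along the axis when the spins there have sign `b`. -/
def axE (N M : ℕ) (b : Bool) : ℝ :=
  energy (recS N M) (lin N b) - energy (recU N M ∪ recL N M) (lin N b)

theorem axE_eq (N M : ℕ) (b : Bool) :
    axE N M b = (∑ p ∈ pairs (recS N M) \ pairs (recU N M ∪ recL N M),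
      sval (lin N b p.1) * sval (lin N b p.2)) / 2 := by
  rw [axE, energy, energy, ← Finset.sum_sdiff (pairs_mono (show recU N M ∪ recL N M ⊆ recS N M by
    rw [recS_eq]; exact Finset.subset_union_left))]
  ring

theorem sval_mul_le_one (a b : Bool) : sval a * sval b ≤ 1 := by
  cases a <;> cases b <;> norm_num [sval]

theorem neg_one_le_sval_mul (a b : Bool) : -1 ≤ sval a * sval b := by
  cases a <;> cases b <;> norm_num [sval]

theorem axE_false_le (N M : ℕ) : axE N M false ≤ axE N M true := by
  rw [axE_eq, axE_eq]
  refine div_le_div_of_nonneg_right (Finset.sum_le_sum fun p _ => ?_) (by norm_num)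
  have h : ∀ x, lin N true x = true := fun x => by simp [lin]
  rw [h, h]
  refine (sval_mul_le_one _ _).trans ?_
  norm_num [sval]

theorem axE_true_le {M : ℕ} (hM : 1 ≤ M) (N : ℕ) : axE N M true ≤ axE N M false + 4 := by
  have h : ∀ x, lin N true x = true := fun x => by simp [lin]
  set T : Finset ((ℤ × ℤ) × (ℤ × ℤ)) := {((0, 0), (1, 0)), ((1, 0), (0, 0)),
    (((N : ℤ), 0), ((N : ℤ) + 1, 0)), (((N : ℤ) + 1, 0), ((N : ℤ), 0))} with hT
  have hcard : (T.card : ℝ) ≤ 4 := by exact_mod_cast Finset.card_le_four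
  have key : ∑ p ∈ pairs (recS N M) \ pairs (recU N M ∪ recL N M),
      (sval (lin N true p.1) * sval (lin N true p.2) - sval (lin N false p.1) * sval (lin N false p.2))
      ≤ ∑ p ∈ T, 2 := by
    have h1 : ∀ p ∈ pairs (recS N M) \ pairs (recU N M ∪ recL N M),
        sval (lin N true p.1) * sval (lin N true p.2)
          - sval (lin N false p.1) * sval (lin N false p.2) ≤ if p ∈ T then 2 else 0 := by
      rintro ⟨⟨a, b⟩, c, d⟩ hp
      rw [h, h]
      split_ifs with hpT
      · have := neg_one_le_sval_mul (lin N false (a, b)) (lin N false (c, d))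
        norm_num [sval] at this ⊢
        linarith
      · have h2 : lin N false (a, b) = lin N false (c, d) := by
          simp only [hT, Finset.mem_insert, Finset.mem_singleton, Prod.mk.injEq, not_or] at hpT
          simp only [Finset.mem_sdiff, mem_pairs, Finset.mem_union, mem_recS, mem_recU, mem_recL,
            nbrs, Finset.mem_insert, Finset.mem_singleton, Prod.mk.injEq] at hp
          have h3 : (b = 0 ∧ 1 ≤ a ∧ a ≤ N) ↔ (d = 0 ∧ 1 ≤ c ∧ c ≤ N) := by omega
          simp only [lin, h3]
        rw [h2]
        cases lin N false (c, d) <;> norm_num [sval]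
    refine (Finset.sum_le_sum h1).trans ?_
    rw [← Finset.sum_filter]
    refine Finset.sum_le_sum_of_subset_of_nonneg (fun p hp => (Finset.mem_filter.1 hp).2)
      fun _ _ _ => by norm_num
  rw [axE_eq, axE_eq]
  rw [Finset.sum_sub_distrib, Finset.sum_const, nsmul_eq_mul] at key
  linarith

section
variable {M : ℕ}

/-- The wall state with sign `b` at the bottom and plus elsewhere. -/
def cw (M : ℕ) (b : Bool) : St M := fun j => if (j : ℕ) = 0 then b else true

theorem sp_cw_zero (b : Bool) : sp (cw M b) 0 = sval b := by
  rw [sp, dif_pos (by omega), cw, if_pos rfl]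

theorem sp_cw_succ (b : Bool) (j : ℕ) : sp (cw M b) (j + 1) = 1 := by
  rw [sp]
  split_ifs
  · simp [cw, sval]
  · rfl

theorem sum_wt_recU {β : ℝ} (hM : 1 ≤ M) {N : ℕ} (hN : 1 ≤ N) (b : Bool) {σ : Cfg2}
    (hσ : ∀ x ∉ recL N M, σ x = lin N b x) :
    ∑ ω ∈ Cf (recU N M) σ, wt β (recU N M) ω = Gf β (vw β) (cw M b) N (cw M b) := by
  have hpt : ∀ (i : ℤ) (j : ℕ), σ (i, 0 + j) = lin N b (i, j) := fun i j => by
    rw [zero_add, hσ _ (by rw [mem_recL]; omega)]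
  rw [← sum_pathW β 0 (vw β) N (cw M b) (cw M b) σ ⟨rfl, rfl⟩]
  · exact Finset.sum_congr rfl fun ω _ => wt_rc hM β 0 hN ω
  · intro j hj
    rw [sp_cw_succ, sp_colSt (by omega), hpt, lin, if_neg (by push_cast; omega)]
    rfl
  · intro j hj
    rw [sp_cw_succ, sp_colSt (by omega), hpt, lin, if_neg (by push_cast; omega)]
    rfl
  · intro i h1 h2
    unfold sameWalls
    rw [sp_cw_succ, sp_colSt (by omega), sp_colSt (by omega), hpt, hpt, sp_cw_zero]
    refine ⟨?_, ?_⟩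
    · exact congrArg sval (if_pos ⟨by simp, by simpa using h1, by simpa using h2⟩)
    · have h3 : ((M + 1 : ℕ) : ℤ) ≠ 0 := by omega
      rw [lin_of_ne h3]
      rfl

theorem recU_of_pairs_recL {N : ℕ} {p : (ℤ × ℤ) × (ℤ × ℤ)} (hp : p ∈ pairs (recL N M)) :
    p.1 ∉ recU N M ∧ p.2 ∉ recU N M := by
  obtain ⟨⟨a, b⟩, c, d⟩ := p
  rw [mem_pairs, mem_recL, mem_recL] at hp
  simp only [mem_recU]
  have h1 : d ≤ b + 1 ∧ b ≤ d + 1 := by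
    have := hp.1
    simp only [nbrs, Finset.mem_insert, Finset.mem_singleton, Prod.mk.injEq] at this
    omega
  have h2 := hp.2
  simp only at h2
  omega

theorem sum_wt_recUL {β : ℝ} (hM : 1 ≤ M) {N : ℕ} (hN : 1 ≤ N) (b : Bool) :
    ∑ ω ∈ Cf (recU N M ∪ recL N M) (lin N b), wt β (recU N M ∪ recL N M) ω
      = Gf β (vw β) (cw M b) N (cw M b) ^ 2 := by
  have hd : Disjoint (recU N M) (recL N M) := by
    rw [Finset.disjoint_left]
    intro x
    rw [mem_recU, mem_recL]
    omega
  have h1 : ∀ ω, wt β (recU N M ∪ recL N M) ω = wt β (recU N M) ω * wt β (recL N M) ω := by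
    intro ω
    rw [wt, wt, wt, energy_recU_recL, mul_add, Real.exp_add]
  rw [sum_Cf_union hd]
  have h2 : ∀ ω₁ ∈ Cf (recL N M) (lin N b), ∑ ω ∈ Cf (recU N M) ω₁, wt β (recU N M ∪ recL N M) ω
      = Gf β (vw β) (cw M b) N (cw M b) * wt β (recL N M) ω₁ := by
    intro ω₁ hω₁
    rw [← sum_wt_recU hM hN b (mem_Cf.1 hω₁), Finset.sum_mul]
    refine Finset.sum_congr rfl fun ω hω => ?_
    rw [h1, wt_congr fun p hp => ⟨mem_Cf.1 hω p.1 (recU_of_pairs_recL hp).1,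
      mem_Cf.1 hω p.2 (recU_of_pairs_recL hp).2⟩]
  rw [Finset.sum_congr rfl h2, ← Finset.mul_sum, recL_eq_map, sum_wt_map _ vrefl_nbrs, sq]
  congr 1
  refine sum_wt_recU hM hN b fun x _ => ?_
  have : vrefl x = (x.1, -x.2) := rfl
  simp only [Function.comp_apply, lin, this, neg_eq_zero]

theorem wt_recS {β : ℝ} {N : ℕ} {b : Bool} {ω : Cfg2} (hω : ω ∈ Cf (recU N M ∪ recL N M) (lin N b)) :
    wt β (recS N M) ω = Real.exp (β * axE N M b) * wt β (recU N M ∪ recL N M) ω := by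
  have hs : recU N M ∪ recL N M ⊆ recS N M := by rw [recS_eq]; exact Finset.subset_union_left
  have h2 := energy_sub hs (mem_Cf.1 hω)
  rw [wt, wt, ← Real.exp_add, ← mul_add]
  congr 2
  rw [axE]
  linarith

/-- Factorization of the probability of a line event. -/
theorem pr_line {β : ℝ} (hM : 1 ≤ M) {N : ℕ} (hN : 1 ≤ N) (b : Bool) :
    pr β (recS N M) (fun _ => true) (seg b 0 N)
        * ∑ ω ∈ Cf (recS N M) (fun _ => true), wt β (recS N M) ω
      = Real.exp (β * axE N M b) * Gf β (vw β) (cw M b) N (cw M b) ^ 2 := by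
  have hd : Disjoint (recU N M ∪ recL N M) (recA N) := by
    rw [Finset.disjoint_left]
    intro x
    rw [Finset.mem_union, mem_recU, mem_recL, mem_recA]
    omega
  have h0 : lin N b ∈ Cf (recA N) (fun _ => true) := mem_Cf.2 fun x hx => by
    rw [mem_recA] at hx
    rw [lin, if_neg (by tauto)]
  have hZ := sum_wt_pos β (recS N M) (Cf_nonempty (recS N M) (fun _ => true))
  rw [pr, ex, exs, div_mul_cancel₀ _ hZ.ne']
  conv_lhs => rw [recS_eq N M]
  rw [sum_Cf_union hd, ← recS_eq, Finset.sum_eq_single_of_mem _ h0, ← sum_wt_recUL hM hN, Finset.mul_sum]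
  · refine Finset.sum_congr rfl fun ω hω => ?_
    have h1 : ω ∈ seg b 0 N := by
      intro t h1 h2
      rw [mem_Cf.1 hω _ (by rw [Finset.mem_union, mem_recU, mem_recL]; simp), lin, if_pos]
      simp only [true_and]
      omega
    rw [ind, if_pos h1, mul_one]
    exact wt_recS hω
  · intro ω₁ hω₁ hne
    refine Finset.sum_eq_zero fun ω hω => ?_
    rw [ind, if_neg, mul_zero]
    intro hseg
    apply hne
    ext x
    by_cases hx : x ∈ recA N
    · have h1 := mem_Cf.1 hω x (Finset.disjoint_right.1 hd hx)
      rw [mem_recA] at hx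
      have h2 := hseg x.1 (by omega) (by omega)
      have h3 : x = (x.1, 0) := Prod.ext rfl hx.2
      rw [← h1, lin, if_pos ⟨hx.2, hx.1⟩, h3, h2]
    · rw [mem_Cf.1 hω₁ x hx]
      exact (mem_Cf.1 h0 x hx).symm

end

end Schonmann
end

noncomputable section
open scoped Classical
namespace Schonmann

theorem le_of_pow_le_mul_pow {a b C : ℝ} (hb : 0 < b)
    (h : ∀ n : ℕ, 1 ≤ n → a ^ n ≤ C * b ^ n) : a ≤ b := by
  by_contra! hab
  have h1 : 1 < a / b := (one_lt_div hb).2 hab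
  obtain ⟨n, hn⟩ := pow_unbounded_of_one_lt (max C 1) h1
  have hn1 : 1 ≤ n := by
    rcases Nat.eq_zero_or_pos n with rfl | h0
    · simp at hn
    · exact h0
  rw [div_pow, lt_div_iff₀ (pow_pos hb n)] at hn
  have h2 := h n hn1
  have h3 : C * b ^ n ≤ max C 1 * b ^ n := mul_le_mul_of_nonneg_right (le_max_left _ _) (pow_pos hb n).le
  linarith

theorem isUpperSet_seg (i : ℤ) (k : ℕ) : IsUpperSet (seg true i k) :=
  fun _ _ hab ha t h1 h2 => isUpperSet_site (t, 0) hab (ha t h1 h2)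

theorem pr_seg_false_le {β : ℝ} (hβ : 0 ≤ β) (Λ : Finset (ℤ × ℤ)) (i : ℤ) (k : ℕ) :
    pr β Λ (fun _ => true) (seg false i k) ≤ pr β Λ (fun _ => true) (seg true i k) := by
  have h1 := pr_flip (β := β) (Λ := Λ) (σ := fun _ => false) (A := seg false i k)
  rw [show flipCfg (fun _ => false) = fun _ => true from rfl] at h1
  rw [h1, show {ω | flipCfg ω ∈ seg false i k} = seg true i k by ext ω; simp [seg, flipCfg]]
  exact pr_le_true hβ (isUpperSet_seg i k)

section
variable {M : ℕ} {β : ℝ}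

theorem pr_line_mul_le (hβ : 0 ≤ β) (hM : 1 ≤ M) {N : ℕ} (hN : 1 ≤ N) :
    pr β (recS N M) (fun _ => true) (seg false 0 N) * Gf β (vw β) (cw M true) N (cw M true) ^ 2
      ≤ pr β (recS N M) (fun _ => true) (seg true 0 N)
        * Gf β (vw β) (cw M false) N (cw M false) ^ 2 := by
  have hZ := sum_wt_pos β (recS N M) (Cf_nonempty (recS N M) (fun _ => true))
  have h1 := pr_line (β := β) hM hN false
  have h2 := pr_line (β := β) hM hN true
  refine le_of_mul_le_mul_right ?_ hZ
  rw [mul_right_comm, h1, mul_right_comm (pr β _ _ (seg true 0 N)), h2]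
  have h3 : Real.exp (β * axE N M false) ≤ Real.exp (β * axE N M true) :=
    Real.exp_le_exp.2 (mul_le_mul_of_nonneg_left (axE_false_le N M) hβ)
  nlinarith [mul_le_mul_of_nonneg_right h3 (mul_nonneg
    (sq_nonneg (Gf β (vw β) (cw M false) N (cw M false)))
    (sq_nonneg (Gf β (vw β) (cw M true) N (cw M true))))]

theorem pr_line_mul_ge (hβ : 0 ≤ β) (hM : 1 ≤ M) {N : ℕ} (hN : 1 ≤ N) :
    pr β (recS N M) (fun _ => true) (seg true 0 N) * Gf β (vw β) (cw M false) N (cw M false) ^ 2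
      ≤ Real.exp (β * 4) * (pr β (recS N M) (fun _ => true) (seg false 0 N)
        * Gf β (vw β) (cw M true) N (cw M true) ^ 2) := by
  have hZ := sum_wt_pos β (recS N M) (Cf_nonempty (recS N M) (fun _ => true))
  have h1 := pr_line (β := β) hM hN false
  have h2 := pr_line (β := β) hM hN true
  refine le_of_mul_le_mul_right ?_ hZ
  rw [mul_right_comm, h2, mul_assoc (Real.exp (β * 4)), mul_right_comm _ _ (∑ ω ∈ _, _), h1]
  have h3 : Real.exp (β * axE N M true) ≤ Real.exp (β * 4) * Real.exp (β * axE N M false) := by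
    rw [← Real.exp_add]
    refine Real.exp_le_exp.2 ?_
    have := mul_le_mul_of_nonneg_left (axE_true_le hM N) hβ
    linarith
  nlinarith [mul_le_mul_of_nonneg_right h3 (mul_nonneg
    (sq_nonneg (Gf β (vw β) (cw M false) N (cw M false)))
    (sq_nonneg (Gf β (vw β) (cw M true) N (cw M true))))]

/-- The surface tension is nonnegative. -/
theorem IsPF.le_of_walls (hβ : 0 ≤ β) (hM : 1 ≤ M) {r r' : ℝ} {u u' : St M → ℝ}
    (hu : IsPF β (cw M true) r u) (hu' : IsPF β (cw M false) r' u') : r' ≤ r := by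
  obtain ⟨A, B, hA, hB, h⟩ := hu.growth
  obtain ⟨A', B', hA', hB', h'⟩ := hu'.growth
  have key : r' ^ 2 ≤ r ^ 2 := by
    refine le_of_pow_le_mul_pow (C := Real.exp (β * 4) * B ^ 2 / A' ^ 2)
      (pow_pos hu.1 2) fun N hN => ?_
    have h1 := pr_line_mul_ge hβ hM hN
    have hL : 0 < pr β (recS N M) (fun _ => true) (seg true 0 N) :=
      pr_pos ⟨_, self_mem_Cf _ _, fun _ _ _ => rfl⟩
    have h2 : Gf β (vw β) (cw M false) N (cw M false) ^ 2
        ≤ Real.exp (β * 4) * Gf β (vw β) (cw M true) N (cw M true) ^ 2 := by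
      refine le_of_mul_le_mul_left ?_ hL
      have h3 := mul_le_mul_of_nonneg_right (pr_seg_false_le hβ (recS N M) 0 N)
        (sq_nonneg (Gf β (vw β) (cw M true) N (cw M true)))
      nlinarith [Real.exp_pos (β * 4)]
    have h3 : (A' * r' ^ N) ^ 2 ≤ Gf β (vw β) (cw M false) N (cw M false) ^ 2 :=
      pow_le_pow_left₀ (mul_pos hA' (pow_pos hu'.1 N)).le (h' N).1 2
    have h4 : Gf β (vw β) (cw M true) N (cw M true) ^ 2 ≤ (B * r ^ N) ^ 2 :=
      pow_le_pow_left₀ ((mul_pos hA (pow_pos hu.1 N)).le.trans (h N).1) (h N).2 2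
    have h5 := h3.trans (h2.trans (mul_le_mul_of_nonneg_left h4 (Real.exp_pos (β * 4)).le))
    rw [div_mul_eq_mul_div, le_div_iff₀ (pow_pos hA' 2), ← pow_mul, ← pow_mul, mul_comm 2 N,
      pow_mul, pow_mul]
    linarith
  exact (sq_le_sq₀ hu'.1.le hu.1.le).1 key

/-- Upper bound for the ratio of the probabilities of line events. -/
theorem IsPF.pr_line_le (hβ : 0 ≤ β) (hM : 1 ≤ M) {r r' : ℝ} {u u' : St M → ℝ}
    (hu : IsPF β (cw M true) r u) (hu' : IsPF β (cw M false) r' u') :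
    ∃ C, 0 < C ∧ ∀ N, 1 ≤ N → pr β (recS N M) (fun _ => true) (seg false 0 N)
      ≤ C * ((r' / r) ^ 2) ^ N * pr β (recS N M) (fun _ => true) (seg true 0 N) := by
  obtain ⟨A, B, hA, hB, h⟩ := hu.growth
  obtain ⟨A', B', hA', hB', h'⟩ := hu'.growth
  refine ⟨B' ^ 2 / A ^ 2, by positivity, fun N hN => ?_⟩
  have h1 := pr_line_mul_le hβ hM hN
  have hr := pow_pos hu.1 N
  have h3 : (A * r ^ N) ^ 2 ≤ Gf β (vw β) (cw M true) N (cw M true) ^ 2 :=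
    pow_le_pow_left₀ (mul_pos hA (pow_pos hu.1 N)).le (h N).1 2
  have h4 : Gf β (vw β) (cw M false) N (cw M false) ^ 2 ≤ (B' * r' ^ N) ^ 2 :=
    pow_le_pow_left₀ ((mul_pos hA' (pow_pos hu'.1 N)).le.trans (h' N).1) (h' N).2 2
  have h5 : pr β (recS N M) (fun _ => true) (seg false 0 N) * (A * r ^ N) ^ 2
      ≤ pr β (recS N M) (fun _ => true) (seg true 0 N) * (B' * r' ^ N) ^ 2 :=
    (mul_le_mul_of_nonneg_left h3 pr_nonneg).trans (h1.trans (mul_le_mul_of_nonneg_left h4 pr_nonneg))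
  rw [← le_div_iff₀ (by positivity)] at h5
  refine h5.trans (le_of_eq ?_)
  rw [← pow_mul, mul_comm 2 N, pow_mul, div_pow]
  field_simp

end

/-! ### Lower bound for the ratio of line events -/

theorem pr_site_box {β : ℝ} (g : ℕ) (i : ℤ) (σ : Cfg2) :
    pr β (tr (i + 1) (cut (box g) (-1))) σ {ω | ω (i + 1, 0) = true}
      = pr β (cut (box g) (-1)) (fun x => σ (x.1 + (i + 1), x.2)) (plusOn {0}) := by
  rw [← pr_tr_plusOn, ← plusOn_singleton]
  congr 2
  ext j
  simp [shiftF]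

theorem tr_cut_subset {Λ : Finset (ℤ × ℤ)} {g : ℕ} {i : ℤ} (h : tr (i + 1) (box g) ⊆ Λ) :
    tr (i + 1) (cut (box g) (-1)) ⊆ cut Λ i := by
  intro x hx
  rw [mem_tr, mem_cut] at hx
  rw [mem_cut]
  exact ⟨h (mem_tr.2 hx.1), fun h' => hx.2 ⟨h'.1, by omega⟩⟩

theorem pr_site_le_pin_minus {β : ℝ} (hβ : 0 ≤ β) {Λ : Finset (ℤ × ℤ)} {g : ℕ} {i : ℤ} {σ : Cfg2}
    (h : tr (i + 1) (box g) ⊆ Λ) (hσ : ∀ x, i - g ≤ x → x ≤ i → σ (x, 0) = false) :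
    pr β (cut Λ i) σ {ω | ω (i + 1, 0) = true} ≤ pin β g {0} allMinus := by
  have h1 : pin β g {0} allMinus
      = pr β (tr (i + 1) (cut (box g) (-1))) (sl i) {ω | ω (i + 1, 0) = true} := by
    rw [pr_site_box, pin]
    congr 1
    ext x
    rw [sl_shift]
  rw [h1, pr_congr_bdry (σ := sl i) (σ' := fun x => if x.2 = 0 ∧ x.1 ≤ i then σ x else true)
    (B := {ω | ω (i + 1, 0) = true})]
  · refine pr_le_pr_of_plus hβ (tr_cut_subset h) (fun x _ => ?_) (fun x hx _ => ?_)
      (isUpperSet_site _)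
    · split_ifs
      · exact le_rfl
      · exact Bool.le_true _
    · exact if_neg (mem_cut.1 hx).2
  · intro x hx y hy _
    rw [mem_tr, mem_cut, mem_box] at hx
    simp only [sl]
    split_ifs with hy2
    · have : y = (y.1, 0) := Prod.ext rfl hy2.1
      rw [this, hσ]
      · simp only [nbrs, Finset.mem_insert, Finset.mem_singleton, Prod.ext_iff] at hy
        simp only at hx
        omega
      · exact hy2.2
    · rfl
  · intro ω _ ω' _ hag
    have := hag (i + 1, 0) (by rw [mem_tr, mem_cut, mem_box]; simp)
    simp only [Set.mem_ofPred_eq, this]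

theorem pr_site_le_pin_plus {β : ℝ} (hβ : 0 ≤ β) {Λ : Finset (ℤ × ℤ)} {g : ℕ} {i : ℤ}
    (h : tr (i + 1) (box g) ⊆ Λ) :
    pr β (cut Λ i) (fun _ => true) {ω | ω (i + 1, 0) = true} ≤ pin β g {0} allPlus := by
  rw [pin, bc_allPlus, ← pr_site_box g i (fun _ => true)]
  exact pr_true_anti hβ (tr_cut_subset h) (isUpperSet_site _)

/-- The configuration with minuses on the axis at abscissas `1, …, i` and plus elsewhere. -/
def slab (i : ℤ) : Cfg2 := fun x => if x.2 = 0 ∧ 1 ≤ x.1 ∧ x.1 ≤ i then false else true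

theorem update_slab {i : ℤ} (hi : 0 ≤ i) : Function.update (slab i) (i + 1, 0) false = slab (i + 1) := by
  ext x
  by_cases hx : x = (i + 1, 0)
  · subst hx
    rw [Function.update_self, slab, if_pos ⟨rfl, by simp only; omega, le_rfl⟩]
  · rw [Function.update_of_ne hx]
    obtain ⟨a, b⟩ := x
    simp only [slab]
    simp only [Prod.mk.injEq, not_and] at hx
    have : (b = 0 ∧ 1 ≤ a ∧ a ≤ i) ↔ (b = 0 ∧ 1 ≤ a ∧ a ≤ i + 1) := by omega
    simp only [this]

theorem prod_le_pr_seg_false {β : ℝ} {Λ : Finset (ℤ × ℤ)} {q : ℤ → ℝ} (hq0 : ∀ t, 0 ≤ q t) (k : ℕ)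
    {i : ℤ} (hi : 0 ≤ i) (h : ∀ t, i < t → t ≤ i + k → (t, 0) ∈ Λ)
    (hq : ∀ t, i ≤ t → t < i + k → q t ≤ pr β (cut Λ t) (slab t) {ω | ω (t + 1, 0) = false}) :
    ∏ j ∈ Finset.range k, q (i + j) ≤ pr β (cut Λ i) (slab i) (seg false i k) := by
  induction k generalizing i with
  | zero => simp [seg_zero, pr_univ]
  | succ k ih =>
    have hx : (i + 1, (0 : ℤ)) ∈ cut Λ i :=
      mem_cut.2 ⟨h _ (by omega) (by push_cast; omega), by simp⟩
    rw [seg_succ, pr_inter_site hx, cut_erase, update_slab hi, Finset.prod_range_succ', mul_comm]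
    refine mul_le_mul ?_ ?_ (Finset.prod_nonneg fun _ _ => hq0 _) pr_nonneg
    · simpa using hq i le_rfl (by push_cast; omega)
    · refine le_trans (le_of_eq (Finset.prod_congr rfl fun j _ => ?_))
        (ih (by omega) (fun t h1 h2 => h t (by omega) (by push_cast; omega))
          fun t h1 h2 => hq t (by omega) (by push_cast; omega))
      congr 1
      push_cast
      ring

theorem pr_seg_true_le_prod {β : ℝ} {Λ : Finset (ℤ × ℤ)} {q : ℤ → ℝ} (hq0 : ∀ t, 0 ≤ q t) (k : ℕ)
    {i : ℤ} (h : ∀ t, i < t → t ≤ i + k → (t, 0) ∈ Λ)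
    (hq : ∀ t, i ≤ t → t < i + k → pr β (cut Λ t) (fun _ => true) {ω | ω (t + 1, 0) = true} ≤ q t) :
    pr β (cut Λ i) (fun _ => true) (seg true i k) ≤ ∏ j ∈ Finset.range k, q (i + j) := by
  induction k generalizing i with
  | zero => simp [seg_zero, pr_univ]
  | succ k ih =>
    have hx : (i + 1, (0 : ℤ)) ∈ cut Λ i :=
      mem_cut.2 ⟨h _ (by omega) (by push_cast; omega), by simp⟩
    rw [seg_succ, pr_inter_site hx, cut_erase, Finset.prod_range_succ', mul_comm (∏ j ∈ _, _),
      show Function.update (fun _ => true) (i + 1, (0 : ℤ)) true = fun _ => true by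
        ext x; simp [Function.update_apply]]
    refine mul_le_mul ?_ ?_ pr_nonneg (hq0 _)
    · simpa using hq i le_rfl (by push_cast; omega)
    · refine le_trans (ih (fun t h1 h2 => h t (by omega) (by push_cast; omega))
          fun t h1 h2 => hq t (by omega) (by push_cast; omega))
        (le_of_eq (Finset.prod_congr rfl fun j _ => ?_))
      congr 1
      push_cast
      ring

/-- The sites close to the ends of the segment `[0, N)`. -/
theorem card_filter_ends_le (N g : ℕ) :
    ((Finset.range N).filter fun j => ¬(g < j ∧ j + 1 + g ≤ N)).card ≤ 2 * g + 1 := by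
  calc _ ≤ (Finset.range (g + 1) ∪ Finset.Ico (N - g) N).card := by
        refine Finset.card_le_card fun j hj => ?_
        simp only [Finset.mem_filter, Finset.mem_range, Finset.mem_union, Finset.mem_Ico] at hj ⊢
        omega
    _ ≤ _ := by
        refine (Finset.card_union_le _ _).trans ?_
        rw [Finset.card_range, Nat.card_Ico]
        omega

theorem tr_box_subset_recS {N M g j : ℕ} (hg : g ≤ M) (h : g < j ∧ j + 1 + g ≤ N) :
    tr ((j : ℤ) + 1) (box g) ⊆ recS N M := by
  intro x hx
  rw [mem_tr, mem_box] at hx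
  rw [mem_recS]
  simp only at hx
  omega

theorem cut_recS_zero (N M : ℕ) : cut (recS N M) 0 = recS N M := by
  ext x
  rw [mem_cut, mem_recS]
  omega

theorem eps_le_one (β : ℝ) : eps β ≤ 1 := pr_le_one

theorem pow_mul_le_pr_line {β : ℝ} (hβ : 0 ≤ β) {N M g : ℕ} (hg : g ≤ M) :
    (1 - pin β g {0} allMinus) ^ N * eps β ^ (2 * g + 1)
      ≤ pr β (recS N M) (fun _ => true) (seg false 0 N) := by
  have hp : 0 ≤ 1 - pin β g {0} allMinus := sub_nonneg.2 pr_le_one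
  have hp1 : 1 - pin β g {0} allMinus ≤ 1 := sub_le_self _ pr_nonneg
  have he := eps_pos β
  have h1 := prod_le_pr_seg_false (β := β) (Λ := recS N M) (i := 0)
    (q := fun t => (1 - pin β g {0} allMinus) * if ¬(g < t.toNat ∧ t.toNat + 1 + g ≤ N) then eps β else 1)
    (fun t => mul_nonneg hp (by split_ifs <;> positivity)) N le_rfl
    (fun t h1 h2 => mem_recS.2 (by simp only; omega)) (fun t h1 h2 => ?_)
  · rw [cut_recS_zero, show slab 0 = fun _ => true by
      ext x
      rw [slab, if_neg (by omega)]] at h1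
    refine le_trans ?_ h1
    simp only [zero_add, Int.toNat_natCast]
    rw [Finset.prod_mul_distrib, Finset.prod_const, Finset.card_range]
    refine mul_le_mul_of_nonneg_left ?_ (pow_nonneg hp N)
    rw [Finset.prod_ite, Finset.prod_const, Finset.prod_const_one, mul_one]
    exact pow_le_pow_of_le_one he.le (eps_le_one β) (card_filter_ends_le N g)
  · obtain ⟨j, rfl⟩ := Int.eq_ofNat_of_zero_le h1
    simp only [Int.toNat_natCast]
    split_ifs with hj
    · have h3 := pr_site_le_pin_minus hβ (tr_box_subset_recS hg hj) (σ := slab j)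
        (fun x h1 h2 => by rw [slab, if_pos ⟨rfl, by simp only; omega, h2⟩])
      have h4 := pr_site_add (β := β) (Λ := cut (recS N M) j) (σ := slab j) (x := ((j : ℤ) + 1, 0))
      linarith
    · refine le_trans (mul_le_of_le_one_left he.le hp1) (eps_le_pr_false hβ ?_)
      rw [mem_cut, mem_recS]
      simp only
      omega

theorem pr_line_true_le {β : ℝ} (hβ : 0 ≤ β) {N M g : ℕ} (hg : g ≤ M) :
    pr β (recS N M) (fun _ => true) (seg true 0 N)
      ≤ pin β g {0} allPlus ^ N * (eps β)⁻¹ ^ (2 * g + 1) := by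
  have he := eps_pos β
  have hp : eps β ≤ pin β g {0} allPlus := (eps_le_PiF hβ _).trans (PiF_le_pin _ _ _ _)
  have h1 := pr_seg_true_le_prod (β := β) (Λ := recS N M) (i := 0)
    (q := fun t => pin β g {0} allPlus * if ¬(g < t.toNat ∧ t.toNat + 1 + g ≤ N) then (eps β)⁻¹ else 1)
    (fun t => mul_nonneg pr_nonneg (by split_ifs <;> positivity)) N
    (fun t h1 h2 => mem_recS.2 (by simp only; omega)) (fun t h1 h2 => ?_)
  · rw [cut_recS_zero] at h1
    refine h1.trans ?_
    simp only [zero_add, Int.toNat_natCast]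
    rw [Finset.prod_mul_distrib, Finset.prod_const, Finset.card_range]
    refine mul_le_mul_of_nonneg_left ?_ (pow_nonneg pr_nonneg N)
    rw [Finset.prod_ite, Finset.prod_const, Finset.prod_const_one, mul_one]
    exact pow_le_pow_right₀ ((one_le_inv₀ he).2 (eps_le_one β)) (card_filter_ends_le N g)
  · obtain ⟨j, rfl⟩ := Int.eq_ofNat_of_zero_le h1
    simp only [Int.toNat_natCast]
    split_ifs with hj
    · rw [mul_one]
      exact pr_site_le_pin_plus hβ (tr_box_subset_recS hg hj)
    · refine pr_le_one.trans ?_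
      rw [← div_eq_mul_inv, one_le_div he]
      exact hp

/-- If the eigenvalue ratios are bounded away from one, then the interface is tight. -/
theorem one_lt_add_of_ratio {β : ℝ} (hβ : 0 ≤ β) {m : ℝ} (hm0 : 0 ≤ m) (hm : m < 1)
    (h : ∀ M, 1 ≤ M → ∀ (r r' : ℝ) (u u' : St M → ℝ), IsPF β (cw M true) r u →
      IsPF β (cw M false) r' u' → r' / r ≤ m) :
    1 < PiF β {0} allPlus + PiF β {0} allMinus := by
  have hpos : 0 < PiF β {0} allPlus := lt_of_lt_of_le (eps_pos β) (eps_le_PiF hβ _)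
  have key : ∀ g : ℕ, 1 ≤ g → 1 - pin β g {0} allMinus ≤ m ^ 2 * pin β g {0} allPlus := by
    intro g hg
    obtain ⟨r, u, hu⟩ := exists_isPF β (cw g true)
    obtain ⟨r', u', hu'⟩ := exists_isPF β (cw g false)
    obtain ⟨C, hC, hCN⟩ := hu.pr_line_le hβ hg hu'
    have hr := h g hg r r' u u' hu hu'
    have hr0 : 0 ≤ r' / r := (div_pos hu'.1 hu.1).le
    have he := eps_pos β
    have hp : 0 < pin β g {0} allPlus := hpos.trans_le (PiF_le_pin _ _ _ _)
    have hmain : 1 - pin β g {0} allMinus ≤ (r' / r) ^ 2 * pin β g {0} allPlus := by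
      refine le_of_pow_le_mul_pow (C := C * (eps β)⁻¹ ^ (2 * g + 1) / eps β ^ (2 * g + 1))
        (mul_pos (pow_pos (div_pos hu'.1 hu.1) 2) hp) fun N hN => ?_
      rw [div_mul_eq_mul_div, le_div_iff₀ (by positivity)]
      refine (pow_mul_le_pr_line hβ le_rfl).trans ((hCN N hN).trans ?_)
      refine (mul_le_mul_of_nonneg_left (pr_line_true_le hβ le_rfl)
        (mul_nonneg hC.le (by positivity))).trans (le_of_eq ?_)
      rw [mul_pow]
      ring
    refine hmain.trans (mul_le_mul_of_nonneg_right (pow_le_pow_left₀ hr0 hr 2) hp.le)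
  have h1 : 1 - PiF β {0} allMinus ≤ m ^ 2 * PiF β {0} allPlus :=
    le_of_tendsto_of_tendsto (tendsto_const_nhds.sub (tendsto_pin hβ {0} allMinus))
      ((tendsto_pin hβ {0} allPlus).const_mul _)
      (eventually_atTop.2 ⟨1, fun g hg => key g hg⟩)
  have h2 : m ^ 2 < 1 := by nlinarith
  nlinarith

end Schonmann
end

noncomputable section
open scoped Classical
namespace Schonmann

/-- A linear recursion preserving the cone `|A| < B` is incompatible with the reflected boundary
condition at the other end. -/
theorem cone_recursion {c s μ κ : ℝ} {M : ℕ} {A B : ℕ → ℝ} (hs : 0 < s) (hμ : 0 < μ)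
    (hcs : c ^ 2 = s ^ 2 + 1)
    (h1 : 0 < 2 * c ^ 2 * μ - s - s * μ ^ 2)
    (h2 : 0 < s ^ 3 - 2 * c * s * (s - μ) - 2 * c ^ 2 * μ + c ^ 2 * s + s * μ ^ 2)
    (h3 : 0 < s ^ 3 + 2 * c * s * (s - μ) - 2 * c ^ 2 * μ + c ^ 2 * s + s * μ ^ 2)
    (hκ0 : -1 < κ) (hκ1 : κ < 1) (hB0 : 0 < B 0) (hA0 : A 0 = κ * B 0) (hend : B M = κ * A M)
    (hB : ∀ k < M, μ * s * B (k + 1) = s * c * (μ - s) * A k + s ^ 3 * B k)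
    (hA : ∀ k < M, μ * s * A (k + 1)
      = (2 * c ^ 2 * μ - c ^ 2 * s - s * μ ^ 2) * A k + c * s * (s - μ) * B k) : False := by
  have key : ∀ k ≤ M, 0 < B k - A k ∧ 0 < B k + A k := by
    intro k
    induction k with
    | zero =>
      intro _
      rw [hA0]
      constructor <;> nlinarith
    | succ k ih =>
      intro hk
      obtain ⟨hp, hq⟩ := ih (by omega)
      have hms : 0 < μ * s := mul_pos hμ hs
      have eB := hB k (by omega)
      have eA := hA k (by omega)
      constructor
      · refine (mul_pos_iff_of_pos_left hms).1 ?_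
        have := mul_pos h1 hp
        have := mul_pos h2 hq
        rw [mul_sub, eB, eA]
        have e : s ^ 3 = s * (c ^ 2 - 1) := by rw [hcs]; ring
        nlinarith
      · refine (mul_pos_iff_of_pos_left hms).1 ?_
        have := mul_pos h3 hp
        have := mul_pos h1 hq
        rw [mul_add, eB, eA]
        have e : s ^ 3 = s * (c ^ 2 - 1) := by rw [hcs]; ring
        nlinarith
  obtain ⟨hp, hq⟩ := key M le_rfl
  rw [hend] at hp hq
  nlinarith

variable {M : ℕ} {β : ℝ}

theorem psi_lin (s t : ℝ) (a b a' b' : ℕ → ℝ) (φ : St M → ℝ) (τ : St M) :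
    psi (fun k => s * a k + t * a' k) (fun k => s * b k + t * b' k) φ τ
      = s * psi a b φ τ + t * psi a' b' φ τ := by
  simp only [psi, Finset.mul_sum, ← Finset.sum_add_distrib]
  exact Finset.sum_congr rfl fun _ _ => by ring

theorem psi_congr {a b a' b' : ℕ → ℝ} (ha : ∀ k ≤ M, a k = a' k) (hb : ∀ k ≤ M, b k = b' k)
    (φ : St M → ℝ) : psi a b φ = psi a' b' φ := by
  ext τ
  refine Finset.sum_congr rfl fun k hk => ?_
  rw [Finset.mem_range] at hk
  rw [ha k (by omega), hb k (by omega)]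

theorem ip_psi_lin {s t : ℝ} {a b a₁ b₁ a₂ b₂ : ℕ → ℝ} {φ χ : St M → ℝ}
    (ha : ∀ k ≤ M, a k = s * a₁ k + t * a₂ k) (hb : ∀ k ≤ M, b k = s * b₁ k + t * b₂ k) :
    ip χ (psi a b φ) = s * ip χ (psi a₁ b₁ φ) + t * ip χ (psi a₂ b₂ φ) := by
  rw [psi_congr ha hb]
  simp only [ip, psi_lin, mul_add, Finset.sum_add_distrib, Finset.mul_sum]
  exact congrArg₂ _ (Finset.sum_congr rfl fun _ _ => by ring)
    (Finset.sum_congr rfl fun _ _ => by ring)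

/-- Commutation of the fermions with the horizontal transfer operator, between eigenvectors. -/
theorem IsPF.ip_psi_rel (hβ : 0 < β) {c c' : St M} {r r' : ℝ} {u u' : St M → ℝ}
    (hu : IsPF β c r u) (hu' : IsPF β c' r' u') (a b : ℕ → ℝ) :
    r' * ip (Schonmann.Dop (-(β / 2)) u') (psi a b (Schonmann.Dop β (Schonmann.Dop (-(β / 2)) u)))
      = r * ip (Schonmann.Dop β (Schonmann.Dop (-(β / 2)) u'))
        (psi (tra M β a b) (trb β a b) (Schonmann.Dop (-(β / 2)) u)) := by
  set x := Schonmann.Dop (-(β / 2)) u with hx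
  set x' := Schonmann.Dop (-(β / 2)) u' with hx'
  have e1 : Schonmann.Kop β (Schonmann.Dop β x) = fun τ => r * x τ := funext hu.Kop_Dop
  have e2 : Schonmann.Kop β (Schonmann.Dop β x') = fun τ => r' * x' τ := funext hu'.Kop_Dop
  have h1 : r' * ip x' (psi a b (Schonmann.Dop β x))
      = ip (Schonmann.Kop β (Schonmann.Dop β x')) (psi a b (Schonmann.Dop β x)) := by
    rw [e2]
    simp only [ip, Finset.mul_sum]
    exact Finset.sum_congr rfl fun _ _ => by ring
  rw [h1, ip_Kop, Kop_psi hβ, e1]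
  simp only [ip, Finset.mul_sum, psi]
  exact Finset.sum_congr rfl fun _ _ => Finset.sum_congr rfl fun _ _ => by ring

theorem IsPF.nonneg {c : St M} {r : ℝ} {u : St M → ℝ} (hu : IsPF β c r u) (τ : St M) : 0 ≤ u τ := by
  by_cases h : sameWalls τ c
  · exact (hu.2.1 τ h).le
  · exact (hu.2.2.1 τ h).ge

theorem IsPF.ip_psi_pos {r r' : ℝ} {u u' : St M → ℝ}
    (hu : IsPF β (cw M true) r u) (hu' : IsPF β (cw M false) r' u') :
    0 < ip (Schonmann.Dop (-(β / 2)) u')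
      (psi 0 (Pi.single 0 1) (Schonmann.Dop β (Schonmann.Dop (-(β / 2)) u))) := by
  have e : ∀ φ : St M → ℝ, ∀ τ, psi 0 (Pi.single 0 1) φ τ = -sp τ 0 * φ (flipTo 0 τ) := by
    intro φ τ
    rw [psi, Finset.sum_eq_single_of_mem 0 (by simp) fun k _ hk => by simp [hk]]
    simp
  simp only [ip, e]
  have hw : sameWalls (flipTo 0 (cw M false)) (cw M true) := by
    unfold sameWalls
    rw [sp_flipTo_le (Nat.zero_le M) le_rfl, sp_flipTo_lt (by omega), sp_cw_zero, sp_cw_zero,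
      sp_cw_succ, sp_cw_succ]
    simp [sval]
  refine Finset.sum_pos' (fun τ _ => ?_) ⟨cw M false, Finset.mem_univ _, ?_⟩
  · by_cases h : sameWalls τ (cw M false)
    · have h0 : -sp τ 0 = 1 := by rw [h.1, sp_cw_zero]; simp [sval]
      rw [h0]
      have h1 := hu.nonneg (flipTo 0 τ)
      have h2 := hu'.nonneg τ
      unfold Schonmann.Dop
      positivity
    · rw [hu'.2.2.1.Dop _ τ h, zero_mul]
  · have h0 : -sp (cw M false) 0 = 1 := by rw [sp_cw_zero]; simp [sval]
    rw [h0]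
    have h1 := hu.2.1 _ hw
    have h2 := hu'.2.1 _ (sameWalls_refl _)
    unfold Schonmann.Dop
    positivity

/-- Positivity of the surface tension below the critical temperature. -/
theorem exists_ratio_le (hβ : 0 < β) (hs : 1 < Real.sinh (2 * β)) :
    ∃ m : ℝ, 0 ≤ m ∧ m < 1 ∧ ∀ M, 1 ≤ M → ∀ (r r' : ℝ) (u u' : St M → ℝ), IsPF β (cw M true) r u →
      IsPF β (cw M false) r' u' → r' / r ≤ m := by
  set s := Real.sinh (2 * β) with hsd
  set c := Real.cosh (2 * β) with hcd
  have hcs : c ^ 2 = s ^ 2 + 1 := Real.cosh_sq _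
  have hc1 : 0 < c := Real.cosh_pos _
  have hcs1 : s < c := Real.sinh_lt_cosh _
  have ev : ∀ᶠ μ in 𝓝 (1 : ℝ), 0 < 2 * c ^ 2 * μ - s - s * μ ^ 2 ∧
      0 < s ^ 3 - 2 * c * s * (s - μ) - 2 * c ^ 2 * μ + c ^ 2 * s + s * μ ^ 2 ∧
      0 < s ^ 3 + 2 * c * s * (s - μ) - 2 * c ^ 2 * μ + c ^ 2 * s + s * μ ^ 2 ∧
      -1 < (c - μ) / s ∧ (c - μ) / s < 1 := by
    have hpos : ∀ f : ℝ → ℝ, Continuous f → 0 < f 1 → ∀ᶠ μ in 𝓝 (1 : ℝ), 0 < f μ :=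
      fun f hf h => hf.continuousAt.eventually (lt_mem_nhds h)
    have e3 : s ^ 3 = s * (c ^ 2 - 1) := by rw [hcs]; ring
    refine (hpos _ (by fun_prop) ?_).and ((hpos _ (by fun_prop) ?_).and
      ((hpos _ (by fun_prop) ?_).and (Eventually.and ?_ ?_)))
    · nlinarith
    · have : 0 < 2 * (c * ((s - 1) * (c - s))) := by
        have := sub_pos.2 hs
        have := sub_pos.2 hcs1
        positivity
      rw [e3]
      linarith
    · have : 0 < 2 * (c * ((s - 1) * (c + s))) := by
        have := sub_pos.2 hs
        positivity
      rw [e3]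
      linarith
    · have hf : Continuous fun μ : ℝ => (c - μ) / s := by fun_prop
      refine hf.continuousAt.eventually (lt_mem_nhds ?_)
      rw [lt_div_iff₀ (by linarith)]
      linarith
    · have hf : Continuous fun μ : ℝ => (c - μ) / s := by fun_prop
      refine hf.continuousAt.eventually (gt_mem_nhds ?_)
      rw [div_lt_iff₀ (by linarith)]
      nlinarith
  obtain ⟨l, hl, hlI⟩ := exists_Ioc_subset_of_mem_nhds ev ⟨0, one_pos⟩
  refine ⟨max l 0, le_max_right _ _, max_lt hl one_pos, fun M hM r r' u u' hu hu' => ?_⟩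
  by_contra! hlt
  have hr := hu.1
  have hle : r' / r ≤ 1 := (div_le_one hr).2 (hu.le_of_walls hβ.le hM hu')
  obtain ⟨h1, h2, h3, h4, h5⟩ := hlI ⟨(le_max_left _ _).trans_lt hlt, hle⟩
  set μ := r' / r with hμd
  have hμ : 0 < μ := div_pos hu'.1 hr
  have hs0 : s ≠ 0 := by linarith
  have rel := hu.ip_psi_rel hβ hu'
  have pos := hu.ip_psi_pos hu'
  set x := Schonmann.Dop (-(β / 2)) u
  set x' := Schonmann.Dop (-(β / 2)) u'
  have relD : ∀ a b : ℕ → ℝ, ip (Dop β x') (psi a b x) = ip x'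
      (psi (fun k => c * a k - s * b k) (fun k => c * b k - s * a k) (Dop β x)) := by
    intro a b
    rw [ip_Dop, Dop_psi]
  set X := Dop β x
  set Y := Dop β x'
  have rel' : ∀ a b : ℕ → ℝ, μ * ip x' (psi a b X) = ip Y (psi (tra M β a b) (trb β a b) x) := by
    intro a b
    rw [hμd, div_mul_eq_mul_div, rel, mul_div_cancel_left₀ _ hr.ne']
  have etra : ∀ a b k, tra M β a b k = if k < M then (c * a k + b (k + 1)) / s else a k :=
    fun _ _ _ => rfl
  have etrb : ∀ a b k, trb β a b k = if k = 0 then b k else (c * b k + a (k - 1)) / s :=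
    fun _ _ _ => rfl
  clear_value X Y x x' s c μ
  set A : ℕ → ℝ := fun k => ip x' (psi (Pi.single k 1) 0 X)
  set B : ℕ → ℝ := fun k => ip x' (psi 0 (Pi.single k 1) X)
  set lA : ℕ → ℝ := fun k => ip Y (psi (Pi.single k 1) 0 x)
  set lB : ℕ → ℝ := fun k => ip Y (psi 0 (Pi.single k 1) x)
  have hlA : ∀ k, lA k = c * A k + -s * B k := fun k => by
    refine (relD _ _).trans (ip_psi_lin (fun j _ => ?_) fun j _ => ?_) <;> simp
  have hlB : ∀ k, lB k = c * B k + -s * A k := fun k => by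
    refine (relD _ _).trans (ip_psi_lin (fun j _ => ?_) fun j _ => ?_) <;> simp
  have relB0 : μ * B 0 = 1 * lB 0 + 0 * lB 0 := by
    refine (rel' _ _).trans (ip_psi_lin (fun j hj => ?_) fun j hj => ?_) <;>
    simp only [etra, etrb, Pi.single_apply, Pi.zero_apply] <;> split_ifs <;>
      first | (exfalso; omega) | simp
  have relAM : μ * A M = 1 * lA M + 0 * lA M := by
    refine (rel' _ _).trans (ip_psi_lin (fun j hj => ?_) fun j hj => ?_) <;>
    simp only [etra, etrb, Pi.single_apply, Pi.zero_apply] <;> split_ifs <;>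
      first | (exfalso; omega) | simp
  have relA : ∀ k < M, μ * A k = c / s * lA k + 1 / s * lB (k + 1) := by
    intro k hk
    refine (rel' _ _).trans (ip_psi_lin (fun j hj => ?_) fun j hj => ?_) <;>
    simp only [etra, etrb, Pi.single_apply, Pi.zero_apply] <;> split_ifs <;>
      first | (exfalso; omega) | simp
  have relB : ∀ k < M, μ * B (k + 1) = c / s * lB (k + 1) + 1 / s * lA k := by
    intro k hk
    refine (rel' _ _).trans (ip_psi_lin (fun j hj => ?_) fun j hj => ?_) <;>
    simp only [etra, etrb, Pi.single_apply, Pi.zero_apply] <;> split_ifs <;>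
      first | (exfalso; omega) | simp
  simp only [hlA, hlB] at relB0 relAM relA relB
  have hB : ∀ k < M, μ * s * B (k + 1) = s * c * (μ - s) * A k + s ^ 3 * B k := by
    intro k hk
    have e1 := relA k hk
    have e2 := relB k hk
    field_simp at e1 e2
    have e3 : s ^ 3 = s * (c ^ 2 - 1) := by rw [hcs]; ring
    rw [e3]
    linear_combination e2 - c * e1 - c * A k * hcs
  have hsp : 0 < s := by linarith
  refine cone_recursion (κ := (c - μ) / s) hsp hμ hcs h1 h2 h3 h4 h5 pos ?_ ?_ hB fun k hk => ?_
  · rw [div_mul_eq_mul_div, eq_div_iff hs0]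
    change A 0 * s = (c - μ) * B 0
    linarith
  · rw [div_mul_eq_mul_div, eq_div_iff hs0]
    linarith
  · have e1 := relA k hk
    have e2 := hB k hk
    field_simp at e1
    refine mul_left_cancel₀ hs0 ?_
    linear_combination s * μ * e1 + c * e2

end Schonmann
end

noncomputable section
open scoped Classical
namespace Schonmann

section
variable {M : ℕ} {β : ℝ}

/-- Euclidean norm of a function on column states. -/
def nr (φ : St M → ℝ) : ℝ := ‖(WithLp.toLp 2 φ : EuclideanSpace ℝ (St M))‖

theorem nr_nonneg (φ : St M → ℝ) : 0 ≤ nr φ := norm_nonneg _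

theorem nr_sq (φ : St M → ℝ) : nr φ ^ 2 = ip φ φ := by
  rw [nr, EuclideanSpace.norm_sq_eq, ip]
  exact Finset.sum_congr rfl fun τ _ => by rw [Real.norm_eq_abs, sq_abs, sq]

theorem nr_add_le (φ χ : St M → ℝ) : nr (fun τ => φ τ + χ τ) ≤ nr φ + nr χ :=
  norm_add_le (WithLp.toLp 2 φ : EuclideanSpace ℝ (St M)) (WithLp.toLp 2 χ)

theorem abs_ip_le (φ χ : St M → ℝ) : |ip φ χ| ≤ nr φ * nr χ := by
  refine abs_le_of_sq_le_sq ?_ (mul_nonneg (nr_nonneg _) (nr_nonneg _))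
  rw [mul_pow, nr_sq, nr_sq]
  simp only [ip, ← sq]
  exact Finset.sum_mul_sq_le_sq_mul_sq _ _ _

theorem nr_le_of_sq {φ : St M → ℝ} {c : ℝ} (hc : 0 ≤ c) (h : ip φ φ ≤ c ^ 2) : nr φ ≤ c :=
  (sq_le_sq₀ (nr_nonneg _) hc).1 ((nr_sq φ).trans_le h)

theorem nf_nonneg (a b : ℕ → ℝ) : 0 ≤ nf M a b :=
  Finset.sum_nonneg fun _ _ => add_nonneg (sq_nonneg _) (sq_nonneg _)

theorem nr_psi_le (a b : ℕ → ℝ) (φ : St M → ℝ) :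
    nr (psi a b φ) ≤ √2 * √(nf M a b) * nr φ := by
  refine nr_le_of_sq (mul_nonneg (by positivity) (nr_nonneg _)) ((ip_psi_self_le a b φ).trans ?_)
  rw [mul_pow, mul_pow, Real.sq_sqrt zero_le_two, Real.sq_sqrt (nf_nonneg _ _), nr_sq]

theorem nr_pos {φ : St M → ℝ} {τ : St M} (h : φ τ ≠ 0) : 0 < nr φ := by
  refine norm_pos_iff.2 fun h0 => h ?_
  exact congrFun (congrArg WithLp.ofLp h0) τ

/-! ### The symmetrized transfer operator acting on fermions -/

/-- Action of the vertical half step on the `a` coefficients. -/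
def osx (β : ℝ) (a b : ℕ → ℝ) (k : ℕ) : ℝ := Real.cosh β * a k - Real.sinh β * b k

/-- Action of the symmetrized transfer operator on the `a` coefficients. -/
def osa (M : ℕ) (β : ℝ) (a b : ℕ → ℝ) : ℕ → ℝ :=
  osx β (tra M β (osx β a b) (osx β b a)) (trb β (osx β a b) (osx β b a))

/-- Action of the symmetrized transfer operator on the `b` coefficients. -/
def osb (M : ℕ) (β : ℝ) (a b : ℕ → ℝ) : ℕ → ℝ :=
  osx β (trb β (osx β a b) (osx β b a)) (tra M β (osx β a b) (osx β b a))

theorem Dop_half_psi (a b : ℕ → ℝ) (φ : St M → ℝ) :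
    Dop (β / 2) (psi a b φ) = psi (osx β a b) (osx β b a) (Dop (β / 2) φ) := by
  rw [Dop_psi, mul_div_cancel₀ β two_ne_zero]
  rfl

theorem Wop_psi (hβ : 0 < β) (a b : ℕ → ℝ) (φ : St M → ℝ) :
    Wop β (psi a b φ) = psi (osa M β a b) (osb M β a b) (Wop β φ) := by
  rw [Wop, Dop_half_psi, Kop_psi hβ, Dop_half_psi]
  rfl

theorem Supp.psi {φ : St M → ℝ} (h : Supp (cw M true) φ) (a b : ℕ → ℝ) :
    Supp (cw M false) (psi a b φ) := by
  intro τ hτ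
  refine Finset.sum_eq_zero fun k hk => ?_
  rw [Finset.mem_range] at hk
  rw [h, mul_zero]
  intro hw
  apply hτ
  unfold sameWalls at hw ⊢
  rw [sp_flipTo_le (by omega) (Nat.zero_le _), sp_flipTo_lt (by omega), sp_cw_zero, sp_cw_succ] at hw
  rw [sp_cw_zero, sp_cw_succ]
  refine ⟨?_, hw.2⟩
  simp only [sval] at hw ⊢
  simp at hw ⊢
  linarith

theorem IsPF.nr_Wop_le {c : St M} {r : ℝ} {u : St M → ℝ} (hu : IsPF β c r u) {φ : St M → ℝ}
    (hφ : Supp c φ) : nr (Wop β φ) ≤ r * nr φ := by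
  refine nr_le_of_sq (mul_nonneg hu.1.le (nr_nonneg _)) ((hu.schur hφ).trans ?_)
  rw [mul_pow, nr_sq]

/-- Norm of a fermion applied to an iterate of the transfer operator, in terms of an approximate
solution of the evolution equation for the coefficients. -/
theorem nr_psi_iterate_le (hβ : 0 < β) {r r' : ℝ} {u' : St M → ℝ} (hr : r' ≤ r)
    (hu' : IsPF β (cw M false) r' u') {v : ℕ → St M → ℝ} (hv : ∀ n, v (n + 1) = Wop β (v n))
    (hs : ∀ n, Supp (cw M true) (v n)) {n T : ℕ} {B : ℝ}
    (hB : ∀ t ≤ T, r ^ t * nr (v (n + T - t)) ≤ B) (a b : ℕ → ℕ → ℝ) :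
    nr (psi (a 0) (b 0) (v (n + T))) ≤ √2 * (∑ t ∈ Finset.range T,
      √(nf M (a t - osa M β (a (t + 1)) (b (t + 1))) (b t - osb M β (a (t + 1)) (b (t + 1))))
        + √(nf M (a T) (b T))) * B := by
  have hr0 : 0 ≤ r := hu'.1.le.trans hr
  have key : ∀ i ≤ T, nr (psi (a 0) (b 0) (v (n + T))) ≤ √2 * (∑ t ∈ Finset.range i,
      √(nf M (a t - osa M β (a (t + 1)) (b (t + 1))) (b t - osb M β (a (t + 1)) (b (t + 1))))) * B
        + r ^ i * nr (psi (a i) (b i) (v (n + T - i))) := by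
    intro i
    induction i with
    | zero => simp
    | succ i ih =>
      intro hi
      refine (ih (by omega)).trans ?_
      rw [Finset.sum_range_succ, mul_add, add_mul, add_assoc]
      refine add_le_add_right ?_ _
      have e : v (n + T - i) = Wop β (v (n + T - (i + 1))) := by
        rw [← hv]
        congr 1
        omega
      set e₁ := a i - osa M β (a (i + 1)) (b (i + 1))
      set e₂ := b i - osb M β (a (i + 1)) (b (i + 1))
      have h1 : psi (a i) (b i) (v (n + T - i)) = fun τ => psi e₁ e₂ (v (n + T - i)) τ
          + Wop β (psi (a (i + 1)) (b (i + 1)) (v (n + T - (i + 1)))) τ := by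
        ext τ
        rw [Wop_psi hβ, ← e, ← one_mul (psi e₁ e₂ _ τ), ← one_mul (psi (osa _ _ _ _) _ _ τ), ← psi_lin]
        congr 1 <;> ext k <;> simp [e₁, e₂]
      rw [h1]
      have h2 := hu'.nr_Wop_le ((hs (n + T - (i + 1))).psi (a (i + 1)) (b (i + 1)))
      have h3 := nr_psi_le e₁ e₂ (v (n + T - i))
      have h4 := hB i (by omega)
      calc _ ≤ r ^ i * (√2 * √(nf M e₁ e₂) * nr (v (n + T - i))
            + r' * nr (psi (a (i + 1)) (b (i + 1)) (v (n + T - (i + 1))))) :=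
            mul_le_mul_of_nonneg_left ((nr_add_le _ _).trans (add_le_add h3 h2)) (pow_nonneg hr0 _)
        _ ≤ √2 * √(nf M e₁ e₂) * (r ^ i * nr (v (n + T - i)))
            + r ^ (i + 1) * nr (psi (a (i + 1)) (b (i + 1)) (v (n + T - (i + 1)))) := by
            have := mul_le_mul_of_nonneg_left (mul_le_mul_of_nonneg_right hr
              (nr_nonneg (psi (a (i + 1)) (b (i + 1)) (v (n + T - (i + 1)))))) (pow_nonneg hr0 i)
            rw [pow_succ]
            linarith
        _ ≤ _ := by gcongr
  refine (key T le_rfl).trans ?_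
  rw [mul_add, add_mul]
  refine add_le_add_right ?_ _
  have h1 := nr_psi_le (a T) (b T) (v (n + T - T))
  have h2 := hB T le_rfl
  calc _ ≤ r ^ T * (√2 * √(nf M (a T) (b T)) * nr (v (n + T - T))) :=
        mul_le_mul_of_nonneg_left h1 (pow_nonneg hr0 _)
    _ = √2 * √(nf M (a T) (b T)) * (r ^ T * nr (v (n + T - T))) := by ring
    _ ≤ _ := by gcongr

/-- The iterates of the transfer operator asymptotically grow at the rate of its eigenvalue. -/
theorem IsPF.exists_growth {r : ℝ} {c : St M} {u : St M → ℝ} (hu : IsPF β c r u)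
    {v : ℕ → St M → ℝ} (hv : ∀ n, v (n + 1) = Wop β (v n)) (hs : ∀ n, Supp c (v n))
    (h0 : ∀ τ, 0 ≤ v 0 τ) (hc : 0 < v 0 c) (T : ℕ) :
    ∃ n, 0 < nr (v (n + T)) ∧ ∀ t ≤ T, r ^ t * nr (v (n + T - t)) ≤ 2 * nr (v (n + T)) := by
  have hr := hu.1
  have hip : ∀ n, ip u (v n) = r ^ n * ip u (v 0) := by
    intro n
    induction n with
    | zero => simp
    | succ n ih =>
      have e : Schonmann.Wop β u = fun τ => r * u τ := funext hu.2.2.2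
      have e2 : ∀ φ χ : St M → ℝ, ip φ (Schonmann.Wop β χ) = ip (Schonmann.Wop β φ) χ := by
        intro φ χ
        rw [Schonmann.Wop, Schonmann.Wop, ← ip_Dop, ← ip_Kop, ← ip_Dop]
      rw [hv, e2, e, pow_succ, mul_right_comm, ← ih]
      simp only [ip, Finset.sum_mul]
      exact Finset.sum_congr rfl fun _ _ => by ring
  have hpos : 0 < ip u (v 0) :=
    Finset.sum_pos' (fun τ _ => mul_nonneg (hu.nonneg τ) (h0 τ))
      ⟨c, Finset.mem_univ _, mul_pos (hu.2.1 c (sameWalls_refl c)) hc⟩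
  have hun : 0 < nr u := nr_pos (hu.2.1 c (sameWalls_refl c)).ne'
  have hlow : ∀ n, r ^ n * (ip u (v 0) / nr u) ≤ nr (v n) := by
    intro n
    rw [← mul_div_assoc, ← hip, div_le_iff₀ hun, mul_comm]
    exact (le_abs_self _).trans (abs_ip_le _ _)
  have hstep : ∀ n t, nr (v (n + t)) ≤ r ^ t * nr (v n) := by
    intro n t
    induction t with
    | zero => simp
    | succ t ih =>
      rw [← add_assoc, hv, pow_succ, mul_comm _ r, mul_assoc]
      exact (hu.nr_Wop_le (hs _)).trans (mul_le_mul_of_nonneg_left ih hr.le)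
  have hex : ∃ n, r ^ T * nr (v n) ≤ 2 * nr (v (n + T)) := by
    by_contra! hcon
    have hgeo : ∀ j : ℕ, 2 ^ j * nr (v (j * T)) ≤ r ^ (j * T) * nr (v 0) := by
      intro j
      induction j with
      | zero => simp
      | succ j ih =>
        have h1 := hcon (j * T)
        rw [add_mul, one_mul, pow_succ, pow_add]
        have h2 := mul_le_mul_of_nonneg_left ih (pow_nonneg hr.le T)
        have h3 := mul_le_mul_of_nonneg_left h1.le (pow_nonneg (zero_le_two (α := ℝ)) j)
        linarith
    have hb : ∀ j : ℕ, 2 ^ j ≤ nr (v 0) / (ip u (v 0) / nr u) := by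
      intro j
      rw [le_div_iff₀ (div_pos hpos hun)]
      have h1 := hgeo j
      have h2 := mul_le_mul_of_nonneg_left (hlow (j * T)) (pow_nonneg (zero_le_two (α := ℝ)) j)
      have h3 := pow_pos hr (j * T)
      refine le_of_mul_le_mul_left ?_ h3
      linarith
    obtain ⟨j, hj⟩ := pow_unbounded_of_one_lt (nr (v 0) / (ip u (v 0) / nr u)) one_lt_two
    exact absurd (hb j) (not_le.2 hj)
  obtain ⟨n, hn⟩ := hex
  refine ⟨n, (mul_pos (pow_pos hr _) (div_pos hpos hun)).trans_le (hlow _), fun t ht => ?_⟩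
  refine le_trans ?_ hn
  have h1 := hstep n (T - t)
  rw [← Nat.add_sub_assoc ht] at h1
  refine (mul_le_mul_of_nonneg_left h1 (pow_nonneg hr.le t)).trans (le_of_eq ?_)
  rw [← mul_assoc, ← pow_add, Nat.add_sub_cancel' ht]

/-- The sign of the height `x` spin after a flip up to height `k`. -/
def sgn (x k : ℕ) : ℝ := if x ≤ k then -1 else 1

theorem psi_sp_mul (a b : ℕ → ℝ) {x : ℕ} (φ : St M → ℝ) :
    psi a b (fun τ => sp τ x * φ τ)
      = fun τ => sp τ x * psi (fun k => sgn x k * a k) (fun k => sgn x k * b k) φ τ := by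
  ext τ
  simp only [psi, Finset.mul_sum]
  refine Finset.sum_congr rfl fun k hk => ?_
  rw [Finset.mem_range] at hk
  unfold sgn
  split_ifs with h
  · rw [sp_flipTo_le (by omega) h]
    ring
  · rw [sp_flipTo_lt (not_le.1 h)]
    ring

theorem nr_sp_mul (x : ℕ) (φ : St M → ℝ) : nr (fun τ => sp τ x * φ τ) = nr φ := by
  rw [← sq_eq_sq₀ (nr_nonneg _) (nr_nonneg _), nr_sq, nr_sq]
  refine Finset.sum_congr rfl fun τ _ => ?_
  linear_combination φ τ * φ τ * sp_mul_self τ x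

/-- A fermion and its partner which almost annihilate `v` force the spin to be centred. -/
theorem ip_sp_le (a b : ℕ → ℝ) (x : ℕ) (v : St M → ℝ) :
    √2 * √(nf M a b) * ip v (fun τ => sp τ x * v τ)
      ≤ (nr (psi a b v) + nr (psi (fun k => sgn x k * a k) (fun k => -(sgn x k * b k)) v)) * nr v := by
  set g := √2 * √(nf M a b) with hg
  have hg2 : g * g = 2 * nf M a b := by
    rw [← sq, hg, mul_pow, Real.sq_sqrt zero_le_two, Real.sq_sqrt (nf_nonneg _ _)]
  rcases (show 0 ≤ g by positivity).eq_or_lt with h0 | h0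
  · rw [← h0, zero_mul]
    exact mul_nonneg (add_nonneg (nr_nonneg _) (nr_nonneg _)) (nr_nonneg _)
  · refine le_of_mul_le_mul_left ?_ h0
    rw [← mul_assoc, hg2, ← ip_psi_psi_add]
    have h1 := (le_abs_self _).trans (abs_ip_le (psi a b v) (psi a b fun τ => sp τ x * v τ))
    have h2 := (le_abs_self _).trans (abs_ip_le (psi a (-b) v) (psi a (-b) fun τ => sp τ x * v τ))
    have h3 := nr_psi_le a b fun τ => sp τ x * v τ
    have h4 := nr_psi_le a (-b) v
    rw [nr_sp_mul] at h3
    rw [show nf M a (-b) = nf M a b by simp [nf]] at h4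
    have h5 : nr (psi a (-b) fun τ => sp τ x * v τ)
        = nr (psi (fun k => sgn x k * a k) (fun k => -(sgn x k * b k)) v) := by
      rw [psi_sp_mul, nr_sp_mul]
      simp
    rw [h5] at h2
    have h6 := mul_le_mul_of_nonneg_left h3 (nr_nonneg (psi a b v))
    have h7 := mul_le_mul_of_nonneg_right h4
      (nr_nonneg (psi (fun k => sgn x k * a k) (fun k => -(sgn x k * b k)) v))
    linarith

end
end Schonmann
end

noncomputable section
open scoped Classical
namespace Schonmann

section
variable {M : ℕ} {β : ℝ}

theorem iterate_Kop_apply (c : St M) (m : ℕ) (χ : St M → ℝ) :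
    (fun φ : St M → ℝ => Kop β fun τ => vw β 0 τ * φ τ)^[m] (Kop β χ) c
      = ip (Gf β (vw β) c m) χ := by
  induction m generalizing χ with
  | zero => exact Finset.sum_congr rfl fun τ _ => by rw [Kw_comm, Gf]
  | succ m ih =>
    rw [Function.iterate_succ_apply, ih, Gf, ip_Kop]
    exact Finset.sum_congr rfl fun τ _ => by simp only [vw]; ring

/-- Insertion of an observable of the central column in a path sum. -/
theorem Gf_insert (c : St M) (P : ℕ) (φ : St M → ℝ) :
    Gf β (fun i τ => vw β i τ * if i = P then φ τ else 1) c (2 * P + 1) c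
      = ip (Gf β (vw β) c P) (fun τ => vw β P τ * φ τ * Gf β (vw β) c P τ) := by
  have h1 : ∀ n ≤ P, Gf β (fun i τ => vw β i τ * if i = P then φ τ else 1) c n
      = Gf β (vw β) c n := by
    intro n
    induction n with
    | zero => exact fun _ => rfl
    | succ n ih =>
      intro hn
      rw [Gf, Gf, ih (by omega)]
      simp only [if_neg (show ¬n = P by omega), mul_one]
  have h2 : ∀ m, Gf β (fun i τ => vw β i τ * if i = P then φ τ else 1) c (P + 1 + m)
      = (fun φ : St M → ℝ => Kop β fun τ => vw β 0 τ * φ τ)^[m]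
        (Kop β fun τ => vw β P τ * φ τ * Gf β (vw β) c P τ) := by
    intro m
    induction m with
    | zero =>
      rw [add_zero, Gf, h1 P le_rfl, Function.iterate_zero_apply]
      simp only [if_true]
    | succ m ih =>
      rw [← add_assoc, Gf, ih, Function.iterate_succ_apply']
      simp only [if_neg (show ¬P + 1 + m = P by omega), mul_one]
      rfl
  rw [show 2 * P + 1 = P + 1 + P by omega, h2, iterate_Kop_apply]

/-- Half-infinite cylinder vectors. -/
def vh (M : ℕ) (β : ℝ) (n : ℕ) : St M → ℝ := Dop (β / 2) (Gf β (vw β) (cw M true) n)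

theorem vh_succ (n : ℕ) : vh M β (n + 1) = Wop β (vh M β n) := by
  rw [vh, vh, Wop, Dop_Dop, Gf]
  congr 2
  ext τ
  rw [Dop, vw]
  congr 3
  ring

theorem ip_vh (n : ℕ) (φ : St M → ℝ) : ip (vh M β n) (fun τ => φ τ * vh M β n τ)
    = ip (Gf β (vw β) (cw M true) n) (fun τ => vw β n τ * φ τ * Gf β (vw β) (cw M true) n τ) := by
  refine Finset.sum_congr rfl fun τ _ => ?_
  simp only [vh, Dop, vw]
  rw [show β * vert τ = β / 2 * vert τ + β / 2 * vert τ by ring, Real.exp_add]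
  ring

theorem supp_vh (n : ℕ) : Supp (cw M true) (vh M β n) := by
  induction n with
  | zero => exact Supp.Dop (fun τ hτ => Kw_eq_zero hτ) _
  | succ n ih =>
    rw [vh_succ]
    exact ih.Wop

theorem vh_zero_nonneg (τ : St M) : 0 ≤ vh M β 0 τ :=
  mul_nonneg (Real.exp_pos _).le (Kw_nonneg _ _ _)

theorem vh_zero_pos : 0 < vh M β 0 (cw M true) :=
  mul_pos (Real.exp_pos _) (Kw_pos (sameWalls_refl _))

theorem sp_cw_true (j : ℕ) : sp (cw M true) j = 1 := by
  rw [sp]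
  split_ifs
  · simp [cw, sval]
  · rfl

theorem sum_wt_insert (hM : 1 ≤ M) (o : ℤ) (P : ℕ) (φ : St M → ℝ) :
    ∑ ω ∈ Cf (rc o (2 * P + 1) M) (fun _ => true),
        wt β (rc o (2 * P + 1) M) ω * φ (colSt M o (P + 1) ω)
      = ip (vh M β P) (fun τ => φ τ * vh M β P τ) := by
  rw [ip_vh, ← Gf_insert, ← sum_pathW β o _ _ (cw M true) (cw M true) (fun _ => true) (sameWalls_refl _)]
  · refine Finset.sum_congr rfl fun ω _ => ?_
    rw [wt_rc hM β o (by omega), pathW, pathW, mul_assoc]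
    congr 1
    have h1 : φ (colSt M o (P + 1) ω)
        = ∏ i ∈ Finset.range (2 * P + 1), if i = P then φ (colSt M o (i + 1) ω) else 1 := by
      rw [Finset.prod_ite_eq' (Finset.range (2 * P + 1)) P fun i => φ (colSt M o (i + 1) ω),
        if_pos (Finset.mem_range.2 (by omega))]
    rw [h1, ← Finset.prod_mul_distrib]
    refine Finset.prod_congr rfl fun i _ => ?_
    simp only [vw]
    ring
  · intro j hj
    rw [sp_cw_true, sp_colSt (by omega)]
    rfl
  · intro j hj
    rw [sp_cw_true, sp_colSt (by omega)]
    rfl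
  · intro i _ _
    unfold sameWalls
    rw [sp_cw_true, sp_cw_true, sp_colSt (by omega), sp_colSt (by omega)]
    exact ⟨rfl, rfl⟩

/-- The plus magnetization is at most the magnetization of a site of a finite cylinder. -/
theorem EP_mul_le_ip (hβ : 0 ≤ β) {x : ℕ} (hx : 1 ≤ x) (hxM : x ≤ M) (P : ℕ) :
    (2 * EP β {0} - 1) * ip (vh M β P) (vh M β P)
      ≤ ip (vh M β P) (fun τ => sp τ x * vh M β P τ) := by
  set Λ := rc (-(x : ℤ)) (2 * P + 1) M with hΛ
  have h1 := sum_wt_insert (β := β) (hx.trans hxM) (-(x : ℤ)) P (fun τ => sp τ x)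
  have h2 := sum_wt_insert (β := β) (hx.trans hxM) (-(x : ℤ)) P (fun _ => 1)
  have hZ := sum_wt_pos β Λ (Cf_nonempty Λ (fun _ => true))
  simp only [mul_one, one_mul] at h2
  rw [← h1, ← h2, ← hΛ]
  have h3 : EP β {0} ≤ pr β Λ (fun _ => true) (plusOn {(P : ℤ) + 1}) := by
    have h4 := EP_le_pr hβ {0} (tr (-((P : ℤ) + 1)) Λ)
    have h5 : ({0} : Finset ℤ) = shiftF (-((P : ℤ) + 1)) {(P : ℤ) + 1} := by
      ext j
      rw [mem_shiftF, Finset.mem_singleton, Finset.mem_singleton]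
      omega
    rwa [h5, pr_tr_plusOn, ← h5] at h4
  have h6 : (2 * pr β Λ (fun _ => true) (plusOn {(P : ℤ) + 1}) - 1)
      * ∑ ω ∈ Cf Λ (fun _ => true), wt β Λ ω
      = ∑ ω ∈ Cf Λ (fun _ => true), wt β Λ ω * sp (colSt M (-(x : ℤ)) (P + 1) ω) x := by
    rw [pr, ex, exs, sub_mul, mul_assoc, div_mul_cancel₀ _ hZ.ne', one_mul, Finset.mul_sum,
      ← Finset.sum_sub_distrib]
    refine Finset.sum_congr rfl fun ω _ => ?_
    rw [sp_colSt (by omega), ind, plusOn_singleton, neg_add_cancel]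
    simp only [Set.mem_ofPred_eq]
    push_cast
    rcases Bool.eq_false_or_eq_true (ω ((P : ℤ) + 1, 0)) with h | h <;> simp [h, sval] <;> ring
  rw [← h6]
  exact mul_le_mul_of_nonneg_right (by linarith) hZ.le

end

end Schonmann
end

noncomputable section
open scoped Classical
namespace Schonmann

/-! ### A discrete holomorphic function at the critical point -/

theorem cpow_taylor {q : ℝ} (hq : 0 ≤ q) (hq1 : q ≤ 1) {w : ℂ} (hw : 5 ≤ w.re) :
    ∃ d : ℂ, ∀ ζ : ℂ, ‖ζ - w‖ ≤ 1 → ‖ζ ^ ((-q : ℝ) : ℂ) - w ^ ((-q : ℝ) : ℂ) - d * (ζ - w)‖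
      ≤ 4 * ‖w‖ ^ (-q - 2) := by
  have hwn : 5 ≤ ‖w‖ := hw.trans (Complex.re_le_norm w)
  have hconv : Convex ℝ (Metric.closedBall w 1) := convex_closedBall w 1
  have hww : w ∈ Metric.closedBall w 1 := Metric.mem_closedBall_self zero_le_one
  have hre : ∀ ζ ∈ Metric.closedBall w 1, 4 ≤ ζ.re := by
    intro ζ hζ
    have h1 := (Complex.abs_re_le_norm (ζ - w)).trans (mem_closedBall_iff_norm.1 hζ)
    rw [Complex.sub_re, abs_le] at h1
    linarith
  have hslit : ∀ ζ ∈ Metric.closedBall w 1, ζ ∈ Complex.slitPlane := fun ζ hζ =>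
    Or.inl (by linarith [hre ζ hζ])
  have hnorm : ∀ ζ ∈ Metric.closedBall w 1, 4 / 5 * ‖w‖ ≤ ‖ζ‖ := by
    intro ζ hζ
    have h1 := mem_closedBall_iff_norm.1 hζ
    have h2 := norm_sub_norm_le w ζ
    rw [norm_sub_rev] at h2
    linarith
  have hder : ∀ p : ℝ, ∀ ζ ∈ Metric.closedBall w 1, HasDerivAt (fun z : ℂ => z ^ (p : ℂ))
      ((p : ℂ) * ζ ^ ((p - 1 : ℝ) : ℂ)) ζ := by
    intro p ζ hζ
    have := (hasDerivAt_id ζ).cpow_const (c := (p : ℂ)) (hslit ζ hζ)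
    simpa using this
  set B : ℝ := 4 * ‖w‖ ^ (-q - 2) with hB
  have hB0 : 0 ≤ B := by positivity
  have h2 : ∀ ζ ∈ Metric.closedBall w 1,
      ‖((-q : ℝ) : ℂ) * (((-q - 1 : ℝ) : ℂ) * ζ ^ ((-q - 1 - 1 : ℝ) : ℂ))‖ ≤ B := by
    intro ζ hζ
    rw [norm_mul, norm_mul, Complex.norm_cpow_real, Complex.norm_real, Complex.norm_real,
      Real.norm_eq_abs, Real.norm_eq_abs, abs_neg, abs_of_nonneg hq,
      show -q - 1 = -(q + 1) by ring, abs_neg, abs_of_nonneg (by linarith : 0 ≤ q + 1),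
      show -(q + 1) - 1 = -q - 2 by ring]
    have h3 : ‖ζ‖ ^ (-q - 2) ≤ (4 / 5 * ‖w‖) ^ (-q - 2) :=
      Real.rpow_le_rpow_of_nonpos (by linarith) (hnorm ζ hζ) (by linarith)
    rw [Real.mul_rpow (by norm_num) (norm_nonneg w)] at h3
    have h4 : (4 / 5 : ℝ) ^ (-q - 2) ≤ 2 := by
      have h5 : (4 / 5 : ℝ) ^ (-q - 2) ≤ (4 / 5 : ℝ) ^ (-3 : ℝ) :=
        Real.rpow_le_rpow_of_exponent_ge (by norm_num) (by norm_num) (by linarith)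
      refine h5.trans ?_
      rw [Real.rpow_neg (by norm_num), show (3 : ℝ) = ((3 : ℕ) : ℝ) by norm_num, Real.rpow_natCast]
      norm_num
    have h6 : 0 ≤ ‖w‖ ^ (-q - 2) := by positivity
    have h7 : 0 ≤ ‖ζ‖ ^ (-q - 2) := by positivity
    have h8 : q * ((q + 1) * ‖ζ‖ ^ (-q - 2)) ≤ 1 * (2 * ‖ζ‖ ^ (-q - 2)) := by gcongr; linarith
    nlinarith [mul_le_mul_of_nonneg_right h4 h6]
  refine ⟨((-q : ℝ) : ℂ) * w ^ ((-q - 1 : ℝ) : ℂ), fun ζ hζ => ?_⟩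
  have hζ' : ζ ∈ Metric.closedBall w 1 := mem_closedBall_iff_norm.2 hζ
  have h3 : ∀ ξ ∈ Metric.closedBall w 1, ‖((-q : ℝ) : ℂ) * ξ ^ ((-q - 1 : ℝ) : ℂ)
      - ((-q : ℝ) : ℂ) * w ^ ((-q - 1 : ℝ) : ℂ)‖ ≤ B := by
    intro ξ hξ
    have h4 := hconv.norm_image_sub_le_of_norm_hasDerivWithin_le
      (f := fun z : ℂ => ((-q : ℝ) : ℂ) * z ^ ((-q - 1 : ℝ) : ℂ)) (C := B)
      (fun z hz => ((hder (-q - 1) z hz).const_mul ((-q : ℝ) : ℂ)).hasDerivWithinAt) h2 hww hξ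
    exact h4.trans (mul_le_of_le_one_right hB0 (mem_closedBall_iff_norm.1 hξ))
  have h5 := hconv.norm_image_sub_le_of_norm_hasDerivWithin_le
    (f := fun z : ℂ => z ^ ((-q : ℝ) : ℂ) - (((-q : ℝ) : ℂ) * w ^ ((-q - 1 : ℝ) : ℂ)) * z) (C := B)
    (f' := fun z => ((-q : ℝ) : ℂ) * z ^ ((-q - 1 : ℝ) : ℂ)
      - (((-q : ℝ) : ℂ) * w ^ ((-q - 1 : ℝ) : ℂ)))
    (fun z hz => by
      have := (hder (-q) z hz).sub
        ((hasDerivAt_id z).const_mul (((-q : ℝ) : ℂ) * w ^ ((-q - 1 : ℝ) : ℂ)))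
      rw [mul_one] at this
      exact this.hasDerivWithinAt) h3 hww hζ'
  refine le_trans (le_of_eq ?_) (h5.trans (mul_le_of_le_one_right hB0 hζ))
  congr 1
  ring

/-! ### Sums over the integers -/

theorem summable_bracket {b : ℝ} (hb : 1 < b) :
    Summable fun j : ℤ => (1 + (j : ℝ) ^ 2) ^ (-(b / 2)) := by
  refine Summable.of_nonneg_of_le (fun j => by positivity) (fun j => ?_)
    ((Real.summable_abs_int_rpow hb).add (hasSum_ite_eq (0 : ℤ) (1 : ℝ)).summable)
  by_cases hj : j = 0
  · subst hj
    simp only [if_true]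
    norm_num
    positivity
  · rw [if_neg hj, add_zero]
    have h1 : 0 < |(j : ℝ)| := abs_pos.2 (by exact_mod_cast hj)
    have h2 : |(j : ℝ)| ^ (-b) = (|(j : ℝ)| ^ 2) ^ (-(b / 2)) := by
      rw [← Real.rpow_natCast, ← Real.rpow_mul h1.le]
      congr 1
      push_cast
      ring
    rw [h2, sq_abs]
    exact Real.rpow_le_rpow_of_nonpos (by positivity) (by linarith) (by linarith)

theorem sum_range_shift_le {f : ℤ → ℝ} (hf : Summable f) (h0 : ∀ j, 0 ≤ f j) (n x : ℕ) :
    ∑ k ∈ Finset.range n, f ((k : ℤ) - x) ≤ ∑' j, f j := by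
  rw [← Finset.sum_image (f := f) (s := Finset.range n) (g := fun k : ℕ => (k : ℤ) - x)
    (fun a _ b _ h => by simpa using h)]
  exact hf.sum_le_tsum _ fun j _ => h0 j

end Schonmann
end

noncomputable section
open scoped Classical
namespace Schonmann

/-! ### Almost invariant fermionic coefficients -/

/-- Lattice points seen from height `x`. -/
def zp (x : ℕ) (t k : ℕ) : ℂ := ⟨t + 4, (k : ℝ) - x⟩

/-- The power function with exponent `-1/2-s`. -/
def hp (s : ℝ) (z : ℂ) : ℂ := z ^ ((-(1 / 2 + s) : ℝ) : ℂ)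

/-- First coefficients. -/
def ca (κ : ℂ) (s : ℝ) (x t k : ℕ) : ℝ := (κ * hp s (zp x t k)).re

/-- Second coefficients. -/
def cb (κ : ℂ) (s : ℝ) (x t k : ℕ) : ℝ := -(κ * hp s (zp x t k)).im

theorem norm_hp (s : ℝ) (z : ℂ) : ‖hp s z‖ = ‖z‖ ^ (-(1 / 2 + s)) := by
  rw [hp, Complex.norm_cpow_real]

theorem sq_norm_zp (x t k : ℕ) : ‖zp x t k‖ ^ 2 = (t + 4 : ℝ) ^ 2 + ((k : ℝ) - x) ^ 2 := by
  rw [Complex.sq_norm, Complex.normSq_apply, zp]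
  ring

theorem le_norm_zp (x t k : ℕ) : (t + 4 : ℝ) ≤ ‖zp x t k‖ := Complex.re_le_norm (zp x t k)

theorem four_le_norm_zp (x t k : ℕ) : 4 ≤ ‖zp x t k‖ :=
  le_trans (by linarith [Nat.cast_nonneg (α := ℝ) t]) (le_norm_zp x t k)

theorem bracket_le (x t k : ℕ) : 1 + (((k : ℤ) - (x : ℤ) : ℤ) : ℝ) ^ 2 ≤ ‖zp x t k‖ ^ 2 := by
  rw [sq_norm_zp]
  push_cast
  nlinarith [Nat.cast_nonneg (α := ℝ) t]

section
variable {β : ℝ}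

theorem cosh_bounds (hβ : 0 < β) (hs : Real.sinh (2 * β) = 1) :
    Real.cosh (2 * β) = √2 ∧ 2 * Real.cosh β * Real.sinh β = 1 ∧
    Real.cosh β ^ 2 + Real.sinh β ^ 2 = √2 ∧ Real.cosh β ^ 2 - Real.sinh β ^ 2 = 1 ∧
    0 < Real.sinh β ∧ 0 < Real.cosh β ∧ Real.cosh β + Real.sinh β ≤ 2 := by
  have h1 : Real.cosh (2 * β) = √2 := by
    have := Real.cosh_sq (2 * β)
    rw [hs] at this
    rw [eq_comm, Real.sqrt_eq_iff_eq_sq (by norm_num) (Real.cosh_pos _).le, this]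
    norm_num
  have h2 := Real.sinh_two_mul β
  have h3 := Real.cosh_two_mul β
  have h4 := Real.cosh_sq_sub_sinh_sq β
  have h5 : 0 < Real.sinh β := Real.sinh_pos_iff.2 hβ
  have h6 := Real.cosh_pos β
  refine ⟨h1, by linarith, by linarith, h4, h5, h6, ?_⟩
  have h7 : (Real.cosh β + Real.sinh β) ^ 2 ≤ 2 ^ 2 := by
    have h8 : √2 ≤ 2 := by rw [Real.sqrt_le_iff]; norm_num
    nlinarith
  exact (sq_le_sq₀ (by positivity) (by norm_num)).1 h7

theorem osa_interior (hβ : 0 < β) (hs : Real.sinh (2 * β) = 1) {M k : ℕ} (hk : 1 ≤ k) (hkM : k < M)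
    (a b : ℕ → ℝ) : osa M β a b k = 2 * a k - √2 * b k - (a (k + 1) + a (k - 1)) / 2
      + Real.cosh β ^ 2 * b (k + 1) + Real.sinh β ^ 2 * b (k - 1) := by
  obtain ⟨h1, h2, h3, h4, -⟩ := cosh_bounds hβ hs
  have h5 : √2 * √2 = 2 := Real.mul_self_sqrt (by norm_num)
  rw [osa, osx, tra, trb, if_pos hkM, if_neg (by omega), hs, h1]
  simp only [osx, div_one]
  linear_combination (√2 * a k) * h3 + a k * h5 - (√2 * b k + (a (k + 1) + a (k - 1)) / 2) * h2

theorem osb_interior (hβ : 0 < β) (hs : Real.sinh (2 * β) = 1) {M k : ℕ} (hk : 1 ≤ k) (hkM : k < M)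
    (a b : ℕ → ℝ) : osb M β a b k = 2 * b k - √2 * a k - (b (k + 1) + b (k - 1)) / 2
      + Real.cosh β ^ 2 * a (k - 1) + Real.sinh β ^ 2 * a (k + 1) := by
  obtain ⟨h1, h2, h3, h4, -⟩ := cosh_bounds hβ hs
  have h5 : √2 * √2 = 2 := Real.mul_self_sqrt (by norm_num)
  rw [osb, osx, tra, trb, if_pos hkM, if_neg (by omega), hs, h1]
  simp only [osx, div_one]
  linear_combination (√2 * b k) * h3 + b k * h5 - (√2 * a k + (b (k + 1) + b (k - 1)) / 2) * h2

theorem abs_osx_le (hβ : 0 < β) (hs : Real.sinh (2 * β) = 1) {a b : ℕ → ℝ} {k : ℕ} {m : ℝ}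
    (ha : |a k| ≤ m) (hb : |b k| ≤ m) : |osx β a b k| ≤ 2 * m := by
  obtain ⟨-, -, -, -, h5, h6, h7⟩ := cosh_bounds hβ hs
  have h8 : 0 ≤ m := (abs_nonneg _).trans ha
  rw [osx]
  refine (abs_sub _ _).trans ?_
  rw [abs_mul, abs_mul, abs_of_pos h5, abs_of_pos h6]
  calc _ ≤ Real.cosh β * m + Real.sinh β * m := by gcongr
    _ = (Real.cosh β + Real.sinh β) * m := by ring
    _ ≤ _ := by gcongr

theorem abs_os_le (hβ : 0 < β) (hs : Real.sinh (2 * β) = 1) {M k : ℕ} {a b : ℕ → ℝ} {m : ℝ}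
    (h : ∀ l, k ≤ l + 1 → l ≤ k + 1 → |a l| ≤ m ∧ |b l| ≤ m) :
    |osa M β a b k| ≤ 12 * m ∧ |osb M β a b k| ≤ 12 * m := by
  have h1 := (cosh_bounds hβ hs).1
  have h2 : √2 ≤ 2 := by rw [Real.sqrt_le_iff]; norm_num
  have hm : 0 ≤ m := (abs_nonneg _).trans (h k (by omega) (by omega)).1
  have hA : ∀ l, k ≤ l + 1 → l ≤ k + 1 → |osx β a b l| ≤ 2 * m ∧ |osx β b a l| ≤ 2 * m :=
    fun l hl hl' => ⟨abs_osx_le hβ hs (h l hl hl').1 (h l hl hl').2,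
      abs_osx_le hβ hs (h l hl hl').2 (h l hl hl').1⟩
  have key : ∀ p q : ℝ, |p| ≤ 2 * m → |q| ≤ 2 * m → |√2 * p + q| ≤ 6 * m := by
    intro p q hp hq
    refine (abs_add_le _ _).trans ?_
    rw [abs_mul, abs_of_nonneg (Real.sqrt_nonneg 2)]
    have : √2 * |p| ≤ 2 * (2 * m) := by gcongr
    linarith
  have hta : |tra M β (osx β a b) (osx β b a) k| ≤ 6 * m := by
    rw [tra, hs, h1, div_one]
    split_ifs
    · exact key _ _ (hA k (by omega) (by omega)).1 (hA (k + 1) (by omega) (by omega)).2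
    · linarith [(hA k (by omega) (by omega)).1]
  have htb : |trb β (osx β a b) (osx β b a) k| ≤ 6 * m := by
    rw [trb, hs, h1, div_one]
    split_ifs
    · linarith [(hA k (by omega) (by omega)).2]
    · exact key _ _ (hA k (by omega) (by omega)).2 (hA (k - 1) (by omega) (by omega)).1
  rw [show 12 * m = 2 * (6 * m) by ring]
  exact ⟨abs_osx_le hβ hs hta htb, abs_osx_le hβ hs htb hta⟩

end

section
variable {β s : ℝ} {κ : ℂ}

theorem abs_coef_le (hκ : ‖κ‖ = 1) (x t k : ℕ) :
    |ca κ s x t k| ≤ ‖zp x t k‖ ^ (-(1 / 2 + s)) ∧ |cb κ s x t k| ≤ ‖zp x t k‖ ^ (-(1 / 2 + s)) := by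
  have h : ‖κ * hp s (zp x t k)‖ = ‖zp x t k‖ ^ (-(1 / 2 + s)) := by
    rw [norm_mul, hκ, one_mul, norm_hp]
  rw [← h, ca, cb, abs_neg]
  exact ⟨Complex.abs_re_le_norm _, Complex.abs_im_le_norm _⟩

theorem coef_sq (hκ : ‖κ‖ = 1) (x t k : ℕ) :
    ca κ s x t k ^ 2 + cb κ s x t k ^ 2 = (‖zp x t k‖ ^ (-(1 / 2 + s))) ^ 2 := by
  have h : ‖κ * hp s (zp x t k)‖ = ‖zp x t k‖ ^ (-(1 / 2 + s)) := by
    rw [norm_mul, hκ, one_mul, norm_hp]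
  rw [← h, Complex.sq_norm, Complex.normSq_apply, ca, cb]
  ring

theorem error_interior (hβ : 0 < β) (hsh : Real.sinh (2 * β) = 1) (hs : 0 ≤ s) (hs1 : s ≤ 1 / 2)
    (hκ : ‖κ‖ = 1) {M x t k : ℕ} (hk : 1 ≤ k) (hkM : k < M) :
    |ca κ s x t k - osa M β (ca κ s x (t + 1)) (cb κ s x (t + 1)) k|
      ≤ 16 * ‖zp x (t + 1) k‖ ^ (-(1 / 2 + s) - 2) ∧
    |cb κ s x t k - osb M β (ca κ s x (t + 1)) (cb κ s x (t + 1)) k|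
      ≤ 16 * ‖zp x (t + 1) k‖ ^ (-(1 / 2 + s) - 2) := by
  obtain ⟨h1, h2, h3, h4, -⟩ := cosh_bounds hβ hsh
  have hs2 : √2 ≤ 2 := by rw [Real.sqrt_le_iff]; norm_num
  set w := zp x (t + 1) k with hw
  obtain ⟨d, hd⟩ := cpow_taylor (q := 1 / 2 + s) (by linarith) (by linarith) (w := w)
    (by rw [hw, zp]; push_cast; linarith [Nat.cast_nonneg (α := ℝ) t])
  set B : ℝ := 4 * ‖w‖ ^ (-(1 / 2 + s) - 2) with hB
  have e0 : zp x t k - w = -1 := by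
    rw [hw]; apply Complex.ext <;> simp [zp]
  have e1 : zp x (t + 1) (k + 1) - w = Complex.I := by
    rw [hw]; apply Complex.ext <;> simp [zp]
  have e2 : zp x (t + 1) (k - 1) - w = -Complex.I := by
    rw [hw]; apply Complex.ext <;> simp [zp, Nat.cast_sub hk]
  have r0 := hd (zp x t k) (by rw [e0]; simp)
  have r1 := hd (zp x (t + 1) (k + 1)) (by rw [e1]; simp)
  have r2 := hd (zp x (t + 1) (k - 1)) (by rw [e2]; simp)
  rw [e0] at r0
  rw [e1] at r1
  rw [e2] at r2
  have key : ∀ ζ v : ℂ, ‖ζ ^ ((-(1 / 2 + s) : ℝ) : ℂ) - w ^ ((-(1 / 2 + s) : ℝ) : ℂ) - d * v‖ ≤ B →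
      |(κ * hp s ζ).re - (κ * hp s w).re - (κ * d * v).re| ≤ B ∧
      |(κ * hp s ζ).im - (κ * hp s w).im - (κ * d * v).im| ≤ B := by
    intro ζ v h
    have h5 : ‖κ * hp s ζ - κ * hp s w - κ * d * v‖ ≤ B := by
      rw [show κ * hp s ζ - κ * hp s w - κ * d * v = κ * (hp s ζ - hp s w - d * v) by ring,
        norm_mul, hκ, one_mul]
      exact h
    rw [← Complex.sub_re, ← Complex.sub_re, ← Complex.sub_im, ← Complex.sub_im]
    exact ⟨(Complex.abs_re_le_norm _).trans h5, (Complex.abs_im_le_norm _).trans h5⟩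
  obtain ⟨a0, b0⟩ := key _ _ r0
  obtain ⟨a1, b1⟩ := key _ _ r1
  obtain ⟨a2, b2⟩ := key _ _ r2
  rw [osa_interior hβ hsh hk hkM, osb_interior hβ hsh hk hkM]
  simp only [ca, cb, ← hw]
  have f1 : (κ * d * (-1)).re = -(κ * d).re := by simp
  have f2 : (κ * d * (-1)).im = -(κ * d).im := by simp
  have f3 : (κ * d * Complex.I).re = -(κ * d).im := by simp
  have f4 : (κ * d * Complex.I).im = (κ * d).re := by simp
  have f5 : (κ * d * -Complex.I).re = (κ * d).im := by simp
  have f6 : (κ * d * -Complex.I).im = -(κ * d).re := by simp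
  rw [f1] at a0
  rw [f2] at b0
  rw [f3] at a1
  rw [f4] at b1
  rw [f5] at a2
  rw [f6] at b2
  have hC0 : 0 ≤ Real.cosh β ^ 2 := sq_nonneg _
  have hS0 : 0 ≤ Real.sinh β ^ 2 := sq_nonneg _
  rw [show 16 * ‖w‖ ^ (-(1 / 2 + s) - 2) = 4 * B by rw [hB]; ring]
  generalize (κ * hp s (zp x t k)).re = A0 at *
  generalize (κ * hp s (zp x t k)).im = B0 at *
  generalize (κ * hp s (zp x (t + 1) (k + 1))).re = A1 at *
  generalize (κ * hp s (zp x (t + 1) (k + 1))).im = B1 at *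
  generalize (κ * hp s (zp x (t + 1) (k - 1))).re = A2 at *
  generalize (κ * hp s (zp x (t + 1) (k - 1))).im = B2 at *
  generalize (κ * hp s w).re = A at *
  generalize (κ * hp s w).im = D at *
  generalize (κ * d).re = p at *
  generalize (κ * d).im = q at *
  generalize Real.cosh β ^ 2 = X at *
  generalize Real.sinh β ^ 2 = Y at *
  have comb : ∀ e0 e1 e2 f1 f2 : ℝ, |e0| ≤ B → |e1| ≤ B → |e2| ≤ B → |f1| ≤ B → |f2| ≤ B →
      |e0 + (e1 + e2) / 2 + X * f1 + Y * f2| ≤ 4 * B := by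
    intro e0 e1 e2 f1 f2 h0 h1 h2 g1 g2
    have g3 : |X * f1 + Y * f2| ≤ 2 * B := by
      refine (abs_add_le _ _).trans ?_
      rw [abs_mul, abs_mul, abs_of_nonneg hC0, abs_of_nonneg hS0]
      have hB0 := (abs_nonneg _).trans h0
      calc _ ≤ X * B + Y * B := by gcongr
        _ = √2 * B := by rw [← h3]; ring
        _ ≤ _ := by gcongr
    rw [abs_le] at *
    constructor <;> linarith
  constructor
  · have := comb _ _ _ _ _ a0 a1 a2 b1 b2
    refine le_of_eq_of_le (congrArg _ ?_) this
    linear_combination D * h3 + p * h4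
  · have hn : ∀ u : ℝ, |u| ≤ B → |-u| ≤ B := fun u hu => by rwa [abs_neg]
    have := comb _ _ _ _ _ (hn _ b0) (hn _ b1) (hn _ b2) (hn _ a2) (hn _ a1)
    refine le_of_eq_of_le (congrArg _ ?_) this
    linear_combination (-A) * h3 + (-q) * h4

end

end Schonmann
end

noncomputable section
open scoped Classical
namespace Schonmann

section
variable {β s : ℝ} {κ : ℂ}

theorem error_wall (hβ : 0 < β) (hsh : Real.sinh (2 * β) = 1) (hs : 0 ≤ s)
    (hκ : ‖κ‖ = 1) {M x k : ℕ} (t : ℕ) (hx : 2 ≤ x) (hk : k = 0 ∨ k = 2 * x) :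
    (ca κ s x t k - osa M β (ca κ s x (t + 1)) (cb κ s x (t + 1)) k) ^ 2
      + (cb κ s x t k - osb M β (ca κ s x (t + 1)) (cb κ s x (t + 1)) k) ^ 2
      ≤ 338 / ((x : ℝ) - 1) := by
  have hx1 : (1 : ℝ) ≤ (x : ℝ) - 1 := by
    have : (2 : ℝ) ≤ x := by exact_mod_cast hx
    linarith
  set m : ℝ := ((x : ℝ) - 1) ^ (-(1 / 2) : ℝ) with hm
  have hm2 : m ^ 2 = 1 / ((x : ℝ) - 1) := by
    rw [hm, ← Real.rpow_natCast, ← Real.rpow_mul (by linarith)]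
    norm_num [Real.rpow_neg_one]
  have hn : ∀ t' l : ℕ, k ≤ l + 1 → l ≤ k + 1 → (x : ℝ) - 1 ≤ ‖zp x t' l‖ := by
    intro t' l h1 h2
    refine le_trans ?_ (Complex.abs_im_le_norm (zp x t' l))
    rw [zp, le_abs]
    rcases hk with rfl | rfl
    · right
      have : (l : ℝ) ≤ 0 + 1 := by exact_mod_cast h2
      simp only
      linarith
    · left
      have : ((2 * x : ℕ) : ℝ) ≤ l + 1 := by exact_mod_cast h1
      push_cast at this
      simp only
      linarith
  have hc : ∀ t' l : ℕ, k ≤ l + 1 → l ≤ k + 1 → |ca κ s x t' l| ≤ m ∧ |cb κ s x t' l| ≤ m := by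
    intro t' l h1 h2
    have h3 : ‖zp x t' l‖ ^ (-(1 / 2 + s)) ≤ m := by
      calc _ ≤ ((x : ℝ) - 1) ^ (-(1 / 2 + s)) :=
            Real.rpow_le_rpow_of_nonpos (by linarith) (hn t' l h1 h2) (by linarith)
        _ ≤ _ := Real.rpow_le_rpow_of_exponent_le hx1 (by linarith)
    exact ⟨(abs_coef_le hκ x t' l).1.trans h3, (abs_coef_le hκ x t' l).2.trans h3⟩
  obtain ⟨h1, h2⟩ := abs_os_le (M := M) hβ hsh (hc (t + 1))
  obtain ⟨h3, h4⟩ := hc t k (by omega) (by omega)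
  have h5 := (abs_sub _ _).trans (add_le_add h3 h1)
  have h6 := (abs_sub _ _).trans (add_le_add h4 h2)
  rw [← sq_abs, ← sq_abs (cb κ s x t k - _)]
  have h7 := pow_le_pow_left₀ (abs_nonneg _) h5 2
  have h8 := pow_le_pow_left₀ (abs_nonneg _) h6 2
  calc _ ≤ (m + 12 * m) ^ 2 + (m + 12 * m) ^ 2 := add_le_add h7 h8
    _ = 338 * m ^ 2 := by ring
    _ = _ := by rw [hm2]; ring

/-- The total mass of the bracket function. -/
def brs (b : ℝ) : ℝ := ∑' j : ℤ, (1 + (j : ℝ) ^ 2) ^ (-(b / 2))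

theorem brs_nonneg (b : ℝ) : 0 ≤ brs b := tsum_nonneg fun j => by positivity

theorem sum_bracket_le {b : ℝ} (hb : 1 < b) (n x : ℕ) :
    ∑ k ∈ Finset.range n, (1 + (((k : ℤ) - (x : ℤ) : ℤ) : ℝ) ^ 2) ^ (-(b / 2)) ≤ brs b :=
  sum_range_shift_le (summable_bracket hb) (fun _ => by positivity) n x

theorem norm_zp_rpow_le {b : ℝ} (hb : 0 ≤ b) (x t k : ℕ) :
    ‖zp x t k‖ ^ (-b) ≤ (1 + (((k : ℤ) - (x : ℤ) : ℤ) : ℝ) ^ 2) ^ (-(b / 2)) := by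
  have h : ‖zp x t k‖ ^ (-b) = (‖zp x t k‖ ^ 2) ^ (-(b / 2)) := by
    rw [← Real.rpow_natCast, ← Real.rpow_mul (norm_nonneg _)]
    congr 1
    push_cast
    ring
  rw [h]
  exact Real.rpow_le_rpow_of_nonpos (by positivity) (bracket_le x t k) (by linarith)

theorem norm_zp_rpow_le' {a b : ℝ} (ha : 0 ≤ a) (hb : 0 ≤ b) (x t k : ℕ) :
    ‖zp x t k‖ ^ (-(a + b))
      ≤ (t + 4 : ℝ) ^ (-a) * (1 + (((k : ℤ) - (x : ℤ) : ℤ) : ℝ) ^ 2) ^ (-(b / 2)) := by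
  have h1 : 0 < ‖zp x t k‖ := by linarith [four_le_norm_zp x t k]
  rw [neg_add, Real.rpow_add h1]
  exact mul_le_mul (Real.rpow_le_rpow_of_nonpos (by positivity) (le_norm_zp x t k) (by linarith))
    (norm_zp_rpow_le hb x t k) (by positivity) (by positivity)

theorem nf_coef_le (hs : 0 < s) (hκ : ‖κ‖ = 1) (M x t : ℕ) :
    nf M (ca κ s x t) (cb κ s x t) ≤ (t + 4 : ℝ) ^ (-s) * brs (1 + s) := by
  rw [nf]
  refine le_trans (Finset.sum_le_sum fun k _ => ?_) (le_trans (le_of_eq (Finset.mul_sum _ _ _).symm)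
    (mul_le_mul_of_nonneg_left (sum_bracket_le (by linarith : 1 < 1 + s) (M + 1) x) (by positivity)))
  rw [coef_sq hκ, ← Real.rpow_natCast, ← Real.rpow_mul (norm_nonneg _)]
  refine le_trans (le_of_eq ?_) (norm_zp_rpow_le' hs.le (by linarith : 0 ≤ 1 + s) x t k)
  congr 1
  push_cast
  ring

theorem nf_error_le (hβ : 0 < β) (hsh : Real.sinh (2 * β) = 1) (hs : 0 ≤ s) (hs1 : s ≤ 1 / 2)
    (hκ : ‖κ‖ = 1) {x : ℕ} (hx : 2 ≤ x) (t : ℕ) :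
    nf (2 * x) (fun k => ca κ s x t k - osa (2 * x) β (ca κ s x (t + 1)) (cb κ s x (t + 1)) k)
      (fun k => cb κ s x t k - osb (2 * x) β (ca κ s x (t + 1)) (cb κ s x (t + 1)) k)
      ≤ 512 * brs 2 * (t + 5 : ℝ) ^ (-3 : ℝ) + 676 / ((x : ℝ) - 1) := by
  have hx1 : (0 : ℝ) ≤ 338 / ((x : ℝ) - 1) := by
    have : (2 : ℝ) ≤ x := by exact_mod_cast hx
    exact div_nonneg (by norm_num) (by linarith)
  have key : ∀ k ∈ Finset.range (2 * x + 1),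
      (ca κ s x t k - osa (2 * x) β (ca κ s x (t + 1)) (cb κ s x (t + 1)) k) ^ 2
        + (cb κ s x t k - osb (2 * x) β (ca κ s x (t + 1)) (cb κ s x (t + 1)) k) ^ 2
      ≤ 512 * (t + 5 : ℝ) ^ (-3 : ℝ) * (1 + (((k : ℤ) - (x : ℤ) : ℤ) : ℝ) ^ 2) ^ (-(2 / 2) : ℝ)
        + ((if k = 0 then 338 / ((x : ℝ) - 1) else 0)
          + (if k = 2 * x then 338 / ((x : ℝ) - 1) else 0)) := by
    intro k hk
    have hp : 0 ≤ 512 * (t + 5 : ℝ) ^ (-3 : ℝ)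
      * (1 + (((k : ℤ) - (x : ℤ) : ℤ) : ℝ) ^ 2) ^ (-(2 / 2) : ℝ) := by positivity
    by_cases hw : k = 0 ∨ k = 2 * x
    · have h1 := error_wall (M := 2 * x) hβ hsh hs hκ t hx hw
      have h2 : 338 / ((x : ℝ) - 1) ≤ (if k = 0 then 338 / ((x : ℝ) - 1) else 0)
          + (if k = 2 * x then 338 / ((x : ℝ) - 1) else 0) := by
        rcases hw with h | h
        · rw [if_pos h]
          split_ifs <;> linarith
        · rw [if_pos h]
          split_ifs <;> linarith
      linarith
    · rw [not_or] at hw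
      rw [if_neg hw.1, if_neg hw.2, add_zero, add_zero]
      rw [Finset.mem_range] at hk
      obtain ⟨h1, h2⟩ := error_interior (M := 2 * x) (t := t) (x := x) hβ hsh hs hs1 hκ
        (show 1 ≤ k by omega) (by omega)
      have h3 : (‖zp x (t + 1) k‖ ^ (-(1 / 2 + s) - 2)) ^ 2 ≤
          (t + 5 : ℝ) ^ (-3 : ℝ) * (1 + (((k : ℤ) - (x : ℤ) : ℤ) : ℝ) ^ 2) ^ (-(2 / 2) : ℝ) := by
        have h4 := norm_zp_rpow_le' (a := 3) (b := 2) (by norm_num) (by norm_num) x (t + 1) k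
        rw [show ((t + 1 : ℕ) : ℝ) + 4 = t + 5 by push_cast; ring] at h4
        refine le_trans ?_ h4
        rw [← Real.rpow_natCast, ← Real.rpow_mul (norm_nonneg _)]
        refine Real.rpow_le_rpow_of_exponent_le (by linarith [four_le_norm_zp x (t + 1) k]) ?_
        push_cast
        linarith
      rw [← sq_abs, ← sq_abs (cb κ s x t k - _)]
      have h7 := pow_le_pow_left₀ (abs_nonneg _) h1 2
      have h8 := pow_le_pow_left₀ (abs_nonneg _) h2 2
      rw [mul_pow] at h7 h8
      linarith
  rw [nf]
  refine (Finset.sum_le_sum key).trans ?_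
  rw [Finset.sum_add_distrib, Finset.sum_add_distrib, ← Finset.mul_sum,
    Finset.sum_ite_eq', Finset.sum_ite_eq', if_pos (by simp), if_pos (by simp)]
  have h1 := mul_le_mul_of_nonneg_left (sum_bracket_le (b := 2) (by norm_num) (2 * x + 1) x)
    (show 0 ≤ 512 * (t + 5 : ℝ) ^ (-3 : ℝ) by positivity)
  have h2 : 338 / ((x : ℝ) - 1) + 338 / ((x : ℝ) - 1) = 676 / ((x : ℝ) - 1) := by ring
  rw [h2]
  linarith

/-- The total error is bounded, up to the influence of the walls. -/
theorem sum_error_le (hβ : 0 < β) (hsh : Real.sinh (2 * β) = 1) :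
    ∃ K : ℝ, 0 ≤ K ∧ ∀ (s : ℝ) (κ : ℂ) (x T : ℕ), 0 ≤ s → s ≤ 1 / 2 → ‖κ‖ = 1 → 2 ≤ x →
      ∑ t ∈ Finset.range T, √(nf (2 * x)
        (fun k => ca κ s x t k - osa (2 * x) β (ca κ s x (t + 1)) (cb κ s x (t + 1)) k)
        (fun k => cb κ s x t k - osb (2 * x) β (ca κ s x (t + 1)) (cb κ s x (t + 1)) k))
        ≤ K + T * √(676 / ((x : ℝ) - 1)) := by
  have hsum : Summable fun t : ℕ => ((t + 5 : ℕ) : ℝ) ^ (-(3 / 2) : ℝ) :=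
    (summable_nat_add_iff 5).2 (Real.summable_nat_rpow.2 (by norm_num))
  refine ⟨√(512 * brs 2) * ∑' t : ℕ, ((t + 5 : ℕ) : ℝ) ^ (-(3 / 2) : ℝ),
    mul_nonneg (Real.sqrt_nonneg _) (tsum_nonneg fun t => by positivity),
    fun s κ x T hs hs1 hκ hx => ?_⟩
  have h1 : ∀ t ∈ Finset.range T, √(nf (2 * x)
        (fun k => ca κ s x t k - osa (2 * x) β (ca κ s x (t + 1)) (cb κ s x (t + 1)) k)
        (fun k => cb κ s x t k - osb (2 * x) β (ca κ s x (t + 1)) (cb κ s x (t + 1)) k))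
      ≤ √(512 * brs 2) * ((t + 5 : ℕ) : ℝ) ^ (-(3 / 2) : ℝ) + √(676 / ((x : ℝ) - 1)) := by
    intro t _
    refine (Real.sqrt_le_sqrt (nf_error_le hβ hsh hs hs1 hκ hx t)).trans ?_
    have hx1 : (0 : ℝ) ≤ 676 / ((x : ℝ) - 1) := by
      have : (2 : ℝ) ≤ x := by exact_mod_cast hx
      exact div_nonneg (by norm_num) (by linarith)
    have hb := brs_nonneg 2
    have hadd : ∀ {p q : ℝ}, 0 ≤ p → 0 ≤ q → √(p + q) ≤ √p + √q := fun {p q} hp hq =>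
      Real.sqrt_le_iff.2 ⟨by positivity, by
        nlinarith [Real.sq_sqrt hp, Real.sq_sqrt hq, mul_nonneg (Real.sqrt_nonneg p) (Real.sqrt_nonneg q)]⟩
    refine (hadd (by positivity) hx1).trans (add_le_add_left (le_of_eq ?_) _)
    rw [Real.sqrt_mul (by positivity)]
    congr 1
    rw [Real.sqrt_eq_rpow, ← Real.rpow_mul (by positivity)]
    push_cast
    norm_num
  refine (Finset.sum_le_sum h1).trans ?_
  rw [Finset.sum_add_distrib, ← Finset.mul_sum, Finset.sum_const, Finset.card_range, nsmul_eq_mul]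
  exact add_le_add_left (mul_le_mul_of_nonneg_left
    (hsum.sum_le_tsum _ fun t _ => by positivity) (Real.sqrt_nonneg _)) _

/-- The initial coefficients have a large norm if the exponent is close to `-1/2`. -/
theorem exists_le_nf (R : ℝ) {ε : ℝ} (hε : 0 < ε) :
    ∃ s : ℝ, 0 < s ∧ s ≤ ε ∧ ∃ J : ℕ, ∀ (κ : ℂ) (x : ℕ), ‖κ‖ = 1 → J ≤ x →
      R ≤ nf (2 * x) (ca κ s x 0) (cb κ s x 0) := by
  obtain ⟨J, hJ⟩ : ∃ J : ℕ, R < ∑ j ∈ Finset.range J, ((4 : ℝ) + j) ^ (-(1 + 2 * (0 : ℝ))) := by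
    obtain ⟨J, hJ⟩ := (Real.tendsto_sum_range_one_div_nat_succ_atTop.eventually_gt_atTop (4 * R)).exists
    refine ⟨J, ?_⟩
    have h1 : ∑ j ∈ Finset.range J, 1 / ((j : ℝ) + 1)
        ≤ ∑ j ∈ Finset.range J, 4 * ((4 : ℝ) + j) ^ (-(1 + 2 * (0 : ℝ))) := by
      refine Finset.sum_le_sum fun j _ => ?_
      rw [mul_zero, add_zero, Real.rpow_neg_one, ← div_eq_mul_inv, div_le_div_iff₀ (by positivity)
        (by positivity)]
      linarith [Nat.cast_nonneg (α := ℝ) j]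
    rw [← Finset.mul_sum] at h1
    exact lt_of_mul_lt_mul_left (hJ.trans_le h1) (by norm_num)
  have hcont : Continuous fun s : ℝ => ∑ j ∈ Finset.range J, ((4 : ℝ) + j) ^ (-(1 + 2 * s)) := by
    refine continuous_finsetSum _ fun j _ => ?_
    exact Continuous.rpow continuous_const (by fun_prop) fun s => Or.inl (by positivity)
  have h1 : ∀ᶠ s in 𝓝[>] (0 : ℝ), R < ∑ j ∈ Finset.range J, ((4 : ℝ) + j) ^ (-(1 + 2 * s)) :=
    (hcont.continuousAt.eventually (lt_mem_nhds hJ)).filter_mono nhdsWithin_le_nhds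
  obtain ⟨s, hs, hs0, hs1⟩ := (h1.and (Ioc_mem_nhdsGT hε)).exists
  refine ⟨s, hs0, hs1, J, fun κ x hκ hx => hs.le.trans ?_⟩
  rw [nf]
  calc _ ≤ ∑ j ∈ Finset.range J, (ca κ s x 0 (x + j) ^ 2 + cb κ s x 0 (x + j) ^ 2) := by
        refine Finset.sum_le_sum fun j _ => ?_
        rw [coef_sq hκ, ← Real.rpow_natCast, ← Real.rpow_mul (norm_nonneg _),
          show -(1 / 2 + s) * ((2 : ℕ) : ℝ) = -(1 + 2 * s) by push_cast; ring]
        refine Real.rpow_le_rpow_of_nonpos (by linarith [four_le_norm_zp x 0 (x + j)]) ?_ (by linarith)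
        refine (Complex.norm_le_abs_re_add_abs_im _).trans (le_of_eq ?_)
        simp [zp]
    _ = ∑ k ∈ (Finset.range J).image (fun j => x + j), (ca κ s x 0 k ^ 2 + cb κ s x 0 k ^ 2) := by
        rw [Finset.sum_image fun a _ b _ h => by simpa using h]
    _ ≤ _ := by
        refine Finset.sum_le_sum_of_subset_of_nonneg (fun k hk => ?_) fun _ _ _ => by positivity
        simp only [Finset.mem_image, Finset.mem_range] at hk ⊢
        omega

end

end Schonmann
end

noncomputable section
open scoped Classical
namespace Schonmann

variable {β s : ℝ}

theorem abs_cos_sub_sin_half_arg_le (hs : 0 ≤ s) (x k : ℕ) :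
    |Real.cos ((1 / 2 + s) * |(zp x 0 k).arg|) - Real.sin ((1 / 2 + s) * |(zp x 0 k).arg|)|
      ≤ 4 * s + 8 / ‖zp x 0 k‖ := by
  have h4 := four_le_norm_zp x 0 k
  have hz : zp x 0 k ≠ 0 := norm_pos_iff.1 (by linarith)
  have hcos : Real.cos |(zp x 0 k).arg| = 4 / ‖zp x 0 k‖ := by
    rw [Real.cos_abs, Complex.cos_arg hz]
    simp [zp]
  have hle : |(zp x 0 k).arg| ≤ Real.pi / 2 :=
    Complex.abs_arg_le_pi_div_two_iff.2 (by simp [zp])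
  have h0 := abs_nonneg (zp x 0 k).arg
  set θ := |(zp x 0 k).arg|
  have hj : Real.pi / 2 - θ ≤ 8 / ‖zp x 0 k‖ := by
    have h1 := Real.mul_le_sin (x := Real.pi / 2 - θ) (by linarith) (by linarith)
    rw [Real.sin_pi_div_two_sub, hcos, div_mul_eq_mul_div, div_le_div_iff₀ Real.pi_pos (by linarith)]
      at h1
    rw [le_div_iff₀ (by linarith)]
    nlinarith [Real.pi_le_four]
  rw [← Real.sin_pi_div_two_sub]
  refine (Real.abs_sin_sub_sin_le _ _).trans ?_
  have h2 : s * θ ≤ s * 2 := mul_le_mul_of_nonneg_left (by linarith [Real.pi_le_four]) hs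
  have h3 : 0 ≤ s * θ := mul_nonneg hs h0
  rw [abs_le]
  constructor <;> linarith

theorem mismatch_eq (s : ℝ) (x k : ℕ) :
    |sgn x k * ca 1 s x 0 k - ca (-Complex.I) s x 0 k|
      = ‖zp x 0 k‖ ^ (-(1 / 2 + s)) * |Real.cos ((1 / 2 + s) * |(zp x 0 k).arg|)
        - Real.sin ((1 / 2 + s) * |(zp x 0 k).arg|)| ∧
    |-(sgn x k * cb 1 s x 0 k) - cb (-Complex.I) s x 0 k|
      = ‖zp x 0 k‖ ^ (-(1 / 2 + s)) * |Real.cos ((1 / 2 + s) * |(zp x 0 k).arg|)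
        - Real.sin ((1 / 2 + s) * |(zp x 0 k).arg|)| := by
  have hr : (hp s (zp x 0 k)).re
      = ‖zp x 0 k‖ ^ (-(1 / 2 + s)) * Real.cos ((1 / 2 + s) * (zp x 0 k).arg) := by
    rw [hp, Complex.cpow_ofReal_re, ← Real.cos_neg]
    congr 2
    ring
  have hi : (hp s (zp x 0 k)).im
      = -(‖zp x 0 k‖ ^ (-(1 / 2 + s)) * Real.sin ((1 / 2 + s) * (zp x 0 k).arg)) := by
    rw [hp, Complex.cpow_ofReal_im, ← mul_neg, ← Real.sin_neg]
    congr 2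
    ring
  have hρ : 0 ≤ ‖zp x 0 k‖ ^ (-(1 / 2 + s)) := by positivity
  have e1 : ca 1 s x 0 k = (hp s (zp x 0 k)).re := by simp [ca]
  have e2 : cb 1 s x 0 k = -(hp s (zp x 0 k)).im := by simp [cb]
  have e3 : ca (-Complex.I) s x 0 k = (hp s (zp x 0 k)).im := by simp [ca]
  have e4 : cb (-Complex.I) s x 0 k = (hp s (zp x 0 k)).re := by simp [cb]
  rw [e1, e2, e3, e4, hr, hi]
  generalize ‖zp x 0 k‖ ^ (-(1 / 2 + s)) = ρ at hρ ⊢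
  have habs : ∀ d : ℝ, ρ * |d| = |ρ * d| := fun d => by rw [abs_mul, abs_of_nonneg hρ]
  rw [habs, sgn]
  by_cases h : x ≤ k
  · have ha : 0 ≤ (zp x 0 k).arg := Complex.arg_nonneg_iff.2 (by simpa [zp] using h)
    rw [if_pos h, abs_of_nonneg ha]
    constructor
    · rw [← abs_neg]
      congr 1
      ring
    · rw [← abs_neg]
      congr 1
      ring
  · have ha : (zp x 0 k).arg < 0 := Complex.arg_neg_iff.2 (by
      have : k < x := not_le.1 h
      simpa [zp] using this)
    rw [if_neg h, abs_of_neg ha, mul_neg, Real.cos_neg, Real.sin_neg]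
    constructor
    · congr 1
      ring
    · rw [← abs_neg]
      congr 1
      ring

theorem nf_mismatch_le (hs : 0 ≤ s) (M x : ℕ) :
    nf M (fun k => sgn x k * ca 1 s x 0 k - ca (-Complex.I) s x 0 k)
      (fun k => -(sgn x k * cb 1 s x 0 k) - cb (-Complex.I) s x 0 k)
      ≤ (8 * s) ^ 2 * nf M (ca 1 s x 0) (cb 1 s x 0) + 256 * brs 2 := by
  have hk : ∀ k ∈ Finset.range (M + 1),
      (sgn x k * ca 1 s x 0 k - ca (-Complex.I) s x 0 k) ^ 2
        + (-(sgn x k * cb 1 s x 0 k) - cb (-Complex.I) s x 0 k) ^ 2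
      ≤ (8 * s) ^ 2 * (ca 1 s x 0 k ^ 2 + cb 1 s x 0 k ^ 2)
        + 256 * (1 + (((k : ℤ) - (x : ℤ) : ℤ) : ℝ) ^ 2) ^ (-((2 : ℝ) / 2)) := by
    intro k _
    have h4 := four_le_norm_zp x 0 k
    have hm := abs_cos_sub_sin_half_arg_le hs x k
    rw [← sq_abs (sgn x k * ca 1 s x 0 k - _), ← sq_abs (-(sgn x k * cb 1 s x 0 k) - _),
      (mismatch_eq s x k).1, (mismatch_eq s x k).2, coef_sq norm_one]
    refine le_trans ?_ (add_le_add_right (mul_le_mul_of_nonneg_left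
      (norm_zp_rpow_le zero_le_two x 0 k) (by norm_num : (0 : ℝ) ≤ 256)) _)
    have hρ0 : 0 ≤ ‖zp x 0 k‖ ^ (-(1 / 2 + s)) := by positivity
    have hρ1 : ‖zp x 0 k‖ ^ (-(1 / 2 + s)) ≤ 1 :=
      Real.rpow_le_one_of_one_le_of_nonpos (by linarith) (by linarith)
    have e : ‖zp x 0 k‖ ^ (-2 : ℝ) = (1 / ‖zp x 0 k‖) ^ 2 := by
      rw [Real.rpow_neg (by linarith), one_div, inv_pow]
      norm_cast
    rw [e]
    have h8 : 8 / ‖zp x 0 k‖ = 8 * (1 / ‖zp x 0 k‖) := by ring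
    rw [h8] at hm
    generalize ‖zp x 0 k‖ ^ (-(1 / 2 + s)) = ρ at hρ0 hρ1 ⊢
    generalize 1 / ‖zp x 0 k‖ = w at hm ⊢
    generalize Real.cos ((1 / 2 + s) * |(zp x 0 k).arg|)
      - Real.sin ((1 / 2 + s) * |(zp x 0 k).arg|) = d at hm ⊢
    have h1 : |d| ^ 2 ≤ (4 * s + 8 * w) ^ 2 := pow_le_pow_left₀ (abs_nonneg d) hm 2
    have h2 : (4 * s + 8 * w) ^ 2 ≤ 32 * s ^ 2 + 128 * w ^ 2 := by
      nlinarith [sq_nonneg (4 * s - 8 * w)]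
    have h3 : ρ ^ 2 * |d| ^ 2 ≤ ρ ^ 2 * (32 * s ^ 2 + 128 * w ^ 2) :=
      mul_le_mul_of_nonneg_left (h1.trans h2) (sq_nonneg ρ)
    have h5 : ρ ^ 2 * w ^ 2 ≤ w ^ 2 := mul_le_of_le_one_left (sq_nonneg w)
      (pow_le_one₀ hρ0 hρ1)
    linarith [mul_pow ρ |d| 2]
  unfold nf
  refine (Finset.sum_le_sum hk).trans ?_
  rw [Finset.sum_add_distrib, ← Finset.mul_sum, ← Finset.mul_sum]
  exact add_le_add_right (mul_le_mul_of_nonneg_left (sum_bracket_le one_lt_two _ _) (by norm_num)) _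

theorem sqrt_nf_mismatch_le (hs : 0 ≤ s) (M x : ℕ) :
    √(nf M (fun k => sgn x k * ca 1 s x 0 k - ca (-Complex.I) s x 0 k)
      (fun k => -(sgn x k * cb 1 s x 0 k) - cb (-Complex.I) s x 0 k))
      ≤ 8 * s * √(nf M (ca 1 s x 0) (cb 1 s x 0)) + 16 * √(brs 2) := by
  refine Real.sqrt_le_iff.2 ⟨by positivity, (nf_mismatch_le hs M x).trans ?_⟩
  have h1 := Real.sq_sqrt (nf_nonneg (M := M) (ca 1 s x 0) (cb 1 s x 0))
  have h2 := Real.sq_sqrt (brs_nonneg 2)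
  have h3 : 0 ≤ 8 * s * √(nf M (ca 1 s x 0) (cb 1 s x 0)) * (16 * √(brs 2)) := by positivity
  nlinarith

/-- At the critical inverse temperature the plus and minus expectations of a spin agree. -/
theorem EP_le_half (hβ : 0 < β) (hsh : Real.sinh (2 * β) = 1) : EP β {0} ≤ 1 / 2 := by
  by_contra! hE
  obtain ⟨K, hK, hsum⟩ := sum_error_le hβ hsh
  set q := 2 * EP β {0} - 1 with hq
  have hq0 : 0 < q := by linarith
  set C := 4 * (K + 2) + 16 * √(brs 2) with hC
  have hC0 : 0 ≤ C := by positivity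
  obtain ⟨s, hs0, hsε, J, hJ⟩ := exists_le_nf ((2 * C / q + 1) ^ 2)
    (ε := min (q / 16) (1 / 2)) (lt_min (by linarith) (by norm_num))
  have hsq : s ≤ q / 16 := hsε.trans (min_le_left _ _)
  have hs1 : s ≤ 1 / 2 := hsε.trans (min_le_right _ _)
  obtain ⟨T, hT⟩ : ∃ T : ℕ, ((T : ℝ) + 4) ^ (-s) * brs (1 + s) ≤ 1 := by
    have h1 : Tendsto (fun T : ℕ => ((T : ℝ) + 4) ^ (-s) * brs (1 + s)) atTop (𝓝 (0 * brs (1 + s))) :=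
      ((tendsto_rpow_neg_atTop hs0).comp
        (tendsto_atTop_add_const_right _ 4 tendsto_natCast_atTop_atTop)).mul_const _
    rw [zero_mul] at h1
    exact (h1.eventually (ge_mem_nhds one_pos)).exists
  obtain ⟨x, hx2, hxJ, hxT⟩ : ∃ x : ℕ, 2 ≤ x ∧ J ≤ x ∧ T * √(676 / ((x : ℝ) - 1)) ≤ 1 := by
    have h1 : Tendsto (fun x : ℕ => T * √(676 / ((x : ℝ) - 1))) atTop (𝓝 (T * √0)) :=
      ((Real.continuous_sqrt.tendsto 0).comp (tendsto_const_nhds.div_atTop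
        (tendsto_atTop_add_const_right _ (-1) tendsto_natCast_atTop_atTop))).const_mul _
    rw [Real.sqrt_zero, mul_zero] at h1
    obtain ⟨x, h, h', h''⟩ := ((eventually_ge_atTop 2).and ((eventually_ge_atTop J).and
      (h1.eventually (ge_mem_nhds one_pos)))).exists
    exact ⟨x, h, h', h''⟩
  obtain ⟨r, u, hu⟩ := exists_isPF β (cw (2 * x) true)
  obtain ⟨r', u', hu'⟩ := exists_isPF β (cw (2 * x) false)
  obtain ⟨n, hn, hB⟩ := hu.exists_growth (v := vh (2 * x) β) vh_succ supp_vh vh_zero_nonneg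
    vh_zero_pos T
  have hv : ∀ κ : ℂ, ‖κ‖ = 1 → nr (psi (ca κ s x 0) (cb κ s x 0) (vh (2 * x) β (n + T)))
      ≤ √2 * (K + 2) * (2 * nr (vh (2 * x) β (n + T))) := by
    intro κ hκ
    refine (nr_psi_iterate_le hβ (hu.le_of_walls hβ.le (by omega) hu') hu' vh_succ supp_vh hB
      (ca κ s x) (cb κ s x)).trans ?_
    have h1 := hsum s κ x T hs0.le hs1 hκ hx2
    have h2 : √(nf (2 * x) (ca κ s x T) (cb κ s x T)) ≤ 1 :=
      Real.sqrt_le_one.2 ((nf_coef_le hs0 hκ (2 * x) x T).trans hT)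
    have h3 : (∑ t ∈ Finset.range T, √(nf (2 * x)
        (ca κ s x t - osa (2 * x) β (ca κ s x (t + 1)) (cb κ s x (t + 1)))
        (cb κ s x t - osb (2 * x) β (ca κ s x (t + 1)) (cb κ s x (t + 1))))
        + √(nf (2 * x) (ca κ s x T) (cb κ s x T))) ≤ K + 2 :=
      (add_le_add (h1.trans (add_le_add_right hxT K)) h2).trans (by linarith)
    exact mul_le_mul_of_nonneg_right (mul_le_mul_of_nonneg_left h3 (Real.sqrt_nonneg _))
      (by linarith)
  have hN : 2 * C / q + 1 ≤ √(nf (2 * x) (ca 1 s x 0) (cb 1 s x 0)) :=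
    Real.le_sqrt_of_sq_le (hJ 1 x norm_one hxJ)
  have hmis := sqrt_nf_mismatch_le hs0.le (2 * x) x
  have hip := ip_sp_le (ca 1 s x 0) (cb 1 s x 0) x (vh (2 * x) β (n + T))
  have hEP := EP_mul_le_ip hβ.le (by omega : 1 ≤ x) (by omega : x ≤ 2 * x) (n + T)
  have h1 := hv 1 norm_one
  have h2 := hv (-Complex.I) (by simp)
  rw [← nr_sq, ← hq] at hEP
  set v := vh (2 * x) β (n + T)
  set N := √(nf (2 * x) (ca 1 s x 0) (cb 1 s x 0))
  set D := √(nf (2 * x) (fun k => sgn x k * ca 1 s x 0 k - ca (-Complex.I) s x 0 k)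
    (fun k => -(sgn x k * cb 1 s x 0 k) - cb (-Complex.I) s x 0 k)) with hD
  have h3 : nr (psi (fun k => sgn x k * ca 1 s x 0 k) (fun k => -(sgn x k * cb 1 s x 0 k)) v)
      ≤ √2 * (K + 2) * (2 * nr v) + √2 * D * nr v := by
    have e : psi (fun k => sgn x k * ca 1 s x 0 k) (fun k => -(sgn x k * cb 1 s x 0 k)) v
        = fun τ => psi (ca (-Complex.I) s x 0) (cb (-Complex.I) s x 0) v τ
          + psi (fun k => sgn x k * ca 1 s x 0 k - ca (-Complex.I) s x 0 k)
            (fun k => -(sgn x k * cb 1 s x 0 k) - cb (-Complex.I) s x 0 k) v τ := by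
      funext τ
      have := psi_lin 1 1 (ca (-Complex.I) s x 0) (cb (-Complex.I) s x 0)
        (fun k => sgn x k * ca 1 s x 0 k - ca (-Complex.I) s x 0 k)
        (fun k => -(sgn x k * cb 1 s x 0 k) - cb (-Complex.I) s x 0 k) v τ
      simpa only [one_mul, add_sub_cancel] using this
    rw [e]
    exact (nr_add_le _ _).trans (add_le_add h2 (nr_psi_le _ _ _))
  have h2p : (0 : ℝ) < √2 := by positivity
  have hN0 : 0 ≤ N := Real.sqrt_nonneg _
  have h4 : √2 * N * (q * nr v ^ 2) ≤ (√2 * (K + 2) * (2 * nr v)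
      + (√2 * (K + 2) * (2 * nr v) + √2 * D * nr v)) * nr v :=
    (mul_le_mul_of_nonneg_left hEP (by positivity)).trans
      (hip.trans (mul_le_mul_of_nonneg_right (add_le_add h1 h3) hn.le))
  have h5 : (√2 * nr v ^ 2) * (N * q) ≤ (√2 * nr v ^ 2) * (4 * (K + 2) + D) := by
    calc _ = √2 * N * (q * nr v ^ 2) := by ring
      _ ≤ _ := h4
      _ = _ := by ring
  have h6 : N * q ≤ 4 * (K + 2) + D := le_of_mul_le_mul_left h5 (by positivity)
  have h7 : N * s ≤ N * (q / 16) := mul_le_mul_of_nonneg_left hsq hN0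
  have h8 : N * q ≤ 2 * C := by
    rw [hC]
    linarith
  have h9 : (2 * C / q + 1) * q ≤ N * q := mul_le_mul_of_nonneg_right hN hq0.le
  rw [add_mul, div_mul_cancel₀ _ hq0.ne'] at h9
  linarith

end Schonmann
end

noncomputable section
open scoped Classical
namespace Schonmann

/-! ### The critical point -/

theorem betaCrit_pos : 0 < betaCrit :=
  div_pos (Real.log_pos (by linarith [Real.sqrt_pos.2 (zero_lt_two (α := ℝ))])) zero_lt_two

theorem sinh_two_mul_betaCrit : Real.sinh (2 * betaCrit) = 1 := by
  have h2 : (0 : ℝ) < √2 := by positivity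
  have h : √2 ^ 2 = 2 := Real.sq_sqrt zero_le_two
  rw [betaCrit, mul_div_cancel₀ _ two_ne_zero, Real.sinh_log (by positivity)]
  field_simp
  nlinarith

theorem lt_add_or_le_half {β : ℝ} (hβ : betaCrit ≤ β) :
    1 < PiF β {0} allPlus + PiF β {0} allMinus ∨ EP β {0} ≤ 1 / 2 := by
  have h0 : 0 < β := betaCrit_pos.trans_le hβ
  rcases hβ.eq_or_lt with rfl | hlt
  · exact Or.inr (EP_le_half h0 sinh_two_mul_betaCrit)
  · have hs : 1 < Real.sinh (2 * β) :=
      sinh_two_mul_betaCrit ▸ Real.sinh_lt_sinh.2 (by linarith)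
    obtain ⟨m, hm0, hm1, h⟩ := exists_ratio_le h0 hs
    exact Or.inl (one_lt_add_of_ratio h0.le hm0 hm1 h)

end Schonmann
end

/-- For `h = 0` and `β ≥ β_c` there is a `(0,1)`-valued g-function
`P` with which the Schonmann projection `ν_{β,0}^+` is consistent, such that `ν_{β,0}^+`
is the unique g-measure consistent with `P`, and such that `P` is continuous at
`ν_{β,0}^+`-almost every past: `ν_{β,0}^+` is an almost regular g-measure. -/
theorem schonmann_almost_regular_g_measure
    (β : ℝ) (hβ : betaCrit ≤ β) (μp : Measure Cfg2) (hμp : IsPlusPhase β 0 μp) :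
    ∃ P : Bool → Past Bool → ℝ,
      IsGFunction P ∧ (∀ a ω, P a ω ∈ Set.Ioo (0 : ℝ) 1) ∧
      IsGMeasure (schonmann μp) P ∧
      (∀ ν : Measure (ZSeq Bool), IsGMeasure ν P → ν = schonmann μp) ∧
      (∀ᵐ ω ∂((schonmann μp).map restrictPast), ∀ a, ContinuousAt (P a) ω) := by
  exact Schonmann.almost_regular (Schonmann.betaCrit_pos.trans_le hβ).le
    (Schonmann.lt_add_or_le_half hβ) hμp
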